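/- Let a=(a_ij) be a continuous map from [0,T]×ℝ^d into the symmetric positive definite d×d matrices such that each a_ij is locally Hölder continuous on [0,T)×ℝ^d and |a_ij(t,x)| ≤ c₁(1+|x|²) for some constant c₁≥0, all (t,x)∈[0,T]×ℝ^d, and all i,j. Let f∈C(ℝ^d) satisfy |f(x)| ≤ c₀(1+|x|^p) for some constants c₀,p>0. Then the terminal-value problem (TVP) — v∈C^{1,2}([0,T)×ℝ^d)∩C([0,T]×ℝ^d), ∂v/∂t + ℒv = 0 on [0,T)×ℝ^d, v(T,x)=f(x) for x∈ℝ^d — admits a unique solution v within the class of functions of at most polynomial growth uniformly in t (i.e., |v(t,x)| ≤ C(1+|x|^q) for some C,q>0 and all (t,x)). -/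

import Mathlib

open Finset Filter Topology Set

noncomputable section

/-- The successor `s'` of `s` in the partition `P` of `[0,T]` (equal to `T` if there is none). -/
def succOf (T : ℝ) (P : Finset ℝ) (s : ℝ) : ℝ :=
  if h : (P.filter (fun u => s < u)).Nonempty then (P.filter (fun u => s < u)).min' h else T

/-- A refining sequence of partitions of `[0,T]` whose meshes tend to zero. -/
structure PartitionSeq (T : ℝ) where
  part : ℕ → Finset ℝ
  subset_Icc : ∀ n, ↑(part n) ⊆ Set.Icc (0 : ℝ) T
  zero_mem : ∀ n, (0 : ℝ) ∈ part n
  top_mem : ∀ n, T ∈ part n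
  refining : ∀ n, part n ⊆ part (n + 1)
  mesh_to_zero : ∀ ε > 0, ∃ N, ∀ n ≥ N, ∀ s ∈ part n, succOf T (part n) s - s < ε
/-- Approximating sums for the covariation `⟨S_i,S_j⟩(t)` along the `n`-th partition. -/
def covSum (T : ℝ) (𝕋 : PartitionSeq T) {d : ℕ} (S : ℝ → Fin d → ℝ) (i j : Fin d)
    (t : ℝ) (n : ℕ) : ℝ :=
  ∑ s ∈ (𝕋.part n).filter (fun s => s ≤ t),
    (S (succOf T (𝕋.part n) s) i - S s i) * (S (succOf T (𝕋.part n) s) j - S s j)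

/-- The Föllmer integral `∫_r^t ξ(s)·dS(s)` exists along `(𝕋_n)` with value `I`. -/
def HasFollmerIntegral (T : ℝ) (𝕋 : PartitionSeq T) {d : ℕ} (ξ S : ℝ → Fin d → ℝ)
    (r t I : ℝ) : Prop :=
  Tendsto (fun n => ∑ s ∈ (𝕋.part n).filter (fun s => r ≤ s ∧ s ≤ t),
    ∑ k, ξ s k * (S (succOf T (𝕋.part n) s) k - S s k)) atTop (𝓝 I)

/-- The open positive orthant `ℝ_+^d`. -/
def posOrth (d : ℕ) : Set (Fin d → ℝ) := {x | ∀ i, 0 < x i}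

/-- The class `𝒮_a`: continuous trajectories whose covariations are `∫_0^t a_ij(s,S(s)) ds`. -/
def SclassA (T : ℝ) (𝕋 : PartitionSeq T) {d : ℕ}
    (a : ℝ → (Fin d → ℝ) → Fin d → Fin d → ℝ) : Set (ℝ → Fin d → ℝ) :=
  {S | ContinuousOn S (Set.Icc 0 T) ∧
    ∀ i j : Fin d, ∀ t ∈ Set.Icc (0 : ℝ) T,
      Tendsto (fun n => covSum T 𝕋 S i j t n) atTop (𝓝 (∫ s in (0 : ℝ)..t, a s (S s) i j))}

/-- The class `𝒮_a^+`: positive continuous trajectories whose covariations are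
`∫_0^t a_ij(s,S(s)) S_i(s) S_j(s) ds`. -/
def SclassAPos (T : ℝ) (𝕋 : PartitionSeq T) {d : ℕ}
    (a : ℝ → (Fin d → ℝ) → Fin d → Fin d → ℝ) : Set (ℝ → Fin d → ℝ) :=
  {S | ContinuousOn S (Set.Icc 0 T) ∧ (∀ t ∈ Set.Icc (0 : ℝ) T, ∀ i, 0 < S t i) ∧
    ∀ i j : Fin d, ∀ t ∈ Set.Icc (0 : ℝ) T,
      Tendsto (fun n => covSum T 𝕋 S i j t n) atTop
        (𝓝 (∫ s in (0 : ℝ)..t, a s (S s) i j * S s i * S s j))}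

/-- First partial derivative in the `i`-th space direction. -/
def pd1 {d : ℕ} (f : (Fin d → ℝ) → ℝ) (i : Fin d) (x : Fin d → ℝ) : ℝ :=
  fderiv ℝ f x (Pi.single i 1)

/-- Second partial derivative in the space directions `i, j`. -/
def pd2 {d : ℕ} (f : (Fin d → ℝ) → ℝ) (i j : Fin d) (x : Fin d → ℝ) : ℝ :=
  fderiv ℝ (fun y => pd1 f j y) x (Pi.single i 1)

/-- Time derivative (within the time interval `I`). -/
def tderiv {d : ℕ} (I : Set ℝ) (v : ℝ → (Fin d → ℝ) → ℝ) (t : ℝ) (x : Fin d → ℝ) : ℝ :=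
  derivWithin (fun τ => v τ x) I t

/-- `v` is of class `C^{1,2}(I × D)`: continuous on `I × D`, continuously differentiable in
`(t,x)` and twice continuously differentiable in `x` on `(int I) × D`, with all derivatives
admitting continuous extensions to `I × D`. -/
structure IsC12 {d : ℕ} (I : Set ℝ) (D : Set (Fin d → ℝ)) (v : ℝ → (Fin d → ℝ) → ℝ) : Prop where
  cont : ContinuousOn (fun p : ℝ × (Fin d → ℝ) => v p.1 p.2) (I ×ˢ D)
  diff : ∀ t ∈ interior I, ∀ x ∈ D,
    DifferentiableAt ℝ (fun p : ℝ × (Fin d → ℝ) => v p.1 p.2) (t, x)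
  diff2 : ∀ t ∈ interior I, ∀ x ∈ D, ∀ j : Fin d, DifferentiableAt ℝ (pd1 (v t) j) x
  derivs_extend : ∃ (gt : ℝ × (Fin d → ℝ) → ℝ) (gx : Fin d → ℝ × (Fin d → ℝ) → ℝ)
      (gxx : Fin d → Fin d → ℝ × (Fin d → ℝ) → ℝ),
    ContinuousOn gt (I ×ˢ D) ∧ (∀ i, ContinuousOn (gx i) (I ×ˢ D)) ∧
    (∀ i j, ContinuousOn (gxx i j) (I ×ˢ D)) ∧
    ∀ t ∈ interior I, ∀ x ∈ D,
      gt (t, x) = deriv (fun τ => v τ x) t ∧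
      (∀ i, gx i (t, x) = pd1 (v t) i x) ∧
      ∀ i j, gxx i j (t, x) = pd2 (v t) i j x

/-- Local Hölder continuity on a set. -/
def LocallyHolderOn {E : Type*} [PseudoMetricSpace E] (f : E → ℝ) (s : Set E) : Prop :=
  ∀ p ∈ s, ∃ U ∈ 𝓝[s] p, ∃ α C : ℝ, 0 < α ∧ α ≤ 1 ∧ 0 ≤ C ∧
    ∀ q ∈ U, ∀ q' ∈ U, |f q - f q'| ≤ C * dist q q' ^ α

/-- A self-improving linear bound can be absorbed. -/
theorem absorb_bound {X : Type*} {F w : X → ℝ} {C : ℝ} (hw : ∀ x, 0 ≤ w x) (hC : 0 ≤ C)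
    (h0 : ∃ B, 0 ≤ B ∧ ∀ x, F x ≤ B * w x)
    (h : ∀ B, 0 ≤ B → (∀ x, F x ≤ B * w x) → ∀ x, F x ≤ (B / 2 + C) * w x) (x : X) :
    F x ≤ 2 * C * w x := by
  obtain ⟨B, hB, hF⟩ := h0
  have key : ∀ n : ℕ, ∀ x, F x ≤ (B / 2 ^ n + 2 * C) * w x := by
    intro n
    induction n with
    | zero =>
      intro x
      have := hF x
      have h1 := mul_nonneg hC (hw x)
      simp only [pow_zero, div_one]
      nlinarith
    | succ k ih =>
      intro x
      refine (h _ (by positivity) ih x).trans (le_of_eq ?_)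
      rw [pow_succ]; field_simp; ring
  have hlim : Tendsto (fun n : ℕ => (B / 2 ^ n + 2 * C) * w x) atTop
      (𝓝 ((0 + 2 * C) * w x)) := by
    refine Tendsto.mul_const _ (Tendsto.add_const _ ?_)
    have := tendsto_pow_atTop_nhds_zero_of_lt_one (r := (1 / 2 : ℝ)) (by norm_num) (by norm_num)
    have := this.const_mul B
    simpa [div_eq_mul_inv] using this
  have := ge_of_tendsto' hlim (fun n => key n x)
  simpa using this

section Differences

variable {E : Type*} [NormedAddCommGroup E] [NormedSpace ℝ E]

/-- Mixed second difference. -/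
def ddiff (f : E → ℝ) (h k x : E) : ℝ := f (x + h + k) - f (x + h) - f (x + k) + f x

theorem ddiff_sub_le {f : E → ℝ} {f1 : E → E →L[ℝ] ℝ} {f2 : E → E →L[ℝ] E →L[ℝ] ℝ} {N α : ℝ}
    (hα : 0 ≤ α) (hN : 0 ≤ N)
    (h1 : ∀ x, HasFDerivAt f (f1 x) x) (h2 : ∀ x, HasFDerivAt f1 (f2 x) x)
    (hol : ∀ x y, ‖f2 x - f2 y‖ ≤ N * ‖x - y‖ ^ α) (x h k : E) :
    |ddiff f h k x - f2 x k h| ≤ N * (‖h‖ + ‖k‖) ^ α * ‖h‖ * ‖k‖ := by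
  have hc1 : Convex ℝ (Metric.closedBall x ‖h‖) := convex_closedBall _ _
  have step1 : ∀ y ∈ Metric.closedBall x ‖h‖,
      ‖f1 (y + k) - f1 y - f2 x k‖ ≤ N * (‖h‖ + ‖k‖) ^ α * ‖k‖ := by
    intro y hy
    have hc : Convex ℝ (Metric.closedBall x (‖h‖ + ‖k‖)) := convex_closedBall _ _
    have := hc.norm_image_sub_le_of_norm_hasFDerivWithin_le' (f := f1) (f' := f2) (φ := f2 x)
      (C := N * (‖h‖ + ‖k‖) ^ α) (x := y) (y := y + k)
      (fun z _ => (h2 z).hasFDerivWithinAt) ?_ ?_ ?_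
    · simpa using this
    · intro z hz
      refine (hol z x).trans ?_
      gcongr
      simpa [dist_eq_norm] using hz
    · exact Metric.closedBall_subset_closedBall (by simp) hy
    · rw [Metric.mem_closedBall, dist_eq_norm] at hy ⊢
      calc ‖y + k - x‖ = ‖(y - x) + k‖ := by congr 1; abel
        _ ≤ _ := (norm_add_le _ _).trans (by gcongr)
  have hd : ∀ y, HasFDerivAt (fun z => f (z + k) - f z) (f1 (y + k) - f1 y) y := by
    intro y
    exact (((hasFDerivAt_comp_add_right k).2 (h1 (y + k)))).sub (h1 y)
  have := hc1.norm_image_sub_le_of_norm_hasFDerivWithin_le' (f := fun z => f (z + k) - f z)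
      (f' := fun y => f1 (y + k) - f1 y) (φ := f2 x k)
      (C := N * (‖h‖ + ‖k‖) ^ α * ‖k‖) (x := x) (y := x + h)
      (fun z _ => (hd z).hasFDerivWithinAt) step1 (by simp) (by simp)
  rw [← Real.norm_eq_abs]
  calc _ = _ := by
        congr 1; unfold ddiff
        simp only [add_sub_cancel_left]
        ring
    _ ≤ _ := this
    _ = _ := by simp only [add_sub_cancel_left]; ring

theorem norm_bilin_le_of_scale {B : E →L[ℝ] E →L[ℝ] ℝ} {s C : ℝ} (hs : 0 < s) (hC : 0 ≤ C)
    (h : ∀ u v : E, ‖u‖ = s → ‖v‖ = s → |B u v| ≤ C * s ^ 2) : ‖B‖ ≤ C := by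
  refine ContinuousLinearMap.opNorm_le_bound₂ _ hC fun u v => ?_
  by_cases hu : u = 0
  · simp [hu]
  by_cases hv : v = 0
  · simp [hv]
  have hu' := norm_pos_iff.2 hu
  have hv' := norm_pos_iff.2 hv
  have := h ((s / ‖u‖) • u) ((s / ‖v‖) • v) (by rw [norm_smul, Real.norm_of_nonneg (by positivity)]; field_simp)
    (by rw [norm_smul, Real.norm_of_nonneg (by positivity)]; field_simp)
  simp only [map_smul, _root_.smul_apply, smul_eq_mul, abs_mul, abs_div, abs_norm,
    abs_of_pos hs] at this
  rw [Real.norm_eq_abs]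
  have e : s / ‖v‖ * (s / ‖u‖ * |B u v|) = s ^ 2 / (‖u‖ * ‖v‖) * |B u v| := by field_simp
  rw [e] at this
  rw [div_mul_eq_mul_div, div_le_iff₀ (by positivity)] at this
  have h3 : s ^ 2 * |B u v| ≤ s ^ 2 * (C * ‖u‖ * ‖v‖) := by linarith
  exact le_of_mul_le_mul_left h3 (by positivity)

omit [NormedSpace ℝ E] in
theorem abs_ddiff_le {f : E → ℝ} {A : ℝ} (hA : ∀ x, |f x| ≤ A) (h k x : E) :
    |ddiff f h k x| ≤ 4 * A := by
  have a1 := abs_le.1 (hA (x + h + k))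
  have a2 := abs_le.1 (hA (x + h))
  have a3 := abs_le.1 (hA (x + k))
  have a4 := abs_le.1 (hA x)
  unfold ddiff
  rw [abs_le]; constructor <;> linarith

theorem interpolate_second {f : E → ℝ} {f1 : E → E →L[ℝ] ℝ} {f2 : E → E →L[ℝ] E →L[ℝ] ℝ}
    {N α A s : ℝ} (hα : 0 ≤ α) (hN : 0 ≤ N) (hs : 0 < s)
    (h1 : ∀ x, HasFDerivAt f (f1 x) x) (h2 : ∀ x, HasFDerivAt f1 (f2 x) x)
    (hol : ∀ x y, ‖f2 x - f2 y‖ ≤ N * ‖x - y‖ ^ α) (hA : ∀ x, |f x| ≤ A) (x : E) :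
    ‖f2 x‖ ≤ N * (2 * s) ^ α + 4 * A / s ^ 2 := by
  have hA0 : 0 ≤ A := (abs_nonneg _).trans (hA x)
  refine norm_bilin_le_of_scale hs (by positivity) fun u v hu hv => ?_
  have a := ddiff_sub_le hα hN h1 h2 hol x v u
  have b := abs_ddiff_le hA v u x
  rw [hu, hv, ← two_mul] at a
  have c := abs_sub_abs_le_abs_sub (f2 x u v) (ddiff f v u x)
  rw [abs_sub_comm] at c
  have : 4 * A / s ^ 2 * s ^ 2 = 4 * A := by field_simp
  nlinarith

theorem interpolate_first {f : E → ℝ} {f1 : E → E →L[ℝ] ℝ} {f2 : E → E →L[ℝ] E →L[ℝ] ℝ}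
    {B A s : ℝ} (hs : 0 < s)
    (h1 : ∀ x, HasFDerivAt f (f1 x) x) (h2 : ∀ x, HasFDerivAt f1 (f2 x) x)
    (hB : ∀ x, ‖f2 x‖ ≤ B) (hA : ∀ x, |f x| ≤ A) (x : E) :
    ‖f1 x‖ ≤ B * s + 2 * A / s := by
  have hA0 : 0 ≤ A := (abs_nonneg _).trans (hA x)
  have hB0 : 0 ≤ B := le_trans (norm_nonneg (f2 x)) (hB x)
  have key : ∀ u : E, ‖u‖ = s → |f1 x u| ≤ (B * s + 2 * A / s) * s := by
    intro u hu
    have hc : Convex ℝ (Metric.closedBall x s) := convex_closedBall _ _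
    have hlip : ∀ y, ‖f1 y - f1 x‖ ≤ B * ‖y - x‖ := fun y =>
      convex_univ.norm_image_sub_le_of_norm_hasFDerivWithin_le
        (fun z _ => (h2 z).hasFDerivWithinAt) (fun z _ => hB z) (mem_univ _) (mem_univ _)
    have := hc.norm_image_sub_le_of_norm_hasFDerivWithin_le' (f := f) (f' := f1) (φ := f1 x)
      (C := B * s) (x := x) (y := x + u)
      (fun z _ => (h1 z).hasFDerivWithinAt) (fun z hz => (hlip z).trans (by
        gcongr; simpa [dist_eq_norm] using hz)) (by simp [hs.le]) (by simp [hu])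
    simp only [add_sub_cancel_left, Real.norm_eq_abs, hu] at this
    have a1 := abs_le.1 (hA (x + u))
    have a2 := abs_le.1 (hA x)
    have a3 := abs_le.1 this
    have : 2 * A / s * s = 2 * A := by field_simp
    rw [abs_le]; constructor <;> nlinarith
  refine ContinuousLinearMap.opNorm_le_bound _ (by positivity) fun u => ?_
  by_cases hu : u = 0
  · simp [hu]
  have hu' := norm_pos_iff.2 hu
  have := key ((s / ‖u‖) • u) (by rw [norm_smul, Real.norm_of_nonneg (by positivity)]; field_simp)
  simp only [map_smul, smul_eq_mul, abs_mul, abs_div, abs_norm, abs_of_pos hs] at this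
  rw [Real.norm_eq_abs]
  rw [div_mul_eq_mul_div, div_le_iff₀ (by positivity)] at this
  have h3 : s * |f1 x u| ≤ s * ((B * s + 2 * A / s) * ‖u‖) := by linarith
  exact le_of_mul_le_mul_left h3 hs

/-- Third differences of order `2 + α` control the Hölder seminorm of the second derivative. -/
theorem holder_of_third_diff {α : ℝ} (hα : 0 < α) : ∃ C : ℝ, 0 ≤ C ∧
    ∀ {f : E → ℝ} {f1 : E → E →L[ℝ] ℝ} {f2 : E → E →L[ℝ] E →L[ℝ] ℝ} {N M : ℝ},
    0 ≤ N → 0 ≤ M → (∀ x, HasFDerivAt f (f1 x) x) → (∀ x, HasFDerivAt f1 (f2 x) x) →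
    (∀ x y, ‖f2 x - f2 y‖ ≤ N * ‖x - y‖ ^ α) →
    (∀ ℓ : ℝ, 0 < ℓ → ∀ x h k l : E, ‖h‖ ≤ ℓ → ‖k‖ ≤ ℓ → ‖l‖ ≤ ℓ →
      |ddiff f h k (x + l) - ddiff f h k x| ≤ M * ℓ ^ (2 + α)) →
    ∀ x y, ‖f2 x - f2 y‖ ≤ C * M * ‖x - y‖ ^ α := by
  obtain ⟨n, hn0, hn⟩ : ∃ n : ℕ, 1 ≤ n ∧ (2 / (n : ℝ)) ^ α ≤ 1 / 4 := by
    have h1 : Tendsto (fun n : ℕ => (2 / (n : ℝ)) ^ α) atTop (𝓝 ((0 : ℝ) ^ α)) :=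
      (tendsto_const_div_atTop_nhds_zero_nat 2).rpow_const (Or.inr hα.le)
    rw [Real.zero_rpow hα.ne'] at h1
    have h2 := h1.eventually (ge_mem_nhds (show (0 : ℝ) < 1 / 4 by norm_num))
    obtain ⟨n, h3, h4⟩ := (h2.and (eventually_ge_atTop 1)).exists
    exact ⟨n, h4, h3⟩
  refine ⟨2 * n ^ 2, by positivity, fun {f f1 f2 N M} hN hM h1 h2 hol hd x y => ?_⟩
  have hn' : (1 : ℝ) ≤ n := by exact_mod_cast hn0
  have main := absorb_bound (X := E × E) (F := fun p => ‖f2 p.1 - f2 p.2‖)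
    (w := fun p => ‖p.1 - p.2‖ ^ α) (C := n ^ 2 * M)
    (fun p => Real.rpow_nonneg (norm_nonneg _) _) (mul_nonneg (sq_nonneg _) hM)
    ⟨N, hN, fun p => hol p.1 p.2⟩ ?_ (x, y)
  · simpa [mul_assoc] using main
  rintro B hB hol' ⟨x, y⟩
  simp only
  by_cases hxy : x = y
  · subst hxy
    have h0 := hol x x
    simpa [Real.zero_rpow hα.ne'] using h0
  set ℓ := ‖x - y‖ with hℓ
  have hℓ0 : 0 < ℓ := norm_pos_iff.2 (sub_ne_zero.2 hxy)
  refine norm_bilin_le_of_scale (s := ℓ) hℓ0 (by positivity) fun u v hu hv => ?_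
  set u' := (n : ℝ)⁻¹ • u
  set v' := (n : ℝ)⁻¹ • v
  have hn1 : ‖(n : ℝ)⁻¹‖ = (n : ℝ)⁻¹ := Real.norm_of_nonneg (by positivity)
  have hu' : ‖u'‖ = ℓ / n := by rw [norm_smul, hu, hn1]; field_simp
  have hv' : ‖v'‖ = ℓ / n := by rw [norm_smul, hv, hn1]; field_simp
  have hle : ℓ / n ≤ ℓ := div_le_self hℓ0.le hn'
  have a1 := ddiff_sub_le hα.le hB h1 h2 (fun a b => hol' (a, b)) x v' u'
  have a2 := ddiff_sub_le hα.le hB h1 h2 (fun a b => hol' (a, b)) y v' u'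
  have a3 := hd ℓ hℓ0 y v' u' (x - y) (hv'.trans_le hle) (hu'.trans_le hle) le_rfl
  rw [add_sub_cancel] at a3
  rw [hu', hv'] at a1 a2
  have e1 : ∀ z, f2 z u' v' = (n : ℝ)⁻¹ ^ 2 * f2 z u v := by
    intro z; simp only [u', v', map_smul, _root_.smul_apply, smul_eq_mul]; ring
  rw [e1] at a1 a2
  have e2 : (ℓ / n + ℓ / n) ^ α = (2 / n) ^ α * ℓ ^ α := by
    rw [← Real.mul_rpow (by positivity) hℓ0.le]; congr 1; ring
  rw [e2] at a1 a2
  have e3 : ℓ ^ (2 + α) = ℓ ^ 2 * ℓ ^ α := by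
    rw [Real.rpow_add hℓ0]; norm_cast
  rw [e3] at a3
  have hn2 : (0 : ℝ) < n := by linarith
  have hpos : 0 ≤ ℓ ^ α := by positivity
  have a4 : B * ((2 / n) ^ α * ℓ ^ α) * (ℓ / n) * (ℓ / n)
      ≤ B * (1 / 4 * ℓ ^ α) * (ℓ / n) * (ℓ / n) := by gcongr
  have a1' := abs_le.1 (a1.trans a4)
  have a2' := abs_le.1 (a2.trans a4)
  have a3' := abs_le.1 a3
  have goal' : |(n : ℝ)⁻¹ ^ 2 * ((f2 x - f2 y) u v)| ≤
      (n : ℝ)⁻¹ ^ 2 * ((B / 2 + n ^ 2 * M) * ℓ ^ α * ℓ ^ 2) := by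
    have e4 : (n : ℝ)⁻¹ ^ 2 * ((B / 2 + n ^ 2 * M) * ℓ ^ α * ℓ ^ 2) =
      2 * (B * (1 / 4 * ℓ ^ α) * (ℓ / n) * (ℓ / n)) + M * (ℓ ^ 2 * ℓ ^ α) := by
      field_simp; ring
    rw [e4, _root_.sub_apply, _root_.sub_apply, mul_sub, abs_le]
    constructor <;> linarith
  rw [abs_mul, abs_of_pos (by positivity : (0 : ℝ) < (n : ℝ)⁻¹ ^ 2)] at goal'
  exact le_of_mul_le_mul_left goal' (by positivity)

end Differences

open MeasureTheory

section Gaussian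

variable {d : ℕ}

/-- The Euclidean pairing on `Fin d → ℝ`. -/
def edot (z v : Fin d → ℝ) : ℝ := ∑ i, z i * v i

theorem edot_add_smul (z v w : Fin d → ℝ) (t : ℝ) :
    edot (z + t • v) w = edot z w + t * edot v w := by
  simp only [edot, Pi.add_apply, Pi.smul_apply, smul_eq_mul, mul_sum, ← sum_add_distrib]
  exact sum_congr rfl fun i _ => by ring

theorem edot_comm (z v : Fin d → ℝ) : edot z v = edot v z := by
  simp only [edot, mul_comm]

theorem abs_edot_le (z v : Fin d → ℝ) : |edot z v| ≤ d * (‖z‖ * ‖v‖) := by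
  calc |edot z v| ≤ ∑ i : Fin d, |z i * v i| := abs_sum_le_sum_abs _ _
    _ ≤ ∑ _i : Fin d, ‖z‖ * ‖v‖ := by
        gcongr with i
        rw [abs_mul]
        exact mul_le_mul (norm_le_pi_norm z i) (norm_le_pi_norm v i) (abs_nonneg _)
          (norm_nonneg _)
    _ = _ := by simp

theorem sq_norm_le_edot (z : Fin d → ℝ) : ‖z‖ ^ 2 ≤ edot z z := by
  have h0 : 0 ≤ edot z z := sum_nonneg fun i _ => mul_self_nonneg _
  have : ‖z‖ ≤ √(edot z z) := by
    refine (pi_norm_le_iff_of_nonneg (Real.sqrt_nonneg _)).2 fun i => ?_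
    refine Real.abs_le_sqrt ?_
    rw [sq]
    exact single_le_sum (f := fun i => z i * z i) (fun i _ => mul_self_nonneg _) (mem_univ i)
  calc ‖z‖ ^ 2 ≤ √(edot z z) ^ 2 := by gcongr
    _ = _ := Real.sq_sqrt h0

/-- The unnormalised Gaussian. -/
def gauss0 (z : Fin d → ℝ) : ℝ := Real.exp (-(edot z z) / 2)

theorem gauss0_pos (z : Fin d → ℝ) : 0 < gauss0 z := Real.exp_pos _

theorem continuous_gauss0 : Continuous (gauss0 (d := d)) := by
  unfold gauss0 edot; fun_prop

theorem gauss0_decay (n : ℕ) : ∃ C, 0 ≤ C ∧ ∀ z : Fin d → ℝ, (1 + ‖z‖) ^ n * gauss0 z ≤ C := by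
  refine ⟨n.factorial * Real.exp (3 / 2), by positivity, fun z => ?_⟩
  have h1 := Real.pow_div_factorial_le_exp (x := 1 + ‖z‖) (by positivity) n
  rw [div_le_iff₀ (by positivity)] at h1
  calc (1 + ‖z‖) ^ n * gauss0 z ≤ (Real.exp (1 + ‖z‖) * n.factorial) * gauss0 z := by
        gcongr; exact (gauss0_pos z).le
    _ = n.factorial * Real.exp (1 + ‖z‖ + -(edot z z) / 2) := by
        rw [Real.exp_add _ (-(edot z z) / 2), gauss0]; ring
    _ ≤ _ := by
        gcongr
        nlinarith [sq_norm_le_edot z, sq_nonneg (‖z‖ - 1)]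

/-- Continuous functions with fast decay are integrable. -/
theorem integrable_of_decay {f : (Fin d → ℝ) → ℝ} {C : ℝ} (hf : Continuous f)
    (h : ∀ z, (1 + ‖z‖) ^ (d + 1) * |f z| ≤ C) : Integrable f := by
  have h1 : Integrable (fun z : Fin d → ℝ => (1 + ‖z‖) ^ (-((d : ℝ) + 1))) :=
    integrable_one_add_norm (by simp)
  refine (h1.const_mul C).mono' hf.aestronglyMeasurable (Eventually.of_forall fun z => ?_)
  rw [Real.rpow_neg (by positivity), ← div_eq_mul_inv, le_div_iff₀ (by positivity),
    Real.norm_eq_abs, mul_comm]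
  exact_mod_cast h z

theorem integrable_pow_mul_gauss0 (n : ℕ) :
    Integrable (fun z : Fin d → ℝ => (1 + ‖z‖) ^ n * gauss0 z) := by
  obtain ⟨C, _, h⟩ := gauss0_decay (d := d) (d + 1 + n)
  refine integrable_of_decay (C := C) (by have := continuous_gauss0 (d := d); fun_prop)
    fun z => ?_
  rw [abs_of_nonneg (mul_nonneg (by positivity) (gauss0_pos z).le), ← mul_assoc, ← pow_add]
  exact h z

theorem integral_gauss0_pos : 0 < ∫ z : Fin d → ℝ, gauss0 z := by
  have h := integrable_pow_mul_gauss0 (d := d) 0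
  simp only [pow_zero, one_mul] at h
  rw [integral_pos_iff_support_of_nonneg (fun z => (gauss0_pos z).le) h]
  have : Function.support (gauss0 (d := d)) = univ := by
    ext z; simp [(gauss0_pos z).ne']
  rw [this]
  exact (isOpen_univ).measure_pos _ univ_nonempty

/-- The standard Gaussian density on `Fin d → ℝ`. -/
def gK (z : Fin d → ℝ) : ℝ := (∫ z : Fin d → ℝ, gauss0 z)⁻¹ * gauss0 z

theorem gK_pos (z : Fin d → ℝ) : 0 < gK z :=
  mul_pos (inv_pos.2 integral_gauss0_pos) (gauss0_pos z)

theorem continuous_gK : Continuous (gK (d := d)) := continuous_gauss0.const_mul _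

theorem integral_gK : ∫ z : Fin d → ℝ, gK z = 1 := by
  unfold gK
  rw [integral_const_mul, inv_mul_cancel₀ integral_gauss0_pos.ne']

theorem gK_decay (n : ℕ) : ∃ C, 0 ≤ C ∧ ∀ z : Fin d → ℝ, (1 + ‖z‖) ^ n * gK z ≤ C := by
  obtain ⟨C, hC, h⟩ := gauss0_decay (d := d) n
  have hc := inv_pos.2 (integral_gauss0_pos (d := d))
  refine ⟨(∫ z : Fin d → ℝ, gauss0 z)⁻¹ * C, by positivity, fun z => ?_⟩
  unfold gK
  rw [mul_left_comm]
  gcongr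
  exact h z

theorem integrable_pow_mul_gK (n : ℕ) :
    Integrable (fun z : Fin d → ℝ => (1 + ‖z‖) ^ n * gK z) := by
  refine ((integrable_pow_mul_gauss0 n).const_mul (∫ z : Fin d → ℝ, gauss0 z)⁻¹).congr
    (Eventually.of_forall fun z => ?_)
  simp only [gK]; ring

theorem hasDerivAt_edot (z v w : Fin d → ℝ) (t : ℝ) :
    HasDerivAt (fun t : ℝ => edot (z + t • v) w) (edot v w) t := by
  simp only [edot_add_smul]
  simpa using ((hasDerivAt_id t).mul_const (edot v w)).const_add (edot z w)

theorem hasDerivAt_gK (z v : Fin d → ℝ) (t : ℝ) :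
    HasDerivAt (fun t : ℝ => gK (z + t • v)) (-edot (z + t • v) v * gK (z + t • v)) t := by
  have h1 : ∀ t : ℝ, edot (z + t • v) (z + t • v)
      = edot z z + t * (2 * edot z v) + t ^ 2 * edot v v := by
    intro t
    rw [edot_add_smul, edot_comm z (z + t • v), edot_comm v (z + t • v), edot_add_smul,
      edot_add_smul, edot_comm v z]
    ring
  have h2 : HasDerivAt (fun t : ℝ => -edot (z + t • v) (z + t • v) / 2)
      (-edot (z + t • v) v) t := by
    simp only [h1, edot_add_smul]
    have := ((((hasDerivAt_id t).mul_const (2 * edot z v)).const_add (edot z z)).add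
      (((hasDerivAt_id t).pow 2).mul_const (edot v v))).neg.div_const 2
    refine this.congr_deriv ?_
    simp; ring
  have h3 := (h2.exp).const_mul (∫ z : Fin d → ℝ, gauss0 z)⁻¹
  refine h3.congr_deriv ?_
  unfold gK gauss0
  ring

/-- Third directional derivative of the Gaussian. -/
def gK3 (u v w z : Fin d → ℝ) : ℝ :=
  (-(edot z u * edot z v * edot z w) + edot u v * edot z w + edot u w * edot z v
    + edot v w * edot z u) * gK z

theorem diff_eq_of_hasDerivAt {E : Type*} [AddCommGroup E] [Module ℝ E]
    {F D : E → ℝ} {v : E}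
    (h : ∀ z (t : ℝ), HasDerivAt (fun t : ℝ => F (z + t • v)) (D (z + t • v)) t) (z : E) :
    ∃ s ∈ Icc (0 : ℝ) 1, F (z + v) - F z = D (z + s • v) := by
  obtain ⟨c, hc, h1⟩ := exists_hasDerivAt_eq_slope (fun t : ℝ => F (z + t • v))
    (fun t => D (z + t • v)) one_pos
    (fun t _ => (h z t).continuousAt.continuousWithinAt) (fun t _ => h z t)
  exact ⟨c, ⟨hc.1.le, hc.2.le⟩, by simp at h1; exact h1.symm⟩

/-- The third difference of the Gaussian is an intermediate third derivative. -/
theorem third_diff_gK (u v w z : Fin d → ℝ) : ∃ r ∈ Icc (0 : ℝ) 1, ∃ s ∈ Icc (0 : ℝ) 1,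
    ∃ t ∈ Icc (0 : ℝ) 1, ddiff gK u v (z + w) - ddiff gK u v z
      = gK3 u v w (z + r • w + s • u + t • v) := by
  have shift : ∀ {F D : (Fin d → ℝ) → ℝ} {v : Fin d → ℝ} (a : Fin d → ℝ),
      (∀ z (t : ℝ), HasDerivAt (fun t : ℝ => F (z + t • v)) (D (z + t • v)) t) →
      ∀ z (t : ℝ), HasDerivAt (fun t : ℝ => F (z + t • v + a)) (D (z + t • v + a)) t := by
    intro F D v a h z t
    simpa only [add_right_comm] using h (z + a) t
  obtain ⟨G1, hG1⟩ : ∃ G, G = fun y => -edot y w * gK y := ⟨_, rfl⟩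
  obtain ⟨G2, hG2⟩ : ∃ G, G = fun y => (edot y u * edot y w - edot u w) * gK y := ⟨_, rfl⟩
  have d1 : ∀ z (t : ℝ), HasDerivAt (fun t : ℝ => gK (z + t • w)) (G1 (z + t • w)) t :=
    fun z t => by rw [hG1]; exact hasDerivAt_gK z w t
  have d2 : ∀ z (t : ℝ), HasDerivAt (fun t : ℝ => G1 (z + t • u)) (G2 (z + t • u)) t := by
    intro z t
    rw [hG1, hG2]
    refine ((hasDerivAt_edot z u w t).neg.mul (hasDerivAt_gK z u t)).congr_deriv ?_
    simp only [Pi.neg_apply]; ring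
  have d3 : ∀ z (t : ℝ), HasDerivAt (fun t : ℝ => G2 (z + t • v)) (gK3 u v w (z + t • v)) t := by
    intro z t
    rw [hG2]
    refine ((((hasDerivAt_edot z v u t).mul (hasDerivAt_edot z v w t)).sub_const _).mul
      (hasDerivAt_gK z v t)).congr_deriv ?_
    simp only [gK3, edot_comm u v, Pi.mul_apply]; ring
  obtain ⟨r, hr, h1⟩ := diff_eq_of_hasDerivAt (F := ddiff gK u v) (D := ddiff G1 u v) (v := w)
    (fun z t => (((shift (F := fun y => gK (y + v)) (D := fun y => G1 (y + v)) u (shift v d1) z t).sub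
      (shift u d1 z t)).sub (shift v d1 z t)).add (d1 z t)) z
  obtain ⟨s, hs, h2⟩ := diff_eq_of_hasDerivAt (F := fun y => G1 (y + v) - G1 y)
    (D := fun y => G2 (y + v) - G2 y) (v := u)
    (fun z t => (shift v d2 z t).sub (d2 z t)) (z + r • w)
  obtain ⟨t, ht, h3⟩ := diff_eq_of_hasDerivAt d3 (z + r • w + s • u)
  refine ⟨r, hr, s, hs, t, ht, ?_⟩
  rw [h1, ← h3, ← h2]
  simp only [ddiff]
  ring

theorem third_diff_gK_decay : ∃ C, 0 ≤ C ∧ ∀ u v w z : Fin d → ℝ,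
    ‖u‖ ≤ 1 → ‖v‖ ≤ 1 → ‖w‖ ≤ 1 →
    (1 + ‖z‖) ^ (d + 2) * |ddiff gK u v (z + w) - ddiff gK u v z| ≤ C * (‖u‖ * ‖v‖ * ‖w‖) := by
  obtain ⟨C, hC, h⟩ := gK_decay (d := d) (d + 5)
  refine ⟨4 ^ (d + 2) * ((d ^ 3 + 3 * d ^ 2) * C), by positivity, fun u v w z hu hv hw => ?_⟩
  obtain ⟨r, hr, s, hs, t, ht, e⟩ := third_diff_gK u v w z
  set y := z + r • w + s • u + t • v with hy
  rw [e]
  have hsm : ∀ {r : ℝ} {a : Fin d → ℝ}, r ∈ Icc (0 : ℝ) 1 → ‖a‖ ≤ 1 → ‖r • a‖ ≤ 1 := by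
    intro r a hr ha
    rw [norm_smul, Real.norm_of_nonneg hr.1]
    exact mul_le_one₀ hr.2 (norm_nonneg _) ha
  have hz : 1 + ‖z‖ ≤ 4 * (1 + ‖y‖) := by
    have : z = y - r • w - s • u - t • v := by rw [hy]; abel
    have h1 := norm_sub_le (y - r • w - s • u) (t • v)
    have h2 := norm_sub_le (y - r • w) (s • u)
    have h3 := norm_sub_le y (r • w)
    rw [← this] at h1
    have := hsm hr hw
    have := hsm hs hu
    have := hsm ht hv
    linarith [norm_nonneg y]
  have hK : |gK3 u v w y| ≤ (d ^ 3 + 3 * d ^ 2) * (1 + ‖y‖) ^ 3 * gK y * (‖u‖ * ‖v‖ * ‖w‖) := by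
    unfold gK3
    rw [abs_mul, abs_of_pos (gK_pos y)]
    have p1 : |edot y u * edot y v * edot y w| ≤
        (d * (‖y‖ * ‖u‖)) * (d * (‖y‖ * ‖v‖)) * (d * (‖y‖ * ‖w‖)) := by
      rw [abs_mul, abs_mul]; gcongr <;> exact abs_edot_le _ _
    have p2 : ∀ a b c e : Fin d → ℝ, |edot a b * edot c e| ≤
        (d * (‖a‖ * ‖b‖)) * (d * (‖c‖ * ‖e‖)) := by
      intro a b c e
      rw [abs_mul]; gcongr <;> exact abs_edot_le _ _
    have q1 := p2 u v y w
    have q2 := p2 u w y v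
    have q3 := p2 v w y u
    have hY : ‖y‖ ^ 3 ≤ (1 + ‖y‖) ^ 3 := by gcongr; linarith
    have hY' : ‖y‖ ≤ (1 + ‖y‖) ^ 3 := by
      have h0 := norm_nonneg y
      nlinarith [sq_nonneg ‖y‖, pow_nonneg h0 3]
    have step : |-(edot y u * edot y v * edot y w) + edot u v * edot y w + edot u w * edot y v
        + edot v w * edot y u| ≤ (d ^ 3 + 3 * d ^ 2) * (1 + ‖y‖) ^ 3 * (‖u‖ * ‖v‖ * ‖w‖) := by
      have s1 : (d * (‖y‖ * ‖u‖)) * (d * (‖y‖ * ‖v‖)) * (d * (‖y‖ * ‖w‖))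
          ≤ d ^ 3 * (1 + ‖y‖) ^ 3 * (‖u‖ * ‖v‖ * ‖w‖) := by
        calc _ = d ^ 3 * ‖y‖ ^ 3 * (‖u‖ * ‖v‖ * ‖w‖) := by ring
          _ ≤ _ := by gcongr
      have s2 : d ^ 2 * ‖y‖ * (‖u‖ * ‖v‖ * ‖w‖)
          ≤ d ^ 2 * (1 + ‖y‖) ^ 3 * (‖u‖ * ‖v‖ * ‖w‖) := by gcongr
      have a1 := abs_le.1 p1
      have a2 := abs_le.1 q1
      have a3 := abs_le.1 q2
      have a4 := abs_le.1 q3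
      rw [abs_le]; constructor <;> nlinarith
    calc _ ≤ ((d ^ 3 + 3 * d ^ 2) * (1 + ‖y‖) ^ 3 * (‖u‖ * ‖v‖ * ‖w‖)) * gK y := by
          gcongr; exact (gK_pos y).le
      _ = _ := by ring
  calc (1 + ‖z‖) ^ (d + 2) * |gK3 u v w y|
      ≤ (4 * (1 + ‖y‖)) ^ (d + 2) * ((d ^ 3 + 3 * d ^ 2) * (1 + ‖y‖) ^ 3 * gK y
          * (‖u‖ * ‖v‖ * ‖w‖)) := by gcongr
    _ = 4 ^ (d + 2) * ((d ^ 3 + 3 * d ^ 2) * ((1 + ‖y‖) ^ (d + 5) * gK y))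
          * (‖u‖ * ‖v‖ * ‖w‖) := by
        rw [mul_pow]; ring
    _ ≤ _ := by gcongr; exact h y

end Gaussian

section UniformContinuity

variable {E : Type*} [NormedAddCommGroup E]

theorem norm_sub_sub_sub_le {V : Type*} [SeminormedAddCommGroup V] {a b c e : V} {p q : ℝ}
    (h : ‖a - b‖ ≤ p) (h' : ‖c - e‖ ≤ q) : ‖a - c - (b - e)‖ ≤ p + q := by
  rw [sub_sub_sub_comm]
  exact norm_sub_le_of_le h h'

/-- Uniform continuity in space-time. -/
def UC {F : Type*} [NormedAddCommGroup F] (g : ℝ → E → F) : Prop :=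
  ∀ ε > 0, ∃ δ > 0, ∀ t s x y, |t - s| < δ → ‖x - y‖ < δ → ‖g t x - g s y‖ ≤ ε

/-- Bounded sources, Hölder in space and uniformly continuous. -/
structure Src (α G : ℝ) (g : ℝ → E → ℝ) : Prop where
  b : ∀ t x, |g t x| ≤ G
  hol : ∀ t x y, |g t x - g t y| ≤ G * ‖x - y‖ ^ α
  uc : UC g

theorem Src.nonneg {α G : ℝ} {g : ℝ → E → ℝ} (h : Src α G g) : 0 ≤ G :=
  (abs_nonneg _).trans (h.b 0 0)

theorem Src.mono {α G G' : ℝ} {g : ℝ → E → ℝ} (h : Src α G g) (hG : G ≤ G') : Src α G' g :=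
  ⟨fun t x => (h.b t x).trans hG, fun t x y => (h.hol t x y).trans (by gcongr), h.uc⟩

variable {F F' : Type*} [NormedAddCommGroup F] [NormedAddCommGroup F']

theorem UC.continuous {g : ℝ → E → F} (h : UC g) : Continuous fun p : ℝ × E => g p.1 p.2 := by
  rw [Metric.continuous_iff]
  intro p ε hε
  obtain ⟨δ, hδ, H⟩ := h (ε / 2) (by positivity)
  refine ⟨δ, hδ, fun q hq => ?_⟩
  rw [Prod.dist_eq, max_lt_iff, Real.dist_eq, dist_eq_norm] at hq
  rw [dist_eq_norm]
  linarith [H q.1 p.1 q.2 p.2 hq.1 hq.2]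

theorem UC.add {g h : ℝ → E → F} (hg : UC g) (hh : UC h) : UC fun t x => g t x + h t x := by
  intro ε hε
  obtain ⟨δ, hδ, H⟩ := hg (ε / 2) (by positivity)
  obtain ⟨δ', hδ', H'⟩ := hh (ε / 2) (by positivity)
  refine ⟨min δ δ', lt_min hδ hδ', fun t s x y h1 h2 => ?_⟩
  rw [lt_min_iff] at h1 h2
  have a := H t s x y h1.1 h2.1
  have b := H' t s x y h1.2 h2.2
  calc _ = ‖(g t x - g s y) + (h t x - h s y)‖ := by rw [add_sub_add_comm]
    _ ≤ _ := (norm_add_le _ _).trans (by linarith)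

/-- Two uniformly continuous functions composed with a locally Lipschitz bilinear-like map. -/
theorem UC.bilin {H : Type*} [NormedAddCommGroup H] {g : ℝ → E → F} {h : ℝ → E → F'}
    {b : F → F' → H} {C A B : ℝ} (hC : 0 ≤ C)
    (hb : ∀ x y x' y', ‖b x y - b x' y'‖ ≤ C * (‖x - x'‖ * ‖y‖ + ‖x'‖ * ‖y - y'‖))
    (hg : UC g) (hh : UC h) (hA : ∀ t x, ‖g t x‖ ≤ A) (hB : ∀ t x, ‖h t x‖ ≤ B) :
    UC fun t x => b (g t x) (h t x) := by
  intro ε hε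
  have hA0 : 0 ≤ A := (norm_nonneg _).trans (hA 0 0)
  have hB0 : 0 ≤ B := (norm_nonneg _).trans (hB 0 0)
  have hpos : 0 < C * (A + B) + 1 := by positivity
  obtain ⟨δ, hδ, K⟩ := hg (ε / (C * (A + B) + 1)) (by positivity)
  obtain ⟨δ', hδ', K'⟩ := hh (ε / (C * (A + B) + 1)) (by positivity)
  refine ⟨min δ δ', lt_min hδ hδ', fun t s x y h1 h2 => ?_⟩
  rw [lt_min_iff] at h1 h2
  calc _ ≤ C * (‖g t x - g s y‖ * ‖h t x‖ + ‖g s y‖ * ‖h t x - h s y‖) := hb _ _ _ _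
    _ ≤ C * (ε / (C * (A + B) + 1) * B + A * (ε / (C * (A + B) + 1))) := by
        gcongr
        · exact K t s x y h1.1 h2.1
        · exact hB t x
        · exact hA s y
        · exact K' t s x y h1.2 h2.2
    _ = C * (A + B) / (C * (A + B) + 1) * ε := by field_simp; ring
    _ ≤ 1 * ε := by gcongr; rw [div_le_one hpos]; linarith
    _ = ε := one_mul _

theorem UC.mul {g h : ℝ → E → ℝ} {A B : ℝ}
    (hg : UC g) (hh : UC h) (hA : ∀ t x, |g t x| ≤ A) (hB : ∀ t x, |h t x| ≤ B) :
    UC fun t x => g t x * h t x :=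
  UC.bilin (b := fun x y => x * y) zero_le_one (fun x y x' y' => by
    rw [one_mul, ← norm_mul, ← norm_mul]
    exact (congrArg norm (by ring)).trans_le (norm_add_le _ _)) hg hh hA hB

theorem UC.lip {g : ℝ → E → F} {b : F → F'} {C : ℝ} (hC : 0 ≤ C)
    (hb : ∀ x x', ‖b x - b x'‖ ≤ C * ‖x - x'‖) (hg : UC g) : UC fun t x => b (g t x) := by
  intro ε hε
  obtain ⟨δ, hδ, K⟩ := hg (ε / (C + 1)) (by positivity)
  refine ⟨δ, hδ, fun t s x y h1 h2 => (hb _ _).trans ?_⟩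
  calc C * ‖g t x - g s y‖ ≤ C * (ε / (C + 1)) := by gcongr; exact K _ _ _ _ h1 h2
    _ = C / (C + 1) * ε := by ring
    _ ≤ 1 * ε := by gcongr; rw [div_le_one (by positivity)]; linarith
    _ = ε := one_mul _

theorem UC.const_mul {g : ℝ → E → ℝ} (c : ℝ) (hg : UC g) : UC fun t x => c * g t x :=
  UC.lip (b := fun y => c * y) (abs_nonneg c) (fun x y => by
    rw [← mul_sub, norm_mul, Real.norm_eq_abs]) hg

theorem UC.neg {g : ℝ → E → F} (hg : UC g) : UC fun t x => -g t x :=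
  UC.lip (b := fun y => -y) zero_le_one (fun x y => by
    rw [neg_sub_neg, norm_sub_rev, one_mul]) hg

theorem UC.sub {g h : ℝ → E → F} (hg : UC g) (hh : UC h) : UC fun t x => g t x - h t x := by
  simpa only [sub_eq_add_neg] using hg.add hh.neg

theorem UC.const (c : F) : UC fun (_ : ℝ) (_ : E) => c :=
  fun ε hε => ⟨1, one_pos, fun _ _ _ _ _ _ => by simpa using hε.le⟩

theorem UC.sum {ι : Type*} (s : Finset ι) {g : ι → ℝ → E → F} (h : ∀ i, UC (g i)) :
    UC fun t x => ∑ i ∈ s, g i t x := by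
  classical
  induction s using Finset.induction_on with
  | empty => simpa using UC.const (0 : F)
  | insert i s hi ih => simpa only [sum_insert hi] using (h i).add ih

/-- Uniform continuity from uniform time regularity and a Hölder bound in space. -/
theorem UC.of_time_holder {g : ℝ → E → F} {C α : ℝ} (hα : 0 < α)
    (hx : ∀ t x y, ‖g t x - g t y‖ ≤ C * ‖x - y‖ ^ α)
    (ht : ∀ ε > 0, ∃ δ > 0, ∀ t s x, |t - s| < δ → ‖g t x - g s x‖ ≤ ε) : UC g := by
  intro ε hε
  obtain ⟨δ, hδ, H⟩ := ht (ε / 2) (by positivity)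
  have hlim : Tendsto (fun r : ℝ => C * r ^ α) (𝓝 0) (𝓝 (C * 0 ^ α)) :=
    ((Real.continuousAt_rpow_const 0 α (Or.inr hα.le)).tendsto).const_mul C
  rw [Real.zero_rpow hα.ne', mul_zero] at hlim
  obtain ⟨δ', hδ', H'⟩ := Metric.eventually_nhds_iff.1
    (hlim.eventually (gt_mem_nhds (show (0 : ℝ) < ε / 2 by positivity)))
  refine ⟨min δ δ', lt_min hδ hδ', fun t s x y h1 h2 => ?_⟩
  rw [lt_min_iff] at h1 h2
  have a := H t s x h1.1
  have b := (hx s x y).trans (H' (y := ‖x - y‖) (by simpa using h2.2)).le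
  calc _ = ‖(g t x - g s x) + (g s x - g s y)‖ := by congr 1; abel
    _ ≤ _ := (norm_add_le _ _).trans (by linarith)

end UniformContinuity

section Jets

variable {E : Type*} [NormedAddCommGroup E] [NormedSpace ℝ E]

/-- A space-time function together with candidates for its derivatives. -/
structure Jet (E : Type*) [NormedAddCommGroup E] [NormedSpace ℝ E] where
  v : ℝ → E → ℝ
  d1 : ℝ → E → E →L[ℝ] ℝ
  d2 : ℝ → E → E →L[ℝ] E →L[ℝ] ℝ
  dt : ℝ → E → ℝ

/-- Bounded space-time functions with bounded derivatives, Hölder in space. -/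
structure Reg (α N : ℝ) (w : Jet E) : Prop where
  h1 : ∀ t x, HasFDerivAt (w.v t) (w.d1 t x) x
  h2 : ∀ t x, HasFDerivAt (w.d1 t) (w.d2 t x) x
  ht : ∀ t x, HasDerivAt (fun s => w.v s x) (w.dt t x) t
  bv : ∀ t x, |w.v t x| ≤ N
  b1 : ∀ t x, ‖w.d1 t x‖ ≤ N
  b2 : ∀ t x, ‖w.d2 t x‖ ≤ N
  bt : ∀ t x, |w.dt t x| ≤ N
  hol : ∀ t x y, ‖w.d2 t x - w.d2 t y‖ ≤ N * ‖x - y‖ ^ α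
  uct : UC w.dt

namespace Reg

variable {α N : ℝ} {w : Jet E}

theorem nonneg (h : Reg α N w) : 0 ≤ N := (abs_nonneg _).trans (h.bv 0 0)

theorem mono {N' : ℝ} (h : Reg α N w) (hN : N ≤ N') : Reg α N' w where
  h1 := h.h1
  h2 := h.h2
  ht := h.ht
  bv t x := (h.bv t x).trans hN
  b1 t x := (h.b1 t x).trans hN
  b2 t x := (h.b2 t x).trans hN
  bt t x := (h.bt t x).trans hN
  hol t x y := (h.hol t x y).trans (by gcongr)
  uct := h.uct

theorem time_lip (h : Reg α N w) (t s : ℝ) (x : E) : |w.v t x - w.v s x| ≤ N * |t - s| := by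
  have := convex_univ.norm_image_sub_le_of_norm_hasDerivWithin_le (f := fun s => w.v s x)
    (f' := fun s => w.dt s x) (C := N) (fun y _ => (h.ht y x).hasDerivWithinAt)
    (fun y _ => h.bt y x) (mem_univ s) (mem_univ t)
  simpa using this

theorem space_lip (h : Reg α N w) (t : ℝ) (x y : E) : |w.v t x - w.v t y| ≤ N * ‖x - y‖ :=
  convex_univ.norm_image_sub_le_of_norm_hasFDerivWithin_le
    (fun z _ => (h.h1 t z).hasFDerivWithinAt) (fun z _ => h.b1 t z) (mem_univ _) (mem_univ _)

theorem d1_lip (h : Reg α N w) (t : ℝ) (x y : E) : ‖w.d1 t x - w.d1 t y‖ ≤ N * ‖x - y‖ :=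
  convex_univ.norm_image_sub_le_of_norm_hasFDerivWithin_le
    (fun z _ => (h.h2 t z).hasFDerivWithinAt) (fun z _ => h.b2 t z) (mem_univ _) (mem_univ _)

theorem ucv (h : Reg α N w) : UC w.v := by
  refine UC.of_time_holder (α := 1) (C := N) one_pos (fun t x y => ?_) fun ε hε => ?_
  · simpa using h.space_lip t x y
  · have hN := h.nonneg
    refine ⟨ε / (N + 1), by positivity, fun t s x hts => (h.time_lip t s x).trans ?_⟩
    calc N * |t - s| ≤ (N + 1) * (ε / (N + 1)) := by gcongr; linarith
      _ = ε := by field_simp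

/-- Uniform time continuity of the second derivative, from interpolation. -/
theorem d2_time (h : Reg α N w) (hα : 0 < α) :
    ∀ ε > 0, ∃ δ > 0, ∀ t s x, |t - s| < δ → ‖w.d2 t x - w.d2 s x‖ ≤ ε := by
  intro ε hε
  have hN := h.nonneg
  have hlim : Tendsto (fun r : ℝ => (2 * N) * (2 * r) ^ α) (𝓝[>] 0)
      (𝓝 ((2 * N) * (2 * 0) ^ α)) :=
    (Continuous.tendsto (((continuous_const.mul continuous_id).rpow_const
      fun _ => Or.inr hα.le).const_mul _) 0).mono_left nhdsWithin_le_nhds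
  rw [mul_zero, Real.zero_rpow hα.ne', mul_zero] at hlim
  obtain ⟨r, hr, hr0⟩ := ((hlim.eventually (gt_mem_nhds (show (0 : ℝ) < ε / 2 by
    positivity))).and self_mem_nhdsWithin).exists
  refine ⟨ε / 2 * r ^ 2 / (4 * (N + 1)), by positivity, fun t s x hts => ?_⟩
  have := interpolate_second (f := fun y => w.v t y - w.v s y)
    (f1 := fun y => w.d1 t y - w.d1 s y) (f2 := fun y => w.d2 t y - w.d2 s y)
    (N := 2 * N) (A := N * |t - s|) hα.le (by positivity) hr0
    (fun y => (h.h1 t y).sub (h.h1 s y)) (fun y => (h.h2 t y).sub (h.h2 s y))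
    (fun y z => ?_) (fun y => h.time_lip t s y) x
  · refine this.trans ?_
    have h4 : 4 * (N * |t - s|) / r ^ 2 ≤ ε / 2 := by
      rw [div_le_iff₀ (by positivity)]
      rw [lt_div_iff₀ (by positivity)] at hts
      nlinarith [abs_nonneg (t - s)]
    linarith
  · exact (norm_sub_sub_sub_le (V := E →L[ℝ] E →L[ℝ] ℝ) (h.hol t y z) (h.hol s y z)).trans_eq (by ring)

theorem uc2 (h : Reg α N w) (hα : 0 < α) : UC w.d2 :=
  UC.of_time_holder hα h.hol (h.d2_time hα)

theorem uc1 (h : Reg α N w) (hα : 0 < α) : UC w.d1 := by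
  refine UC.of_time_holder (α := 1) (C := N) one_pos (fun t x y => ?_) fun ε hε => ?_
  · simpa using h.d1_lip t x y
  · have hN := h.nonneg
    obtain ⟨δ, hδ, H⟩ := h.d2_time hα (ε / 2) (by positivity)
    refine ⟨min δ (ε / 2 / (2 * (N + 1))), by positivity, fun t s x hts => ?_⟩
    rw [lt_min_iff] at hts
    have := interpolate_first (f := fun y => w.v t y - w.v s y)
      (f1 := fun y => w.d1 t y - w.d1 s y) (f2 := fun y => w.d2 t y - w.d2 s y)
      (B := ε / 2) (A := N * |t - s|) one_pos
      (fun y => (h.h1 t y).sub (h.h1 s y)) (fun y => (h.h2 t y).sub (h.h2 s y))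
      (fun y => H t s y hts.1) (fun y => h.time_lip t s y) x
    refine this.trans ?_
    have h2 := hts.2
    rw [lt_div_iff₀ (by positivity)] at h2
    nlinarith [abs_nonneg (t - s)]

/-- Joint differentiability. -/
theorem hasFDerivAt (h : Reg α N w) (hα : 0 < α) (t : ℝ) (x : E) :
    HasFDerivAt (fun p : ℝ × E => w.v p.1 p.2)
      (((ContinuousLinearMap.toSpanSingleton ℝ (w.dt t x))).coprod (w.d1 t x)) (t, x) := by
  have c1 := h.uct.continuous
  have e : ∀ c : ℝ, ContinuousLinearMap.toSpanSingleton ℝ c = c • ContinuousLinearMap.id ℝ ℝ :=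
    fun c => by ext; simp
  have := hasStrictFDerivAt_uncurry_coprod (𝕜 := ℝ) (u := (t, x)) (f := w.v)
    (f₁ := fun t x => ContinuousLinearMap.toSpanSingleton ℝ (w.dt t x)) (f₂ := w.d1)
    (Eventually.of_forall fun p => (h.ht p.1 p.2).hasFDerivAt)
    (Eventually.of_forall fun p => h.h1 p.1 p.2)
    (by
      simp only [e]
      exact (c1.smul continuous_const).continuousAt)
    (h.uc1 hα).continuous.continuousAt
  exact this.hasFDerivAt

end Reg

end Jets

section Averages

variable {d : ℕ}

/-- The standard Gaussian measure. -/
def gaussMeas (d : ℕ) : Measure (Fin d → ℝ) := volume.withDensity fun z => ENNReal.ofReal (gK z)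

/-- The standard exponential law. -/
def expoMeas : Measure ℝ :=
  (volume.restrict (Set.Ioi 0)).withDensity fun r => ENNReal.ofReal (Real.exp (-r))

theorem integral_ofReal_density {X : Type*} [MeasurableSpace X] {μ : Measure X} {k : X → ℝ}
    (hk : Measurable k) (h0 : ∀ x, 0 ≤ k x) (g : X → ℝ) :
    ∫ x, g x ∂(μ.withDensity fun x => ENNReal.ofReal (k x)) = ∫ x, k x * g x ∂μ := by
  rw [integral_withDensity_eq_integral_toReal_smul (by fun_prop) (by simp)]
  simp [ENNReal.toReal_ofReal, h0]

theorem integral_gaussMeas (g : (Fin d → ℝ) → ℝ) :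
    ∫ z, g z ∂gaussMeas d = ∫ z, gK z * g z :=
  integral_ofReal_density continuous_gK.measurable (fun z => (gK_pos z).le) g

theorem integral_expoMeas (g : ℝ → ℝ) :
    ∫ r, g r ∂expoMeas = ∫ r in Set.Ioi (0 : ℝ), Real.exp (-r) * g r :=
  integral_ofReal_density (by fun_prop) (fun r => (Real.exp_pos _).le) g

theorem isProbabilityMeasure_density {X : Type*} [MeasurableSpace X] {μ : Measure X} {k : X → ℝ}
    (h0 : ∀ x, 0 ≤ k x) (hi : Integrable k μ) (h1 : ∫ x, k x ∂μ = 1) :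
    IsProbabilityMeasure (μ.withDensity fun x => ENNReal.ofReal (k x)) := by
  constructor
  rw [withDensity_apply _ MeasurableSet.univ, Measure.restrict_univ,
    ← ofReal_integral_eq_lintegral_ofReal hi (Eventually.of_forall h0), h1, ENNReal.ofReal_one]

instance : IsProbabilityMeasure (gaussMeas d) :=
  isProbabilityMeasure_density (fun z => (gK_pos z).le)
    (by simpa using integrable_pow_mul_gK (d := d) 0) integral_gK

instance : IsProbabilityMeasure expoMeas :=
  isProbabilityMeasure_density (fun r => (Real.exp_pos _).le)
    (integrableOn_exp_neg_Ioi 0) (by simpa using integral_exp_neg_Ioi 0)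

/-- The product of the exponential and the Gaussian law. -/
def shiftMeas (d : ℕ) : Measure (ℝ × (Fin d → ℝ)) := expoMeas.prod (gaussMeas d)

instance : IsProbabilityMeasure (shiftMeas d) := by unfold shiftMeas; infer_instance

/-- The resolvent average of `g` for the constant-coefficient operator given by `σ`. -/
def avg (σ : (Fin d → ℝ) →L[ℝ] (Fin d → ℝ)) (g : ℝ → (Fin d → ℝ) → ℝ) (t : ℝ)
    (x : Fin d → ℝ) : ℝ :=
  ∫ p, g (t - p.1) (x - √p.1 • σ p.2) ∂shiftMeas d

variable {σ : (Fin d → ℝ) →L[ℝ] (Fin d → ℝ)} {g : ℝ → (Fin d → ℝ) → ℝ} {G : ℝ}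

theorem integrable_shift {F : Type*} [NormedAddCommGroup F] {g : ℝ → (Fin d → ℝ) → F}
    (hb : ∀ t x, ‖g t x‖ ≤ G)
    (hc : Continuous fun p : ℝ × (Fin d → ℝ) => g p.1 p.2) (t : ℝ) (x : Fin d → ℝ) :
    Integrable (fun p : ℝ × (Fin d → ℝ) => g (t - p.1) (x - √p.1 • σ p.2)) (shiftMeas d) := by
  have : Continuous fun p : ℝ × (Fin d → ℝ) => g (t - p.1) (x - √p.1 • σ p.2) :=
    hc.comp (f := fun p : ℝ × (Fin d → ℝ) => (t - p.1, x - √p.1 • σ p.2)) (by fun_prop)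
  exact Integrable.of_bound this.aestronglyMeasurable G (Eventually.of_forall fun p => hb _ _)

theorem avg_eq_iterated (hb : ∀ t x, |g t x| ≤ G)
    (hc : Continuous fun p : ℝ × (Fin d → ℝ) => g p.1 p.2) (t : ℝ) (x : Fin d → ℝ) :
    avg σ g t x = ∫ r in Set.Ioi (0 : ℝ), Real.exp (-r) *
      ∫ z, gK z * g (t - r) (x - √r • σ z) := by
  unfold avg shiftMeas
  rw [integral_prod _ (integrable_shift hb hc t x), integral_expoMeas]
  simp only [integral_gaussMeas]

end Averages

section Identity

variable {d : ℕ} {α N : ℝ}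

/-- The standard basis vectors. -/
abbrev eb (k : Fin d) : Fin d → ℝ := Pi.single k 1

theorem norm_eb (k : Fin d) : ‖eb k‖ = 1 := by simp [eb, Pi.norm_single]

/-- The constant-coefficient second-order operator attached to `σ`. -/
def lapl (σ : (Fin d → ℝ) →L[ℝ] (Fin d → ℝ)) (H : (Fin d → ℝ) →L[ℝ] (Fin d → ℝ) →L[ℝ] ℝ) : ℝ :=
  1 / 2 * ∑ k, H (σ (eb k)) (σ (eb k))

theorem abs_lapl_le (σ : (Fin d → ℝ) →L[ℝ] (Fin d → ℝ))
    (H : (Fin d → ℝ) →L[ℝ] (Fin d → ℝ) →L[ℝ] ℝ) : |lapl σ H| ≤ d * ‖σ‖ ^ 2 * ‖H‖ := by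
  unfold lapl
  have h1 : ∀ k : Fin d, |H (σ (eb k)) (σ (eb k))| ≤ ‖σ‖ ^ 2 * ‖H‖ := by
    intro k
    have h2 : ‖σ (eb k)‖ ≤ ‖σ‖ := by
      simpa [norm_eb] using σ.le_opNorm (eb k)
    calc _ ≤ ‖H‖ * ‖σ (eb k)‖ * ‖σ (eb k)‖ := H.le_opNorm₂ _ _
      _ ≤ ‖H‖ * ‖σ‖ * ‖σ‖ := by gcongr
      _ = _ := by ring
  have h3 : |∑ k : Fin d, H (σ (eb k)) (σ (eb k))| ≤ d * (‖σ‖ ^ 2 * ‖H‖) := by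
    refine (abs_sum_le_sum_abs _ _).trans ((sum_le_sum fun k _ => h1 k).trans ?_)
    simp
  rw [abs_mul, abs_of_pos (by norm_num : (0 : ℝ) < 1 / 2)]
  have := abs_nonneg (∑ k : Fin d, H (σ (eb k)) (σ (eb k)))
  linarith

theorem lapl_sub (σ : (Fin d → ℝ) →L[ℝ] (Fin d → ℝ))
    (H K : (Fin d → ℝ) →L[ℝ] (Fin d → ℝ) →L[ℝ] ℝ) : lapl σ (H - K) = lapl σ H - lapl σ K := by
  simp only [lapl, _root_.sub_apply, sum_sub_distrib, mul_sub]

theorem UC.lapl {H : ℝ → (Fin d → ℝ) → (Fin d → ℝ) →L[ℝ] (Fin d → ℝ) →L[ℝ] ℝ} (h : UC H)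
    (σ : (Fin d → ℝ) →L[ℝ] (Fin d → ℝ)) : UC fun t x => lapl σ (H t x) :=
  UC.lip (b := _root_.lapl σ) (C := d * ‖σ‖ ^ 2) (by positivity)
    (fun K K' => by rw [← lapl_sub]; exact abs_lapl_le _ _) h

/-- Gaussian integration by parts. -/
theorem gauss_ibp {φ φ' : (Fin d → ℝ) → ℝ} {C : ℝ} (k : Fin d) (hc : Continuous φ)
    (hc' : Continuous φ') (hb : ∀ z, |φ z| ≤ C) (hb' : ∀ z, |φ' z| ≤ C)
    (hd : ∀ z, HasLineDerivAt ℝ φ (φ' z) z (eb k)) :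
    ∫ z, gK z * (z k * φ z) = ∫ z, gK z * φ' z := by
  have e : ∀ z : Fin d → ℝ, edot z (eb k) = z k := fun z => by simp [edot, eb, Pi.single_apply]
  have hg : ∀ z : Fin d → ℝ, HasLineDerivAt ℝ gK (-(z k) * gK z) z (eb k) := by
    intro z
    have := hasDerivAt_gK z (eb k) 0
    simp only [zero_smul, add_zero, e] at this
    exact this
  have hint : ∀ {ψ : (Fin d → ℝ) → ℝ}, Continuous ψ → (∀ z, |ψ z| ≤ C * (1 + ‖z‖) ^ 1) →
      Integrable fun z => gK z * ψ z := by
    intro ψ h1 h2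
    refine ((integrable_pow_mul_gK (d := d) 1).const_mul C).mono'
      (continuous_gK.mul h1).aestronglyMeasurable (Eventually.of_forall fun z => ?_)
    rw [norm_mul, Real.norm_of_nonneg (gK_pos z).le, ← mul_assoc, mul_comm]
    exact mul_le_mul_of_nonneg_right (h2 z) (gK_pos z).le
  have hC : 0 ≤ C := (abs_nonneg _).trans (hb 0)
  have hle : ∀ z : Fin d → ℝ, C ≤ C * (1 + ‖z‖) ^ 1 := fun z => by
    rw [pow_one]; nlinarith [norm_nonneg z]
  have i1 := hint hc fun z => (hb z).trans (hle z)
  have i2 := hint hc' fun z => (hb' z).trans (hle z)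
  have i3 := hint (ψ := fun z => z k * φ z) (by fun_prop) fun z => by
    rw [abs_mul, mul_comm, pow_one]
    gcongr
    · exact hb z
    · have := norm_le_pi_norm z k
      rw [Real.norm_eq_abs] at this; linarith
  have := integral_bilinear_hasLineDerivAt_right_eq_neg_left_of_integrable (μ := volume)
    (f := φ) (f' := φ') (g := gK) (g' := fun z => -(z k) * gK z) (v := eb k)
    (B := ContinuousLinearMap.mul ℝ ℝ)
    (i2.congr (Eventually.of_forall fun z => by simp [mul_comm]))
    (i3.neg.congr (Eventually.of_forall fun z => by simp; ring))
    (i1.congr (Eventually.of_forall fun z => by simp [mul_comm]))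
    (fun z _ => hd z) (fun z _ => hg z)
  simp only [ContinuousLinearMap.mul_apply'] at this
  rw [← neg_inj, ← integral_neg, ← integral_neg]
  rw [← integral_neg] at this
  convert this using 2
  · ext z; ring
  · ext z; ring

theorem continuous_comp_shift {F : Type*} [TopologicalSpace F] {g : ℝ → (Fin d → ℝ) → F}
    (hc : Continuous fun p : ℝ × (Fin d → ℝ) => g p.1 p.2) (t : ℝ)
    (x : Fin d → ℝ) (σ : (Fin d → ℝ) →L[ℝ] (Fin d → ℝ)) :
    Continuous fun p : ℝ × (Fin d → ℝ) => g (t - p.1) (x - √p.1 • σ p.2) :=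
  hc.comp (f := fun p : ℝ × (Fin d → ℝ) => (t - p.1, x - √p.1 • σ p.2)) (by fun_prop)

theorem continuous_gauss_shift {g : ℝ → (Fin d → ℝ) → ℝ} {G : ℝ} (hb : ∀ t x, |g t x| ≤ G)
    (hc : Continuous fun p : ℝ × (Fin d → ℝ) => g p.1 p.2) (t : ℝ)
    (x : Fin d → ℝ) (σ : (Fin d → ℝ) →L[ℝ] (Fin d → ℝ)) :
    Continuous fun r : ℝ => ∫ z, gK z * g (t - r) (x - √r • σ z) := by
  have h := continuous_comp_shift hc t x σ
  refine continuous_of_dominated (bound := fun z => G * gK z) (fun r => ?_) (fun r => ?_) ?_ ?_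
  · exact (continuous_gK.mul (h.comp (by fun_prop : Continuous fun z : Fin d → ℝ =>
      (r, z)))).aestronglyMeasurable
  · refine Eventually.of_forall fun z => ?_
    rw [norm_mul, Real.norm_of_nonneg (gK_pos z).le, mul_comm]
    exact mul_le_mul_of_nonneg_right (hb _ _) (gK_pos z).le
  · simpa using (integrable_pow_mul_gK (d := d) 0).const_mul G
  · exact Eventually.of_forall fun z => continuous_const.mul
      (h.comp (by fun_prop : Continuous fun r : ℝ => (r, z)))

variable {w : Jet (Fin d → ℝ)} {σ : (Fin d → ℝ) →L[ℝ] (Fin d → ℝ)}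

/-- The source for which `w` solves the constant-coefficient equation. -/
def csrc (σ : (Fin d → ℝ) →L[ℝ] (Fin d → ℝ)) (w : Jet (Fin d → ℝ)) (t : ℝ) (x : Fin d → ℝ) : ℝ :=
  w.dt t x - lapl σ (w.d2 t x) + w.v t x

theorem Reg.hasDerivAt_shift (h : Reg α N w) (hα : 0 < α) (t : ℝ) (x z : Fin d → ℝ) {r : ℝ}
    (hr : 0 < r) : HasDerivAt (fun r : ℝ => w.v (t - r) (x - √r • σ z))
      (-w.dt (t - r) (x - √r • σ z)
        - 1 / (2 * √r) * w.d1 (t - r) (x - √r • σ z) (σ z)) r := by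
  have h1 : HasDerivAt (fun r : ℝ => (t - r, x - √r • σ z))
      (-1, -((1 / (2 * √r)) • σ z)) r := by
    refine HasDerivAt.prodMk ((hasDerivAt_id r).const_sub t) ?_
    exact ((Real.hasDerivAt_sqrt hr.ne').smul_const (σ z)).const_sub x
  have h2 := (h.hasFDerivAt hα (t - r) (x - √r • σ z)).comp_hasDerivAt r h1
  refine h2.congr_deriv ?_
  simp
  ring

theorem Reg.gauss_first (h : Reg α N w) (hα : 0 < α) (s c : ℝ) (x : Fin d → ℝ) :
    ∫ z, gK z * w.d1 s (x - c • σ z) (σ z)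
      = -c * ∫ z, gK z * (2 * lapl σ (w.d2 s (x - c • σ z))) := by
  have hN := h.nonneg
  have e1 : ∀ z : Fin d → ℝ, gK z * w.d1 s (x - c • σ z) (σ z)
      = ∑ k, gK z * (z k * w.d1 s (x - c • σ z) (σ (eb k))) := by
    intro z
    have : σ z = ∑ k, z k • σ (eb k) := by
      conv_lhs => rw [pi_eq_sum_univ' z]
      simp only [map_sum, map_smul]
    conv_lhs => rw [this]
    simp only [map_sum, map_smul, smul_eq_mul, mul_sum]
    rw [← this]
  have c1 : Continuous fun z : Fin d → ℝ => w.d1 s (x - c • σ z) :=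
    (h.uc1 hα).continuous.comp (f := fun z : Fin d → ℝ => (s, x - c • σ z)) (by fun_prop)
  have c2 : Continuous fun z : Fin d → ℝ => w.d2 s (x - c • σ z) :=
    (h.uc2 hα).continuous.comp (f := fun z : Fin d → ℝ => (s, x - c • σ z)) (by fun_prop)
  set C := N * ‖σ‖ + |c| * (N * ‖σ‖ * ‖σ‖) with hC
  have hσ : ∀ k : Fin d, ‖σ (eb k)‖ ≤ ‖σ‖ := fun k => by
    simpa [norm_eb] using σ.le_opNorm (eb k)
  have bd1 : ∀ k z, |w.d1 s (x - c • σ z) (σ (eb k))| ≤ C := fun k z => by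
    calc _ ≤ ‖w.d1 s (x - c • σ z)‖ * ‖σ (eb k)‖ := (w.d1 s (x - c • σ z)).le_opNorm _
      _ ≤ N * ‖σ‖ := by gcongr; exacts [h.b1 _ _, hσ k]
      _ ≤ C := le_add_of_nonneg_right (by positivity)
  have bd2 : ∀ k z, |-c * w.d2 s (x - c • σ z) (σ (eb k)) (σ (eb k))| ≤ C := fun k z => by
    rw [abs_mul, abs_neg]
    calc _ ≤ |c| * (‖w.d2 s (x - c • σ z)‖ * ‖σ (eb k)‖ * ‖σ (eb k)‖) := by
          gcongr; exact (w.d2 s (x - c • σ z)).le_opNorm₂ _ _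
      _ ≤ |c| * (N * ‖σ‖ * ‖σ‖) := by gcongr; exacts [h.b2 _ _, hσ k, hσ k]
      _ ≤ C := le_add_of_nonneg_left (by positivity)
  have ib : ∀ {ψ : (Fin d → ℝ) → ℝ}, Continuous ψ → (∀ z, |ψ z| ≤ C) →
      Integrable fun z => gK z * ψ z := fun hψ hb =>
    ((integrable_pow_mul_gK (d := d) 0).mul_const C).mono'
      (continuous_gK.mul hψ).aestronglyMeasurable (Eventually.of_forall fun z => by
        rw [norm_mul, Real.norm_of_nonneg (gK_pos z).le, pow_zero, one_mul]
        exact mul_le_mul_of_nonneg_left (hb z) (gK_pos z).le)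
  have cd1 : ∀ k, Continuous fun z => w.d1 s (x - c • σ z) (σ (eb k)) := fun k => by fun_prop
  have cd2 : ∀ k, Continuous fun z => -c * w.d2 s (x - c • σ z) (σ (eb k)) (σ (eb k)) :=
    fun k => by fun_prop
  have e2 : ∀ k, ∫ z, gK z * (z k * w.d1 s (x - c • σ z) (σ (eb k)))
      = ∫ z, gK z * (-c * w.d2 s (x - c • σ z) (σ (eb k)) (σ (eb k))) := by
    intro k
    refine gauss_ibp k (cd1 k) (cd2 k) (bd1 k) (bd2 k) fun z => ?_
    have i1 : HasFDerivAt (fun z => x - c • σ z) (-(c • σ)) z :=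
      ((σ.hasFDerivAt).const_smul c).const_sub x
    have i2 := ((h.h2 s (x - c • σ z)).comp z i1).clm_apply (hasFDerivAt_const (σ (eb k)) z)
    have i3 := i2.hasLineDerivAt (eb k)
    have e : -c * w.d2 s (x - c • σ z) (σ (eb k)) (σ (eb k))
        = ((w.d1 s ∘ fun z => x - c • σ z) z ∘SL (0 : (Fin d → ℝ) →L[ℝ] (Fin d → ℝ))
          + (w.d2 s (x - c • σ z) ∘SL (-(c • σ))).flip (σ (eb k))) (eb k) := by simp
    rw [e]
    exact i3
  have e3 : ∀ z, -c * (gK z * (2 * lapl σ (w.d2 s (x - c • σ z))))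
      = ∑ k, gK z * (-c * w.d2 s (x - c • σ z) (σ (eb k)) (σ (eb k))) := by
    intro z
    simp only [lapl, mul_sum]
    exact sum_congr rfl fun k _ => by ring
  rw [← integral_const_mul]
  simp only [e1, e3]
  rw [integral_finsetSum, integral_finsetSum]
  · exact sum_congr rfl fun k _ => e2 k
  · exact fun k _ => ib (cd2 k) (bd2 k)
  · intro k _
    refine ((integrable_pow_mul_gK (d := d) 1).mul_const C).mono'
      (continuous_gK.mul ((continuous_apply k).mul (cd1 k))).aestronglyMeasurable
      (Eventually.of_forall fun z => ?_)
    have h1 := norm_le_pi_norm z k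
    rw [norm_mul, Real.norm_of_nonneg (gK_pos z).le, norm_mul, pow_one, mul_comm (1 + ‖z‖),
      mul_assoc]
    refine mul_le_mul_of_nonneg_left ?_ (gK_pos z).le
    exact mul_le_mul (by linarith) (bd1 k z) (abs_nonneg _) (by positivity)

/-- A bounded regular function is the resolvent average of its source. -/
theorem Reg.avg_csrc (h : Reg α N w) (hα : 0 < α) (t : ℝ) (x : Fin d → ℝ) :
    avg σ (csrc σ w) t x = w.v t x := by
  have hN := h.nonneg
  have cdt := h.uct.continuous
  have cv := h.ucv.continuous
  have clap := ((h.uc2 hα).lapl σ).continuous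
  set P := d * ‖σ‖ ^ 2 * N with hP
  have hP0 : 0 ≤ P := by positivity
  have blap : ∀ t x, |lapl σ (w.d2 t x)| ≤ P := fun t x =>
    (abs_lapl_le _ _).trans (by rw [hP]; gcongr; exact h.b2 _ _)
  have cs : Continuous fun p : ℝ × (Fin d → ℝ) => csrc σ w p.1 p.2 := (cdt.sub clap).add cv
  have bs : ∀ t x, |csrc σ w t x| ≤ N + P + N := fun t x =>
    (abs_add_le _ _).trans (add_le_add ((abs_sub _ _).trans (add_le_add (h.bt _ _) (blap _ _)))
      (h.bv _ _))
  rw [avg_eq_iterated bs cs]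
  have ig : ∀ {ψ : ℝ → (Fin d → ℝ) → ℝ} {C : ℝ},
      (Continuous fun p : ℝ × (Fin d → ℝ) => ψ p.1 p.2) → (∀ t x, |ψ t x| ≤ C) → ∀ r : ℝ,
      Integrable fun z => gK z * ψ (t - r) (x - √r • σ z) := fun hψ hb r =>
    ((integrable_pow_mul_gK (d := d) 0).mul_const _).mono'
      (continuous_gK.mul ((continuous_comp_shift hψ t x σ).comp
        (by fun_prop : Continuous fun z : Fin d → ℝ => (r, z)))).aestronglyMeasurable
      (Eventually.of_forall fun z => by
        rw [norm_mul, Real.norm_of_nonneg (gK_pos z).le, pow_zero, one_mul]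
        exact mul_le_mul_of_nonneg_left (hb _ _) (gK_pos z).le)
  have cΦ := continuous_gauss_shift h.bv cv t x σ
  have hΦ : ∀ r : ℝ, 0 < r → HasDerivAt (fun r => ∫ z, gK z * w.v (t - r) (x - √r • σ z))
      (∫ z, gK z * (w.v (t - r) (x - √r • σ z) - csrc σ w (t - r) (x - √r • σ z))) r := by
    intro r hr
    set F' : ℝ → (Fin d → ℝ) → ℝ := fun r z => gK z * (-w.dt (t - r) (x - √r • σ z)
        - 1 / (2 * √r) * w.d1 (t - r) (x - √r • σ z) (σ z)) with hF'
    set K := N + 1 / (2 * √(r / 2)) * (N * ‖σ‖) with hK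
    have hK1 : N ≤ K := le_add_of_nonneg_right (by positivity)
    have c1 : Continuous fun z : Fin d → ℝ => w.d1 (t - r) (x - √r • σ z) (σ z) := by
      have : Continuous fun z : Fin d → ℝ => w.d1 (t - r) (x - √r • σ z) :=
        (h.uc1 hα).continuous.comp (f := fun z : Fin d → ℝ => (t - r, x - √r • σ z))
          (by fun_prop)
      fun_prop
    have c0 : Continuous fun z : Fin d → ℝ => w.dt (t - r) (x - √r • σ z) :=
      cdt.comp (f := fun z : Fin d → ℝ => (t - r, x - √r • σ z)) (by fun_prop)
    have b1 : ∀ s z, |w.d1 s (x - √(t - s) • σ z) (σ z)| ≤ N * ‖σ‖ * ‖z‖ := fun s z => by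
      calc _ ≤ ‖w.d1 s (x - √(t - s) • σ z)‖ * ‖σ z‖ := (w.d1 _ _).le_opNorm _
        _ ≤ N * (‖σ‖ * ‖z‖) := by gcongr; exacts [h.b1 _ _, σ.le_opNorm z]
        _ = _ := by ring
    have key := hasDerivAt_integral_of_dominated_loc_of_deriv_le (μ := volume)
      (F := fun r z => gK z * w.v (t - r) (x - √r • σ z)) (F' := F') (x₀ := r)
      (s := Set.Ioi (r / 2)) (bound := fun z => (1 + ‖z‖) ^ 1 * gK z * K)
      (Ioi_mem_nhds (by linarith))
      (Eventually.of_forall fun r => (ig cv h.bv r).aestronglyMeasurable)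
      (ig cv h.bv r)
      (by
        simp only [hF']
        exact (continuous_gK.mul (c0.neg.sub (c1.const_mul _))).aestronglyMeasurable)
      (Eventually.of_forall fun z r' hr' => by
        have hr' : r / 2 < r' := hr'
        rw [hF', norm_mul, Real.norm_of_nonneg (gK_pos z).le, mul_comm _ (gK z), mul_assoc]
        refine mul_le_mul_of_nonneg_left ?_ (gK_pos z).le
        have hb := b1 (t - r') z
        rw [sub_sub_cancel] at hb
        refine (norm_sub_le _ _).trans ?_
        rw [norm_neg, norm_mul, Real.norm_eq_abs, Real.norm_eq_abs, Real.norm_eq_abs,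
          abs_of_nonneg (by positivity : 0 ≤ 1 / (2 * √r'))]
        have hq : 1 / (2 * √r') ≤ 1 / (2 * √(r / 2)) := by gcongr
        have hs := h.bt (t - r') (x - √r' • σ z)
        calc _ ≤ N + 1 / (2 * √(r / 2)) * (N * ‖σ‖ * ‖z‖) := by gcongr
          _ ≤ (1 + ‖z‖) ^ 1 * K := by
            rw [hK, pow_one]
            have := norm_nonneg z
            have : 0 ≤ 1 / (2 * √(r / 2)) * (N * ‖σ‖) := by positivity
            nlinarith)
      ((integrable_pow_mul_gK (d := d) 1).mul_const K)
      (Eventually.of_forall fun z r' hr' =>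
        (h.hasDerivAt_shift hα t x z (lt_trans (by positivity) hr')).const_mul (gK z))
    refine key.2.congr_deriv ?_
    have i1 := ig cdt h.bt r
    have i2 := ig clap blap r
    have i3 : Integrable fun z => gK z * w.d1 (t - r) (x - √r • σ z) (σ z) := by
      have := (i1.add key.1).const_mul (-(2 * √r))
      refine this.congr (Eventually.of_forall fun z => ?_)
      have hs : √r ≠ 0 := (Real.sqrt_pos.2 hr).ne'
      simp only [hF', Pi.add_apply]
      field_simp
      ring
    have i1n : Integrable fun z => -(gK z * w.dt (t - r) (x - √r • σ z)) := i1.neg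
    have e1 : ∫ z, F' r z = -(∫ z, gK z * w.dt (t - r) (x - √r • σ z))
        - 1 / (2 * √r) * ∫ z, gK z * w.d1 (t - r) (x - √r • σ z) (σ z) := by
      rw [← integral_neg, ← integral_const_mul, ← integral_sub i1n (i3.const_mul _)]
      congr 1; ext z; simp only [hF']; ring
    have e2 : ∫ z, gK z * (w.v (t - r) (x - √r • σ z) - csrc σ w (t - r) (x - √r • σ z))
        = -(∫ z, gK z * w.dt (t - r) (x - √r • σ z))
          + ∫ z, gK z * lapl σ (w.d2 (t - r) (x - √r • σ z)) := by
      rw [← integral_neg, ← integral_add i1n i2]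
      congr 1; ext z; simp only [csrc]; ring
    rw [e1, e2, h.gauss_first hα]
    have hs : √r ≠ 0 := (Real.sqrt_pos.2 hr).ne'
    have e3 : ∫ z, gK z * (2 * lapl σ (w.d2 (t - r) (x - √r • σ z)))
        = 2 * ∫ z, gK z * lapl σ (w.d2 (t - r) (x - √r • σ z)) := by
      rw [← integral_const_mul]; congr 1; ext z; ring
    rw [e3]
    field_simp
    ring
  have hexp : ∀ r : ℝ, HasDerivAt (fun r : ℝ => Real.exp (-r)) (-Real.exp (-r)) r := fun r => by
    simpa using (hasDerivAt_neg r).exp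
  have cS := continuous_gauss_shift bs cs t x σ
  have FTC := integral_Ioi_of_hasDerivAt_of_tendsto (a := 0) (m := 0)
    (f := fun r => Real.exp (-r) * ∫ z, gK z * w.v (t - r) (x - √r • σ z))
    (f' := fun r => -(Real.exp (-r) * ∫ z, gK z * csrc σ w (t - r) (x - √r • σ z)))
    (by
      refine Continuous.continuousWithinAt ?_
      exact (by fun_prop : Continuous fun r : ℝ => Real.exp (-r)).mul cΦ)
    (fun r hr => by
      refine ((hexp r).mul (hΦ r hr)).congr_deriv ?_
      have : ∫ z, gK z * (w.v (t - r) (x - √r • σ z) - csrc σ w (t - r) (x - √r • σ z))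
          = (∫ z, gK z * w.v (t - r) (x - √r • σ z))
            - ∫ z, gK z * csrc σ w (t - r) (x - √r • σ z) := by
        rw [← integral_sub (ig cv h.bv r) (ig cs bs r)]
        congr 1; ext z; ring
      rw [this]; ring)
    (by
      refine Integrable.neg ?_
      refine ((integrableOn_exp_neg_Ioi 0).mul_const (N + P + N)).mono'
        (((by fun_prop : Continuous fun r : ℝ => Real.exp (-r)).mul cS).aestronglyMeasurable)
        (Eventually.of_forall fun r => ?_)
      rw [norm_mul, Real.norm_of_nonneg (Real.exp_pos _).le]
      refine mul_le_mul_of_nonneg_left ?_ (Real.exp_pos _).le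
      rw [← integral_gaussMeas (fun z => csrc σ w (t - r) (x - √r • σ z))]
      have := norm_integral_le_of_norm_le_const (μ := gaussMeas d) (C := N + P + N)
        (f := fun z => csrc σ w (t - r) (x - √r • σ z)) (Eventually.of_forall fun z => bs _ _)
      simpa using this)
    (by
      refine squeeze_zero_norm (a := fun r => Real.exp (-r) * N) (fun r => ?_) ?_
      · rw [norm_mul, Real.norm_of_nonneg (Real.exp_pos _).le]
        refine mul_le_mul_of_nonneg_left ?_ (Real.exp_pos _).le
        rw [← integral_gaussMeas (fun z => w.v (t - r) (x - √r • σ z))]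
        have := norm_integral_le_of_norm_le_const (μ := gaussMeas d) (C := N)
          (f := fun z => w.v (t - r) (x - √r • σ z)) (Eventually.of_forall fun z => h.bv _ _)
        simpa using this
      · simpa using (Real.tendsto_exp_neg_atTop_nhds_zero).mul_const N)
  rw [integral_neg] at FTC
  have e0 : ∫ z, gK z * w.v (t - 0) (x - √0 • σ z) = w.v t x := by
    simp [integral_mul_const, integral_gK]
  rw [e0] at FTC
  simp only [neg_zero, Real.exp_zero, one_mul, zero_sub, neg_inj] at FTC
  exact FTC

end Identity

section ConstantCoefficients

variable {d : ℕ} {α N : ℝ}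

theorem integral_mul_diff {k φ : (Fin d → ℝ) → ℝ} {B : ℝ} (hk : Integrable k)
    (hφ : Continuous φ) (hb : ∀ z, |φ z| ≤ B) (c : Fin d → ℝ) :
    ∫ z, k z * (φ (z + c) - φ z) = ∫ z, (k (z + -c) - k z) * φ z := by
  have i : ∀ {k ψ : (Fin d → ℝ) → ℝ}, Integrable k → Continuous ψ → (∀ z, |ψ z| ≤ B) →
      Integrable fun z => k z * ψ z := fun h1 h2 h3 =>
    h1.mul_bdd h2.aestronglyMeasurable (Eventually.of_forall h3)
  have i1 : Integrable fun z => k z * φ (z + c) := i hk (hφ.comp (continuous_add_const c)) fun z => hb _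
  have i2 := i hk hφ hb
  have i3 := i (hk.comp_add_right (-c)) hφ hb
  simp only [mul_sub, sub_mul]
  rw [integral_sub i1 i2, integral_sub i3 i2]
  congr 1
  rw [← integral_add_right_eq_self (fun z => k (z + -c) * φ z) c]
  simp

theorem integral_gK_third_diff {φ : (Fin d → ℝ) → ℝ} {B : ℝ}
    (hφ : Continuous φ) (hb : ∀ z, |φ z| ≤ B) (u v w : Fin d → ℝ) :
    ∫ z, gK z * (ddiff φ u v (z + w) - ddiff φ u v z)
      = ∫ z, (ddiff gK (-u) (-v) (z + -w) - ddiff gK (-u) (-v) z) * φ z := by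
  have hI : Integrable (gK (d := d)) := by simpa using integrable_pow_mul_gK (d := d) 0
  have hd : ∀ {k : (Fin d → ℝ) → ℝ}, Integrable k → ∀ c, Integrable fun z => k (z + -c) - k z :=
    fun h c => (h.comp_add_right (-c)).sub h
  set ψ : (Fin d → ℝ) → ℝ := fun z => φ (z + v) - φ z with hψ
  have cψ : Continuous ψ := (hφ.comp (continuous_add_const v)).sub hφ
  have bψ : ∀ z, |ψ z| ≤ B + B := fun z => (abs_sub _ _).trans (add_le_add (hb _) (hb _))
  have e1 : ∀ z, ddiff φ u v z = ψ (z + u) - ψ z := fun z => by simp only [ddiff, hψ]; ring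
  have h1 := integral_mul_diff (φ := fun z => ψ (z + u) - ψ z) (B := B + B + (B + B)) hI
    ((cψ.comp (continuous_add_const u)).sub cψ)
    (fun z => (abs_sub _ _).trans (add_le_add (bψ _) (bψ _))) w
  have h2 := integral_mul_diff (hd hI w) cψ bψ u
  have h3 := integral_mul_diff (hd (hd hI w) u) hφ hb v
  simp only [e1]
  rw [h1, h2, h3]
  congr 1; ext z
  simp only [ddiff, add_right_comm _ (-v), add_right_comm _ (-u) (-w)]
  ring

variable {σ : (Fin d → ℝ) →L[ℝ] (Fin d → ℝ)}

theorem avg_third_diff {g : ℝ → (Fin d → ℝ) → ℝ} {G : ℝ} (hb : ∀ t x, |g t x| ≤ G)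
    (hc : Continuous fun p : ℝ × (Fin d → ℝ) => g p.1 p.2) (t : ℝ) (x h k l : Fin d → ℝ) :
    ddiff (avg σ g t) h k (x + l) - ddiff (avg σ g t) h k x
      = avg σ (fun s y => ddiff (g s) h k (y + l) - ddiff (g s) h k y) t x := by
  have i := fun c => integrable_shift (σ := σ) (g := g) hb hc t c
  have e : ∀ a c p : Fin d → ℝ, a - p + c = a + c - p := fun a c p => by abel
  have q : ∀ c₁ c₂ c₃ c₄ : Fin d → ℝ, Integrable (fun p : ℝ × (Fin d → ℝ) =>
      g (t - p.1) (c₁ - √p.1 • σ p.2) - g (t - p.1) (c₂ - √p.1 • σ p.2)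
        - g (t - p.1) (c₃ - √p.1 • σ p.2) + g (t - p.1) (c₄ - √p.1 • σ p.2)) (shiftMeas d) ∧
      ∫ p, (g (t - p.1) (c₁ - √p.1 • σ p.2) - g (t - p.1) (c₂ - √p.1 • σ p.2)
        - g (t - p.1) (c₃ - √p.1 • σ p.2) + g (t - p.1) (c₄ - √p.1 • σ p.2)) ∂shiftMeas d
      = avg σ g t c₁ - avg σ g t c₂ - avg σ g t c₃ + avg σ g t c₄ := by
    intro c₁ c₂ c₃ c₄
    have j1 : Integrable (fun p : ℝ × (Fin d → ℝ) => g (t - p.1) (c₁ - √p.1 • σ p.2)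
      - g (t - p.1) (c₂ - √p.1 • σ p.2)) (shiftMeas d) := (i c₁).sub (i c₂)
    have j2 : Integrable (fun p : ℝ × (Fin d → ℝ) => g (t - p.1) (c₁ - √p.1 • σ p.2)
      - g (t - p.1) (c₂ - √p.1 • σ p.2) - g (t - p.1) (c₃ - √p.1 • σ p.2)) (shiftMeas d) :=
      j1.sub (i c₃)
    refine ⟨j2.add (i c₄), ?_⟩
    rw [integral_add j2 (i c₄), integral_sub j1 (i c₃), integral_sub (i c₁) (i c₂)]
    rfl
  symm
  simp only [ddiff]
  conv_lhs => unfold avg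
  simp only [e]
  rw [integral_sub (q _ _ _ _).1 (q _ _ _ _).1, (q _ _ _ _).2, (q _ _ _ _).2]

theorem third_diff_le {φ : (Fin d → ℝ) → ℝ} {A : ℝ} {l : Fin d → ℝ}
    (h : ∀ y, |φ (y + l) - φ y| ≤ A) (u v y : Fin d → ℝ) :
    |ddiff φ u v (y + l) - ddiff φ u v y| ≤ 4 * A := by
  have h1 := abs_le.1 (h (y + u + v))
  have h2 := abs_le.1 (h (y + u))
  have h3 := abs_le.1 (h (y + v))
  have h4 := abs_le.1 (h y)
  have e : ∀ c, y + l + c = y + c + l := fun c => by abel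
  simp only [ddiff, e, add_right_comm _ l]
  rw [abs_le]; constructor <;> linarith

/-- Third differences of Gaussian averages gain regularity. -/
theorem gauss_third_diff_bound (hα : 0 < α) (hα1 : α < 1) (S K : ℝ) : ∃ C, 0 ≤ C ∧
    ∀ σ : (Fin d → ℝ) →L[ℝ] (Fin d → ℝ), ‖σ‖ ≤ S → (∀ h, ∃ k, σ k = h ∧ ‖k‖ ≤ K * ‖h‖) →
    ∀ (φ : (Fin d → ℝ) → ℝ) (B G : ℝ), 0 ≤ G → (∀ z, |φ z| ≤ B) →
    (∀ x y, |φ x - φ y| ≤ G * ‖x - y‖ ^ α) → ∀ ℓ c : ℝ, 0 < ℓ → 0 < c → K * ℓ ≤ c →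
    ∀ x h k l : Fin d → ℝ, ‖h‖ ≤ ℓ → ‖k‖ ≤ ℓ → ‖l‖ ≤ ℓ →
    |∫ z, gK z * (ddiff φ h k (x - c • σ z + l) - ddiff φ h k (x - c • σ z))|
      ≤ C * G * ℓ ^ 3 * c ^ (α - 3) := by
  obtain ⟨C, hC, hdec⟩ := third_diff_gK_decay (d := d)
  set D : ℝ := ∫ z : Fin d → ℝ, (1 + ‖z‖) ^ (-((d : ℝ) + 1)) with hD
  have hDi : Integrable (fun z : Fin d → ℝ => (1 + ‖z‖) ^ (-((d : ℝ) + 1))) :=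
    integrable_one_add_norm (by simp)
  have hD0 : 0 ≤ D := integral_nonneg fun z => by positivity
  refine ⟨C * |K| ^ 3 * |S| ^ α * D, by positivity, ?_⟩
  intro σ hσ hinv φ B G hG hb hol ℓ c hℓ hc hKc x h k l hh hk hl
  have hφ : Continuous φ := by
    rw [continuous_iff_continuousAt]
    intro y
    rw [ContinuousAt, tendsto_iff_norm_sub_tendsto_zero]
    refine squeeze_zero (fun _ => norm_nonneg _) (fun z => hol z y) ?_
    have : Tendsto (fun z : Fin d → ℝ => G * ‖z - y‖ ^ α) (𝓝 y) (𝓝 (G * ‖y - y‖ ^ α)) :=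
      Continuous.tendsto ((((continuous_id.sub continuous_const).norm).rpow_const
        fun _ => Or.inr hα.le).const_mul G) y
    simpa [Real.zero_rpow hα.ne'] using this
  choose s hs1 hs2 using hinv
  have hsh : ∀ h : Fin d → ℝ, ‖h‖ ≤ ℓ → ‖c⁻¹ • s h‖ ≤ |K| * ℓ / c ∧ ‖c⁻¹ • s h‖ ≤ 1 := by
    intro h hh
    have h1 : ‖s h‖ ≤ |K| * ℓ := (hs2 h).trans (by
      gcongr; exact le_abs_self K)
    rw [norm_smul, Real.norm_of_nonneg (by positivity)]
    refine ⟨by rw [inv_mul_eq_div]; gcongr, ?_⟩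
    rw [inv_mul_le_iff₀ hc, mul_one]
    rcases le_or_gt 0 K with hK | hK
    · rw [abs_of_nonneg hK] at h1; linarith
    · nlinarith [hs2 h, norm_nonneg h]
  have hsx : ∀ h y : Fin d → ℝ, x - c • σ y + h = x - c • σ (y + -(c⁻¹ • s h)) := by
    intro h y
    rw [map_add, map_neg, map_smul, hs1, smul_add, smul_neg, smul_inv_smul₀ hc.ne']
    abel
  set u := c⁻¹ • s h with hu
  set v := c⁻¹ • s k with hv
  set w := c⁻¹ • s l with hw
  set Φ : (Fin d → ℝ) → ℝ := fun z => φ (x - c • σ z) - φ x with hΦ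
  have e1 : ∀ z, ddiff φ h k (x - c • σ z + l) - ddiff φ h k (x - c • σ z)
      = ddiff Φ (-u) (-v) (z + -w) - ddiff Φ (-u) (-v) z := by
    intro z
    simp only [ddiff, hΦ, hsx]
    ring
  have cΦ : Continuous Φ := by
    refine (hφ.comp ?_).sub continuous_const
    fun_prop
  simp only [e1]
  rw [integral_gK_third_diff cΦ (B := B + B)
    (fun z => (abs_sub _ _).trans (add_le_add (hb _) (hb _))), neg_neg, neg_neg, neg_neg]
  set P := C * (|K| * ℓ / c * (|K| * ℓ / c) * (|K| * ℓ / c)) with hP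
  have hP0 : 0 ≤ P := by positivity
  have hpt : ∀ z, ‖(ddiff gK u v (z + w) - ddiff gK u v z) * Φ z‖
      ≤ P * (G * (c * |S|) ^ α) * (1 + ‖z‖) ^ (-((d : ℝ) + 1)) := by
    intro z
    have h1 := hdec u v w z (hsh h hh).2 (hsh k hk).2 (hsh l hl).2
    have h2 : C * (‖u‖ * ‖v‖ * ‖w‖) ≤ P := by
      rw [hP]; gcongr
      exacts [(hsh h hh).1, (hsh k hk).1, (hsh l hl).1]
    have h3 : |Φ z| ≤ G * (c * |S|) ^ α * (1 + ‖z‖) := by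
      have h4 : ‖x - c • σ z - x‖ ≤ c * |S| * (1 + ‖z‖) := by
        rw [sub_sub_cancel_left, norm_neg, norm_smul, Real.norm_of_nonneg hc.le, mul_assoc]
        gcongr
        calc ‖σ z‖ ≤ ‖σ‖ * ‖z‖ := σ.le_opNorm z
          _ ≤ |S| * (1 + ‖z‖) := by
            gcongr
            · exact hσ.trans (le_abs_self S)
            · linarith
      calc |Φ z| ≤ G * ‖x - c • σ z - x‖ ^ α := hol _ _
        _ ≤ G * (c * |S| * (1 + ‖z‖)) ^ α := by gcongr
        _ = G * (c * |S|) ^ α * (1 + ‖z‖) ^ α := by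
          rw [Real.mul_rpow (by positivity) (by positivity)]; ring
        _ ≤ _ := by
          gcongr
          have h5 : (1 : ℝ) ≤ 1 + ‖z‖ := by linarith [norm_nonneg z]
          simpa using Real.rpow_le_rpow_of_exponent_le h5 hα1.le
    rw [norm_mul, Real.norm_eq_abs, Real.norm_eq_abs, Real.rpow_neg (by positivity),
      ← div_eq_mul_inv, le_div_iff₀ (by positivity)]
    have e5 : (1 + ‖z‖) ^ ((d : ℝ) + 1) = (1 + ‖z‖) ^ (d + 1) := by exact_mod_cast rfl
    rw [e5]
    have hT := abs_nonneg (ddiff gK u v (z + w) - ddiff gK u v z)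
    calc _ ≤ |ddiff gK u v (z + w) - ddiff gK u v z| * (G * (c * |S|) ^ α * (1 + ‖z‖))
          * (1 + ‖z‖) ^ (d + 1) := by gcongr
      _ = (1 + ‖z‖) ^ (d + 2) * |ddiff gK u v (z + w) - ddiff gK u v z|
          * (G * (c * |S|) ^ α) := by ring
      _ ≤ P * (G * (c * |S|) ^ α) := by
        gcongr
        exact h1.trans h2
  have hfin := norm_integral_le_of_norm_le (hDi.const_mul _) (Eventually.of_forall hpt)
  rw [integral_const_mul, ← hD] at hfin
  refine hfin.trans (le_of_eq ?_)
  rw [hP, Real.mul_rpow hc.le (abs_nonneg S), Real.rpow_sub hc,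
    show c ^ (3 : ℝ) = c ^ 3 by norm_cast]
  field_simp

/-- Schauder estimate for the constant-coefficient equation. -/
theorem schauder_const (hα : 0 < α) (hα1 : α < 1) (S K : ℝ) : ∃ C, 0 ≤ C ∧
    ∀ σ : (Fin d → ℝ) →L[ℝ] (Fin d → ℝ), ‖σ‖ ≤ S → (∀ h, ∃ k, σ k = h ∧ ‖k‖ ≤ K * ‖h‖) →
    ∀ (w : Jet (Fin d → ℝ)) (N G : ℝ), Reg α N w → 0 ≤ G →
    (∀ t x y, |csrc σ w t x - csrc σ w t y| ≤ G * ‖x - y‖ ^ α) →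
    ∀ t x y, ‖w.d2 t x - w.d2 t y‖ ≤ C * G * ‖x - y‖ ^ α := by
  wlog hK : 0 < K generalizing K
  · obtain ⟨C, hC, H⟩ := this (K := 1) one_pos
    refine ⟨C, hC, fun σ hσ hinv => H σ hσ fun h => ?_⟩
    obtain ⟨k, h1, h2⟩ := hinv h
    exact ⟨k, h1, h2.trans (by nlinarith [norm_nonneg h])⟩
  obtain ⟨C1, hC1, hg⟩ := gauss_third_diff_bound (d := d) hα hα1 S K
  obtain ⟨C2, hC2, hz⟩ := holder_of_third_diff (E := Fin d → ℝ) hα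
  set Q : ℝ := 4 * K ^ 2 + C1 * (K ^ (α - 1) * (2 / (1 - α))) with hQ
  have hQ0 : 0 ≤ Q := by
    have : 0 ≤ 2 / (1 - α) := div_nonneg (by norm_num) (by linarith)
    positivity
  refine ⟨C2 * Q, by positivity, fun σ hσ hinv w N G hw hG hol t => ?_⟩
  have hN := hw.nonneg
  set g := csrc σ w with hgdef
  have cs : Continuous fun p : ℝ × (Fin d → ℝ) => g p.1 p.2 :=
    (hw.uct.continuous.sub ((hw.uc2 hα).lapl σ).continuous).add hw.ucv.continuous
  obtain ⟨P, bs⟩ : ∃ P, ∀ t x, |g t x| ≤ P := ⟨N + d * ‖σ‖ ^ 2 * N + N, fun t x =>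
    (abs_add_le _ _).trans (add_le_add ((abs_sub _ _).trans (add_le_add (hw.bt _ _)
      ((abs_lapl_le _ _).trans (by gcongr; exact hw.b2 _ _)))) (hw.bv _ _))⟩
  have main : ∀ ℓ : ℝ, 0 < ℓ → ∀ x h k l : Fin d → ℝ, ‖h‖ ≤ ℓ → ‖k‖ ≤ ℓ → ‖l‖ ≤ ℓ →
      |ddiff (w.v t) h k (x + l) - ddiff (w.v t) h k x| ≤ Q * G * ℓ ^ (2 + α) := by
    intro ℓ hℓ x h k l hh hk hl
    have e0 : w.v t = avg σ g t := funext fun x => (hw.avg_csrc hα t x).symm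
    rw [e0, avg_third_diff bs cs]
    have hdl : ∀ s y, |g s (y + l) - g s y| ≤ G * ℓ ^ α := fun s y => by
      refine (hol s _ _).trans ?_
      rw [add_sub_cancel_left]
      gcongr
    have hd : ∀ s y, |ddiff (g s) h k (y + l) - ddiff (g s) h k y| ≤ 4 * (G * ℓ ^ α) :=
      fun s y => third_diff_le (hdl s) h k y
    have hcont : Continuous fun p : ℝ × (Fin d → ℝ) =>
        ddiff (g p.1) h k (p.2 + l) - ddiff (g p.1) h k p.2 := by
      have hc : ∀ c : Fin d → ℝ, Continuous fun p : ℝ × (Fin d → ℝ) => g p.1 (p.2 + c) :=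
        fun c => cs.comp (f := fun p : ℝ × (Fin d → ℝ) => (p.1, p.2 + c)) (by fun_prop)
      simp only [ddiff, add_assoc]
      exact ((((hc _).sub (hc _)).sub (hc _)).add (hc _)).sub
        ((((hc _).sub (hc _)).sub (hc _)).add cs)
    rw [avg_eq_iterated hd hcont]
    set I : ℝ → ℝ := fun r => ∫ z, gK z * (ddiff (g (t - r)) h k (x - √r • σ z + l)
      - ddiff (g (t - r)) h k (x - √r • σ z)) with hI
    have hcI : Continuous I := continuous_gauss_shift hd hcont t x σ
    have hIs : ∀ r, |I r| ≤ 4 * (G * ℓ ^ α) := fun r => by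
      simp only [hI]
      rw [← integral_gaussMeas (fun z => ddiff (g (t - r)) h k (x - √r • σ z + l)
        - ddiff (g (t - r)) h k (x - √r • σ z))]
      have := norm_integral_le_of_norm_le_const (μ := gaussMeas d) (C := 4 * (G * ℓ ^ α))
        (f := fun z => ddiff (g (t - r)) h k (x - √r • σ z + l)
          - ddiff (g (t - r)) h k (x - √r • σ z)) (Eventually.of_forall fun z => hd _ _)
      simpa using this
    set r0 := (K * ℓ) ^ 2 with hr0
    have hr0p : 0 < r0 := by positivity
    have hIl : ∀ r, r0 < r → |I r| ≤ C1 * G * ℓ ^ 3 * r ^ ((α - 3) / 2) := fun r hr => by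
      have hrp : 0 < r := hr0p.trans hr
      have h1 := hg σ hσ hinv (g (t - r)) P G hG (bs _) (hol _) ℓ (√r) hℓ (Real.sqrt_pos.2 hrp)
        (Real.le_sqrt_of_sq_le hr.le) x h k l hh hk hl
      rw [Real.sqrt_eq_rpow, ← Real.rpow_mul hrp.le] at h1
      rw [show (α - 3) / 2 = 1 / 2 * (α - 3) by ring]
      simpa only [hI, Real.sqrt_eq_rpow] using h1
    have hexp : ∀ r, 0 < r → Real.exp (-r) ≤ 1 := fun r hr => Real.exp_le_one_iff.2 (by linarith)
    have hce : Continuous fun r => Real.exp (-r) * I r :=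
      (by fun_prop : Continuous fun r : ℝ => Real.exp (-r)).mul hcI
    have hint : IntegrableOn (fun r => Real.exp (-r) * I r) (Set.Ioi 0) :=
      ((integrableOn_exp_neg_Ioi 0).mul_const (4 * (G * ℓ ^ α))).mono'
        hce.aestronglyMeasurable (Eventually.of_forall fun r => by
          rw [norm_mul, Real.norm_of_nonneg (Real.exp_pos _).le]
          exact mul_le_mul_of_nonneg_left (hIs r) (Real.exp_pos _).le)
    have hle : ∀ r, 0 < r → ‖Real.exp (-r) * I r‖ ≤ |I r| := fun r hr => by
      rw [norm_mul, Real.norm_of_nonneg (Real.exp_pos _).le]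
      exact mul_le_of_le_one_left (abs_nonneg _) (hexp r hr)
    have hsplit : Set.Ioi (0 : ℝ) = Set.Ioc 0 r0 ∪ Set.Ioi r0 :=
      (Set.Ioc_union_Ioi_eq_Ioi hr0p.le).symm
    have hex : (α - 3) / 2 < -1 := by linarith
    rw [hsplit, setIntegral_union (Set.Ioc_disjoint_Ioi le_rfl) measurableSet_Ioi
      (hint.mono_set Set.Ioc_subset_Ioi_self) (hint.mono_set (Set.Ioi_subset_Ioi hr0p.le))]
    have p1 : ‖∫ r in Set.Ioc 0 r0, Real.exp (-r) * I r‖ ≤ 4 * (G * ℓ ^ α) * r0 := by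
      have := norm_setIntegral_le_of_norm_le_const (μ := volume) (s := Set.Ioc 0 r0)
        (C := 4 * (G * ℓ ^ α)) (f := fun r => Real.exp (-r) * I r) (by simp)
        fun r hr => (hle r hr.1).trans (hIs r)
      simpa [hr0p.le] using this
    have p2 : ‖∫ r in Set.Ioi r0, Real.exp (-r) * I r‖
        ≤ C1 * G * ℓ ^ 3 * (-r0 ^ ((α - 3) / 2 + 1) / ((α - 3) / 2 + 1)) := by
      rw [← integral_Ioi_rpow_of_lt hex hr0p, ← integral_const_mul]
      refine norm_integral_le_of_norm_le ((integrableOn_Ioi_rpow_of_lt hex hr0p).const_mul _) ?_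
      filter_upwards [ae_restrict_mem measurableSet_Ioi] with r hr
      exact (hle r (hr0p.trans hr)).trans (hIl r hr)
    refine (norm_add_le _ _).trans ((add_le_add p1 p2).trans (le_of_eq ?_))
    have q1 : r0 ^ ((α - 3) / 2 + 1) = K ^ (α - 1) * ℓ ^ (α - 1) := by
      rw [hr0, ← Real.rpow_natCast, ← Real.rpow_mul (by positivity),
        ← Real.mul_rpow hK.le hℓ.le]
      congr 1; push_cast; ring
    have q2 : ℓ ^ (2 + α) = ℓ ^ 2 * ℓ ^ α := by
      rw [Real.rpow_add hℓ]; norm_cast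
    have q3 : ℓ ^ (α - 1) = ℓ ^ α / ℓ := by rw [Real.rpow_sub hℓ, Real.rpow_one]
    have q4 : -(K ^ (α - 1) * (ℓ ^ α / ℓ)) / ((α - 3) / 2 + 1)
        = K ^ (α - 1) * (2 / (1 - α)) * (ℓ ^ α / ℓ) := by
      have h1 : (1 - α) ≠ 0 := by linarith
      have h2 : ((α - 3) / 2 + 1) ≠ 0 := by linarith
      rw [show (α - 3) / 2 + 1 = -((1 - α) / 2) by ring]
      field_simp
    rw [q1, q2, q3, q4, hr0, hQ]
    field_simp
  intro x y
  rw [show C2 * Q * G = C2 * (Q * G) by ring]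
  exact hz hN (by positivity) (hw.h1 t) (hw.h2 t) (hw.hol t) main x y

end ConstantCoefficients

section Trace

variable {d : ℕ}

/-- The second-order operator with coefficient matrix `A`. -/
def tr (A : Fin d → Fin d → ℝ) (H : (Fin d → ℝ) →L[ℝ] (Fin d → ℝ) →L[ℝ] ℝ) : ℝ :=
  1 / 2 * ∑ i, ∑ j, A i j * H (eb i) (eb j)

theorem abs_apply_eb_le (H : (Fin d → ℝ) →L[ℝ] (Fin d → ℝ) →L[ℝ] ℝ) (i j : Fin d) :
    |H (eb i) (eb j)| ≤ ‖H‖ := by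
  simpa [norm_eb] using H.le_opNorm₂ (eb i) (eb j)

theorem abs_tr_le {A : Fin d → Fin d → ℝ} {Λ : ℝ} (hA : ∀ i j, |A i j| ≤ Λ)
    (H : (Fin d → ℝ) →L[ℝ] (Fin d → ℝ) →L[ℝ] ℝ) : |tr A H| ≤ d ^ 2 * Λ * ‖H‖ := by
  have h : |∑ i, ∑ j, A i j * H (eb i) (eb j)| ≤ d ^ 2 * Λ * ‖H‖ := by
    calc _ ≤ ∑ _i : Fin d, ∑ _j : Fin d, Λ * ‖H‖ := by
          refine (abs_sum_le_sum_abs _ _).trans (sum_le_sum fun i _ =>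
            (abs_sum_le_sum_abs _ _).trans (sum_le_sum fun j _ => ?_))
          rw [abs_mul]
          exact mul_le_mul (hA i j) (abs_apply_eb_le H i j) (abs_nonneg _)
            ((abs_nonneg _).trans (hA i j))
      _ = _ := by simp; ring
  rw [tr, abs_mul, abs_of_pos (by norm_num : (0 : ℝ) < 1 / 2)]
  linarith [abs_nonneg (∑ i, ∑ j, A i j * H (eb i) (eb j))]

theorem tr_smul (A : Fin d → Fin d → ℝ) (c : ℝ) (H : (Fin d → ℝ) →L[ℝ] (Fin d → ℝ) →L[ℝ] ℝ) :
    tr A (c • H) = c * tr A H := by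
  simp only [tr, _root_.smul_apply, smul_eq_mul, mul_sum]
  exact sum_congr rfl fun i _ => sum_congr rfl fun j _ => by ring

theorem tr_sub (A : Fin d → Fin d → ℝ) (H K : (Fin d → ℝ) →L[ℝ] (Fin d → ℝ) →L[ℝ] ℝ) :
    tr A (H - K) = tr A H - tr A K := by
  simp only [tr, _root_.sub_apply, mul_sub, sum_sub_distrib]

open scoped MatrixOrder Matrix.Norms.L2Operator in
theorem exists_gram {A : Fin d → Fin d → ℝ} (hs : ∀ i j, A i j = A j i)
    (hp : ∀ y : Fin d → ℝ, 0 ≤ ∑ i, ∑ j, A i j * y i * y j) :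
    ∃ B : Fin d → Fin d → ℝ, ∀ i j, A i j = ∑ k, B k i * B k j := by
  have h : (Matrix.of A).PosSemidef := by
    refine Matrix.PosSemidef.of_dotProduct_mulVec_nonneg ?_ fun y => ?_
    · ext i j; simp [hs j i]
    · refine (hp y).trans_eq ?_
      simp only [dotProduct, Matrix.mulVec, mul_sum, Matrix.of_apply, star_trivial, Pi.star_apply]
      exact sum_congr rfl fun i _ => sum_congr rfl fun j _ => by ring
  obtain ⟨B, hB⟩ := CStarAlgebra.nonneg_iff_eq_star_mul_self.mp h.nonneg
  refine ⟨B, fun i j => ?_⟩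
  have := congrFun (congrFun hB i) j
  simpa [Matrix.mul_apply, Matrix.star_apply] using this

/-- The linear map with columns `B k`. -/
def gramMap (B : Fin d → Fin d → ℝ) : (Fin d → ℝ) →L[ℝ] (Fin d → ℝ) :=
  ∑ k, (ContinuousLinearMap.proj (R := ℝ) (φ := fun _ : Fin d => ℝ) k).smulRight (B k)

theorem gramMap_apply (B : Fin d → Fin d → ℝ) (x : Fin d → ℝ) :
    gramMap B x = ∑ k, x k • B k := by
  simp [gramMap, _root_.sum_apply]

theorem gramMap_eb (B : Fin d → Fin d → ℝ) (k : Fin d) : gramMap B (eb k) = B k := by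
  rw [gramMap_apply]
  simp [eb, Pi.single_apply]

theorem tr_eq_lapl {A B : Fin d → Fin d → ℝ} (h : ∀ i j, A i j = ∑ k, B k i * B k j)
    (H : (Fin d → ℝ) →L[ℝ] (Fin d → ℝ) →L[ℝ] ℝ) : tr A H = lapl (gramMap B) H := by
  have e : ∀ k, H (B k) (B k) = ∑ i, ∑ j, B k i * B k j * H (eb i) (eb j) := by
    intro k
    have : B k = ∑ i, B k i • eb i := pi_eq_sum_univ' (B k)
    conv_lhs => rw [this]
    simp only [map_sum, map_smul, _root_.sum_apply, _root_.smul_apply, smul_eq_mul, mul_sum]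
    rw [sum_comm]
    exact sum_congr rfl fun i _ => sum_congr rfl fun j _ => by ring
  simp only [tr, lapl, gramMap_eb, e, h, sum_mul]
  congr 1
  symm
  rw [sum_comm]
  exact sum_congr rfl fun i _ => sum_comm

theorem tr_nonpos {A : Fin d → Fin d → ℝ} (hs : ∀ i j, A i j = A j i)
    (hp : ∀ y : Fin d → ℝ, 0 ≤ ∑ i, ∑ j, A i j * y i * y j)
    {H : (Fin d → ℝ) →L[ℝ] (Fin d → ℝ) →L[ℝ] ℝ} (hH : ∀ v, H v v ≤ 0) : tr A H ≤ 0 := by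
  obtain ⟨B, hB⟩ := exists_gram hs hp
  rw [tr_eq_lapl hB, lapl]
  have : ∑ k, H (gramMap B (eb k)) (gramMap B (eb k)) ≤ 0 := sum_nonpos fun k _ => hH _
  linarith

/-- Uniformly elliptic matrices have a square root with quantitative bounds. -/
theorem exists_sqrt_bounds (d : ℕ) (lam Λ : ℝ) (hl : 0 < lam) : ∃ S K : ℝ,
    ∀ A : Fin d → Fin d → ℝ, (∀ i j, A i j = A j i) →
    (∀ y : Fin d → ℝ, lam * ‖y‖ ^ 2 ≤ ∑ i, ∑ j, A i j * y i * y j) → (∀ i j, |A i j| ≤ Λ) →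
    ∃ σ : (Fin d → ℝ) →L[ℝ] (Fin d → ℝ), (∀ H, tr A H = lapl σ H) ∧ ‖σ‖ ≤ S ∧
      ∀ h, ∃ k, σ k = h ∧ ‖k‖ ≤ K * ‖h‖ := by
  refine ⟨d * (1 + |Λ|), d * (1 + |Λ|) * (d / lam), fun A hs hp hA => ?_⟩
  obtain ⟨B, hB⟩ := exists_gram hs fun y => le_trans (by positivity) (hp y)
  have hBk : ∀ k i, |B k i| ≤ 1 + |Λ| := by
    intro k i
    have h1 : B k i * B k i ≤ A i i := by
      rw [hB]
      exact single_le_sum (f := fun k => B k i * B k i) (fun k _ => mul_self_nonneg _)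
        (mem_univ k)
    have h2 := (le_abs_self _).trans ((hA i i).trans (le_abs_self Λ))
    have h3 := abs_nonneg Λ
    rw [← sq] at h1
    exact abs_le_of_sq_le_sq (by nlinarith) (by positivity)
  refine ⟨gramMap B, tr_eq_lapl hB, ?_, ?_⟩
  · refine ContinuousLinearMap.opNorm_le_bound _ (by positivity) fun x => ?_
    rw [gramMap_apply, pi_norm_le_iff_of_nonneg (by positivity)]
    intro i
    rw [Finset.sum_apply, Real.norm_eq_abs]
    calc _ ≤ ∑ _k : Fin d, ‖x‖ * (1 + |Λ|) := by
          refine (abs_sum_le_sum_abs _ _).trans (sum_le_sum fun k _ => ?_)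
          simp only [Pi.smul_apply, smul_eq_mul, abs_mul]
          exact mul_le_mul (norm_le_pi_norm x k) (hBk k i) (abs_nonneg _) (norm_nonneg _)
      _ = _ := by simp; ring
  · have hdot : ∀ y : Fin d → ℝ, lam * ‖y‖ ≤ d * ‖Matrix.mulVecLin (Matrix.of A) y‖ := by
      intro y
      set h := Matrix.mulVecLin (Matrix.of A) y with hh
      have e1 : ∑ i, ∑ j, A i j * y i * y j = edot y h := by
        simp only [edot, hh, Matrix.mulVecLin_apply, Matrix.mulVec, dotProduct, Matrix.of_apply,
          mul_sum]
        exact sum_congr rfl fun i _ => sum_congr rfl fun j _ => by ring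
      have h1 := (hp y).trans (e1.le.trans ((le_abs_self _).trans (abs_edot_le y h)))
      rcases (norm_nonneg y).eq_or_lt with h0 | h0
      · rw [← h0]; simp; positivity
      · refine le_of_mul_le_mul_left ?_ h0
        nlinarith
    have hinj : Function.Injective (Matrix.mulVecLin (Matrix.of A)) := by
      rw [injective_iff_map_eq_zero]
      intro y hy
      have := hdot y
      rw [hy, norm_zero, mul_zero] at this
      exact norm_eq_zero.1 (le_antisymm (by nlinarith) (norm_nonneg y))
    intro h
    obtain ⟨y, hy⟩ := (LinearMap.injective_iff_surjective.1 hinj) h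
    refine ⟨fun k => edot (B k) y, ?_, ?_⟩
    · rw [gramMap_apply, ← hy]
      ext i
      simp only [Finset.sum_apply, Pi.smul_apply, smul_eq_mul, Matrix.mulVecLin_apply, Matrix.mulVec,
        dotProduct, Matrix.of_apply, hB, edot, sum_mul]
      rw [sum_comm]
      exact sum_congr rfl fun i _ => sum_congr rfl fun j _ => by ring
    · have h1 := hdot y
      rw [hy] at h1
      have h2 : ‖y‖ ≤ d / lam * ‖h‖ := by
        rw [div_mul_eq_mul_div, le_div_iff₀ hl]; linarith
      rw [pi_norm_le_iff_of_nonneg (by positivity)]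
      intro k
      have h3 : ‖B k‖ ≤ 1 + |Λ| := (pi_norm_le_iff_of_nonneg (by positivity)).2 (hBk k)
      calc |edot (B k) y| ≤ d * (‖B k‖ * ‖y‖) := abs_edot_le _ _
        _ ≤ d * ((1 + |Λ|) * (d / lam * ‖h‖)) := by gcongr
        _ = _ := by ring

end Trace

section MaximumPrinciple

variable {d : ℕ}

theorem second_deriv_nonpos_of_isLocalMax {E : Type*} [NormedAddCommGroup E] [NormedSpace ℝ E]
    {f : E → ℝ} {f1 : E → E →L[ℝ] ℝ} {f2 : E →L[ℝ] E →L[ℝ] ℝ} {x : E} (hm : IsLocalMax f x)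
    (h1 : ∀ᶠ y in 𝓝 x, HasFDerivAt f (f1 y) y) (h2 : HasFDerivAt f1 f2 x) (v : E) :
    f2 v v ≤ 0 := by
  by_contra! hv
  set φ : ℝ → ℝ := fun s => f (x + s • v) with hφ
  have hl : ∀ s : ℝ, HasDerivAt (fun s : ℝ => x + s • v) v s := fun s => by
    simpa using ((hasDerivAt_id s).smul_const v).const_add x
  have ht : Tendsto (fun s : ℝ => x + s • v) (𝓝 0) (𝓝 x) := by
    have := (hl 0).continuousAt.tendsto
    simpa using this
  have hd : ∀ᶠ s in 𝓝 (0 : ℝ), HasDerivAt φ (f1 (x + s • v) v) s :=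
    (ht.eventually h1).mono fun s hs => hs.comp_hasDerivAt s (hl s)
  have hd' : deriv φ =ᶠ[𝓝 0] fun s => f1 (x + s • v) v := hd.mono fun s hs => hs.deriv
  have h2' : HasDerivAt (fun s : ℝ => f1 (x + s • v) v) (f2 v v) 0 := by
    have h0 : HasFDerivAt f1 f2 (x + (0 : ℝ) • v) := by simpa using h2
    have h3 : HasDerivAt (fun s : ℝ => f1 (x + s • v)) (f2 v) 0 := h0.comp_hasDerivAt (0 : ℝ) (hl 0)
    exact (ContinuousLinearMap.apply ℝ ℝ v).hasFDerivAt.comp_hasDerivAt (0 : ℝ) h3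
  have hmφ : IsLocalMax φ 0 := by
    have : ∀ᶠ s in 𝓝 (0 : ℝ), f (x + s • v) ≤ f x := ht.eventually hm
    simpa [IsLocalMax, IsMaxFilter, hφ] using this
  have hdd : deriv (deriv φ) 0 = f2 v v := by rw [hd'.deriv_eq]; exact h2'.deriv
  have hmin : IsLocalMin φ 0 := isLocalMin_of_deriv_deriv_pos (by rw [hdd]; exact hv)
    hmφ.deriv_eq_zero hd.self_of_nhds.continuousAt
  have hc : φ =ᶠ[𝓝 0] fun _ => φ 0 := by
    filter_upwards [hmφ, hmin] with s a b using le_antisymm a b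
  have h0 : deriv φ =ᶠ[𝓝 0] fun _ => 0 := by
    refine hc.eventuallyEq_nhds.mono fun s hs => ?_
    rw [hs.deriv_eq]; simp
  rw [h0.deriv_eq] at hdd
  simp at hdd
  linarith

/-- The inequality `∂φ/∂t - tr (a D²φ) ≤ e` holds at the point `(t, x)`. -/
structure SubAt (a : ℝ → (Fin d → ℝ) → Fin d → Fin d → ℝ) (φ : ℝ → (Fin d → ℝ) → ℝ) (t : ℝ)
    (x : Fin d → ℝ) (e : ℝ) : Prop where
  intro ::
  ex : ∃ (p : ℝ) (D1 : (Fin d → ℝ) → (Fin d → ℝ) →L[ℝ] ℝ)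
    (D2 : (Fin d → ℝ) →L[ℝ] (Fin d → ℝ) →L[ℝ] ℝ),
    HasDerivWithinAt (fun s => φ s x) p (Set.Iic t) t ∧ (∀ y, HasFDerivAt (φ t) (D1 y) y) ∧
    HasFDerivAt D1 D2 x ∧ p - tr (a t x) D2 ≤ e

theorem deriv_nonneg_of_left_max {f : ℝ → ℝ} {p t : ℝ}
    (h : HasDerivWithinAt f p (Set.Iic t) t) (hm : ∀ᶠ s in 𝓝[Set.Iio t] t, f s ≤ f t) :
    0 ≤ p := by
  have h1 := hasDerivWithinAt_iff_tendsto_slope.1 h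
  rw [Set.Iic_sdiff_right] at h1
  have : (𝓝[Set.Iio t] t).NeBot := inferInstance
  refine ge_of_tendsto h1 ?_
  filter_upwards [hm, self_mem_nhdsWithin] with s hs hst
  rw [slope_def_field]
  exact div_nonneg_of_nonpos (by linarith) (by linarith [Set.mem_Iio.1 hst])

theorem max_principle_compact {a : ℝ → (Fin d → ℝ) → Fin d → Fin d → ℝ}
    {φ : ℝ → (Fin d → ℝ) → ℝ} {t₀ S R : ℝ}
    (hs : ∀ t ∈ Set.Ioc t₀ S, ∀ x, ∀ i j, a t x i j = a t x j i)
    (hp : ∀ t ∈ Set.Ioc t₀ S, ∀ x, ∀ y : Fin d → ℝ, 0 ≤ ∑ i, ∑ j, a t x i j * y i * y j)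
    (hc : ContinuousOn (fun q : ℝ × (Fin d → ℝ) => φ q.1 q.2)
      (Set.Icc t₀ S ×ˢ Metric.closedBall 0 R))
    (h0 : ∀ x, ‖x‖ ≤ R → φ t₀ x ≤ 0) (hR : ∀ t ∈ Set.Icc t₀ S, ∀ x, ‖x‖ = R → φ t x ≤ 0)
    (hsub : ∀ t ∈ Set.Ioc t₀ S, ∀ x, ‖x‖ < R → 0 < φ t x → ∃ e < 0, SubAt a φ t x e) :
    ∀ t ∈ Set.Icc t₀ S, ∀ x, ‖x‖ ≤ R → φ t x ≤ 0 := by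
  intro t ht x hx
  by_contra! hpos
  have hmem : (t, x) ∈ Set.Icc t₀ S ×ˢ Metric.closedBall (0 : Fin d → ℝ) R :=
    ⟨ht, by simpa using hx⟩
  obtain ⟨⟨s, y⟩, hsy, hmax⟩ := (isCompact_Icc.prod (isCompact_closedBall (0 : Fin d → ℝ) R)
    ).exists_isMaxOn ⟨_, hmem⟩ hc
  have hm : ∀ t' ∈ Set.Icc t₀ S, ∀ x', ‖x'‖ ≤ R → φ t' x' ≤ φ s y := fun t' ht' x' hx' =>
    hmax (show (t', x') ∈ _ from ⟨ht', by simpa using hx'⟩)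
  have hsyp : 0 < φ s y := hpos.trans_le (hm t ht x hx)
  obtain ⟨hs1, hy1⟩ := hsy
  have hs1 : s ∈ Set.Icc t₀ S := hs1
  have hy1' : ‖y‖ ≤ R := by simpa using hy1
  have hs2 : t₀ < s := lt_of_le_of_ne hs1.1 fun h => by
    subst h; exact absurd (h0 y hy1') (not_le.2 hsyp)
  have hy2 : ‖y‖ < R := lt_of_le_of_ne hy1' fun h => absurd (hR s hs1 y h) (not_le.2 hsyp)
  obtain ⟨e, he, ⟨p, D1, D2, k1, k2, k3, k4⟩⟩ := hsub s ⟨hs2, hs1.2⟩ y hy2 hsyp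
  have q1 : 0 ≤ p := deriv_nonneg_of_left_max k1 (by
    filter_upwards [Ioo_mem_nhdsLT hs2] with r hr
    exact hm r ⟨hr.1.le, hr.2.le.trans hs1.2⟩ y hy1')
  have hloc : IsLocalMax (φ s) y := by
    have : ∀ᶠ z in 𝓝 y, ‖z‖ < R := continuous_norm.continuousAt.eventually (gt_mem_nhds hy2)
    exact this.mono fun z hz => hm s hs1 z hz.le
  have q2 := tr_nonpos (hs s ⟨hs2, hs1.2⟩ y) (hp s ⟨hs2, hs1.2⟩ y)
    (second_deriv_nonpos_of_isLocalMax hloc (Eventually.of_forall k2) k3)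
  linarith

end MaximumPrinciple

section BilinearNorms

variable {E : Type*} [NormedAddCommGroup E] [NormedSpace ℝ E]

theorem bl_norm_add_le (A B : E →L[ℝ] E →L[ℝ] ℝ) : ‖A + B‖ ≤ ‖A‖ + ‖B‖ :=
  ContinuousLinearMap.opNorm_add_le A B

theorem bl_norm_smul_le (c : ℝ) (A : E →L[ℝ] E →L[ℝ] ℝ) : ‖c • A‖ ≤ |c| * ‖A‖ :=
  ContinuousLinearMap.opNorm_smul_le c A

theorem bl_norm_zero : ‖(0 : E →L[ℝ] E →L[ℝ] ℝ)‖ = 0 :=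
  norm_zero (E := E →L[ℝ] E →L[ℝ] ℝ)

theorem bl_norm_sub_le (A B : E →L[ℝ] E →L[ℝ] ℝ) : ‖A - B‖ ≤ ‖A‖ + ‖B‖ :=
  norm_sub_le (E := E →L[ℝ] E →L[ℝ] ℝ) A B

theorem bl_sub_self (A : E →L[ℝ] E →L[ℝ] ℝ) : A - A = 0 :=
  sub_self (G := E →L[ℝ] E →L[ℝ] ℝ) A

theorem bl_sub_comm (A B C D : E →L[ℝ] E →L[ℝ] ℝ) : A - B - (C - D) = A - C - (B - D) :=
  sub_sub_sub_comm (α := E →L[ℝ] E →L[ℝ] ℝ) A B C D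

theorem bl_smulRight_norm (f g : E →L[ℝ] ℝ) : ‖f.smulRight g‖ = ‖f‖ * ‖g‖ :=
  ContinuousLinearMap.norm_smulRight_apply f g

end BilinearNorms

section Barrier

variable {d : ℕ}

/-- The Euclidean pairing as a continuous bilinear map. -/
def edotL (d : ℕ) : (Fin d → ℝ) →L[ℝ] (Fin d → ℝ) →L[ℝ] ℝ :=
  ∑ i, (ContinuousLinearMap.proj (R := ℝ) (φ := fun _ : Fin d => ℝ) i).smulRight
    (ContinuousLinearMap.proj (R := ℝ) (φ := fun _ : Fin d => ℝ) i)

theorem edotL_apply (x y : Fin d → ℝ) : edotL d x y = edot x y := by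
  simp [edotL, _root_.sum_apply, edot]

theorem norm_edotL_apply_le (x : Fin d → ℝ) : ‖edotL d x‖ ≤ d * ‖x‖ := by
  refine ContinuousLinearMap.opNorm_le_bound _ (by positivity) fun y => ?_
  rw [edotL_apply, Real.norm_eq_abs, mul_assoc]
  exact abs_edot_le x y

theorem norm_edotL_le : ‖edotL d‖ ≤ d :=
  ContinuousLinearMap.opNorm_le_bound _ (by positivity) norm_edotL_apply_le

/-- The polynomial barrier `(1 + |x|²)^m` (Euclidean norm). -/
def barr (m : ℕ) (x : Fin d → ℝ) : ℝ := (1 + edot x x) ^ m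

theorem one_add_sq_le (x : Fin d → ℝ) : 1 + ‖x‖ ^ 2 ≤ 1 + edot x x := by
  linarith [sq_norm_le_edot x]

theorem one_le_one_add_edot (x : Fin d → ℝ) : 1 ≤ 1 + edot x x := by
  nlinarith [one_add_sq_le x, sq_nonneg ‖x‖]

theorem one_le_barr (m : ℕ) (x : Fin d → ℝ) : 1 ≤ barr m x := one_le_pow₀ (one_le_one_add_edot x)

theorem barr_pos (m : ℕ) (x : Fin d → ℝ) : 0 < barr m x := one_pos.trans_le (one_le_barr m x)

theorem barr_mono {m n : ℕ} (h : m ≤ n) (x : Fin d → ℝ) : barr m x ≤ barr n x :=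
  pow_le_pow_right₀ (one_le_one_add_edot x) h

/-- First derivative of `barr`. -/
def barr1 (m : ℕ) (x : Fin d → ℝ) : (Fin d → ℝ) →L[ℝ] ℝ :=
  (2 * m * (1 + edot x x) ^ (m - 1)) • edotL d x

/-- Second derivative of `barr`. -/
def barr2 (m : ℕ) (x : Fin d → ℝ) : (Fin d → ℝ) →L[ℝ] (Fin d → ℝ) →L[ℝ] ℝ :=
  (2 * m * (1 + edot x x) ^ (m - 1)) • edotL d +
    ((2 * m) * (((m - 1 : ℕ) * (1 + edot x x) ^ (m - 1 - 1) * 2))) • (edotL d x).smulRight (edotL d x)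

theorem hasFDerivAt_one_add_edot (x : Fin d → ℝ) :
    HasFDerivAt (fun x : Fin d → ℝ => 1 + edot x x) ((2 : ℝ) • edotL d x) x := by
  have h : HasFDerivAt (fun x : Fin d → ℝ => 1 + edotL d x x) ((2 : ℝ) • edotL d x) x := by
    have h1 := ((edotL d).hasFDerivAt (x := x)).clm_apply (hasFDerivAt_id x)
    refine (h1.const_add 1).congr_fderiv ?_
    ext y
    simp [edotL_apply, edot_comm y x, two_mul]
  simpa only [edotL_apply] using h

theorem hasFDerivAt_barr (m : ℕ) (x : Fin d → ℝ) : HasFDerivAt (barr m) (barr1 m x) x := by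
  refine ((hasFDerivAt_one_add_edot x).pow m).congr_fderiv ?_
  ext y
  simp [barr1]; ring

theorem continuous_barr (m : ℕ) : Continuous (barr (d := d) m) :=
  continuous_iff_continuousAt.2 fun x => (hasFDerivAt_barr m x).continuousAt

theorem hasFDerivAt_barr1 (m : ℕ) (x : Fin d → ℝ) : HasFDerivAt (barr1 m) (barr2 m x) x := by
  have h1 : HasFDerivAt (fun x : Fin d → ℝ => 2 * m * (1 + edot x x) ^ (m - 1))
      ((2 * m * ((m - 1 : ℕ) * (1 + edot x x) ^ (m - 1 - 1) * 2)) • edotL d x) x := by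
    refine (((hasFDerivAt_one_add_edot x).pow (m - 1)).const_mul (2 * (m : ℝ))).congr_fderiv ?_
    ext y
    simp; ring
  refine (h1.smul ((edotL d).hasFDerivAt (x := x))).congr_fderiv ?_
  ext y z
  simp [barr2]; ring

theorem norm_barr2_le (m : ℕ) (x : Fin d → ℝ) :
    ‖barr2 m x‖ * (1 + ‖x‖ ^ 2) ≤ (2 * m * d + 4 * m * m * d ^ 2) * barr m x := by
  have hq := one_le_one_add_edot x
  have hq' := one_add_sq_le x
  rcases m with _ | m
  · have : barr2 0 x = 0 := by ext y z; simp [barr2]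
    rw [this, bl_norm_zero]; simp
  set q := 1 + edot x x with hqd
  have e1 : ‖(edotL d x).smulRight (edotL d x)‖ ≤ d ^ 2 * ‖x‖ ^ 2 := by
    rw [bl_smulRight_norm]
    nlinarith [norm_edotL_apply_le x, norm_nonneg (edotL d x)]
  have e2 : ‖barr2 (m + 1) x‖ ≤ 2 * (m + 1) * q ^ m * d +
      2 * (m + 1) * (m * q ^ (m - 1) * 2) * (d ^ 2 * ‖x‖ ^ 2) := by
    rw [barr2]
    simp only [Nat.add_sub_cancel, ← hqd]
    refine (bl_norm_add_le _ _).trans (add_le_add ?_ ?_)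
    · refine (bl_norm_smul_le _ _).trans ?_
      rw [abs_of_nonneg (by positivity)]
      push_cast
      exact mul_le_mul_of_nonneg_left norm_edotL_le (by positivity)
    · refine (bl_norm_smul_le _ _).trans ?_
      rw [abs_of_nonneg (by positivity)]
      push_cast
      exact mul_le_mul_of_nonneg_left e1 (by positivity)
  have hx : ‖x‖ ^ 2 ≤ q := by linarith
  have e3 : (m : ℝ) * q ^ (m - 1) * ‖x‖ ^ 2 ≤ m * q ^ m := by
    rcases m with _ | m
    · simp
    · rw [Nat.add_sub_cancel, mul_assoc, pow_succ q]
      have h1 : q ^ m * ‖x‖ ^ 2 ≤ q ^ m * q := mul_le_mul_of_nonneg_left hx (by positivity)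
      exact mul_le_mul_of_nonneg_left h1 (by positivity)
  have e4 : ‖barr2 (m + 1) x‖ ≤ (2 * (m + 1) * d + 4 * (m + 1) * (m + 1) * d ^ 2) * q ^ m := by
    have : 4 * ((m : ℝ) + 1) * d ^ 2 * (m * q ^ (m - 1) * ‖x‖ ^ 2) ≤
        4 * ((m : ℝ) + 1) * d ^ 2 * ((m + 1) * q ^ m) := by
      refine mul_le_mul_of_nonneg_left (e3.trans ?_) (by positivity)
      exact mul_le_mul_of_nonneg_right (by linarith) (by positivity)
    nlinarith
  calc _ ≤ (2 * (m + 1) * d + 4 * (m + 1) * (m + 1) * d ^ 2) * q ^ m * q := by gcongr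
    _ = _ := by rw [barr]; push_cast; ring

theorem abs_tr_barr2_le {A : Fin d → Fin d → ℝ} {c : ℝ} {x : Fin d → ℝ} (hc : 0 ≤ c)
    (hA : ∀ i j, |A i j| ≤ c * (1 + ‖x‖ ^ 2)) (m : ℕ) :
    |tr A (barr2 m x)| ≤ d ^ 2 * c * (2 * m * d + 4 * m * m * d ^ 2) * barr m x := by
  refine (abs_tr_le hA _).trans ?_
  calc _ = d ^ 2 * c * (‖barr2 m x‖ * (1 + ‖x‖ ^ 2)) := by ring
    _ ≤ d ^ 2 * c * ((2 * m * d + 4 * m * m * d ^ 2) * barr m x) := by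
      exact mul_le_mul_of_nonneg_left (norm_barr2_le m x) (by positivity)
    _ = _ := by ring

/-- A growth rate at which `barr m` becomes a supersolution. -/
def rate (d : ℕ) (c : ℝ) (m : ℕ) : ℝ := d ^ 2 * c * (2 * m * d + 4 * m * m * d ^ 2)

theorem comparison {a : ℝ → (Fin d → ℝ) → Fin d → Fin d → ℝ}
    {φ : ℝ → (Fin d → ℝ) → ℝ} {t₀ S c C : ℝ} (m : ℕ) (hc0 : 0 ≤ c)
    (hs : ∀ t ∈ Set.Ioc t₀ S, ∀ x, ∀ i j, a t x i j = a t x j i)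
    (hp : ∀ t ∈ Set.Ioc t₀ S, ∀ x, ∀ y : Fin d → ℝ, 0 ≤ ∑ i, ∑ j, a t x i j * y i * y j)
    (hg : ∀ t ∈ Set.Ioc t₀ S, ∀ x, ∀ i j, |a t x i j| ≤ c * (1 + ‖x‖ ^ 2))
    (hc : ContinuousOn (fun q : ℝ × (Fin d → ℝ) => φ q.1 q.2) (Set.Icc t₀ S ×ˢ Set.univ))
    (hC : ∀ t ∈ Set.Icc t₀ S, ∀ x, φ t x ≤ C * barr m x)
    (h0 : ∀ x, φ t₀ x ≤ 0)
    (hsub : ∀ t ∈ Set.Ioc t₀ S, ∀ x, 0 < φ t x → SubAt a φ t x 0) :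
    ∀ t ∈ Set.Icc t₀ S, ∀ x, φ t x ≤ 0 := by
  intro t ht x
  set L := rate d c (m + 1) + 1 with hL
  have hL1 : 1 ≤ L := by
    have : 0 ≤ rate d c (m + 1) := by rw [rate]; positivity
    linarith
  have hL0 : 0 ≤ L := by linarith
  have key : ∀ ε > 0, φ t x ≤ ε * (barr (m + 1) x * Real.exp (L * (t - t₀))) := by
    intro ε hε
    set Φ : ℝ → (Fin d → ℝ) → ℝ := fun s y =>
      φ s y - ε * Real.exp (L * (s - t₀)) * barr (m + 1) y with hΦ
    set R := ‖x‖ + |C| / ε + 1 with hR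
    have hCe : 0 ≤ |C| / ε := by positivity
    have hR1 : 1 ≤ R := by linarith [norm_nonneg x]
    have := max_principle_compact (a := a) (φ := Φ) (t₀ := t₀) (S := S) (R := R) hs hp
      ?_ ?_ ?_ ?_ t ht x (by linarith)
    · simp only [hΦ] at this
      linarith
    · refine ContinuousOn.sub (hc.mono (Set.prod_mono_right (Set.subset_univ _))) ?_
      refine Continuous.continuousOn ?_
      have := (continuous_barr (d := d) (m + 1)).comp continuous_snd (X := ℝ × (Fin d → ℝ))
      exact (by fun_prop : Continuous fun q : ℝ × (Fin d → ℝ) =>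
        ε * Real.exp (L * (q.1 - t₀))).mul this
    · intro y _
      have := barr_pos (m + 1) y
      have h2 : 0 < ε * Real.exp (L * (t₀ - t₀)) * barr (m + 1) y := by positivity
      simp only [hΦ]
      linarith [h0 y]
    · intro s hs' y hy
      have h1 := hC s hs' y
      have h2 : 1 ≤ Real.exp (L * (s - t₀)) :=
        Real.one_le_exp (mul_nonneg hL0 (by linarith [hs'.1]))
      have h3 : |C| ≤ ε * (1 + edot y y) := by
        have : |C| / ε ≤ 1 + edot y y := by
          nlinarith [one_add_sq_le y, norm_nonneg x]
        rwa [div_le_iff₀' hε] at this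
      have hb := barr_pos m y
      have h4 : C * barr m y ≤ ε * barr (m + 1) y := by
        calc C * barr m y ≤ ε * (1 + edot y y) * barr m y := by
              gcongr; exact (le_abs_self C).trans h3
          _ = _ := by rw [barr, barr, pow_succ]; ring
      have h5 : ε * barr (m + 1) y ≤ ε * Real.exp (L * (s - t₀)) * barr (m + 1) y := by
        have := barr_pos (m + 1) y
        have h6 : ε ≤ ε * Real.exp (L * (s - t₀)) := le_mul_of_one_le_right hε.le h2
        gcongr
      simp only [hΦ]
      linarith
    · intro s hs' y _ hpos
      have hE : 0 < ε * Real.exp (L * (s - t₀)) := by positivity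
      have hb := barr_pos (m + 1) y
      have hφ : 0 < φ s y := by
        have : 0 < ε * Real.exp (L * (s - t₀)) * barr (m + 1) y := by positivity
        simp only [hΦ] at hpos
        linarith
      obtain ⟨⟨p, D1, D2, k1, k2, k3, k4⟩⟩ := hsub s hs' y hφ
      refine ⟨-(ε * Real.exp (L * (s - t₀)) * barr (m + 1) y), by
        have : 0 < ε * Real.exp (L * (s - t₀)) * barr (m + 1) y := by positivity
        linarith, ⟨⟨p - ε * (Real.exp (L * (s - t₀)) * L) * barr (m + 1) y,
        fun z => D1 z - (ε * Real.exp (L * (s - t₀))) • barr1 (m + 1) z,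
        D2 - (ε * Real.exp (L * (s - t₀))) • barr2 (m + 1) y, ?_, ?_, ?_, ?_⟩⟩⟩
      · have e1 : HasDerivAt (fun s => Real.exp (L * (s - t₀))) (Real.exp (L * (s - t₀)) * L) s := by
          have : HasDerivAt (fun s => L * (s - t₀)) L s := by
            simpa using ((hasDerivAt_id s).sub_const t₀).const_mul L
          exact this.exp
        exact k1.sub ((e1.const_mul ε).mul_const (barr (m + 1) y)).hasDerivWithinAt
      · exact fun z => (k2 z).sub ((hasFDerivAt_barr (m + 1) z).const_mul _)
      · exact k3.sub ((hasFDerivAt_barr1 (m + 1) y).const_smul (ε * Real.exp (L * (s - t₀))))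
      · rw [tr_sub, tr_smul]
        have h7 := (abs_le.1 (abs_tr_barr2_le hc0 (hg s hs' y) (m + 1))).2
        have h8 : tr (a s y) (barr2 (m + 1) y) ≤ (L - 1) * barr (m + 1) y := by
          rw [hL, rate]; linarith
        nlinarith [mul_le_mul_of_nonneg_left h8 hE.le]
  have hpos : 0 < barr (m + 1) x * Real.exp (L * (t - t₀)) :=
    mul_pos (barr_pos _ _) (Real.exp_pos _)
  by_contra! hlt
  have := key (φ t x / (2 * (barr (m + 1) x * Real.exp (L * (t - t₀))))) (by positivity)
  have e : φ t x / (2 * (barr (m + 1) x * Real.exp (L * (t - t₀)))) *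
      (barr (m + 1) x * Real.exp (L * (t - t₀))) = φ t x / 2 := by
    generalize barr (m + 1) x * Real.exp (L * (t - t₀)) = z at hpos
    field_simp
  rw [e] at this
  linarith

/-- Maximum principle for bounded entire solutions. -/
theorem Reg.le_of_source_le {α N G Λ : ℝ} {a : ℝ → (Fin d → ℝ) → Fin d → Fin d → ℝ}
    {w : Jet (Fin d → ℝ)} {g : ℝ → (Fin d → ℝ) → ℝ} (h : Reg α N w)
    (hs : ∀ t x i j, a t x i j = a t x j i)
    (hp : ∀ t x, ∀ y : Fin d → ℝ, 0 ≤ ∑ i, ∑ j, a t x i j * y i * y j)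
    (hΛ : ∀ t x i j, |a t x i j| ≤ Λ)
    (hw : ∀ t x, w.dt t x = tr (a t x) (w.d2 t x) - w.v t x + g t x)
    (hg : ∀ t x, g t x ≤ G) (hG : 0 ≤ G) (t : ℝ) (x : Fin d → ℝ) : w.v t x ≤ G := by
  have hN := h.nonneg
  have key : ∀ t₀ ≤ t, (w.v t x - G) * Real.exp t ≤ N * Real.exp t₀ := by
    intro t₀ ht
    set φ : ℝ → (Fin d → ℝ) → ℝ := fun s y =>
      (w.v s y - G) * Real.exp s - N * Real.exp t₀ with hφ
    have := comparison (a := a) (φ := φ) (t₀ := t₀) (S := t) (c := |Λ|)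
      (C := (N + G) * Real.exp t + N) 0 (abs_nonneg _)
      (fun s _ => hs s) (fun s _ => hp s) (fun s _ y i j => (hΛ s y i j).trans (by
        nlinarith [le_abs_self Λ, abs_nonneg Λ, sq_nonneg ‖y‖, mul_nonneg (abs_nonneg Λ) (sq_nonneg ‖y‖)]))
      ?_ ?_ ?_ ?_ t ⟨ht, le_rfl⟩ x
    · simp only [hφ] at this
      linarith
    · have := h.ucv.continuous
      exact (by fun_prop : Continuous fun q : ℝ × (Fin d → ℝ) =>
        (w.v q.1 q.2 - G) * Real.exp q.1 - N * Real.exp t₀).continuousOn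
    · intro s hs' y
      simp only [hφ, barr, pow_zero, mul_one]
      have h1 := abs_le.1 (h.bv s y)
      have h2 : Real.exp s ≤ Real.exp t := Real.exp_le_exp.2 hs'.2
      have h3 : (w.v s y - G) * Real.exp s ≤ (N + G) * Real.exp t := by
        have := Real.exp_pos s
        calc _ ≤ (N + G) * Real.exp s := by gcongr; linarith
          _ ≤ _ := by gcongr
      have := mul_nonneg hN (Real.exp_pos t₀).le
      linarith
    · intro y
      have h1 := abs_le.1 (h.bv t₀ y)
      have := Real.exp_pos t₀
      simp only [hφ]
      nlinarith
    · intro s _ y _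
      refine ⟨⟨w.dt s y * Real.exp s + (w.v s y - G) * Real.exp s,
        fun z => Real.exp s • w.d1 s z, Real.exp s • w.d2 s y, ?_, ?_, ?_, ?_⟩⟩
      · exact ((((h.ht s y).sub_const G).mul (Real.hasDerivAt_exp s)).sub_const
          (N * Real.exp t₀)).hasDerivWithinAt
      · exact fun z => (((h.h1 s z).sub_const G).mul_const (Real.exp s)).sub_const (N * Real.exp t₀)
      · exact (h.h2 s y).const_smul (Real.exp s)
      · rw [tr_smul, hw]
        have := Real.exp_pos s
        nlinarith [hg s y]
  have hl : Tendsto (fun t₀ => N * Real.exp t₀) atBot (𝓝 0) := by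
    simpa using Real.tendsto_exp_atBot.const_mul N
  have h1 : (w.v t x - G) * Real.exp t ≤ 0 :=
    ge_of_tendsto hl ((eventually_le_atBot t).mono key)
  by_contra! hlt
  have := mul_pos (sub_pos.2 hlt) (Real.exp_pos t)
  linarith

/-- Pointwise linear combination of jets. -/
def Jet.sub {E : Type*} [NormedAddCommGroup E] [NormedSpace ℝ E] (u w : Jet E) : Jet E where
  v t x := u.v t x - w.v t x
  d1 t x := u.d1 t x - w.d1 t x
  d2 t x := u.d2 t x - w.d2 t x
  dt t x := u.dt t x - w.dt t x

theorem Reg.sub {E : Type*} [NormedAddCommGroup E] [NormedSpace ℝ E] {α N M : ℝ} {u w : Jet E}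
    (hu : Reg α N u) (hw : Reg α M w) : Reg α (N + M) (u.sub w) where
  h1 t x := (hu.h1 t x).sub (hw.h1 t x)
  h2 t x := (hu.h2 t x).sub (hw.h2 t x)
  ht t x := (hu.ht t x).sub (hw.ht t x)
  bv t x := (abs_sub _ _).trans (add_le_add (hu.bv t x) (hw.bv t x))
  b1 t x := (norm_sub_le _ _).trans (add_le_add (hu.b1 t x) (hw.b1 t x))
  b2 t x := (bl_norm_sub_le _ _).trans (add_le_add (hu.b2 t x) (hw.b2 t x))
  bt t x := (abs_sub _ _).trans (add_le_add (hu.bt t x) (hw.bt t x))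
  hol t x y := by
    simp only [Jet.sub]
    rw [bl_sub_comm, add_mul]
    exact (bl_norm_sub_le _ _).trans (add_le_add (hu.hol t x y) (hw.hol t x y))
  uct := hu.uct.sub hw.uct

/-- Coefficient fields for which the linear theory is developed. -/
structure Coef (lam Λ α : ℝ) (a : ℝ → (Fin d → ℝ) → Fin d → Fin d → ℝ) : Prop where
  symm : ∀ t x i j, a t x i j = a t x j i
  ell : ∀ t x, ∀ y : Fin d → ℝ, lam * ‖y‖ ^ 2 ≤ ∑ i, ∑ j, a t x i j * y i * y j
  bdd : ∀ t x i j, |a t x i j| ≤ Λ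
  hol : ∀ t x y i j, |a t x i j - a t y i j| ≤ Λ * ‖x - y‖ ^ α
  uc : ∀ i j, UC fun t x => a t x i j

theorem Coef.psd {lam Λ α : ℝ} {a : ℝ → (Fin d → ℝ) → Fin d → Fin d → ℝ} (h : Coef lam Λ α a)
    (hl : 0 ≤ lam) (t : ℝ) (x y : Fin d → ℝ) : 0 ≤ ∑ i, ∑ j, a t x i j * y i * y j :=
  le_trans (by positivity) (h.ell t x y)

/-- `w` solves `∂ₜw = tr (a D²w) - w + g`. -/
def Sol (a : ℝ → (Fin d → ℝ) → Fin d → Fin d → ℝ) (g : ℝ → (Fin d → ℝ) → ℝ)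
    (w : Jet (Fin d → ℝ)) : Prop :=
  ∀ t x, w.dt t x = tr (a t x) (w.d2 t x) - w.v t x + g t x

theorem Sol.sub {a : ℝ → (Fin d → ℝ) → Fin d → Fin d → ℝ} {g h : ℝ → (Fin d → ℝ) → ℝ}
    {u w : Jet (Fin d → ℝ)} (hu : Sol a g u) (hw : Sol a h w) :
    Sol a (fun t x => g t x - h t x) (u.sub w) := by
  intro t x
  simp only [Jet.sub, tr_sub, hu t x, hw t x]
  ring

/-- Two-sided maximum principle. -/
theorem Sol.abs_le {α N G lam Λ β : ℝ} {a : ℝ → (Fin d → ℝ) → Fin d → Fin d → ℝ}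
    {w : Jet (Fin d → ℝ)} {g : ℝ → (Fin d → ℝ) → ℝ} (hw : Sol a g w) (h : Reg α N w)
    (ha : Coef lam Λ β a) (hl : 0 ≤ lam)
    (hg : ∀ t x, |g t x| ≤ G) (t : ℝ) (x : Fin d → ℝ) : |w.v t x| ≤ G := by
  have hG : 0 ≤ G := (abs_nonneg _).trans (hg 0 0)
  have h0 : Reg α 0 (⟨fun _ _ => 0, fun _ _ => 0, fun _ _ => 0, fun _ _ => 0⟩ :
      Jet (Fin d → ℝ)) := by
    constructor <;> intros <;>
      simp [UC.const, hasFDerivAt_const, hasDerivAt_const, bl_norm_zero, bl_sub_self]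
  refine _root_.abs_le.2 ⟨?_, h.le_of_source_le ha.symm (ha.psd hl) ha.bdd hw
    (fun t x => (_root_.abs_le.1 (hg t x)).2) hG t x⟩
  have := (h0.sub h).le_of_source_le (g := fun t x => -g t x) ha.symm (ha.psd hl) ha.bdd
    (fun t x => by simp only [Jet.sub, hw t x, tr_sub]; simp [tr]; ring)
    (fun t x => by linarith [(_root_.abs_le.1 (hg t x)).1]) hG t x
  simp only [Jet.sub] at this
  linarith

end Barrier

section HolderCalculus

variable {E : Type*} [NormedAddCommGroup E]

/-- Bounded functions, uniformly Hölder in space. -/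
structure BH (α A : ℝ) (f : ℝ → E → ℝ) : Prop where
  b : ∀ t x, |f t x| ≤ A
  hol : ∀ t x y, |f t x - f t y| ≤ A * ‖x - y‖ ^ α

namespace BH

variable {α A B : ℝ} {f g : ℝ → E → ℝ}

theorem nonneg (h : BH α A f) : 0 ≤ A := (abs_nonneg _).trans (h.b 0 0)

theorem mono (h : BH α A f) (hA : A ≤ B) : BH α B f where
  b t x := (h.b t x).trans hA
  hol t x y := (h.hol t x y).trans (by gcongr)

theorem add (hf : BH α A f) (hg : BH α B g) : BH α (A + B) fun t x => f t x + g t x where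
  b t x := (abs_add_le _ _).trans (add_le_add (hf.b t x) (hg.b t x))
  hol t x y := by
    rw [add_sub_add_comm, add_mul]
    exact (abs_add_le _ _).trans (add_le_add (hf.hol t x y) (hg.hol t x y))

theorem neg (hf : BH α A f) : BH α A fun t x => -f t x where
  b t x := by rw [abs_neg]; exact hf.b t x
  hol t x y := by rw [← neg_add', abs_neg, ← sub_eq_add_neg]; exact hf.hol t x y

theorem sub (hf : BH α A f) (hg : BH α B g) : BH α (A + B) fun t x => f t x - g t x := by
  simpa only [sub_eq_add_neg] using hf.add hg.neg

theorem mul (hf : BH α A f) (hg : BH α B g) : BH α (2 * A * B) fun t x => f t x * g t x where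
  b t x := by
    have hA := hf.nonneg
    have hB := hg.nonneg
    rw [abs_mul]
    nlinarith [mul_le_mul (hf.b t x) (hg.b t x) (abs_nonneg _) hA, mul_nonneg hA hB]
  hol t x y := by
    have hA := hf.nonneg
    have hB := hg.nonneg
    have e : f t x * g t x - f t y * g t y = f t x * (g t x - g t y) + (f t x - f t y) * g t y := by
      ring
    rw [e]
    calc _ ≤ |f t x| * |g t x - g t y| + |f t x - f t y| * |g t y| := by
          rw [← abs_mul, ← abs_mul]; exact abs_add_le _ _
      _ ≤ A * (B * ‖x - y‖ ^ α) + (A * ‖x - y‖ ^ α) * B := by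
          have h1 := hf.b t x
          have h2 := hg.hol t x y
          have h3 := hf.hol t x y
          have h4 := hg.b t y
          have := Real.rpow_nonneg (norm_nonneg (x - y)) α
          gcongr
      _ = _ := by ring

theorem const_mul (c : ℝ) (hf : BH α A f) : BH α (|c| * A) fun t x => c * f t x where
  b t x := by rw [abs_mul]; exact mul_le_mul_of_nonneg_left (hf.b t x) (abs_nonneg c)
  hol t x y := by
    rw [← mul_sub, abs_mul, mul_assoc]
    exact mul_le_mul_of_nonneg_left (hf.hol t x y) (abs_nonneg c)

theorem sum {ι : Type*} [Fintype ι] {f : ι → ℝ → E → ℝ} (hf : ∀ i, BH α A (f i)) :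
    BH α (Fintype.card ι * A) fun t x => ∑ i, f i t x where
  b t x := by
    calc _ ≤ ∑ _i : ι, A := (abs_sum_le_sum_abs _ _).trans (sum_le_sum fun i _ => (hf i).b t x)
      _ = _ := by simp
  hol t x y := by
    rw [← sum_sub_distrib]
    calc _ ≤ ∑ _i : ι, A * ‖x - y‖ ^ α :=
          (abs_sum_le_sum_abs _ _).trans (sum_le_sum fun i _ => (hf i).hol t x y)
      _ = _ := by simp; ring

theorem of_lip (hα : 0 ≤ α) (hα1 : α ≤ 1) (hb : ∀ t x, |f t x| ≤ A)
    (hl : ∀ t x y, |f t x - f t y| ≤ A * ‖x - y‖) : BH α (2 * A) f where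
  b t x := by
    have := hb t x
    linarith [abs_nonneg (f t x)]
  hol t x y := by
    have hA : 0 ≤ A := (abs_nonneg _).trans (hb t x)
    rcases le_total ‖x - y‖ 1 with h | h
    · calc _ ≤ A * ‖x - y‖ := hl t x y
        _ ≤ A * ‖x - y‖ ^ α := by
          gcongr
          exact Real.self_le_rpow_of_le_one (norm_nonneg _) h hα1
        _ ≤ _ := by gcongr; linarith
    · have h1 : 1 ≤ ‖x - y‖ ^ α := Real.one_le_rpow h hα
      have h2 := abs_sub (f t x) (f t y)
      nlinarith [hb t x, hb t y]

end BH

theorem Src.bh {α G : ℝ} {g : ℝ → E → ℝ} (h : Src α G g) : BH α G g := ⟨h.b, h.hol⟩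

theorem BH.src {α G : ℝ} {g : ℝ → E → ℝ} (h : BH α G g) (hu : UC g) : Src α G g :=
  ⟨h.b, h.hol, hu⟩

end HolderCalculus

section JetCalculus

variable {d : ℕ} {α N : ℝ}

theorem norm_le_sum_entries (f : (Fin d → ℝ) →L[ℝ] ℝ) : ‖f‖ ≤ ∑ i, |f (eb i)| := by
  refine ContinuousLinearMap.opNorm_le_bound _ (sum_nonneg fun _ _ => abs_nonneg _) fun x => ?_
  have : x = ∑ i, x i • eb i := pi_eq_sum_univ' x
  conv_lhs => rw [this]
  simp only [map_sum, map_smul, smul_eq_mul, sum_mul]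
  refine (norm_sum_le _ _).trans (sum_le_sum fun i _ => ?_)
  rw [norm_mul, mul_comm]
  exact mul_le_mul_of_nonneg_left (norm_le_pi_norm x i) (abs_nonneg _)

theorem norm_le_of_entries {f : (Fin d → ℝ) →L[ℝ] ℝ} {A : ℝ} (h : ∀ i, |f (eb i)| ≤ A) :
    ‖f‖ ≤ d * A :=
  (norm_le_sum_entries f).trans ((sum_le_sum fun i _ => h i).trans_eq (by simp))

theorem bl_norm_le_of_entries {H : (Fin d → ℝ) →L[ℝ] (Fin d → ℝ) →L[ℝ] ℝ} {A : ℝ}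
    (h : ∀ i j, |H (eb i) (eb j)| ≤ A) : ‖H‖ ≤ d * (d * A) := by
  have hA : 0 ≤ (d : ℝ) * A := by
    rcases Nat.eq_zero_or_pos d with rfl | hd
    · simp
    · exact mul_nonneg (Nat.cast_nonneg d) ((abs_nonneg _).trans (h ⟨0, hd⟩ ⟨0, hd⟩))
  refine ContinuousLinearMap.opNorm_le_bound _ (by positivity) fun x => ?_
  rw [mul_assoc]
  refine norm_le_of_entries fun j => ?_
  have : x = ∑ i, x i • eb i := pi_eq_sum_univ' x
  conv_lhs => rw [this]
  simp only [map_sum, map_smul, _root_.sum_apply, _root_.smul_apply, smul_eq_mul]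
  calc _ ≤ ∑ _i : Fin d, ‖x‖ * A := by
        refine (abs_sum_le_sum_abs _ _).trans (sum_le_sum fun i _ => ?_)
        rw [abs_mul]
        exact mul_le_mul (norm_le_pi_norm x i) (h i j) (abs_nonneg _) (norm_nonneg _)
    _ = _ := by simp; ring

theorem abs_apply_eb_le_norm (f : (Fin d → ℝ) →L[ℝ] ℝ) (i : Fin d) : |f (eb i)| ≤ ‖f‖ := by
  simpa [norm_eb] using f.le_opNorm (eb i)

variable {w u : Jet (Fin d → ℝ)}

theorem Reg.bh_v {β : ℝ} (h : Reg β N w) (hα : 0 ≤ α) (hα1 : α ≤ 1) {A B : ℝ} (hA : ∀ t x, |w.v t x| ≤ A)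
    (hB : ∀ t x, ‖w.d1 t x‖ ≤ B) : BH α (2 * (A + B)) w.v := by
  have hA0 : 0 ≤ A := (abs_nonneg _).trans (hA 0 0)
  have hB0 : 0 ≤ B := (norm_nonneg _).trans (hB 0 0)
  refine BH.of_lip hα hα1 (fun t x => (hA t x).trans (by linarith)) fun t x y => ?_
  have := convex_univ.norm_image_sub_le_of_norm_hasFDerivWithin_le
    (fun z _ => (h.h1 t z).hasFDerivWithinAt) (fun z _ => hB t z) (Set.mem_univ y) (Set.mem_univ x)
  exact this.trans (mul_le_mul_of_nonneg_right (by linarith) (norm_nonneg _))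

theorem Reg.bh_d1 {β : ℝ} (h : Reg β N w) (hα : 0 ≤ α) (hα1 : α ≤ 1) {A B : ℝ} (hA : ∀ t x, ‖w.d1 t x‖ ≤ A)
    (hB : ∀ t x, ‖w.d2 t x‖ ≤ B) (i : Fin d) : BH α (2 * (A + B)) fun t x => w.d1 t x (eb i) := by
  have hA0 : 0 ≤ A := (norm_nonneg _).trans (hA 0 0)
  have hB0 : 0 ≤ B := (norm_nonneg (E := (Fin d → ℝ) →L[ℝ] (Fin d → ℝ) →L[ℝ] ℝ) _).trans (hB 0 0)
  refine BH.of_lip hα hα1 (fun t x =>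
    (abs_apply_eb_le_norm _ i).trans ((hA t x).trans (by linarith))) fun t x y => ?_
  have := convex_univ.norm_image_sub_le_of_norm_hasFDerivWithin_le
    (fun z _ => (h.h2 t z).hasFDerivWithinAt) (fun z _ => hB t z) (Set.mem_univ y) (Set.mem_univ x)
  rw [← _root_.sub_apply]
  exact (abs_apply_eb_le_norm _ i).trans
    (this.trans (mul_le_mul_of_nonneg_right (by linarith) (norm_nonneg _)))

theorem Reg.bh_d2 (h : Reg α N w) (i j : Fin d) : BH α N fun t x => w.d2 t x (eb i) (eb j) where
  b t x := (abs_apply_eb_le _ i j).trans (h.b2 t x)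
  hol t x y := by
    have : w.d2 t x (eb i) (eb j) - w.d2 t y (eb i) (eb j) =
      (w.d2 t x - w.d2 t y) (eb i) (eb j) := by simp
    rw [this]
    exact (abs_apply_eb_le _ i j).trans (h.hol t x y)

/-- Assemble regularity from entrywise bounds. -/
theorem Reg.of_entries {A : ℝ} (hA : 0 ≤ A) (h1 : ∀ t x, HasFDerivAt (w.v t) (w.d1 t x) x)
    (h2 : ∀ t x, HasFDerivAt (w.d1 t) (w.d2 t x) x)
    (ht : ∀ t x, HasDerivAt (fun s => w.v s x) (w.dt t x) t)
    (bv : ∀ t x, |w.v t x| ≤ A) (b1 : ∀ t x i, |w.d1 t x (eb i)| ≤ A)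
    (b2 : ∀ i j, BH α A fun t x => w.d2 t x (eb i) (eb j)) (bt : ∀ t x, |w.dt t x| ≤ A)
    (uct : UC w.dt) : Reg α ((1 + d * (d + 1)) * A) w where
  h1 := h1
  h2 := h2
  ht := ht
  bv t x := (bv t x).trans (by nlinarith [mul_nonneg (by positivity : 0 ≤ (d : ℝ) * (d + 1)) hA])
  b1 t x := (norm_le_of_entries (b1 t x)).trans (by
    nlinarith [mul_nonneg (by positivity : 0 ≤ (d : ℝ) * d) hA])
  b2 t x := (bl_norm_le_of_entries fun i j => (b2 i j).b t x).trans (by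
    nlinarith [mul_nonneg (by positivity : 0 ≤ (d : ℝ)) hA])
  bt t x := (bt t x).trans (by nlinarith [mul_nonneg (by positivity : 0 ≤ (d : ℝ) * (d + 1)) hA])
  hol t x y := by
    refine (bl_norm_le_of_entries (A := A * ‖x - y‖ ^ α) fun i j => ?_).trans ?_
    · simpa using (b2 i j).hol t x y
    · have := mul_nonneg hA (Real.rpow_nonneg (norm_nonneg (x - y)) α)
      nlinarith [mul_nonneg (by positivity : 0 ≤ (d : ℝ)) this]
  uct := uct

/-- Product of jets. -/
def Jet.mul (z u : Jet (Fin d → ℝ)) : Jet (Fin d → ℝ) where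
  v t x := z.v t x * u.v t x
  d1 t x := z.v t x • u.d1 t x + u.v t x • z.d1 t x
  d2 t x := (z.v t x • u.d2 t x + (z.d1 t x).smulRight (u.d1 t x)) +
    (u.v t x • z.d2 t x + (u.d1 t x).smulRight (z.d1 t x))
  dt t x := z.dt t x * u.v t x + z.v t x * u.dt t x

theorem Jet.mul_d2_apply (z u : Jet (Fin d → ℝ)) (t : ℝ) (x h k : Fin d → ℝ) :
    (z.mul u).d2 t x h k = z.v t x * u.d2 t x h k + z.d1 t x h * u.d1 t x k +
      (u.v t x * z.d2 t x h k + u.d1 t x h * z.d1 t x k) := by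
  simp [Jet.mul]

theorem Reg.mul {z : Jet (Fin d → ℝ)} {M : ℝ} (hz : Reg α M z) (hu : Reg α N u) (hα : 0 < α)
    (hα1 : α ≤ 1) : ∃ N', Reg α N' (z.mul u) := by
  have hM := hz.nonneg
  have hN := hu.nonneg
  have a1 := hz.bh_v hα.le hα1 hz.bv hz.b1
  have a2 := hz.bh_d1 hα.le hα1 hz.b1 hz.b2
  have a3 := hu.bh_v hα.le hα1 hu.bv hu.b1
  have a4 := hu.bh_d1 hα.le hα1 hu.b1 hu.b2
  have hMN := mul_nonneg hM hN
  refine ⟨_, Reg.of_entries (A := 100 * (M * N)) (by positivity) (fun t x => ?_) (fun t x => ?_)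
    (fun t x => ?_) (fun t x => ?_) (fun t x i => ?_) (fun i j => ?_) (fun t x => ?_) ?_⟩
  · exact (hz.h1 t x).mul (hu.h1 t x)
  · exact ((hz.h1 t x).smul (hu.h2 t x)).add ((hu.h1 t x).smul (hz.h2 t x))
  · exact (hz.ht t x).mul (hu.ht t x)
  · simp only [Jet.mul, abs_mul]
    nlinarith [mul_le_mul (hz.bv t x) (hu.bv t x) (abs_nonneg _) hM]
  · simp only [Jet.mul, _root_.add_apply, _root_.smul_apply, smul_eq_mul]
    refine (abs_add_le _ _).trans ?_
    rw [abs_mul, abs_mul]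
    nlinarith [mul_le_mul (hz.bv t x) ((abs_apply_eb_le_norm _ i).trans (hu.b1 t x))
      (abs_nonneg _) hM, mul_le_mul (hu.bv t x) ((abs_apply_eb_le_norm _ i).trans (hz.b1 t x))
      (abs_nonneg _) hN]
  · simp only [Jet.mul_d2_apply]
    exact (((a1.mul (hu.bh_d2 i j)).add ((a2 i).mul (a4 j))).add
      ((a3.mul (hz.bh_d2 i j)).add ((a4 i).mul (a2 j)))).mono (by nlinarith)
  · simp only [Jet.mul]
    refine (abs_add_le _ _).trans ?_
    rw [abs_mul, abs_mul]
    nlinarith [mul_le_mul (hz.bt t x) (hu.bv t x) (abs_nonneg _) hM,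
      mul_le_mul (hz.bv t x) (hu.bt t x) (abs_nonneg _) hM]
  · exact (hz.uct.mul hu.ucv hz.bt hu.bv).add (hz.ucv.mul hu.uct hz.bv hu.bt)

/-- Translation of a jet. -/
def Jet.shift (t₀ : ℝ) (x₀ : Fin d → ℝ) (z : Jet (Fin d → ℝ)) : Jet (Fin d → ℝ) where
  v t x := z.v (t - t₀) (x - x₀)
  d1 t x := z.d1 (t - t₀) (x - x₀)
  d2 t x := z.d2 (t - t₀) (x - x₀)
  dt t x := z.dt (t - t₀) (x - x₀)

theorem Reg.shift (h : Reg α N w) (t₀ : ℝ) (x₀ : Fin d → ℝ) : Reg α N (w.shift t₀ x₀) where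
  h1 t x := (hasFDerivAt_comp_sub x₀).2 (h.h1 _ _)
  h2 t x := (hasFDerivAt_comp_sub x₀).2 (h.h2 _ _)
  ht t x := (h.ht _ _).comp_sub_const t t₀
  bv t x := h.bv _ _
  b1 t x := h.b1 _ _
  b2 t x := h.b2 _ _
  bt t x := h.bt _ _
  hol t x y := by simpa [Jet.shift] using h.hol (t - t₀) (x - x₀) (y - x₀)
  uct := by
    intro ε hε
    obtain ⟨δ, hδ, H⟩ := h.uct ε hε
    refine ⟨δ, hδ, fun t s x y h1 h2 => H _ _ _ _ ?_ ?_⟩ <;> simpa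

end JetCalculus

section SmoothBounds

variable {X : Type*} [NormedAddCommGroup X] [NormedSpace ℝ X] {φ : X → ℝ}

theorem hasFDerivAt_fderiv_of_three (hφ : ContDiff ℝ 3 φ) (p : X) :
    HasFDerivAt φ (fderiv ℝ φ p) p :=
  ((hφ.differentiable (by norm_num)) p).hasFDerivAt

theorem hasFDerivAt_fderiv_fderiv (hφ : ContDiff ℝ 3 φ) (p : X) :
    HasFDerivAt (fderiv ℝ φ) (fderiv ℝ (fderiv ℝ φ) p) p := by
  have c1 : ContDiff ℝ 2 (fderiv ℝ φ) := hφ.fderiv_right (by norm_num)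
  exact ((c1.differentiable (by norm_num)) p).hasFDerivAt

theorem bl_apply_le {H : X →L[ℝ] X →L[ℝ] ℝ} {C : ℝ} (hH : ‖H‖ ≤ C) (h k : X) :
    |H h k| ≤ C * ‖h‖ * ‖k‖ :=
  (H.le_opNorm₂ h k).trans (by gcongr)

theorem exists_bound_and_lip {V : Type*} [NormedAddCommGroup V] [NormedSpace ℝ V] {ψ : X → V}
    (hψ : ContDiff ℝ 1 ψ) (hs : HasCompactSupport ψ) :
    ∃ M, 0 ≤ M ∧ (∀ p, ‖ψ p‖ ≤ M) ∧ ∀ p q, ‖ψ p - ψ q‖ ≤ M * ‖p - q‖ := by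
  obtain ⟨M0, hM0⟩ := hs.exists_bound_of_continuous hψ.continuous
  obtain ⟨M1, hM1⟩ := hψ.lipschitzWith_of_hasCompactSupport hs one_ne_zero
  refine ⟨|M0| + M1, by positivity, fun p => ?_, fun p q => ?_⟩
  · exact (hM0 p).trans ((le_abs_self M0).trans (le_add_of_nonneg_right M1.2))
  · have h := hM1.dist_le_mul p q
    rw [dist_eq_norm, dist_eq_norm] at h
    exact h.trans (mul_le_mul_of_nonneg_right (le_add_of_nonneg_left (abs_nonneg M0))
      (norm_nonneg _))

theorem bl_sub_apply (H K : X →L[ℝ] X →L[ℝ] ℝ) (h k : X) : (H - K) h k = H h k - K h k := rfl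

theorem smooth_bounds (hφ : ContDiff ℝ 3 φ) (hs : HasCompactSupport φ) : ∃ M : ℝ,
    (∀ p, |φ p| ≤ M) ∧ (∀ p h, |fderiv ℝ φ p h| ≤ M * ‖h‖) ∧
    (∀ p h k, |fderiv ℝ (fderiv ℝ φ) p h k| ≤ M * ‖h‖ * ‖k‖) ∧
    ∀ p q h k, |fderiv ℝ (fderiv ℝ φ) p h k - fderiv ℝ (fderiv ℝ φ) q h k| ≤
      M * ‖p - q‖ * ‖h‖ * ‖k‖ := by
  have c1 : ContDiff ℝ 2 (fderiv ℝ φ) := hφ.fderiv_right (by norm_num)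
  have c2 : ContDiff ℝ 1 (fderiv ℝ (fderiv ℝ φ)) := c1.fderiv_right (by norm_num)
  have s1 := hs.fderiv (𝕜 := ℝ)
  have s2 := s1.fderiv (𝕜 := ℝ)
  obtain ⟨M0, k0, hM0, -⟩ := exists_bound_and_lip (hφ.of_le (by norm_num)) hs
  obtain ⟨M1, k1, hM1, -⟩ := exists_bound_and_lip (c1.of_le (by norm_num)) s1
  obtain ⟨M2, k2, hM2, hM3⟩ := exists_bound_and_lip c2 s2
  refine ⟨M0 + M1 + M2, fun p => (hM0 p).trans (by linarith), fun p h => ?_, fun p h k => ?_,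
    fun p q h k => ?_⟩
  · exact ((fderiv ℝ φ p).le_of_opNorm_le (hM1 p) h).trans
      (mul_le_mul_of_nonneg_right (by linarith) (norm_nonneg _))
  · exact (bl_apply_le (hM2 p) h k).trans (mul_le_mul_of_nonneg_right
      (mul_le_mul_of_nonneg_right (by linarith) (norm_nonneg _)) (norm_nonneg _))
  · have h1 := bl_apply_le (hM3 p q) h k
    rw [bl_sub_apply] at h1
    exact h1.trans (mul_le_mul_of_nonneg_right (mul_le_mul_of_nonneg_right
      (mul_le_mul_of_nonneg_right (by linarith) (norm_nonneg _)) (norm_nonneg _)) (norm_nonneg _))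

theorem conv_hasFDerivAt {V : Type*} [NormedAddCommGroup V] [NormedSpace ℝ V] [CompleteSpace V]
    [FiniteDimensional ℝ X] [MeasurableSpace X] [BorelSpace X] (μ : Measure X)
    [μ.IsAddHaarMeasure] {g : X → ℝ} (hg : Continuous g) {ψ : X → V}
    (hψ : ContDiff ℝ 1 ψ) (hs : HasCompactSupport ψ) (p : X) :
    HasFDerivAt (fun p => ∫ q, g q • ψ (p - q) ∂μ) (∫ q, g q • fderiv ℝ ψ (p - q) ∂μ) p := by
  have h := hs.hasFDerivAt_convolution_right (ContinuousLinearMap.lsmul ℝ ℝ)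
    (hg.locallyIntegrable (μ := μ)) hψ p
  have e : (∫ q, g q • fderiv ℝ ψ (p - q) ∂μ) =
      (MeasureTheory.convolution g (fderiv ℝ ψ) ((ContinuousLinearMap.lsmul ℝ ℝ).precompR X) μ) p := by
    rw [MeasureTheory.convolution]
    refine integral_congr_ae (Eventually.of_forall fun q => ?_)
    ext h
    simp [ContinuousLinearMap.precompR]
  rw [e]
  exact h

theorem norm_conv_le {V : Type*} [NormedAddCommGroup V] [NormedSpace ℝ V]
    [FiniteDimensional ℝ X] [MeasurableSpace X] [BorelSpace X] (μ : Measure X)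
    [μ.IsAddHaarMeasure] {g : X → ℝ} {G : ℝ} (hb : ∀ q, |g q| ≤ G) {ψ : X → V}
    (hψ : Continuous ψ) (hs : HasCompactSupport ψ) (p : X) :
    ‖∫ q, g q • ψ (p - q) ∂μ‖ ≤ G * ∫ q, ‖ψ q‖ ∂μ := by
  have hi : Integrable (fun q => ‖ψ q‖) μ := (hψ.integrable_of_hasCompactSupport hs).norm
  have h := norm_integral_le_of_norm_le (f := fun q => g q • ψ (p - q))
    (g := fun q => G * ‖ψ (p - q)‖) ((hi.comp_sub_left p).const_mul G)
    (Eventually.of_forall fun q => by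
      rw [norm_smul]; exact mul_le_mul_of_nonneg_right (hb q) (norm_nonneg _))
  rw [integral_const_mul, integral_sub_left_eq_self (fun q => ‖ψ q‖) μ p] at h
  exact h

theorem exists_conv_bound_and_lip {V : Type*} [NormedAddCommGroup V] [NormedSpace ℝ V]
    [CompleteSpace V] [FiniteDimensional ℝ X] [MeasurableSpace X] [BorelSpace X] (μ : Measure X)
    [μ.IsAddHaarMeasure] {g : X → ℝ} {G : ℝ} (hg : Continuous g) (hb : ∀ q, |g q| ≤ G) {ψ : X → V}
    (hψ : ContDiff ℝ 1 ψ) (hs : HasCompactSupport ψ) : ∃ M, 0 ≤ M ∧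
      (∀ p, ‖∫ q, g q • ψ (p - q) ∂μ‖ ≤ M) ∧
      ∀ p p', ‖(∫ q, g q • ψ (p - q) ∂μ) - ∫ q, g q • ψ (p' - q) ∂μ‖ ≤ M * ‖p - p'‖ := by
  have b0 := norm_conv_le μ hb hψ.continuous hs
  have b1 := norm_conv_le μ hb (hψ.continuous_fderiv one_ne_zero) (hs.fderiv (𝕜 := ℝ))
  have n0 := (norm_nonneg _).trans (b0 0)
  have n1 := (norm_nonneg _).trans (b1 0)
  refine ⟨_, add_nonneg n0 n1, fun p => (b0 p).trans (le_add_of_nonneg_right n1), fun p p' => ?_⟩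
  exact (convex_univ.norm_image_sub_le_of_norm_hasFDerivWithin_le
    (fun z _ => (conv_hasFDerivAt μ hg hψ hs z).hasFDerivWithinAt) (fun z _ => b1 z)
    (Set.mem_univ p') (Set.mem_univ p)).trans
      (mul_le_mul_of_nonneg_right (le_add_of_nonneg_left n0) (norm_nonneg _))

end SmoothBounds

section SmoothJets

variable {d : ℕ}

/-- The jet of a space-time function with two derivatives. -/
def jetOf (F : ℝ × (Fin d → ℝ) → ℝ) (F1 : ℝ × (Fin d → ℝ) → (ℝ × (Fin d → ℝ)) →L[ℝ] ℝ)
    (F2 : ℝ × (Fin d → ℝ) → (ℝ × (Fin d → ℝ)) →L[ℝ] (ℝ × (Fin d → ℝ)) →L[ℝ] ℝ) :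
    Jet (Fin d → ℝ) where
  v t x := F (t, x)
  d1 t x := (F1 (t, x)).comp (ContinuousLinearMap.inr ℝ ℝ (Fin d → ℝ))
  d2 t x := ((ContinuousLinearMap.compL ℝ (Fin d → ℝ) (ℝ × (Fin d → ℝ)) ℝ).flip
    (ContinuousLinearMap.inr ℝ ℝ (Fin d → ℝ))).comp
      ((F2 (t, x)).comp (ContinuousLinearMap.inr ℝ ℝ (Fin d → ℝ)))
  dt t x := F1 (t, x) (1, 0)

variable {F : ℝ × (Fin d → ℝ) → ℝ} {F1 : ℝ × (Fin d → ℝ) → (ℝ × (Fin d → ℝ)) →L[ℝ] ℝ}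
    {F2 : ℝ × (Fin d → ℝ) → (ℝ × (Fin d → ℝ)) →L[ℝ] (ℝ × (Fin d → ℝ)) →L[ℝ] ℝ}

theorem hasFDerivAt_mk_right (t : ℝ) (x : Fin d → ℝ) :
    HasFDerivAt (fun x : Fin d → ℝ => (t, x)) (ContinuousLinearMap.inr ℝ ℝ (Fin d → ℝ)) x :=
  (hasFDerivAt_const t x).prodMk (hasFDerivAt_id x)

theorem abs_jetOf_dt_sub_le {M : ℝ} (hM : 0 ≤ M) (h2 : ∀ p, HasFDerivAt F1 (F2 p) p)
    (b2 : ∀ p h k, |F2 p h k| ≤ M * ‖h‖ * ‖k‖) (p q : ℝ × (Fin d → ℝ)) :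
    |F1 p (1, 0) - F1 q (1, 0)| ≤ M * ‖p - q‖ := by
  refine convex_univ.norm_image_sub_le_of_norm_hasFDerivWithin_le
    (f := fun p => F1 p (1, 0)) (f' := fun p => (F2 p).flip (1, 0))
    (fun z _ => ?_) (fun z _ => ?_) (Set.mem_univ q) (Set.mem_univ p)
  · exact ((ContinuousLinearMap.apply ℝ ℝ ((1 : ℝ), (0 : Fin d → ℝ))).hasFDerivAt.comp z
      (h2 z)).hasFDerivWithinAt
  · refine ContinuousLinearMap.opNorm_le_bound _ hM fun h => ?_
    have := b2 z h (1, 0)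
    simpa [Prod.norm_def] using this

theorem bh_jetOf_dt {α M : ℝ} (hα : 0 ≤ α) (hα1 : α ≤ 1) (hM : 0 ≤ M)
    (h2 : ∀ p, HasFDerivAt F1 (F2 p) p) (b1 : ∀ p h, |F1 p h| ≤ M * ‖h‖)
    (b2 : ∀ p h k, |F2 p h k| ≤ M * ‖h‖ * ‖k‖) : BH α (2 * M) (jetOf F F1 F2).dt := by
  refine BH.of_lip hα hα1 (fun t x => ?_) fun t x y => ?_
  · simpa [jetOf, Prod.norm_def] using b1 (t, x) (1, 0)
  · simpa [jetOf, Prod.norm_def] using abs_jetOf_dt_sub_le hM h2 b2 (t, x) (t, y)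

theorem reg_jetOf {α M : ℝ} (hα : 0 ≤ α) (hα1 : α ≤ 1) (h1 : ∀ p, HasFDerivAt F (F1 p) p)
    (h2 : ∀ p, HasFDerivAt F1 (F2 p) p) (b0 : ∀ p, |F p| ≤ M) (b1 : ∀ p h, |F1 p h| ≤ M * ‖h‖)
    (b2 : ∀ p h k, |F2 p h k| ≤ M * ‖h‖ * ‖k‖)
    (b3 : ∀ p q h k, |F2 p h k - F2 q h k| ≤ M * ‖p - q‖ * ‖h‖ * ‖k‖) :
    ∃ N, Reg α N (jetOf F F1 F2) := by
  have hM : 0 ≤ M := (abs_nonneg _).trans (b0 0)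
  have he : ∀ i : Fin d, ‖((0 : ℝ), (eb i : Fin d → ℝ))‖ = 1 := fun i => by
    simp [Prod.norm_def, norm_eb]
  refine ⟨_, Reg.of_entries (A := 2 * M) (by positivity) (fun t x => ?_) (fun t x => ?_)
    (fun t x => ?_) (fun t x => ?_) (fun t x i => ?_) (fun i j => ?_) (fun t x => ?_) ?_⟩
  · exact (h1 (t, x)).comp x (hasFDerivAt_mk_right t x)
  · have h : HasFDerivAt (fun x => F1 (t, x)) ((F2 (t, x)).comp
        (ContinuousLinearMap.inr ℝ ℝ (Fin d → ℝ))) x := (h2 (t, x)).comp x (hasFDerivAt_mk_right t x)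
    exact ((ContinuousLinearMap.compL ℝ (Fin d → ℝ) (ℝ × (Fin d → ℝ)) ℝ).flip
      (ContinuousLinearMap.inr ℝ ℝ (Fin d → ℝ))).hasFDerivAt.comp x h
  · have h : HasDerivAt (fun s : ℝ => (s, x)) ((1 : ℝ), (0 : Fin d → ℝ)) t :=
      (hasDerivAt_id t).prodMk (hasDerivAt_const t x)
    exact (h1 (t, x)).comp_hasDerivAt t h
  · exact (b0 _).trans (by linarith)
  · have := b1 (t, x) (0, eb i)
    rw [he] at this
    simp only [jetOf, ContinuousLinearMap.comp_apply, ContinuousLinearMap.inr_apply]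
    linarith
  · refine BH.of_lip hα hα1 (fun t x => ?_) fun t x y => ?_
    · have := b2 (t, x) (0, eb i) (0, eb j)
      rw [he, he] at this
      simpa [jetOf] using this
    · have := b3 (t, x) (t, y) (0, eb i) (0, eb j)
      rw [he, he] at this
      simpa [jetOf, Prod.norm_def] using this
  · have := b1 (t, x) (1, 0)
    simp [Prod.norm_def] at this
    simp only [jetOf]
    linarith
  · have hl := abs_jetOf_dt_sub_le hM h2 b2
    intro ε hε
    refine ⟨ε / (M + 1), by positivity, fun t s x y hts hxy => ?_⟩
    have h3 : ‖(t, x) - (s, y)‖ ≤ ε / (M + 1) := by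
      rw [Prod.norm_def]; exact max_le hts.le hxy.le
    have h4 := hl (t, x) (s, y)
    have h5 : M * (ε / (M + 1)) ≤ ε := by
      rw [mul_div_assoc', div_le_iff₀ (by positivity)]; nlinarith
    exact h4.trans ((mul_le_mul_of_nonneg_left h3 hM).trans h5)

variable {φ : ℝ × (Fin d → ℝ) → ℝ}

/-- The jet of a smooth function. -/
def smoothJet (φ : ℝ × (Fin d → ℝ) → ℝ) : Jet (Fin d → ℝ) :=
  jetOf φ (fderiv ℝ φ) (fderiv ℝ (fderiv ℝ φ))

theorem reg_smoothJet {α : ℝ} (hα : 0 ≤ α) (hα1 : α ≤ 1) (hφ : ContDiff ℝ 3 φ)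
    (hs : HasCompactSupport φ) : ∃ N, Reg α N (smoothJet φ) ∧ BH α N (smoothJet φ).dt := by
  obtain ⟨M, b0, b1, b2, b3⟩ := smooth_bounds hφ hs
  have hM : 0 ≤ M := (abs_nonneg _).trans (b0 0)
  obtain ⟨N, hN⟩ := reg_jetOf hα hα1 (fun p => hasFDerivAt_fderiv_of_three hφ p)
    (fun p => hasFDerivAt_fderiv_fderiv hφ p) b0 b1 b2 b3
  have hN0 := hN.nonneg
  exact ⟨N + 2 * M, hN.mono (by linarith),
    (bh_jetOf_dt hα hα1 hM (fun p => hasFDerivAt_fderiv_fderiv hφ p) b1 b2).mono (by linarith)⟩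

end SmoothJets

section Cutoff

variable {d : ℕ} {φ : ℝ × (Fin d → ℝ) → ℝ}

theorem smoothJet_of_eventuallyEq {c : ℝ} {t : ℝ} {x : Fin d → ℝ}
    (h : φ =ᶠ[𝓝 (t, x)] fun _ => c) :
    (smoothJet φ).v t x = c ∧ (smoothJet φ).d1 t x = 0 ∧ (smoothJet φ).d2 t x = 0 ∧
      (smoothJet φ).dt t x = 0 := by
  have h1 : fderiv ℝ φ =ᶠ[𝓝 (t, x)] fun _ => 0 := by
    have := h.fderiv (𝕜 := ℝ)
    rwa [fderiv_fun_const] at this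
  have h2 : fderiv ℝ (fderiv ℝ φ) (t, x) = 0 := by
    rw [h1.fderiv_eq, fderiv_fun_const]; rfl
  refine ⟨h.eq_of_nhds, ?_, ?_, ?_⟩
  · simp only [smoothJet, jetOf]; rw [h1.eq_of_nhds]; rfl
  · simp only [smoothJet, jetOf]; rw [h2]; ext u v; simp
  · simp only [smoothJet, jetOf]; rw [h1.eq_of_nhds]; rfl

theorem exists_cutoff {α : ℝ} (hα : 0 ≤ α) (hα1 : α ≤ 1) {r : ℝ} (hr : 0 < r) :
    ∃ N, ∃ z : Jet (Fin d → ℝ), Reg α N z ∧ BH α N z.dt ∧ (∀ t x, 0 ≤ z.v t x ∧ z.v t x ≤ 1) ∧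
      (∀ t x, ‖(t, x)‖ < r / 2 → z.v t x = 1 ∧ z.d1 t x = 0 ∧ z.d2 t x = 0 ∧ z.dt t x = 0) ∧
      ∀ t x, r ≤ ‖(t, x)‖ → z.v t x = 0 ∧ z.d1 t x = 0 ∧ z.d2 t x = 0 ∧ z.dt t x = 0 := by
  let b : ContDiffBump (0 : ℝ × (Fin d → ℝ)) := ⟨r / 2, r * (3 / 4), by positivity, by linarith⟩
  obtain ⟨N, hN, hN'⟩ := reg_smoothJet (φ := b) hα hα1 b.contDiff b.hasCompactSupport
  refine ⟨N, smoothJet b, hN, hN', fun t x => ⟨b.nonneg, b.le_one⟩, fun t x h => ?_, fun t x h => ?_⟩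
  · refine smoothJet_of_eventuallyEq ?_
    filter_upwards [Metric.isOpen_ball.mem_nhds (show (t, x) ∈ Metric.ball 0 (r / 2) by simpa using h)]
      with q hq using b.one_of_mem_closedBall (Metric.ball_subset_closedBall hq)
  · refine smoothJet_of_eventuallyEq ?_
    have h1 : (t, x) ∈ (Metric.closedBall (0 : ℝ × (Fin d → ℝ)) (r * (3 / 4)))ᶜ := by
      rw [Set.mem_compl_iff, mem_closedBall_zero_iff]; linarith
    filter_upwards [Metric.isClosed_closedBall.isOpen_compl.mem_nhds h1] with q hq
    rw [Set.mem_compl_iff, mem_closedBall_zero_iff, not_le] at hq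
    exact b.zero_of_le_dist (by rw [dist_zero_right]; exact hq.le)

end Cutoff

section Mollify

variable {d : ℕ}

theorem Src.exists_approx_aux (μ : Measure (ℝ × (Fin d → ℝ))) [μ.IsAddHaarMeasure] {α G : ℝ} {g : ℝ → (Fin d → ℝ) → ℝ} (hα : 0 ≤ α) (hα1 : α ≤ 1)
    (hg : Src α G g) {ε : ℝ} (hε : 0 < ε) : ∃ N, ∃ j : Jet (Fin d → ℝ), Reg α N j ∧
      Src α G j.v ∧ ∀ t x, |j.v t x - g t x| ≤ ε := by
  obtain ⟨δ, hδ, H⟩ := hg.uc ε hε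
  let b : ContDiffBump (0 : ℝ × (Fin d → ℝ)) := ⟨δ / 2, δ, by positivity, by linarith⟩
  set ψ : ℝ × (Fin d → ℝ) → ℝ := b.normed μ with hψ
  have hc : ContDiff ℝ 3 ψ := b.contDiff_normed
  have hs : HasCompactSupport ψ := b.hasCompactSupport_normed
  have c1 : ContDiff ℝ 2 (fderiv ℝ ψ) := hc.fderiv_right (by norm_num)
  have c2 : ContDiff ℝ 1 (fderiv ℝ (fderiv ℝ ψ)) := c1.fderiv_right (by norm_num)
  have s1 := hs.fderiv (𝕜 := ℝ)
  have s2 := s1.fderiv (𝕜 := ℝ)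
  have hgc : Continuous fun q : ℝ × (Fin d → ℝ) => g q.1 q.2 := hg.uc.continuous
  have hint : ∀ {k : ℝ × (Fin d → ℝ) → ℝ}, Continuous k → Integrable (fun q => ψ q * k q) μ :=
    fun hk => (hc.continuous.mul hk).integrable_of_hasCompactSupport hs.mul_right
  have h0 : ∀ q, 0 ≤ ψ q := fun q => b.nonneg_normed q
  have hone : ∫ q, ψ q ∂μ = 1 := b.integral_normed
  have hflip : ∀ p : ℝ × (Fin d → ℝ), (∫ q, g q.1 q.2 • ψ (p - q) ∂μ) =
      ∫ q, ψ q * g (p - q).1 (p - q).2 ∂μ := by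
    intro p
    rw [← integral_sub_left_eq_self (fun q => ψ q * g (p - q).1 (p - q).2) μ p]
    simp only [sub_sub_cancel, smul_eq_mul, mul_comm]
  have hbd : ∀ {k : ℝ × (Fin d → ℝ) → ℝ} {C : ℝ}, Continuous k → (∀ q, ψ q ≠ 0 → |k q| ≤ C) →
      |∫ q, ψ q * k q ∂μ| ≤ C := by
    intro k C hk hC
    have h1 := norm_integral_le_of_norm_le (f := fun q => ψ q * k q) (g := fun q => ψ q * C)
      (hint continuous_const) (Eventually.of_forall fun q => by
        rw [norm_mul, Real.norm_eq_abs, Real.norm_eq_abs, abs_of_nonneg (h0 q)]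
        by_cases hq : ψ q = 0
        · simp [hq]
        · exact mul_le_mul_of_nonneg_left (hC q hq) (h0 q))
    rwa [integral_mul_const, hone, one_mul] at h1
  have hcomp : ∀ p : ℝ × (Fin d → ℝ), Continuous fun q : ℝ × (Fin d → ℝ) =>
      g (p - q).1 (p - q).2 := fun p => hgc.comp (continuous_const.sub continuous_id)
  have hsrc : Src α G fun t x => ∫ q : ℝ × (Fin d → ℝ), g q.1 q.2 • ψ ((t, x) - q) ∂μ := by
    refine ⟨fun t x => ?_, fun t x y => ?_, fun e he => ?_⟩
    · rw [hflip]
      exact hbd (hcomp _) fun q _ => hg.b _ _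
    · rw [hflip, hflip, ← integral_sub (hint (hcomp _)) (hint (hcomp _))]
      simp only [← mul_sub]
      refine hbd ((hcomp _).sub (hcomp _)) fun q _ => (hg.hol _ _ _).trans (le_of_eq ?_)
      simp
    · obtain ⟨δ', hδ', H'⟩ := hg.uc e he
      refine ⟨δ', hδ', fun t s x y h1 h2 => ?_⟩
      rw [hflip, hflip, ← integral_sub (hint (hcomp _)) (hint (hcomp _))]
      simp only [← mul_sub]
      refine hbd ((hcomp _).sub (hcomp _)) fun q _ => H' _ _ _ _ ?_ ?_
      · simpa using h1
      · simpa using h2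
  have hgb : ∀ q : ℝ × (Fin d → ℝ), |g q.1 q.2| ≤ G := fun q => hg.b _ _
  obtain ⟨M0, k0, bM0, -⟩ := exists_conv_bound_and_lip μ hgc hgb (hc.of_le (by norm_num)) hs
  obtain ⟨M1, k1, bM1, -⟩ := exists_conv_bound_and_lip μ hgc hgb (c1.of_le (by norm_num)) s1
  obtain ⟨M2, k2, bM2, bM3⟩ := exists_conv_bound_and_lip μ hgc hgb c2 s2
  obtain ⟨N, hN⟩ := reg_jetOf (M := M0 + M1 + M2) hα hα1
    (fun p => conv_hasFDerivAt μ hgc (hc.of_le (by norm_num)) hs p)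
    (fun p => conv_hasFDerivAt μ hgc (c1.of_le (by norm_num)) s1 p)
    (fun p => (bM0 p).trans (by linarith))
    (fun p h => (ContinuousLinearMap.le_of_opNorm_le _ (bM1 p) h).trans
      (mul_le_mul_of_nonneg_right (by linarith) (norm_nonneg _)))
    (fun p h k => (bl_apply_le (bM2 p) h k).trans (mul_le_mul_of_nonneg_right
      (mul_le_mul_of_nonneg_right (by linarith) (norm_nonneg _)) (norm_nonneg _)))
    (fun p q h k => by
      have h1 := bl_apply_le (bM3 p q) h k
      rw [bl_sub_apply] at h1
      exact h1.trans (mul_le_mul_of_nonneg_right (mul_le_mul_of_nonneg_right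
        (mul_le_mul_of_nonneg_right (by linarith) (norm_nonneg _)) (norm_nonneg _))
          (norm_nonneg _)))
  refine ⟨N, _, hN, hsrc, fun t x => ?_⟩
  have h1 : g t x = ∫ q, ψ q * g t x ∂μ := by rw [integral_mul_const, hone, one_mul]
  simp only [jetOf]
  rw [hflip, h1, ← integral_sub (hint (hcomp _)) (hint continuous_const)]
  simp only [← mul_sub]
  refine hbd ((hcomp _).sub continuous_const) fun q hq => ?_
  have h2 : q ∈ Metric.ball (0 : ℝ × (Fin d → ℝ)) δ := by
    have h3 : q ∈ Function.support (b.normed μ) := hq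
    rwa [b.support_normed_eq] at h3
  rw [mem_ball_zero_iff, Prod.norm_def, max_lt_iff] at h2
  exact H _ _ _ _ (by simpa using h2.1) (by simpa using h2.2)

theorem Src.exists_approx {α G : ℝ} {g : ℝ → (Fin d → ℝ) → ℝ} (hα : 0 ≤ α) (hα1 : α ≤ 1)
    (hg : Src α G g) {ε : ℝ} (hε : 0 < ε) : ∃ N, ∃ j : Jet (Fin d → ℝ), Reg α N j ∧
      Src α G j.v ∧ ∀ t x, |j.v t x - g t x| ≤ ε :=
  hg.exists_approx_aux Measure.addHaar hα hα1 hε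

end Mollify

section Freezing

variable {d : ℕ} {α : ℝ}

theorem BH.const {E : Type*} [NormedAddCommGroup E] {c A : ℝ} (h : |c| ≤ A) :
    BH α A fun (_ : ℝ) (_ : E) => c where
  b _ _ := h
  hol t x y := by
    rw [sub_self, abs_zero]
    exact mul_nonneg ((abs_nonneg c).trans h) (Real.rpow_nonneg (norm_nonneg _) _)

/-- The Hölder constant of a product with one factor small. -/
theorem abs_mul_sub_mul_le_of_small {p q p' q' δ A P Q ρ : ℝ} (hp : |p| ≤ δ) (hq' : |q'| ≤ A)
    (h1 : |p - p'| ≤ P * ρ) (h2 : |q - q'| ≤ Q * ρ) :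
    |p * q - p' * q'| ≤ (δ * Q + P * A) * ρ := by
  have hδ := (abs_nonneg p).trans hp
  have hA := (abs_nonneg q').trans hq'
  calc |p * q - p' * q'| = |p * (q - q') + (p - p') * q'| := by congr 1; ring
    _ ≤ |p| * |q - q'| + |p - p'| * |q'| := by
        rw [← abs_mul, ← abs_mul]; exact abs_add_le _ _
    _ ≤ δ * (Q * ρ) + (P * ρ) * A := by gcongr; exact (abs_nonneg _).trans h1
    _ = _ := by ring

variable {M N G δ A H lam Λ : ℝ} {a : ℝ → (Fin d → ℝ) → Fin d → Fin d → ℝ}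
  {z w : Jet (Fin d → ℝ)} {g : ℝ → (Fin d → ℝ) → ℝ}

theorem csrc_mul_eq (hw : Sol a g w) {A0 : Fin d → Fin d → ℝ}
    {σ : (Fin d → ℝ) →L[ℝ] (Fin d → ℝ)} (hσ : ∀ H, tr A0 H = lapl σ H) (t : ℝ) (x : Fin d → ℝ) :
    csrc σ (z.mul w) t x = z.dt t x * w.v t x + z.v t x * g t x +
      (-(1 / 2)) * ∑ i, ∑ j, A0 i j * (w.v t x * z.d2 t x (eb i) (eb j) +
        (z.d1 t x (eb i) * w.d1 t x (eb j) + w.d1 t x (eb i) * z.d1 t x (eb j))) +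
      1 / 2 * ∑ i, ∑ j, (a t x i j - A0 i j) * z.v t x * w.d2 t x (eb i) (eb j) := by
  have e1 : tr A0 ((z.mul w).d2 t x) = 1 / 2 * ∑ i, ∑ j, (A0 i j * (w.v t x * z.d2 t x (eb i) (eb j) +
        (z.d1 t x (eb i) * w.d1 t x (eb j) + w.d1 t x (eb i) * z.d1 t x (eb j))) +
        A0 i j * z.v t x * w.d2 t x (eb i) (eb j)) := by
    simp only [tr, Jet.mul_d2_apply]
    congr 1
    exact sum_congr rfl fun i _ => sum_congr rfl fun j _ => by ring
  have e2 : z.v t x * tr (a t x) (w.d2 t x) =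
      1 / 2 * ∑ i, ∑ j, ((a t x i j - A0 i j) * z.v t x * w.d2 t x (eb i) (eb j) +
        A0 i j * z.v t x * w.d2 t x (eb i) (eb j)) := by
    simp only [tr, mul_sum]
    exact sum_congr rfl fun i _ => sum_congr rfl fun j _ => by ring
  rw [csrc, ← hσ, e1]
  simp only [Jet.mul, hw t x]
  simp only [sum_add_distrib] at e2 ⊢
  linear_combination e2

theorem csrc_mul_holder (hα : 0 < α) (hα1 : α < 1) (hz : Reg α M z) (hzt : BH α M z.dt)
    (hz1 : ∀ t x, |z.v t x| ≤ 1) (hw : Reg α N w) (hs : Sol a g w) (ha : Coef lam Λ α a)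
    {A0 : Fin d → Fin d → ℝ} {σ : (Fin d → ℝ) →L[ℝ] (Fin d → ℝ)} (hσ : ∀ H, tr A0 H = lapl σ H)
    (hΛ : 0 ≤ Λ) (hA0 : ∀ i j, |A0 i j| ≤ Λ) (hδ0 : 0 ≤ δ)
    (hδ : ∀ t x, z.v t x ≠ 0 → ∀ i j, |a t x i j - A0 i j| ≤ δ) (hg : Src α G g)
    (bv : ∀ t x, |w.v t x| ≤ A) (b1 : ∀ t x, ‖w.d1 t x‖ ≤ A) (b2 : ∀ t x, ‖w.d2 t x‖ ≤ A)
    (hH : ∀ t x y, ‖w.d2 t x - w.d2 t y‖ ≤ H * ‖x - y‖ ^ α) (t : ℝ) (x y : Fin d → ℝ) :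
    |csrc σ (z.mul w) t x - csrc σ (z.mul w) t y| ≤
      (d ^ 2 * (δ * H) + 100 * (1 + d ^ 2 * Λ) * M * (G + A)) * ‖x - y‖ ^ α := by
  have hM := hz.nonneg
  have hG := hg.nonneg
  have hA : 0 ≤ A := (abs_nonneg _).trans (bv 0 0)
  have z0 := hz.bh_v hα.le hα1.le hz.bv hz.b1
  have z1 := hz.bh_d1 hα.le hα1.le hz.b1 hz.b2
  have w0 := hw.bh_v hα.le hα1.le bv b1
  have w1 := hw.bh_d1 hα.le hα1.le b1 b2
  have q1 : BH α (72 * Λ * M * A * d ^ 2) fun t x =>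
      ∑ i, ∑ j, A0 i j * (w.v t x * z.d2 t x (eb i) (eb j) +
        (z.d1 t x (eb i) * w.d1 t x (eb j) + w.d1 t x (eb i) * z.d1 t x (eb j))) := by
    refine (BH.sum fun i => BH.sum (A := 72 * Λ * M * A) fun j => BH.mono
      ((((w0.mul (hz.bh_d2 i j)).add (((z1 i).mul (w1 j)).add ((w1 i).mul (z1 j)))).const_mul
        (A0 i j))) ?_).mono ?_
    · have := mul_le_mul_of_nonneg_right (hA0 i j) (by positivity : 0 ≤ 72 * M * A)
      linarith
    · simp; nlinarith
  have q := ((hzt.mul w0).add (z0.mul hg.bh)).add (q1.const_mul (-(1 / 2)))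
  have p : |(1 / 2 * ∑ i, ∑ j, (a t x i j - A0 i j) * z.v t x * w.d2 t x (eb i) (eb j)) -
      1 / 2 * ∑ i, ∑ j, (a t y i j - A0 i j) * z.v t y * w.d2 t y (eb i) (eb j)| ≤
      d ^ 2 * ((δ * H + (16 * Λ * M) * A) * ‖x - y‖ ^ α) := by
    have h3 : ∀ i j, |(a t x i j - A0 i j) * z.v t x * w.d2 t x (eb i) (eb j) -
        (a t y i j - A0 i j) * z.v t y * w.d2 t y (eb i) (eb j)| ≤
        (δ * H + (16 * Λ * M) * A) * ‖x - y‖ ^ α := by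
      intro i j
      have c : BH α (16 * Λ * M) fun t x => (a t x i j - A0 i j) * z.v t x := by
        have c1 : BH α Λ fun t x => a t x i j := ⟨fun t x => ha.bdd t x i j, fun t x y => ha.hol t x y i j⟩
        exact ((c1.sub (BH.const (hA0 i j))).mul z0).mono (by nlinarith)
      refine abs_mul_sub_mul_le_of_small ?_ ((abs_apply_eb_le _ i j).trans (b2 t y)) (c.hol t x y) ?_
      · by_cases h : z.v t x = 0
        · simpa [h] using hδ0
        · rw [abs_mul]
          exact (mul_le_mul (hδ t x h i j) (hz1 t x) (abs_nonneg _) hδ0).trans_eq (mul_one _)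
      · have e : w.d2 t x (eb i) (eb j) - w.d2 t y (eb i) (eb j) =
          (w.d2 t x - w.d2 t y) (eb i) (eb j) := by simp
        rw [e]
        exact (abs_apply_eb_le _ i j).trans (hH t x y)
    have h0 : 0 ≤ |∑ i, ∑ j, ((a t x i j - A0 i j) * z.v t x * w.d2 t x (eb i) (eb j) -
        (a t y i j - A0 i j) * z.v t y * w.d2 t y (eb i) (eb j))| := abs_nonneg _
    have h4 : |∑ i, ∑ j, ((a t x i j - A0 i j) * z.v t x * w.d2 t x (eb i) (eb j) -
        (a t y i j - A0 i j) * z.v t y * w.d2 t y (eb i) (eb j))| ≤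
        d ^ 2 * ((δ * H + (16 * Λ * M) * A) * ‖x - y‖ ^ α) :=
      ((abs_sum_le_sum_abs _ _).trans (sum_le_sum fun i _ => (abs_sum_le_sum_abs _ _).trans
        (sum_le_sum fun j _ => h3 i j))).trans_eq (by simp; ring)
    rw [← mul_sub, ← sum_sub_distrib]
    simp only [← sum_sub_distrib]
    rw [abs_mul, abs_of_pos (by norm_num : (0 : ℝ) < 1 / 2)]
    linarith
  rw [csrc_mul_eq hs hσ, csrc_mul_eq hs hσ, add_sub_add_comm]
  refine (abs_add_le _ _).trans ((add_le_add (q.hol t x y) p).trans ?_)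
  rw [abs_neg, abs_of_pos (by norm_num : (0 : ℝ) < 1 / 2), ← mul_assoc ((d : ℝ) ^ 2), ← add_mul]
  refine mul_le_mul_of_nonneg_right ?_ (Real.rpow_nonneg (norm_nonneg _) _)
  have k1 : 0 ≤ d ^ 2 * Λ * M * A := by positivity
  have k2 : 0 ≤ d ^ 2 * Λ * M * G := by positivity
  have k3 : 0 ≤ M * G := by positivity
  have k4 : 0 ≤ M * A := by positivity
  nlinarith

theorem holder_step (hα : 0 < α) (hα1 : α < 1) {S K CA r : ℝ} (hCA0 : 0 ≤ CA) (hr : 0 < r)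
    (hCA : ∀ σ : (Fin d → ℝ) →L[ℝ] (Fin d → ℝ), ‖σ‖ ≤ S → (∀ h, ∃ k, σ k = h ∧ ‖k‖ ≤ K * ‖h‖) →
      ∀ (w : Jet (Fin d → ℝ)) (N G : ℝ), Reg α N w → 0 ≤ G →
      (∀ t x y, |csrc σ w t x - csrc σ w t y| ≤ G * ‖x - y‖ ^ α) →
      ∀ t x y, ‖w.d2 t x - w.d2 t y‖ ≤ CA * G * ‖x - y‖ ^ α)
    (hSK : ∀ A : Fin d → Fin d → ℝ, (∀ i j, A i j = A j i) →
      (∀ y : Fin d → ℝ, lam * ‖y‖ ^ 2 ≤ ∑ i, ∑ j, A i j * y i * y j) → (∀ i j, |A i j| ≤ Λ) →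
      ∃ σ : (Fin d → ℝ) →L[ℝ] (Fin d → ℝ), (∀ H, tr A H = lapl σ H) ∧ ‖σ‖ ≤ S ∧
        ∀ h, ∃ k, σ k = h ∧ ‖k‖ ≤ K * ‖h‖)
    (hz : Reg α M z) (hzt : BH α M z.dt) (hz01 : ∀ t x, 0 ≤ z.v t x ∧ z.v t x ≤ 1)
    (hin : ∀ t x, ‖(t, x)‖ < r / 2 → z.v t x = 1 ∧ z.d1 t x = 0 ∧ z.d2 t x = 0 ∧ z.dt t x = 0)
    (hout : ∀ t x, r ≤ ‖(t, x)‖ → z.v t x = 0)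
    (hw : Reg α N w) (hs : Sol a g w) (ha : Coef lam Λ α a)
    (hΛ : 0 ≤ Λ) (hδ0 : 0 ≤ δ)
    (hδ : ∀ t s x y, |t - s| < r → ‖x - y‖ < r → ∀ i j, |a t x i j - a s y i j| ≤ δ)
    (hg : Src α G g)
    (bv : ∀ t x, |w.v t x| ≤ A) (b1 : ∀ t x, ‖w.d1 t x‖ ≤ A) (b2 : ∀ t x, ‖w.d2 t x‖ ≤ A)
    (hH0 : 0 ≤ H) (hH : ∀ t x y, ‖w.d2 t x - w.d2 t y‖ ≤ H * ‖x - y‖ ^ α)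
    (t : ℝ) (x y : Fin d → ℝ) :
    ‖w.d2 t x - w.d2 t y‖ ≤ (CA * (d ^ 2 * (δ * H) + 100 * (1 + d ^ 2 * Λ) * M * (G + A)) +
      2 * (2 / r) ^ α * A) * ‖x - y‖ ^ α := by
  have hM := hz.nonneg
  have hG := hg.nonneg
  have hA : 0 ≤ A := (abs_nonneg _).trans (bv 0 0)
  have hρ := Real.rpow_nonneg (norm_nonneg (x - y)) α
  rcases lt_or_ge ‖x - y‖ (r / 2) with h | h
  · obtain ⟨σ, h1, h2, h3⟩ := hSK (a t y) (ha.symm t y) (ha.ell t y) (ha.bdd t y)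
    have hz' := hz.shift t y
    have hzt' : BH α M (z.shift t y).dt :=
      ⟨fun s x => hzt.b _ _, fun s x x' => by simpa [Jet.shift] using hzt.hol (s - t) (x - y) (x' - y)⟩
    obtain ⟨N', hN'⟩ := hz'.mul hw hα hα1.le
    have h4 := hCA σ h2 h3 _ N' (d ^ 2 * (δ * H) + 100 * (1 + d ^ 2 * Λ) * M * (G + A)) hN'
      (by positivity) (fun t' x y' => csrc_mul_holder hα hα1 hz' hzt' (fun s x' => by
        simp only [Jet.shift]
        rw [abs_of_nonneg (hz01 _ _).1]; exact (hz01 _ _).2) hw hs ha h1 hΛ (ha.bdd t y) hδ0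
        (fun s x' hne i j => by
          have h5 : ‖(s - t, x' - y)‖ < r := by
            by_contra! h6
            exact hne (hout _ _ h6)
          rw [Prod.norm_def, max_lt_iff] at h5
          exact hδ s t x' y h5.1 h5.2 i j) hg bv b1 b2 hH t' x y') t x y
    have e : ∀ x', ‖x' - y‖ < r / 2 → ((z.shift t y).mul w).d2 t x' = w.d2 t x' := by
      intro x' hx'
      obtain ⟨e1, e2, e3, -⟩ := hin (t - t) (x' - y) (by
        rw [Prod.norm_def, sub_self, norm_zero]; exact max_lt (by positivity) hx')
      simp only [Jet.mul, Jet.shift, e1, e2, e3]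
      ext u v
      simp
    rw [e x h, e y (by simpa using hr)] at h4
    refine h4.trans (mul_le_mul_of_nonneg_right (le_add_of_nonneg_right ?_) hρ)
    positivity
  · have h5 : 1 ≤ (2 / r) ^ α * ‖x - y‖ ^ α := by
      rw [← Real.mul_rpow (by positivity) (norm_nonneg _)]
      refine Real.one_le_rpow ?_ hα.le
      rw [div_mul_eq_mul_div, le_div_iff₀ hr]
      linarith
    have h6 : ‖w.d2 t x - w.d2 t y‖ ≤ A + A :=
      (bl_norm_sub_le _ _).trans (add_le_add (b2 t x) (b2 t y))
    have h7 : 0 ≤ CA * (d ^ 2 * (δ * H) + 100 * (1 + d ^ 2 * Λ) * M * (G + A)) := by positivity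
    have h8 := mul_nonneg h7 hρ
    have h9 := mul_le_mul_of_nonneg_left h5 hA
    linarith

theorem Reg.sup_bounds (hw : Reg α N w) (hα : 0 ≤ α) (hH0 : 0 ≤ H)
    (hH : ∀ t x y, ‖w.d2 t x - w.d2 t y‖ ≤ H * ‖x - y‖ ^ α) (bv : ∀ t x, |w.v t x| ≤ G) {s : ℝ}
    (hs : 0 < s) (t : ℝ) (x : Fin d → ℝ) : ‖w.d2 t x‖ ≤ H * (2 * s) ^ α + 4 * G / s ^ 2 ∧
      ‖w.d1 t x‖ ≤ H * (2 * s) ^ α + 4 * G / s ^ 2 + 2 * G := by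
  have h2 : ∀ x, ‖w.d2 t x‖ ≤ H * (2 * s) ^ α + 4 * G / s ^ 2 := fun x =>
    interpolate_second hα hH0 hs (hw.h1 t) (hw.h2 t) (hH t) (bv t) x
  refine ⟨h2 x, ?_⟩
  simpa using interpolate_first one_pos (hw.h1 t) (hw.h2 t) h2 (bv t) x

/-- The global a priori estimate for coefficients of small oscillation at a fixed scale. -/
theorem apriori (hα : 0 < α) (hα1 : α < 1) (hl : 0 < lam) (hΛ : 0 ≤ Λ) : ∃ δ > 0, ∀ r > 0,
    ∃ C, 0 ≤ C ∧ ∀ a : ℝ → (Fin d → ℝ) → Fin d → Fin d → ℝ, Coef lam Λ α a →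
    (∀ t s x y, |t - s| < r → ‖x - y‖ < r → ∀ i j, |a t x i j - a s y i j| ≤ δ) →
    ∀ w N g G, Reg α N w → Src α G g → Sol a g w → Reg α (C * G) w := by
  obtain ⟨S, K, hSK⟩ := exists_sqrt_bounds d lam Λ hl
  obtain ⟨CA, hCA0, hCA⟩ := schauder_const (d := d) hα hα1 S K
  set δ : ℝ := 1 / (4 * (CA * d ^ 2 + 1)) with hδ
  have hδ0 : 0 < δ := by positivity
  refine ⟨δ, hδ0, fun r hr => ?_⟩
  obtain ⟨M, z, hz, hzt, hz01, hin, hout⟩ := exists_cutoff (d := d) hα.le hα1.le hr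
  have hM := hz.nonneg
  set K1 : ℝ := 100 * (1 + d ^ 2 * Λ) * M with hK1
  have hK10 : 0 ≤ K1 := by positivity
  set P : ℝ := 2 * (2 / r) ^ α with hP
  have hP0 : 0 ≤ P := by positivity
  set β : ℝ := 1 / (4 * (CA * K1 + P + 1)) with hβ
  have hβ0 : 0 < β := by positivity
  set s : ℝ := β ^ (1 / α) / 2 with hs
  have hs0 : 0 < s := by positivity
  have hsβ : (2 * s) ^ α = β := by
    rw [hs, mul_div_cancel₀ _ two_ne_zero, ← Real.rpow_mul hβ0.le, one_div_mul_cancel hα.ne',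
      Real.rpow_one]
  set Q : ℝ := 4 / s ^ 2 with hQ
  have hQ0 : 0 ≤ Q := by positivity
  set C1 : ℝ := CA * K1 * (3 + Q) + P * (2 + Q) with hC1
  have hC10 : 0 ≤ C1 := by positivity
  have i1 : CA * d ^ 2 * δ ≤ 1 / 4 := by
    rw [hδ, mul_one_div, div_le_iff₀ (by positivity)]; linarith
  have i2 : (CA * K1 + P) * β ≤ 1 / 4 := by
    rw [hβ, mul_one_div, div_le_iff₀ (by positivity)]; linarith
  refine ⟨2 * C1 + (1 + d ^ 2 * Λ) * (β * (2 * C1) + Q + 2) + 2, by positivity,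
    fun a ha hosc w N g G hw hg hsol => ?_⟩
  have hG := hg.nonneg
  have bv := hsol.abs_le hw ha hl.le hg.b
  have hsup : ∀ H, 0 ≤ H → (∀ t x y, ‖w.d2 t x - w.d2 t y‖ ≤ H * ‖x - y‖ ^ α) →
      (∀ t x, ‖w.d1 t x‖ ≤ β * H + (Q + 2) * G) ∧ ∀ t x, ‖w.d2 t x‖ ≤ β * H + (Q + 2) * G := by
    intro H hH0 hH
    have e : 4 * G / s ^ 2 = Q * G := by rw [hQ]; ring
    have := hw.sup_bounds hα.le hH0 hH bv hs0
    rw [hsβ, e] at this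
    exact ⟨fun t x => (this t x).2.trans (by linarith), fun t x => (this t x).1.trans (by linarith)⟩
  have hhol := absorb_bound (X := ℝ × (Fin d → ℝ) × (Fin d → ℝ))
    (F := fun q => ‖w.d2 q.1 q.2.1 - w.d2 q.1 q.2.2‖) (w := fun q => ‖q.2.1 - q.2.2‖ ^ α)
    (C := C1 * G) (fun q => Real.rpow_nonneg (norm_nonneg _) _) (by positivity)
    ⟨N, hw.nonneg, fun q => hw.hol _ _ _⟩ (by
      rintro H hH0 hH ⟨t, x, y⟩
      have hH' : ∀ t x y, ‖w.d2 t x - w.d2 t y‖ ≤ H * ‖x - y‖ ^ α := fun t x y => hH (t, x, y)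
      obtain ⟨b1, b2⟩ := hsup H hH0 hH'
      have h := holder_step hα hα1 hCA0 hr hCA hSK hz hzt hz01 hin (fun t x h => (hout t x h).1)
        hw hsol ha hΛ hδ0.le hosc hg (fun t x => (bv t x).trans (by nlinarith)) b1 b2 hH0 hH' t x y
      refine h.trans (mul_le_mul_of_nonneg_right ?_ (Real.rpow_nonneg (norm_nonneg _) _))
      rw [← hK1, ← hP]
      have j1 := mul_le_mul_of_nonneg_right i1 hH0
      have j2 := mul_le_mul_of_nonneg_right i2 hH0
      rw [hC1]
      linarith)
  have hhol' : ∀ t x y, ‖w.d2 t x - w.d2 t y‖ ≤ (2 * (C1 * G)) * ‖x - y‖ ^ α :=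
    fun t x y => hhol (t, x, y)
  obtain ⟨b1, b2⟩ := hsup _ (by positivity) hhol'
  have k1 : 0 ≤ C1 * G := by positivity
  have k2 : 0 ≤ (β * (2 * C1) + Q + 2) * G := by positivity
  have k3 : 0 ≤ d ^ 2 * Λ * ((β * (2 * C1) + Q + 2) * G) := by positivity
  refine ⟨hw.h1, hw.h2, hw.ht, fun t x => (bv t x).trans ?_, fun t x => (b1 t x).trans ?_,
    fun t x => (b2 t x).trans ?_, fun t x => ?_, fun t x y => (hhol' t x y).trans
      (mul_le_mul_of_nonneg_right ?_ (Real.rpow_nonneg (norm_nonneg _) _)), hw.uct⟩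
  · linarith
  · linarith
  · linarith
  · rw [hsol t x]
    have h1 := (abs_tr_le (ha.bdd t x) (w.d2 t x)).trans
      (mul_le_mul_of_nonneg_left (b2 t x) (by positivity))
    have h2 := abs_add_le (tr (a t x) (w.d2 t x) - w.v t x) (g t x)
    have h3 := abs_sub (tr (a t x) (w.d2 t x)) (w.v t x)
    linarith [bv t x, hg.b t x]
  · linarith

end Freezing

section Limits

theorem UC.of_approx {E F : Type*} [NormedAddCommGroup E] [NormedAddCommGroup F]
    {g : ℝ → E → F} (h : ∀ ε > 0, ∃ k : ℝ → E → F, UC k ∧ ∀ t x, ‖k t x - g t x‖ ≤ ε) : UC g := by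
  intro ε hε
  obtain ⟨k, hk, hkg⟩ := h (ε / 3) (by positivity)
  obtain ⟨δ, hδ, H⟩ := hk (ε / 3) (by positivity)
  refine ⟨δ, hδ, fun t s x y h1 h2 => ?_⟩
  have e : g t x - g s y = -(k t x - g t x) + (k t x - k s y) + (k s y - g s y) := by abel
  rw [e]
  refine (norm_add₃_le).trans ?_
  rw [norm_neg]
  linarith [hkg t x, hkg s y, H t s x y h1 h2]

variable {E : Type*} [NormedAddCommGroup E] [NormedSpace ℝ E]

/-- Uniform Cauchy property of all components of a sequence of jets on a product set. -/
def JetCauchyOn (I : Set ℝ) (B : Set E) (u : ℕ → Jet E) : Prop :=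
  ∀ ε > 0, ∃ K, ∀ k ≥ K, ∀ l ≥ K, ∀ t ∈ I, ∀ x ∈ B,
    |(u k).v t x - (u l).v t x| ≤ ε ∧ ‖(u k).d1 t x - (u l).d1 t x‖ ≤ ε ∧
    ‖(u k).d2 t x - (u l).d2 t x‖ ≤ ε ∧ |(u k).dt t x - (u l).dt t x| ≤ ε

/-- Pointwise convergence of all components of a sequence of jets. -/
structure JetTendsto (u : ℕ → Jet E) (f : Jet E) (t : ℝ) (x : E) : Prop where
  v : Tendsto (fun k => (u k).v t x) atTop (𝓝 (f.v t x))
  d1 : Tendsto (fun k => (u k).d1 t x) atTop (𝓝 (f.d1 t x))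
  d2 : Tendsto (fun k => (u k).d2 t x) atTop (𝓝 (f.d2 t x))
  dt : Tendsto (fun k => (u k).dt t x) atTop (𝓝 (f.dt t x))

theorem exists_lim_of_cauchy {V : Type*} [NormedAddCommGroup V] [CompleteSpace V] {u : ℕ → V}
    (h : ∀ ε > 0, ∃ K, ∀ k ≥ K, ∀ l ≥ K, ‖u k - u l‖ ≤ ε) : ∃ y, Tendsto u atTop (𝓝 y) := by
  refine cauchySeq_tendsto_of_complete (Metric.cauchySeq_iff.2 fun ε hε => ?_)
  obtain ⟨K, hK⟩ := h (ε / 2) (by positivity)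
  exact ⟨K, fun k hk l hl => by rw [dist_eq_norm]; linarith [hK k hk l hl]⟩

theorem exists_jet_limit {u : ℕ → Jet E} {P : ℝ → E → Prop}
    (h : ∀ t x, P t x → ∃ I B, t ∈ I ∧ x ∈ B ∧ JetCauchyOn I B u) :
    ∃ f : Jet E, ∀ t x, P t x → JetTendsto u f t x := by
  have key : ∀ t x, ∃ y : ℝ × (E →L[ℝ] ℝ) × (E →L[ℝ] E →L[ℝ] ℝ) × ℝ, P t x →
      Tendsto (fun k => (u k).v t x) atTop (𝓝 y.1) ∧
      Tendsto (fun k => (u k).d1 t x) atTop (𝓝 y.2.1) ∧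
      Tendsto (fun k => (u k).d2 t x) atTop (𝓝 y.2.2.1) ∧
      Tendsto (fun k => (u k).dt t x) atTop (𝓝 y.2.2.2) := by
    intro t x
    by_cases hP : P t x
    · obtain ⟨I, B, hI, hB, hC⟩ := h t x hP
      obtain ⟨y0, h0⟩ := exists_lim_of_cauchy (u := fun k => (u k).v t x) fun ε hε => by
        obtain ⟨K, hK⟩ := hC ε hε
        exact ⟨K, fun k hk l hl => (hK k hk l hl t hI x hB).1⟩
      obtain ⟨y1, h1⟩ := exists_lim_of_cauchy (u := fun k => (u k).d1 t x) fun ε hε => by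
        obtain ⟨K, hK⟩ := hC ε hε
        exact ⟨K, fun k hk l hl => (hK k hk l hl t hI x hB).2.1⟩
      obtain ⟨y2, h2⟩ := exists_lim_of_cauchy (u := fun k => (u k).d2 t x) fun ε hε => by
        obtain ⟨K, hK⟩ := hC ε hε
        exact ⟨K, fun k hk l hl => (hK k hk l hl t hI x hB).2.2.1⟩
      obtain ⟨y3, h3⟩ := exists_lim_of_cauchy (u := fun k => (u k).dt t x) fun ε hε => by
        obtain ⟨K, hK⟩ := hC ε hε
        exact ⟨K, fun k hk l hl => (hK k hk l hl t hI x hB).2.2.2⟩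
      exact ⟨(y0, y1, y2, y3), fun _ => ⟨h0, h1, h2, h3⟩⟩
    · exact ⟨(0, 0, 0, 0), fun h => absurd h hP⟩
  choose y hy using key
  exact ⟨⟨fun t x => (y t x).1, fun t x => (y t x).2.1, fun t x => (y t x).2.2.1,
    fun t x => (y t x).2.2.2⟩, fun t x hP => ⟨(hy t x hP).1, (hy t x hP).2.1, (hy t x hP).2.2.1,
      (hy t x hP).2.2.2⟩⟩

theorem tendstoUniformlyOn_of_cauchy {V X : Type*} [NormedAddCommGroup V] {u : ℕ → X → V}
    {f : X → V} {s : Set X}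
    (h : ∀ ε > 0, ∃ K, ∀ k ≥ K, ∀ l ≥ K, ∀ x ∈ s, ‖u k x - u l x‖ ≤ ε)
    (hf : ∀ x ∈ s, Tendsto (fun k => u k x) atTop (𝓝 (f x))) :
    TendstoUniformlyOn u f atTop s := by
  rw [Metric.tendstoUniformlyOn_iff]
  intro ε hε
  obtain ⟨K, hK⟩ := h (ε / 2) (by positivity)
  filter_upwards [eventually_ge_atTop K] with k hk x hx
  rw [dist_comm, dist_eq_norm]
  have : ‖u k x - f x‖ ≤ ε / 2 :=
    le_of_tendsto ((tendsto_const_nhds.sub (hf x hx)).norm)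
      ((eventually_ge_atTop K).mono fun l hl => hK k hk l hl x hx)
  linarith

theorem norm_sub_le_of_tendsto {V : Type*} [NormedAddCommGroup V] {u w : ℕ → V} {y z : V} {C : ℝ}
    (hu : Tendsto u atTop (𝓝 y)) (hw : Tendsto w atTop (𝓝 z)) (h : ∀ k, ‖u k - w k‖ ≤ C) :
    ‖y - z‖ ≤ C :=
  le_of_tendsto (hu.sub hw).norm (Eventually.of_forall h)

namespace JetCauchyOn

variable {I : Set ℝ} {B : Set E} {u : ℕ → Jet E} {f : Jet E}

theorem uniform_v (h : JetCauchyOn I B u) (hf : ∀ t ∈ I, ∀ x ∈ B, JetTendsto u f t x) :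
    TendstoUniformlyOn (fun k p => (u k).v p.1 p.2) (fun p => f.v p.1 p.2) atTop (I ×ˢ B) :=
  tendstoUniformlyOn_of_cauchy (fun ε hε => (h ε hε).imp fun _ hK k hk l hl p hp =>
    (hK k hk l hl p.1 hp.1 p.2 hp.2).1) fun p hp => (hf p.1 hp.1 p.2 hp.2).v

theorem uniform_d1 (h : JetCauchyOn I B u) (hf : ∀ t ∈ I, ∀ x ∈ B, JetTendsto u f t x) :
    TendstoUniformlyOn (fun k p => (u k).d1 p.1 p.2) (fun p => f.d1 p.1 p.2) atTop (I ×ˢ B) :=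
  tendstoUniformlyOn_of_cauchy (fun ε hε => (h ε hε).imp fun _ hK k hk l hl p hp =>
    (hK k hk l hl p.1 hp.1 p.2 hp.2).2.1) fun p hp => (hf p.1 hp.1 p.2 hp.2).d1

theorem uniform_d2 (h : JetCauchyOn I B u) (hf : ∀ t ∈ I, ∀ x ∈ B, JetTendsto u f t x) :
    TendstoUniformlyOn (fun k p => (u k).d2 p.1 p.2) (fun p => f.d2 p.1 p.2) atTop (I ×ˢ B) :=
  tendstoUniformlyOn_of_cauchy (V := E →L[ℝ] E →L[ℝ] ℝ)
    (fun ε hε => (h ε hε).imp fun _ hK k hk l hl p hp =>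
    (hK k hk l hl p.1 hp.1 p.2 hp.2).2.2.1) fun p hp => (hf p.1 hp.1 p.2 hp.2).d2

theorem uniform_dt (h : JetCauchyOn I B u) (hf : ∀ t ∈ I, ∀ x ∈ B, JetTendsto u f t x) :
    TendstoUniformlyOn (fun k p => (u k).dt p.1 p.2) (fun p => f.dt p.1 p.2) atTop (I ×ˢ B) :=
  tendstoUniformlyOn_of_cauchy (fun ε hε => (h ε hε).imp fun _ hK k hk l hl p hp =>
    (hK k hk l hl p.1 hp.1 p.2 hp.2).2.2.2) fun p hp => (hf p.1 hp.1 p.2 hp.2).dt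

theorem h1 (h : JetCauchyOn I B u) (hf : ∀ t ∈ I, ∀ x ∈ B, JetTendsto u f t x) (hB : IsOpen B)
    (hu : ∀ k, ∀ t ∈ I, ∀ x ∈ B, HasFDerivAt ((u k).v t) ((u k).d1 t x) x) {t : ℝ} (ht : t ∈ I)
    {x : E} (hx : x ∈ B) : HasFDerivAt (f.v t) (f.d1 t x) x :=
  hasFDerivAt_of_tendstoUniformlyOn (f := fun k x => (u k).v t x) (f' := fun k x => (u k).d1 t x)
    (g' := fun x => f.d1 t x) hB
    (((h.uniform_d1 hf).comp (fun x => (t, x))).mono fun _ hy => ⟨ht, hy⟩)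
    (fun k y hy => hu k t ht y hy) (fun y hy => (hf t ht y hy).v) hx

theorem h2 (h : JetCauchyOn I B u) (hf : ∀ t ∈ I, ∀ x ∈ B, JetTendsto u f t x) (hB : IsOpen B)
    (hu : ∀ k, ∀ t ∈ I, ∀ x ∈ B, HasFDerivAt ((u k).d1 t) ((u k).d2 t x) x) {t : ℝ} (ht : t ∈ I)
    {x : E} (hx : x ∈ B) : HasFDerivAt (f.d1 t) (f.d2 t x) x :=
  hasFDerivAt_of_tendstoUniformlyOn (f := fun k x => (u k).d1 t x) (f' := fun k x => (u k).d2 t x)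
    (g' := fun x => f.d2 t x) hB
    (((h.uniform_d2 hf).comp (fun x => (t, x))).mono fun _ hy => ⟨ht, hy⟩)
    (fun k y hy => hu k t ht y hy) (fun y hy => (hf t ht y hy).d1) hx

theorem ht (h : JetCauchyOn I B u) (hf : ∀ t ∈ I, ∀ x ∈ B, JetTendsto u f t x) (hI : IsOpen I)
    (hu : ∀ k, ∀ t ∈ I, ∀ x ∈ B, HasDerivAt (fun s => (u k).v s x) ((u k).dt t x) t)
    {t : ℝ} (ht : t ∈ I) {x : E} (hx : x ∈ B) : HasDerivAt (fun s => f.v s x) (f.dt t x) t :=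
  hasDerivAt_of_tendstoUniformlyOn (f := fun k s => (u k).v s x) (f' := fun k s => (u k).dt s x)
    (g' := fun s => f.dt s x) hI
    (((h.uniform_dt hf).comp (fun s => (s, x))).mono fun _ hy => ⟨hy, hx⟩)
    (Eventually.of_forall fun k y hy => hu k y hy x hx) (fun y hy => (hf y hy x hx).v) ht

end JetCauchyOn

/-- Bounded regular functions are closed under uniform convergence of jets. -/
theorem Reg.limit {α N : ℝ} {u : ℕ → Jet E} {f : Jet E} (hu : ∀ k, Reg α N (u k))
    (h : JetCauchyOn Set.univ Set.univ u) (hf : ∀ t x, JetTendsto u f t x) : Reg α N f := by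
  have hf' : ∀ t ∈ (Set.univ : Set ℝ), ∀ x ∈ (Set.univ : Set E), JetTendsto u f t x :=
    fun t _ x _ => hf t x
  refine ⟨fun t x => h.h1 hf' isOpen_univ (fun k t _ x _ => (hu k).h1 t x) trivial trivial,
    fun t x => h.h2 hf' isOpen_univ (fun k t _ x _ => (hu k).h2 t x) trivial trivial,
    fun t x => h.ht hf' isOpen_univ (fun k t _ x _ => (hu k).ht t x) trivial trivial,
    fun t x => le_of_tendsto (hf t x).v.abs (Eventually.of_forall fun k => (hu k).bv t x),
    fun t x => le_of_tendsto (hf t x).d1.norm (Eventually.of_forall fun k => (hu k).b1 t x),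
    fun t x => le_of_tendsto (Tendsto.norm (E := E →L[ℝ] E →L[ℝ] ℝ) (hf t x).d2)
      (Eventually.of_forall fun k => (hu k).b2 t x),
    fun t x => le_of_tendsto (hf t x).dt.abs (Eventually.of_forall fun k => (hu k).bt t x),
    fun t x y => norm_sub_le_of_tendsto (V := E →L[ℝ] E →L[ℝ] ℝ) (hf t x).d2 (hf t y).d2
      fun k => (hu k).hol t x y, ?_⟩
  refine UC.of_approx fun ε hε => ?_
  obtain ⟨k, hk⟩ := (Metric.tendstoUniformlyOn_iff.1 (h.uniform_dt hf') ε hε).exists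
  refine ⟨_, (hu k).uct, fun t x => ?_⟩
  have := hk (t, x) ⟨trivial, trivial⟩
  rw [dist_comm, dist_eq_norm] at this
  exact this.le

end Limits

section Existence

variable {d : ℕ} {α : ℝ}

theorem continuous_tr (A : Fin d → Fin d → ℝ) : Continuous (tr A) := by
  unfold tr
  fun_prop

theorem exists_sol_of_tendsto {lam Λ β N : ℝ} {a : ℝ → (Fin d → ℝ) → Fin d → Fin d → ℝ}
    (hα : 0 < α) (ha : Coef lam Λ β a) (hl : 0 ≤ lam) (hΛ : 0 ≤ Λ) {u : ℕ → Jet (Fin d → ℝ)}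
    {gs : ℕ → ℝ → (Fin d → ℝ) → ℝ} {g : ℝ → (Fin d → ℝ) → ℝ} (hu : ∀ k, Reg α N (u k))
    (hs : ∀ k, Sol a (gs k) (u k))
    (hg : ∀ ε > 0, ∃ K, ∀ k ≥ K, ∀ t x, |gs k t x - g t x| ≤ ε) :
    ∃ w, Reg α N w ∧ Sol a g w := by
  have hN := (hu 0).nonneg
  have hC : JetCauchyOn Set.univ Set.univ u := by
    intro ε hε
    set P : ℝ := 1 + d ^ 2 * Λ with hP
    have hP1 : 1 ≤ P := by rw [hP]; linarith [show (0 : ℝ) ≤ d ^ 2 * Λ by positivity]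
    have hP0 : 0 < P := by linarith
    have hlim : Tendsto (fun s : ℝ => (N + N) * (2 * s) ^ α) (𝓝[>] 0)
        (𝓝 ((N + N) * (2 * 0) ^ α)) :=
      (Continuous.tendsto (((continuous_const.mul continuous_id).rpow_const
        fun _ => Or.inr hα.le).const_mul _) 0).mono_left nhdsWithin_le_nhds
    rw [mul_zero, Real.zero_rpow hα.ne', mul_zero] at hlim
    obtain ⟨s, hs1, hs0, hs2⟩ := ((hlim.eventually (gt_mem_nhds (show (0 : ℝ) < ε / (4 * P) by
      positivity))).and (Ioo_mem_nhdsGT (show (0 : ℝ) < 1 by norm_num))).exists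
    set G : ℝ := ε * s ^ 2 / (16 * P) with hG
    have hG0 : 0 < G := by positivity
    have hG1 : 4 * G / s ^ 2 = ε / (4 * P) := by rw [hG]; field_simp; norm_num
    have hG2 : G ≤ ε / 16 := by
      rw [hG, div_le_div_iff₀ (by positivity) (by norm_num)]
      have : s ^ 2 ≤ 1 := by nlinarith
      nlinarith [mul_le_mul_of_nonneg_left (this.trans hP1) hε.le]
    obtain ⟨K, hK⟩ := hg (G / 2) (by positivity)
    refine ⟨K, fun k hk l hl' t _ x _ => ?_⟩
    have hsub := (hs k).sub (hs l)
    have hreg := (hu k).sub (hu l)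
    have hv : ∀ t x, |((u k).sub (u l)).v t x| ≤ G := hsub.abs_le hreg ha hl fun t x => by
      have h1 := _root_.abs_le.1 (hK k hk t x)
      have h2 := _root_.abs_le.1 (hK l hl' t x)
      exact _root_.abs_le.2 ⟨by linarith, by linarith⟩
    obtain ⟨b2, b1⟩ := hreg.sup_bounds hα.le (by positivity) hreg.hol hv hs0 t x
    rw [hG1] at b2 b1
    have hsrc : |gs k t x - gs l t x| ≤ G := by
      have h1 := _root_.abs_le.1 (hK k hk t x)
      have h2 := _root_.abs_le.1 (hK l hl' t x)
      exact _root_.abs_le.2 ⟨by linarith, by linarith⟩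
    have b2' : ‖((u k).sub (u l)).d2 t x‖ ≤ ε / (2 * P) := b2.trans (by
      have : ε / (2 * P) = ε / (4 * P) + ε / (4 * P) := by field_simp; norm_num
      linarith)
    have e1 : ε / (2 * P) ≤ ε / 2 := by gcongr; linarith
    have e2 : ε / (4 * P) ≤ ε / 4 := by gcongr; linarith
    refine ⟨(hv t x).trans (by linarith), b1.trans (by linarith), b2'.trans (by linarith), ?_⟩
    have htr := abs_tr_le (ha.bdd t x) (((u k).sub (u l)).d2 t x)
    have h3 : d ^ 2 * Λ * ‖((u k).sub (u l)).d2 t x‖ ≤ ε / 2 := by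
      calc _ ≤ P * (ε / (2 * P)) :=
            mul_le_mul (by rw [hP]; linarith) b2'
              (norm_nonneg (E := (Fin d → ℝ) →L[ℝ] (Fin d → ℝ) →L[ℝ] ℝ) _) hP0.le
        _ = ε / 2 := by field_simp
    have e := hsub t x
    have e' : ((u k).sub (u l)).dt t x = (u k).dt t x - (u l).dt t x := rfl
    rw [← e', e]
    have h1 := _root_.abs_le.1 (hv t x)
    have h2 := _root_.abs_le.1 (htr.trans h3)
    have h4 := _root_.abs_le.1 hsrc
    exact _root_.abs_le.2 ⟨by linarith, by linarith⟩
  obtain ⟨w, hw⟩ := exists_jet_limit (u := u) (P := fun _ _ => True)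
    fun t x _ => ⟨Set.univ, Set.univ, trivial, trivial, hC⟩
  refine ⟨w, Reg.limit hu hC fun t x => hw t x trivial, fun t x => ?_⟩
  have hw' := hw t x trivial
  refine tendsto_nhds_unique hw'.dt ?_
  have hgl : Tendsto (fun k => gs k t x) atTop (𝓝 (g t x)) := by
    rw [Metric.tendsto_atTop]
    intro ε hε
    obtain ⟨K, hK⟩ := hg (ε / 2) (by positivity)
    exact ⟨K, fun k hk => by rw [Real.dist_eq]; linarith [hK k hk t x]⟩
  simp only [fun k => hs k t x]
  exact ((((continuous_tr (a t x)).tendsto _).comp hw'.d2).sub hw'.v).add hgl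

end Existence

section Heat

variable {d : ℕ} {α : ℝ}

theorem hasFDerivAt_shift_integral {V : Type*} [NormedAddCommGroup V] [NormedSpace ℝ V]
    (σ : (Fin d → ℝ) →L[ℝ] (Fin d → ℝ)) {F : ℝ → (Fin d → ℝ) → V}
    {F' : ℝ → (Fin d → ℝ) → (Fin d → ℝ) →L[ℝ] V} {C : ℝ}
    (h : ∀ t x, HasFDerivAt (F t) (F' t x) x) (hF : UC F) (hF' : UC F')
    (hb : ∀ t x, ‖F t x‖ ≤ C) (hb' : ∀ t x, ‖F' t x‖ ≤ C) (t : ℝ) (x : Fin d → ℝ) :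
    HasFDerivAt (fun x => ∫ p, F (t - p.1) (x - √p.1 • σ p.2) ∂shiftMeas d)
      (∫ p, F' (t - p.1) (x - √p.1 • σ p.2) ∂shiftMeas d) x := by
  refine hasFDerivAt_integral_of_dominated_of_fderiv_le (bound := fun _ => C)
    (F' := fun x p => F' (t - p.1) (x - √p.1 • σ p.2)) (s := Set.univ) Filter.univ_mem
    (Eventually.of_forall fun y => (integrable_shift hb hF.continuous t y).1)
    (integrable_shift hb hF.continuous t x) (integrable_shift hb' hF'.continuous t x).1
    (Eventually.of_forall fun p y _ => hb' _ _) (integrable_const C)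
    (Eventually.of_forall fun p y _ => ?_)
  exact (hasFDerivAt_comp_sub (√p.1 • σ p.2)).2 (h _ _)

theorem hasDerivAt_shift_integral (σ : (Fin d → ℝ) →L[ℝ] (Fin d → ℝ))
    {F F' : ℝ → (Fin d → ℝ) → ℝ} {C : ℝ}
    (h : ∀ t x, HasDerivAt (fun s => F s x) (F' t x) t) (hF : UC F) (hF' : UC F')
    (hb : ∀ t x, ‖F t x‖ ≤ C) (hb' : ∀ t x, ‖F' t x‖ ≤ C) (t : ℝ) (x : Fin d → ℝ) :
    HasDerivAt (fun t => ∫ p, F (t - p.1) (x - √p.1 • σ p.2) ∂shiftMeas d)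
      (∫ p, F' (t - p.1) (x - √p.1 • σ p.2) ∂shiftMeas d) t := by
  refine (hasDerivAt_integral_of_dominated_loc_of_deriv_le (bound := fun _ => C)
    (F := fun t (p : ℝ × (Fin d → ℝ)) => F (t - p.1) (x - √p.1 • σ p.2))
    (F' := fun t (p : ℝ × (Fin d → ℝ)) => F' (t - p.1) (x - √p.1 • σ p.2)) (s := Set.univ) Filter.univ_mem
    (Eventually.of_forall fun y => (integrable_shift hb hF.continuous y x).1)
    (integrable_shift hb hF.continuous t x) (integrable_shift hb' hF'.continuous t x).1
    (Eventually.of_forall fun p y _ => hb' _ _) (integrable_const C)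
    (Eventually.of_forall fun p y _ => ?_)).2
  exact HasDerivAt.comp_sub_const y p.1 (h _ _)

theorem norm_shift_integral_sub_le {V : Type*} [NormedAddCommGroup V] [NormedSpace ℝ V]
    (σ : (Fin d → ℝ) →L[ℝ] (Fin d → ℝ)) {F : ℝ → (Fin d → ℝ) → V} {C D : ℝ}
    (hF : UC F) (hb : ∀ t x, ‖F t x‖ ≤ C) {t s : ℝ} {x y : Fin d → ℝ}
    (h : ∀ r z, ‖F (t - r) (x - z) - F (s - r) (y - z)‖ ≤ D) :
    ‖(∫ p, F (t - p.1) (x - √p.1 • σ p.2) ∂shiftMeas d) -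
      ∫ p, F (s - p.1) (y - √p.1 • σ p.2) ∂shiftMeas d‖ ≤ D := by
  rw [← integral_sub (integrable_shift hb hF.continuous t x)
    (integrable_shift hb hF.continuous s y)]
  simpa using norm_integral_le_of_norm_le_const (μ := shiftMeas d) (C := D)
    (Eventually.of_forall fun p : ℝ × (Fin d → ℝ) => h p.1 (√p.1 • σ p.2))

theorem norm_shift_integral_le {V : Type*} [NormedAddCommGroup V] [NormedSpace ℝ V]
    (σ : (Fin d → ℝ) →L[ℝ] (Fin d → ℝ)) {F : ℝ → (Fin d → ℝ) → V} {C : ℝ}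
    (hb : ∀ t x, ‖F t x‖ ≤ C) (t : ℝ) (x : Fin d → ℝ) :
    ‖∫ p, F (t - p.1) (x - √p.1 • σ p.2) ∂shiftMeas d‖ ≤ C := by
  simpa using norm_integral_le_of_norm_le_const (μ := shiftMeas d) (C := C)
    (Eventually.of_forall fun p : ℝ × (Fin d → ℝ) => hb (t - p.1) (x - √p.1 • σ p.2))

/-- The jet of a resolvent average. -/
def avgJet (σ : (Fin d → ℝ) →L[ℝ] (Fin d → ℝ)) (j : Jet (Fin d → ℝ)) : Jet (Fin d → ℝ) where
  v t x := ∫ p, j.v (t - p.1) (x - √p.1 • σ p.2) ∂shiftMeas d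
  d1 t x := ∫ p, j.d1 (t - p.1) (x - √p.1 • σ p.2) ∂shiftMeas d
  d2 t x := ∫ p, j.d2 (t - p.1) (x - √p.1 • σ p.2) ∂shiftMeas d
  dt t x := ∫ p, j.dt (t - p.1) (x - √p.1 • σ p.2) ∂shiftMeas d

theorem Reg.reg_avgJet (σ : (Fin d → ℝ) →L[ℝ] (Fin d → ℝ)) {j : Jet (Fin d → ℝ)} {N : ℝ} (hα : 0 < α)
    (h : Reg α N j) : Reg α N (avgJet σ j) where
  h1 := hasFDerivAt_shift_integral σ h.h1 h.ucv (h.uc1 hα) h.bv h.b1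
  h2 := hasFDerivAt_shift_integral σ h.h2 (h.uc1 hα) (h.uc2 hα) h.b1 h.b2
  ht := hasDerivAt_shift_integral σ h.ht h.ucv h.uct h.bv h.bt
  bv := norm_shift_integral_le (V := ℝ) σ h.bv
  b1 := norm_shift_integral_le σ h.b1
  b2 := norm_shift_integral_le (V := (Fin d → ℝ) →L[ℝ] (Fin d → ℝ) →L[ℝ] ℝ) σ h.b2
  bt := norm_shift_integral_le (V := ℝ) σ h.bt
  hol t x y := norm_shift_integral_sub_le (V := (Fin d → ℝ) →L[ℝ] (Fin d → ℝ) →L[ℝ] ℝ) σ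
    (h.uc2 hα) h.b2 fun r z => by simpa using h.hol (t - r) (x - z) (y - z)
  uct ε hε := by
    obtain ⟨δ, hδ, H⟩ := h.uct ε hε
    exact ⟨δ, hδ, fun t s x y hts hxy => norm_shift_integral_sub_le σ h.uct h.bt fun r z =>
      H _ _ _ _ (by simpa using hts) (by simpa using hxy)⟩

theorem Reg.avgJet_sol (σ : (Fin d → ℝ) →L[ℝ] (Fin d → ℝ)) {j : Jet (Fin d → ℝ)} {N : ℝ}
    (hα : 0 < α) (h : Reg α N j) (t : ℝ) (x : Fin d → ℝ) :
    (avgJet σ j).dt t x = lapl σ ((avgJet σ j).d2 t x) - (avgJet σ j).v t x + j.v t x := by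
  have i2 := integrable_shift (σ := σ) (F := (Fin d → ℝ) →L[ℝ] (Fin d → ℝ) →L[ℝ] ℝ) h.b2
    (h.uc2 hα).continuous t x
  have i2' : ∀ u, Integrable (fun p : ℝ × (Fin d → ℝ) =>
      j.d2 (t - p.1) (x - √p.1 • σ p.2) u) (shiftMeas d) := fun u =>
    Integrable.apply_continuousLinearMap (E := (Fin d → ℝ) →L[ℝ] ℝ) i2 u
  have i2'' : ∀ u w, Integrable (fun p : ℝ × (Fin d → ℝ) =>
      j.d2 (t - p.1) (x - √p.1 • σ p.2) u w) (shiftMeas d) := fun u w =>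
    (i2' u).apply_continuousLinearMap w
  have e : ∀ u w, (avgJet σ j).d2 t x u w =
      ∫ p, j.d2 (t - p.1) (x - √p.1 • σ p.2) u w ∂shiftMeas d := fun u w => by
    simp only [avgJet]
    rw [ContinuousLinearMap.integral_apply i2, ContinuousLinearMap.integral_apply (i2' u)]
  have iv := integrable_shift (σ := σ) h.bv h.ucv.continuous t x
  have it := integrable_shift (σ := σ) h.bt h.uct.continuous t x
  have il : Integrable (fun p : ℝ × (Fin d → ℝ) =>
      lapl σ (j.d2 (t - p.1) (x - √p.1 • σ p.2))) (shiftMeas d) :=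
    (integrable_finsetSum _ fun k _ => i2'' _ _).const_mul _
  have el : lapl σ ((avgJet σ j).d2 t x) =
      ∫ p, lapl σ (j.d2 (t - p.1) (x - √p.1 • σ p.2)) ∂shiftMeas d := by
    simp only [lapl, e]
    rw [integral_const_mul, integral_finsetSum _ fun k _ => i2'' _ _]
  have key := h.avg_csrc (σ := σ) hα t x
  unfold avg csrc at key
  have itl : Integrable (fun p : ℝ × (Fin d → ℝ) => j.dt (t - p.1) (x - √p.1 • σ p.2) -
      lapl σ (j.d2 (t - p.1) (x - √p.1 • σ p.2))) (shiftMeas d) := it.sub il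
  rw [integral_add itl iv, integral_sub it il, ← el] at key
  simp only [avgJet] at key ⊢
  linarith

/-- The identity coefficient matrix. -/
def idMat (i j : Fin d) : ℝ := if i = j then 1 else 0

theorem coef_idMat : Coef 1 1 α fun (_ : ℝ) (_ : Fin d → ℝ) => idMat where
  symm _ _ i j := by simp [idMat, eq_comm]
  ell _ _ y := by
    simpa [idMat, edot] using sq_norm_le_edot y
  bdd _ _ i j := by unfold idMat; split_ifs <;> simp
  hol _ x y i j := by simpa using Real.rpow_nonneg (norm_nonneg (x - y)) α
  uc i j := UC.const _

theorem exists_sol_idMat (hα : 0 < α) (hα1 : α < 1) :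
    ∃ C, 0 ≤ C ∧ ∀ (g : ℝ → (Fin d → ℝ) → ℝ) G, Src α G g →
      ∃ w, Reg α (C * G) w ∧ Sol (fun _ _ => idMat) g w := by
  obtain ⟨δ, hδ, H⟩ := apriori (d := d) hα hα1 (one_pos (α := ℝ)) zero_le_one
  obtain ⟨C, hC0, hC⟩ := H 1 one_pos
  refine ⟨C, hC0, fun g G hg => ?_⟩
  have hap : ∀ k : ℕ, ∃ u : Jet (Fin d → ℝ), ∃ g' : ℝ → (Fin d → ℝ) → ℝ, Reg α (C * G) u ∧
      Sol (fun _ _ => idMat) g' u ∧ ∀ t x, |g' t x - g t x| ≤ 1 / ((k : ℝ) + 1) := by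
    intro k
    obtain ⟨N, j, hj, hjs, hjg⟩ := hg.exists_approx hα.le hα1.le
      (show (0 : ℝ) < 1 / ((k : ℝ) + 1) by positivity)
    have hsol : Sol (fun _ _ => idMat) j.v (avgJet (gramMap idMat) j) := fun t x => by
      rw [tr_eq_lapl (B := idMat) fun i j => by simp [idMat, eq_comm]]
      exact hj.avgJet_sol _ hα t x
    exact ⟨avgJet (gramMap idMat) j, j.v, hC _ coef_idMat
      (fun _ _ _ _ _ _ i j => by simpa using hδ.le) _ _ _ _ (hj.reg_avgJet _ hα) hjs hsol, hsol, hjg⟩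
  choose u gs hu hs hgs using hap
  refine exists_sol_of_tendsto (β := α) hα coef_idMat zero_le_one zero_le_one hu hs fun ε hε => ?_
  obtain ⟨K, hK⟩ := exists_nat_one_div_lt hε
  refine ⟨K, fun k hk t x => (hgs k t x).trans (le_trans ?_ hK.le)⟩
  gcongr

end Heat

section Continuity

variable {d : ℕ} {α : ℝ}

theorem UC.apply_apply {H : ℝ → (Fin d → ℝ) → (Fin d → ℝ) →L[ℝ] (Fin d → ℝ) →L[ℝ] ℝ}
    (hH : UC H) (i j : Fin d) : UC fun t x => H t x (eb i) (eb j) := by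
  refine UC.lip (b := fun K : (Fin d → ℝ) →L[ℝ] (Fin d → ℝ) →L[ℝ] ℝ => K (eb i) (eb j))
    zero_le_one (fun K L => ?_) hH
  simpa using abs_apply_eb_le (K - L) i j

/-- Applying a second-order operator to a regular function yields a source. -/
theorem Reg.src_tr {N A : ℝ} {w : Jet (Fin d → ℝ)} (hw : Reg α N w) (hα : 0 < α)
    {b : ℝ → (Fin d → ℝ) → Fin d → Fin d → ℝ} (hb : ∀ i j, BH α A fun t x => b t x i j)
    (hu : ∀ i j, UC fun t x => b t x i j) (s : ℝ) :
    Src α (|s * (1 / 2)| * (d * (d * (2 * A * N)))) fun t x => s * tr (b t x) (w.d2 t x) := by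
  have e : (fun t x => s * tr (b t x) (w.d2 t x)) = fun t x =>
      s * (1 / 2) * ∑ i, ∑ j, b t x i j * w.d2 t x (eb i) (eb j) := by
    funext t x
    rw [tr, mul_assoc]
  rw [e]
  refine BH.src ?_ ?_
  · refine BH.const_mul _ ?_
    simpa using BH.sum fun i => BH.sum fun j => (hb i j).mul (hw.bh_d2 i j)
  · refine UC.const_mul _ (UC.sum _ fun i => UC.sum _ fun j => ?_)
    exact (hu i j).mul ((hw.uc2 hα).apply_apply i j) (hb i j).b (hw.bh_d2 i j).b

/-- Solvability for a coefficient field with estimates of constant `C`. -/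
def Solvable (α C : ℝ) (a : ℝ → (Fin d → ℝ) → Fin d → Fin d → ℝ) : Prop :=
  ∀ (g : ℝ → (Fin d → ℝ) → ℝ) G, Src α G g → ∃ w, Reg α (C * G) w ∧ Sol a g w

/-- One step of the method of continuity. -/
theorem Solvable.step {C A s lam Λ : ℝ} {a b c : ℝ → (Fin d → ℝ) → Fin d → Fin d → ℝ} (hα : 0 < α)
    (hC : 0 ≤ C) (ha : Solvable α C a) (hc : Coef lam Λ α c) (hl : 0 ≤ lam) (hΛ : 0 ≤ Λ)
    (hb : ∀ i j, BH α A fun t x => b t x i j) (hu : ∀ i j, UC fun t x => b t x i j)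
    (e : ∀ t x i j, c t x i j = a t x i j + s * b t x i j)
    (hs : |s * (1 / 2)| * (d * (d * (2 * A * C))) ≤ 1 / 2)
    (hap : ∀ w N g G, Reg α N w → Src α G g → Sol c g w → Reg α (C * G) w) : Solvable α C c := by
  intro g G hg
  have hG := hg.nonneg
  have etr : ∀ t x H, tr (c t x) H = tr (a t x) H + s * tr (b t x) H := by
    intro t x H
    simp only [tr, e, mul_sum, ← sum_add_distrib]
    exact sum_congr rfl fun i _ => sum_congr rfl fun j _ => by ring
  have step : ∀ w h, Reg α (C * h) w → 0 ≤ h →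
      Src α (h / 2) fun t x => s * tr (b t x) (w.d2 t x) := by
    intro w h hw hh
    refine (hw.src_tr hα hb hu s).mono ?_
    calc _ = |s * (1 / 2)| * (d * (d * (2 * A * C))) * h := by ring
      _ ≤ 1 / 2 * h := by gcongr
      _ = h / 2 := by ring
  have key : ∀ K : ℕ, ∃ u h, Reg α (2 * C * G * (1 - (1 / 2) ^ (K + 1))) u ∧
      Src α (G * (1 / 2) ^ (K + 1)) h ∧ Sol c (fun t x => g t x + h t x) u := by
    intro K
    induction K with
    | zero =>
      obtain ⟨w, hw, hws⟩ := ha g G hg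
      have hsrc := step _ _ hw hG
      refine ⟨w, fun t x => -s * tr (b t x) (w.d2 t x), hw.mono (by ring_nf; rfl),
        BH.src ?_ ?_, fun t x => ?_⟩
      · simpa [div_eq_mul_inv] using hsrc.bh.neg
      · simpa using hsrc.uc.neg
      · rw [hws t x, etr]; ring
    | succ K ih =>
      obtain ⟨u, h, hu', hh, hsol⟩ := ih
      obtain ⟨w, hw, hws⟩ := ha h _ hh
      refine ⟨u.sub w, fun t x => s * tr (b t x) (w.d2 t x),
        (hu'.sub hw).mono (by ring_nf; rfl), (step _ _ hw hh.nonneg).mono (by ring_nf; rfl),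
        fun t x => ?_⟩
      simp only [Jet.sub, tr_sub]
      rw [hsol t x, hws t x, etr t x (w.d2 t x)]
      ring
  choose u h hu' hh hsol using key
  obtain ⟨w, hw, hws⟩ := exists_sol_of_tendsto (g := g) hα hc hl hΛ (N := 2 * C * G)
    (fun K => (hu' K).mono (by
      have : (0 : ℝ) ≤ (1 / 2) ^ (K + 1) := by positivity
      nlinarith [mul_nonneg (mul_nonneg hC hG) this])) hsol fun ε hε => by
    have hlim : Tendsto (fun K : ℕ => G * (1 / 2 : ℝ) ^ (K + 1)) atTop (𝓝 (G * 0)) :=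
      ((tendsto_pow_atTop_nhds_zero_of_lt_one (by norm_num) (by norm_num)).comp
        (tendsto_add_atTop_nat 1)).const_mul G
    rw [mul_zero] at hlim
    obtain ⟨K, hK⟩ := eventually_atTop.1 (hlim.eventually (ge_mem_nhds hε))
    exact ⟨K, fun k hk t x => by
      rw [add_sub_cancel_left]
      exact ((hh k).b t x).trans (hK k hk)⟩
  exact ⟨w, hap w _ g G hw hg hws, hws⟩

/-- Global solvability in Hölder spaces. -/
theorem Coef.solvable {lam Λ : ℝ} {a : ℝ → (Fin d → ℝ) → Fin d → Fin d → ℝ} (hα : 0 < α)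
    (hα1 : α < 1) (ha : Coef lam Λ α a) (hl : 0 < lam) : ∃ C, 0 ≤ C ∧ Solvable α C a ∧
      ∀ w N g G, Reg α N w → Src α G g → Sol a g w → Reg α (C * G) w := by
  set lam' := min lam 1 with hlam
  set Λ' := max Λ 1 with hΛ'
  have hl' : 0 < lam' := lt_min hl one_pos
  have hΛ0 : 0 ≤ Λ' := zero_le_one.trans (le_max_right _ _)
  let aθ : ℝ → ℝ → (Fin d → ℝ) → Fin d → Fin d → ℝ :=
    fun θ t x i j => (1 - θ) * idMat i j + θ * a t x i j
  have hid := coef_idMat (d := d) (α := α)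
  have hcoef : ∀ θ, 0 ≤ θ → θ ≤ 1 → Coef lam' Λ' α (aθ θ) := by
    intro θ h0 h1
    have h1' : 0 ≤ 1 - θ := by linarith
    refine ⟨fun t x i j => ?_, fun t x y => ?_, fun t x i j => ?_, fun t x y i j => ?_,
      fun i j => ?_⟩
    · simp only [aθ]; rw [ha.symm, hid.symm 0 0]
    · have e : ∑ i, ∑ j, aθ θ t x i j * y i * y j = (1 - θ) * ∑ i, ∑ j, idMat i j * y i * y j +
          θ * ∑ i, ∑ j, a t x i j * y i * y j := by
        simp only [aθ, mul_sum, ← sum_add_distrib]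
        exact sum_congr rfl fun i _ => sum_congr rfl fun j _ => by ring
      rw [e]
      have e1 := mul_le_mul_of_nonneg_left (hid.ell 0 0 y) h1'
      have e2 := mul_le_mul_of_nonneg_left (ha.ell t x y) h0
      have e3 : lam' * ‖y‖ ^ 2 ≤ lam * ‖y‖ ^ 2 := by gcongr; exact min_le_left _ _
      have e4 : lam' * ‖y‖ ^ 2 ≤ 1 * ‖y‖ ^ 2 := by gcongr; exact min_le_right _ _
      nlinarith [mul_le_mul_of_nonneg_left e3 h0, mul_le_mul_of_nonneg_left e4 h1']
    · have e1 := (hid.bdd 0 0 i j).trans (le_max_right Λ 1)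
      have e2 := (ha.bdd t x i j).trans (le_max_left Λ 1)
      calc _ ≤ |(1 - θ) * idMat i j| + |θ * a t x i j| := abs_add_le _ _
        _ = (1 - θ) * |idMat i j| + θ * |a t x i j| := by
          rw [abs_mul, abs_mul, abs_of_nonneg h0, abs_of_nonneg h1']
        _ ≤ (1 - θ) * Λ' + θ * Λ' := by gcongr
        _ = Λ' := by ring
    · have e : aθ θ t x i j - aθ θ t y i j = θ * (a t x i j - a t y i j) := by
        simp only [aθ]; ring
      rw [e, abs_mul, abs_of_nonneg h0]
      have e2 : Λ * ‖x - y‖ ^ α ≤ Λ' * ‖x - y‖ ^ α := by gcongr; exact le_max_left _ _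
      calc θ * |a t x i j - a t y i j| ≤ 1 * |a t x i j - a t y i j| := by gcongr
        _ ≤ _ := by rw [one_mul]; exact (ha.hol t x y i j).trans e2
    · exact (UC.const _).add ((ha.uc i j).const_mul θ)
  obtain ⟨δ, hδ, H⟩ := apriori (d := d) hα hα1 hl' hΛ0
  have hosc : ∃ r > 0, ∀ t s x y, |t - s| < r → ‖x - y‖ < r → ∀ i j,
      |a t x i j - a s y i j| ≤ δ := by
    choose r hr0 hr using fun i j => ha.uc i j δ hδ
    rcases isEmpty_or_nonempty (Fin d) with hd | hd
    · exact ⟨1, one_pos, fun _ _ _ _ _ _ i => hd.elim i⟩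
    · obtain ⟨q, hq⟩ := Finite.exists_min fun q : Fin d × Fin d => r q.1 q.2
      exact ⟨r q.1 q.2, hr0 _ _, fun t s x y h1 h2 i j => hr i j t s x y
        (h1.trans_le (hq (i, j))) (h2.trans_le (hq (i, j)))⟩
  obtain ⟨r, hr, hosc⟩ := hosc
  obtain ⟨C₁, hC₁, hap₁⟩ := H r hr
  obtain ⟨C₀, hC₀, h₀⟩ := exists_sol_idMat (d := d) hα hα1
  have hap : ∀ θ, 0 ≤ θ → θ ≤ 1 → ∀ w N g G, Reg α N w → Src α G g → Sol (aθ θ) g w →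
      Reg α (C₁ * G) w := by
    intro θ h0 h1
    refine hap₁ _ (hcoef θ h0 h1) fun t s x y h2 h3 i j => ?_
    have e : aθ θ t x i j - aθ θ s y i j = θ * (a t x i j - a s y i j) := by
      simp only [aθ]; ring
    rw [e, abs_mul, abs_of_nonneg h0]
    calc θ * |a t x i j - a s y i j| ≤ 1 * |a t x i j - a s y i j| := by gcongr
      _ ≤ δ := by rw [one_mul]; exact hosc t s x y h2 h3 i j
  have hzero : Solvable α C₁ (aθ 0) := by
    intro g G hg
    obtain ⟨w, hw, hws⟩ := h₀ g G hg
    have hws' : Sol (aθ 0) g w := fun t x => by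
      have : aθ 0 t x = idMat := by funext i j; simp [aθ]
      rw [this]; exact hws t x
    exact ⟨w, hap 0 le_rfl zero_le_one _ _ _ _ hw hg hws', hws'⟩
  have hb : ∀ i j, BH α (Λ + 1) fun t x => a t x i j - idMat i j := fun i j =>
    BH.sub ⟨fun t x => ha.bdd t x i j, fun t x y => ha.hol t x y i j⟩ (BH.const (hid.bdd 0 0 i j))
  have hu : ∀ i j, UC fun t x => a t x i j - idMat i j := fun i j => (ha.uc i j).sub (UC.const _)
  obtain ⟨n, hn⟩ := exists_nat_ge (d * (d * (2 * (Λ + 1) * C₁)))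
  have hn1 : (0 : ℝ) < n + 1 := by positivity
  have hstep : ∀ k : ℕ, k ≤ n + 1 → Solvable α C₁ (aθ (k / (n + 1))) := by
    intro k
    induction k with
    | zero => intro _; simpa using hzero
    | succ k ih =>
      intro hk
      have hk' : ((k + 1 : ℕ) : ℝ) ≤ (n : ℝ) + 1 := by exact_mod_cast hk
      have h1 : ((k + 1 : ℕ) : ℝ) / (n + 1) ≤ 1 := (div_le_one hn1).2 hk'
      refine (ih (by omega)).step (s := 1 / ((n : ℝ) + 1)) (A := Λ + 1) hα hC₁
        (hcoef _ (by positivity) h1) hl'.le hΛ0 hb hu (fun t x i j => ?_) ?_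
        (hap _ (by positivity) h1)
      · simp only [aθ]; push_cast; field_simp; ring
      · rw [abs_of_nonneg (by positivity)]
        calc _ ≤ 1 / ((n : ℝ) + 1) * (1 / 2) * (n + 1) := by gcongr; linarith
          _ = 1 / 2 := by field_simp
  have e1 : aθ 1 = a := by funext t x i j; simp [aθ]
  have h1 := hstep (n + 1) le_rfl
  have hdiv : ((n + 1 : ℕ) : ℝ) / (n + 1) = 1 := by push_cast; exact div_self hn1.ne'
  rw [hdiv, e1] at h1
  have h2 := hap 1 zero_le_one le_rfl
  rw [e1] at h2
  exact ⟨C₁, hC₁, h1, h2⟩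

end Continuity

section JetComposition

variable {d : ℕ} {α : ℝ}

theorem Reg.of_exponent_le {β N : ℝ} {w : Jet (Fin d → ℝ)} (h : Reg α N w) (hβ : 0 ≤ β)
    (hβα : β ≤ α) : Reg β (2 * N) w := by
  have hN := h.nonneg
  refine ⟨h.h1, h.h2, h.ht, fun t x => (h.bv t x).trans (by linarith),
    fun t x => (h.b1 t x).trans (by linarith), fun t x => (h.b2 t x).trans (by linarith),
    fun t x => (h.bt t x).trans (by linarith), fun t x y => ?_, h.uct⟩
  rcases le_total ‖x - y‖ 1 with h1 | h1
  · refine (h.hol t x y).trans ?_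
    rcases (norm_nonneg (x - y)).eq_or_lt with h0 | h0
    · rcases hβ.eq_or_lt with rfl | hβ'
      · have : ‖x - y‖ ^ α ≤ 1 := Real.rpow_le_one (norm_nonneg _) h1 hβα
        rw [Real.rpow_zero]
        nlinarith
      · rw [← h0, Real.zero_rpow hβ'.ne', Real.zero_rpow (hβ'.trans_le hβα).ne']
        simp
    · have := Real.rpow_le_rpow_of_exponent_ge h0 h1 hβα
      have h2 := Real.rpow_nonneg (norm_nonneg (x - y)) β
      nlinarith
  · have h2 : 1 ≤ ‖x - y‖ ^ β := Real.one_le_rpow h1 hβ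
    have h3 := (bl_norm_sub_le (w.d2 t x) (w.d2 t y)).trans (add_le_add (h.b2 t x) (h.b2 t y))
    nlinarith

/-- Composition of a jet with a scalar function. -/
def Jet.comp (Φ Φ1 Φ2 : ℝ → ℝ) (z : Jet (Fin d → ℝ)) : Jet (Fin d → ℝ) where
  v t x := Φ (z.v t x)
  d1 t x := Φ1 (z.v t x) • z.d1 t x
  d2 t x := Φ1 (z.v t x) • z.d2 t x + (Φ2 (z.v t x) • z.d1 t x).smulRight (z.d1 t x)
  dt t x := Φ1 (z.v t x) * z.dt t x

theorem Reg.comp {N Q : ℝ} {z : Jet (Fin d → ℝ)} (hz : Reg α N z) (hzt : BH α N z.dt)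
    (hα : 0 < α) (hα1 : α ≤ 1) {Φ Φ1 Φ2 : ℝ → ℝ} (h1 : ∀ s, HasDerivAt Φ (Φ1 s) s)
    (h2 : ∀ s, HasDerivAt Φ1 (Φ2 s) s) (b0 : ∀ s, |Φ s| ≤ Q) (b1 : ∀ s, |Φ1 s| ≤ Q)
    (b2 : ∀ s, |Φ2 s| ≤ Q) (b3 : ∀ s r, |Φ2 s - Φ2 r| ≤ Q * |s - r|) :
    Reg α ((1 + d * (d + 1)) * (200 * (1 + N) ^ 3 * Q)) (z.comp Φ Φ1 Φ2) ∧
      BH α ((1 + d * (d + 1)) * (200 * (1 + N) ^ 3 * Q)) (z.comp Φ Φ1 Φ2).dt := by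
  have hN := hz.nonneg
  have hQ : 0 ≤ Q := (abs_nonneg _).trans (b0 0)
  have l1 : ∀ s r, |Φ1 s - Φ1 r| ≤ Q * |s - r| := fun s r =>
    convex_univ.norm_image_sub_le_of_norm_hasDerivWithin_le (f := Φ1) (f' := Φ2)
      (fun y _ => (h2 y).hasDerivWithinAt) (fun y _ => b2 y) (Set.mem_univ r) (Set.mem_univ s)
  have hlip : ∀ Ψ : ℝ → ℝ, (∀ s, |Ψ s| ≤ Q) → (∀ s r, |Ψ s - Ψ r| ≤ Q * |s - r|) →
      BH α (2 * (Q * (1 + N))) fun t x => Ψ (z.v t x) := fun Ψ hb hl => by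
    refine BH.of_lip hα.le hα1 (fun t x => (hb _).trans (by nlinarith)) fun t x y => ?_
    calc _ ≤ Q * |z.v t x - z.v t y| := hl _ _
      _ ≤ Q * (N * ‖x - y‖) := by gcongr; exact hz.space_lip t x y
      _ ≤ _ := by nlinarith [mul_nonneg hQ (norm_nonneg (x - y))]
  have B1 := hlip Φ1 b1 l1
  have B2 := hlip Φ2 b2 b3
  have D := hz.bh_d1 hα.le hα1 hz.b1 hz.b2
  have q1 : Q * N ≤ 200 * (1 + N) ^ 3 * Q := by
    have : N ≤ 200 * (1 + N) ^ 3 := by nlinarith [pow_nonneg hN 3, pow_nonneg hN 2]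
    nlinarith
  have q2 : Q ≤ 200 * (1 + N) ^ 3 * Q := by
    have : 1 ≤ 200 * (1 + N) ^ 3 := by nlinarith [pow_nonneg hN 3, pow_nonneg hN 2]
    nlinarith
  have q0 : 0 ≤ 200 * (1 + N) ^ 3 * Q := by positivity
  refine ⟨Reg.of_entries q0 (fun t x => ?_) (fun t x => ?_) (fun t x => ?_)
    (fun t x => (b0 _).trans q2) (fun t x i => ?_) (fun i j => ?_) (fun t x => ?_) ?_, ?_⟩
  · exact (h1 _).comp_hasFDerivAt x (hz.h1 t x)
  · exact ((h2 _).comp_hasFDerivAt x (hz.h1 t x)).smul (hz.h2 t x)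
  · exact (h1 _).comp t (hz.ht t x)
  · simp only [Jet.comp, _root_.smul_apply, smul_eq_mul, abs_mul]
    exact (mul_le_mul (b1 _) ((abs_apply_eb_le_norm _ i).trans (hz.b1 t x)) (abs_nonneg _)
      hQ).trans q1
  · have e : (fun t x => (z.comp Φ Φ1 Φ2).d2 t x (eb i) (eb j)) = fun t x =>
        Φ1 (z.v t x) * z.d2 t x (eb i) (eb j) +
          Φ2 (z.v t x) * z.d1 t x (eb i) * z.d1 t x (eb j) := by
      funext t x; simp [Jet.comp]
    rw [e]
    refine ((B1.mul (hz.bh_d2 i j)).add ((B2.mul (D i)).mul (D j))).mono ?_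
    have : 4 * (1 + N) * N + 128 * (1 + N) * N ^ 2 ≤ 200 * (1 + N) ^ 3 := by
      nlinarith [pow_nonneg hN 3, pow_nonneg hN 2]
    nlinarith
  · simp only [Jet.comp, abs_mul]
    exact (mul_le_mul (b1 _) (hz.bt t x) (abs_nonneg _) hQ).trans q1
  · exact (UC.lip hQ (fun s r => l1 s r) hz.ucv).mul hz.uct (fun _ _ => b1 _) hz.bt
  · refine (B1.mul hzt).mono ?_
    have h3 : 2 * (2 * (Q * (1 + N))) * N ≤ 200 * (1 + N) ^ 3 * Q := by
      have : 4 * (1 + N) * N ≤ 200 * (1 + N) ^ 3 := by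
        nlinarith [pow_nonneg hN 3, pow_nonneg hN 2]
      nlinarith
    have h4 : (0 : ℝ) ≤ d * (d + 1) := by positivity
    nlinarith [mul_nonneg h4 q0]

/-- A smooth step function together with its first two derivatives. -/
theorem exists_profile : ∃ (θ θ1 θ2 : ℝ → ℝ) (L : ℝ), 1 ≤ L ∧ (∀ s, HasDerivAt θ (θ1 s) s) ∧
    (∀ s, HasDerivAt θ1 (θ2 s) s) ∧ (∀ s, 0 ≤ θ s ∧ θ s ≤ 1) ∧ (∀ s, |θ1 s| ≤ L) ∧
    (∀ s, |θ2 s| ≤ L) ∧ (∀ s r, |θ2 s - θ2 r| ≤ L * |s - r|) ∧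
    (∀ s < 1, θ s = 0 ∧ θ1 s = 0 ∧ θ2 s = 0) ∧ ∀ s, 3 / 2 < s → θ s = 1 ∧ θ1 s = 0 ∧ θ2 s = 0 := by
  set θ : ℝ → ℝ := fun s => Real.smoothTransition (2 * s - 2) with hθ
  have hsm : ContDiff ℝ 3 θ := Real.smoothTransition.contDiff.comp (by fun_prop)
  have c1 : ContDiff ℝ 2 (deriv θ) := by
    have : ContDiff ℝ (2 + 1) θ := by simpa [show (2 : WithTop ℕ∞) + 1 = 3 by norm_num] using hsm
    exact (contDiff_succ_iff_deriv.1 this).2.2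
  have c2 : ContDiff ℝ 1 (deriv (deriv θ)) := by
    have : ContDiff ℝ (1 + 1) (deriv θ) := by
      simpa [show (1 : WithTop ℕ∞) + 1 = 2 by norm_num] using c1
    exact (contDiff_succ_iff_deriv.1 this).2.2
  have lo : ∀ s < 1, θ =ᶠ[𝓝 s] fun _ => 0 := fun s hs => by
    filter_upwards [gt_mem_nhds hs] with r hr
    exact Real.smoothTransition.zero_of_nonpos (by linarith)
  have hi : ∀ s, 3 / 2 < s → θ =ᶠ[𝓝 s] fun _ => 1 := fun s hs => by
    filter_upwards [lt_mem_nhds hs] with r hr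
    exact Real.smoothTransition.one_of_one_le (by linarith)
  have ev : ∀ (c s : ℝ), θ =ᶠ[𝓝 s] (fun _ => c) → θ s = c ∧ deriv θ s = 0 ∧
      deriv (deriv θ) s = 0 := fun c s h => by
    have h1 : deriv θ =ᶠ[𝓝 s] fun _ => 0 := by simpa using h.deriv
    exact ⟨h.eq_of_nhds, h1.eq_of_nhds, by simpa using h1.deriv_eq⟩
  have hc : HasCompactSupport (deriv θ) := by
    refine HasCompactSupport.intro (isCompact_Icc (a := (1 : ℝ)) (b := 3 / 2)) fun s hs => ?_
    rw [Set.mem_Icc, not_and_or, not_le, not_le] at hs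
    rcases hs with hs | hs
    · exact (ev _ s (lo s hs)).2.1
    · exact (ev _ s (hi s hs)).2.1
  obtain ⟨L1, hL1⟩ := hc.exists_bound_of_continuous c1.continuous
  obtain ⟨L2, hL2⟩ := hc.deriv.exists_bound_of_continuous c2.continuous
  obtain ⟨L3, hL3⟩ := hc.deriv.deriv.exists_bound_of_continuous (c2.continuous_deriv le_rfl)
  have m1 : L1 ≤ max 1 (max L1 (max L2 L3)) := by simp
  have m2 : L2 ≤ max 1 (max L1 (max L2 L3)) := by simp
  have m3 : L3 ≤ max 1 (max L1 (max L2 L3)) := by simp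
  refine ⟨θ, deriv θ, deriv (deriv θ), max 1 (max L1 (max L2 L3)), le_max_left _ _,
    fun s => (hsm.differentiable (by norm_num) s).hasDerivAt,
    fun s => (c1.differentiable (by norm_num) s).hasDerivAt,
    fun s => ⟨Real.smoothTransition.nonneg _, Real.smoothTransition.le_one _⟩,
    fun s => (hL1 s).trans m1, fun s => (hL2 s).trans m2, fun s r => ?_,
    fun s hs => ev _ s (lo s hs), fun s hs => ev _ s (hi s hs)⟩
  exact convex_univ.norm_image_sub_le_of_norm_hasDerivWithin_le
    (fun y _ => (c2.differentiable (by norm_num) y).hasDerivAt.hasDerivWithinAt)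
    (fun y _ => (hL3 y).trans m3) (Set.mem_univ r) (Set.mem_univ s)

end JetComposition

section Interior

variable {d : ℕ} {α : ℝ}

theorem tr_jet_mul {A : Fin d → Fin d → ℝ} (hA : ∀ i j, A i j = A j i) (z u : Jet (Fin d → ℝ))
    (t : ℝ) (x : Fin d → ℝ) : tr A ((z.mul u).d2 t x) = z.v t x * tr A (u.d2 t x) +
      u.v t x * tr A (z.d2 t x) + ∑ i, ∑ j, A i j * z.d1 t x (eb i) * u.d1 t x (eb j) := by
  have e : ∑ i, ∑ j, A i j * (u.d1 t x (eb i) * z.d1 t x (eb j)) =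
      ∑ i, ∑ j, A i j * z.d1 t x (eb i) * u.d1 t x (eb j) := by
    rw [sum_comm]
    exact sum_congr rfl fun i _ => sum_congr rfl fun j _ => by rw [hA]; ring
  have e2 : ∑ i, ∑ j, A i j * (z.mul u).d2 t x (eb i) (eb j) =
      z.v t x * ∑ i, ∑ j, A i j * u.d2 t x (eb i) (eb j) +
      u.v t x * ∑ i, ∑ j, A i j * z.d2 t x (eb i) (eb j) +
      ∑ i, ∑ j, A i j * z.d1 t x (eb i) * u.d1 t x (eb j) +
      ∑ i, ∑ j, A i j * (u.d1 t x (eb i) * z.d1 t x (eb j)) := by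
    simp only [mul_sum, ← sum_add_distrib, Jet.mul_d2_apply]
    exact sum_congr rfl fun i _ => sum_congr rfl fun j _ => by ring
  simp only [tr]
  rw [e2, e]
  ring

/-- The source produced by multiplying a solution with a cutoff. -/
def cutSrc (a : ℝ → (Fin d → ℝ) → Fin d → Fin d → ℝ) (z u : Jet (Fin d → ℝ)) (t : ℝ)
    (x : Fin d → ℝ) : ℝ :=
  z.dt t x * u.v t x - u.v t x * tr (a t x) (z.d2 t x) -
    ∑ i, ∑ j, a t x i j * z.d1 t x (eb i) * u.d1 t x (eb j)

theorem sol_cut {a : ℝ → (Fin d → ℝ) → Fin d → Fin d → ℝ} (ha : ∀ t x i j, a t x i j = a t x j i)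
    {z v : Jet (Fin d → ℝ)} (h : ∀ t x, z.v t x = 0 ∨ v.dt t x = tr (a t x) (v.d2 t x) - v.v t x) :
    Sol a (cutSrc a z v) (z.mul v) := by
  intro t x
  rw [tr_jet_mul (ha t x), cutSrc]
  simp only [Jet.mul]
  rcases h t x with h | h <;> rw [h] <;> ring

theorem Coef.bh {lam Λ : ℝ} {a : ℝ → (Fin d → ℝ) → Fin d → Fin d → ℝ} (ha : Coef lam Λ α a)
    (i j : Fin d) : BH α Λ fun t x => a t x i j :=
  ⟨fun t x => ha.bdd t x i j, fun t x y => ha.hol t x y i j⟩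

theorem src_cutSrc {lam Λ Q A N β : ℝ} {a : ℝ → (Fin d → ℝ) → Fin d → Fin d → ℝ}
    (ha : Coef lam Λ α a) (hα : 0 < α) (hα1 : α ≤ 1) {z u : Jet (Fin d → ℝ)} (hz : Reg α Q z)
    (hzt : BH α Q z.dt) (hβ : 0 < β) (hu : Reg β N u) (b0 : ∀ t x, |u.v t x| ≤ A)
    (b1 : ∀ t x, ‖u.d1 t x‖ ≤ A) (b2 : ∀ t x, ‖u.d2 t x‖ ≤ A) :
    Src α ((8 + 72 * d ^ 2 * Λ) * (Q * A)) (cutSrc a z u) := by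
  have hU := hu.bh_v hα.le hα1 b0 b1
  have hU1 := hu.bh_d1 hα.le hα1 b1 b2
  have hZ1 := hz.bh_d1 hα.le hα1 hz.b1 hz.b2
  have htr : (fun t x => tr (a t x) (z.d2 t x)) = fun t x => 1 / 2 * ∑ i, ∑ j,
      a t x i j * z.d2 t x (eb i) (eb j) := rfl
  have u1 : ∀ j, UC fun t x => u.d1 t x (eb j) := fun j =>
    UC.lip (b := fun K : (Fin d → ℝ) →L[ℝ] ℝ => K (eb j)) zero_le_one
      (fun K L => by simpa using abs_apply_eb_le_norm (K - L) j) (hu.uc1 hβ)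
  have z1 : ∀ j, UC fun t x => z.d1 t x (eb j) := fun j =>
    UC.lip (b := fun K : (Fin d → ℝ) →L[ℝ] ℝ => K (eb j)) zero_le_one
      (fun K L => by simpa using abs_apply_eb_le_norm (K - L) j) (hz.uc1 hα)
  have B1 := BH.const_mul (1 / 2) (BH.sum fun i => BH.sum fun j =>
    (ha.bh i j).mul (hz.bh_d2 i j))
  have B2 := BH.sum fun i => BH.sum fun j => ((ha.bh i j).mul (hZ1 i)).mul (hU1 j)
  rw [← htr] at B1
  have U1 : UC fun t x => tr (a t x) (z.d2 t x) := by
    rw [htr]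
    exact UC.const_mul _ (UC.sum _ fun i => UC.sum _ fun j => (ha.uc i j).mul
      ((hz.uc2 hα).apply_apply i j) (ha.bh i j).b (hz.bh_d2 i j).b)
  have U2 : UC fun t x => ∑ i, ∑ j, a t x i j * z.d1 t x (eb i) * u.d1 t x (eb j) :=
    UC.sum _ fun i => UC.sum _ fun j => ((ha.uc i j).mul (z1 i) (ha.bh i j).b (hZ1 i).b).mul
      (u1 j) ((ha.bh i j).mul (hZ1 i)).b (hU1 j).b
  refine BH.src ((((hzt.mul hU).sub (hU.mul B1)).sub B2).mono (le_of_eq ?_))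
    (((hz.uct.mul hu.ucv hzt.b b0).sub (hu.ucv.mul U1 b0 B1.b)).sub U2)
  simp only [Fintype.card_fin, abs_of_pos (show (0 : ℝ) < 1 / 2 by norm_num)]
  ring

theorem Jet.eq_of_v_eq {M N : ℝ} {β : ℝ} {u w : Jet (Fin d → ℝ)} (hu : Reg α M u) (hw : Reg β N w)
    (h : ∀ t x, u.v t x = w.v t x) : u = w := by
  have h0 : u.v = w.v := by funext t x; exact h t x
  have h1 : u.d1 = w.d1 := by
    funext t x; exact (hu.h1 t x).unique (by rw [h0]; exact hw.h1 t x)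
  have h2 : u.d2 = w.d2 := by
    funext t x; exact (hu.h2 t x).unique (by rw [h1]; exact hw.h2 t x)
  have h3 : u.dt = w.dt := by
    funext t x; exact (hu.ht t x).unique (by rw [h0]; exact hw.ht t x)
  cases u; cases w; simp_all

/-- Solutions of low regularity inherit the Hölder exponent of the data. -/
theorem Sol.upgrade {lam Λ C β N G : ℝ} {a : ℝ → (Fin d → ℝ) → Fin d → Fin d → ℝ}
    (ha : Coef lam Λ α a) (hl : 0 ≤ lam) (hα : 0 < α) (hβ : 0 < β) (hC : Solvable α C a)
    {w : Jet (Fin d → ℝ)} {g : ℝ → (Fin d → ℝ) → ℝ} (hw : Reg β N w) (hg : Src α G g)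
    (hs : Sol a g w) : Reg α (C * G) w := by
  obtain ⟨u, hu, hus⟩ := hC g G hg
  have hm : 0 < min α β := lt_min hα hβ
  have key := (hs.sub hus).abs_le (G := 0) ((hw.of_exponent_le hm.le (min_le_right _ _)).sub
    (hu.of_exponent_le hm.le (min_le_left _ _))) ha hl (by simp)
  rw [Jet.eq_of_v_eq hw hu fun t x => sub_eq_zero.1 (abs_nonpos_iff.1 (key t x))]
  exact hu

/-- Absorption along a sequence of nested estimates. -/
theorem absorb_seq {P : ℕ → ℝ → Prop} (hP : ∀ k x y, P k x → x ≤ y → P k y) {b : ℕ → ℝ}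
    (hb : ∀ k, 0 ≤ b k) {C : ℝ} (hC : 0 < C) (h0 : ∃ B, 0 ≤ B ∧ ∀ k, P k (B * b k))
    (h : ∀ B, 0 ≤ B → (∀ k, P k (B * b k)) → ∀ k, P k ((B / 2 + C) * b k)) (k : ℕ) :
    P k (3 * C * b k) := by
  obtain ⟨B, hB, hF⟩ := h0
  have key : ∀ n : ℕ, ∀ k, P k ((B / 2 ^ n + 2 * C) * b k) := by
    intro n
    induction n with
    | zero => exact fun k => hP k _ _ (hF k) (by have := hb k; gcongr; simp; linarith)
    | succ n ih =>
      intro k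
      refine hP k _ _ (h _ (by positivity) ih k) (le_of_eq ?_)
      rw [pow_succ]; ring
  have hlim : Tendsto (fun n : ℕ => B * (1 / 2 : ℝ) ^ n) atTop (𝓝 (B * 0)) :=
    (tendsto_pow_atTop_nhds_zero_of_lt_one (by norm_num) (by norm_num)).const_mul B
  rw [mul_zero] at hlim
  obtain ⟨n, hn⟩ := (hlim.eventually (ge_mem_nhds hC)).exists
  refine hP k _ _ (key n k) (mul_le_mul_of_nonneg_right ?_ (hb k))
  have : B / 2 ^ n = B * (1 / 2) ^ n := by rw [one_div, inv_pow]; rfl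
  linarith

theorem Jet.comp_d2_eq_zero {z : Jet (Fin d → ℝ)} {Φ Φ1 Φ2 : ℝ → ℝ} {t : ℝ} {x : Fin d → ℝ}
    (h1 : Φ1 (z.v t x) = 0) (h2 : Φ2 (z.v t x) = 0) : (z.comp Φ Φ1 Φ2).d2 t x = 0 :=
  ContinuousLinearMap.ext fun h => ContinuousLinearMap.ext fun k => by
    change Φ1 (z.v t x) * z.d2 t x h k + (Φ2 (z.v t x) * z.d1 t x h) * z.d1 t x k = 0
    rw [h1, h2]; ring

/-- A nested sequence of cutoffs on the superlevel sets of a smooth bump. -/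
theorem exists_cutoffs (hα : 0 < α) (hα1 : α ≤ 1) {φ : ℝ × (Fin d → ℝ) → ℝ}
    (hφ : ContDiff ℝ 3 φ) (hs : HasCompactSupport φ) :
    ∃ K0, 0 ≤ K0 ∧ ∃ ζ : ℕ → Jet (Fin d → ℝ),
      (∀ k, Reg α (K0 * 8 ^ k) (ζ k) ∧ BH α (K0 * 8 ^ k) (ζ k).dt) ∧
      (∀ k t x, 2 ^ k * φ (t, x) < 1 → (ζ k).v t x = 0 ∧ (ζ k).d1 t x = 0 ∧
        (ζ k).d2 t x = 0 ∧ (ζ k).dt t x = 0) ∧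
      (∀ k t x, 3 / 2 < 2 ^ k * φ (t, x) → (ζ k).v t x = 1 ∧ (ζ k).d1 t x = 0 ∧
        (ζ k).d2 t x = 0) ∧ ∀ k t x, |(ζ k).v t x| ≤ 1 := by
  obtain ⟨θ, θ1, θ2, L, hL, hθ1, hθ2, b0, b1, b2, b3, lo, hi⟩ := exists_profile
  obtain ⟨N0, hZ, hZt⟩ := reg_smoothJet hα.le hα1 hφ hs
  have hN0 := hZ.nonneg
  set K0 : ℝ := (1 + d * (d + 1)) * (200 * (1 + N0) ^ 3) with hK0
  let ζ : ℕ → Jet (Fin d → ℝ) := fun k => (smoothJet φ).comp (fun s => θ (2 ^ k * s))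
    (fun s => 2 ^ k * θ1 (2 ^ k * s)) (fun s => 4 ^ k * θ2 (2 ^ k * s))
  have p24 : ∀ k : ℕ, (2 : ℝ) ^ k * 2 ^ k = 4 ^ k := fun k => by rw [← mul_pow]; norm_num
  have p28 : ∀ k : ℕ, (4 : ℝ) ^ k * 2 ^ k = 8 ^ k := fun k => by rw [← mul_pow]; norm_num
  have hζ : ∀ k, Reg α (K0 * (L * 8 ^ k)) (ζ k) ∧ BH α (K0 * (L * 8 ^ k)) (ζ k).dt := by
    intro k
    have q0 : (0 : ℝ) < 2 ^ k := by positivity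
    have q2 : (2 : ℝ) ^ k ≤ 8 ^ k := by gcongr; norm_num
    have q4 : (4 : ℝ) ^ k ≤ 8 ^ k := by gcongr; norm_num
    have q1 : (1 : ℝ) ≤ 8 ^ k := one_le_pow₀ (by norm_num)
    have hin : ∀ s, HasDerivAt (fun s : ℝ => 2 ^ k * s) (2 ^ k) s := fun s => by
      simpa using (hasDerivAt_id s).const_mul ((2 : ℝ) ^ k)
    have := hZ.comp (Q := L * 8 ^ k) hZt hα hα1 (Φ := fun s => θ (2 ^ k * s))
      (Φ1 := fun s => 2 ^ k * θ1 (2 ^ k * s)) (Φ2 := fun s => 4 ^ k * θ2 (2 ^ k * s))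
      (fun s => ((hθ1 _).comp s (hin s)).congr_deriv (mul_comm _ _))
      (fun s => by
        have := ((hθ2 _).comp s (hin s)).const_mul ((2 : ℝ) ^ k)
        refine this.congr_deriv ?_
        rw [← p24 k]; ring)
      (fun s => by
        rw [abs_of_nonneg (b0 _).1]
        nlinarith [(b0 (2 ^ k * s)).2])
      (fun s => by
        rw [abs_mul, abs_of_pos q0, mul_comm]
        exact mul_le_mul (b1 _) q2 q0.le (by linarith))
      (fun s => by
        rw [abs_mul, abs_of_pos (by positivity : (0 : ℝ) < 4 ^ k), mul_comm]
        exact mul_le_mul (b2 _) q4 (by positivity) (by linarith))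
      (fun s r => by
        rw [← mul_sub, abs_mul, abs_of_pos (by positivity : (0 : ℝ) < 4 ^ k)]
        have := b3 (2 ^ k * s) (2 ^ k * r)
        rw [← mul_sub, abs_mul, abs_of_pos q0] at this
        calc _ ≤ 4 ^ k * (L * (2 ^ k * |s - r|)) := by gcongr
          _ = _ := by rw [← p28 k]; ring)
    simpa only [hK0, mul_assoc] using this
  refine ⟨K0 * L, by positivity, ζ, fun k => by simpa only [mul_assoc] using hζ k, ?_, ?_, ?_⟩
  · intro k t x h
    obtain ⟨e0, e1, e2⟩ := lo _ h
    have f1 : 2 ^ k * θ1 (2 ^ k * (smoothJet φ).v t x) = 0 := mul_eq_zero_of_right _ e1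
    have f2 : 4 ^ k * θ2 (2 ^ k * (smoothJet φ).v t x) = 0 := mul_eq_zero_of_right _ e2
    refine ⟨e0, ?_, Jet.comp_d2_eq_zero f1 f2, ?_⟩
    · exact (congrArg (· • (smoothJet φ).d1 t x) f1).trans (zero_smul ℝ _)
    · exact mul_eq_zero_of_left f1 _
  · intro k t x h
    obtain ⟨e0, e1, e2⟩ := hi _ h
    have f1 : 2 ^ k * θ1 (2 ^ k * (smoothJet φ).v t x) = 0 := mul_eq_zero_of_right _ e1
    have f2 : 4 ^ k * θ2 (2 ^ k * (smoothJet φ).v t x) = 0 := mul_eq_zero_of_right _ e2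
    refine ⟨e0, ?_, Jet.comp_d2_eq_zero f1 f2⟩
    exact (congrArg (· • (smoothJet φ).d1 t x) f1).trans (zero_smul ℝ _)
  · intro k t x
    have := b0 (2 ^ k * (smoothJet φ).v t x)
    exact (abs_of_nonneg this.1).trans_le this.2

theorem interior_estimate {lam Λ : ℝ} {a : ℝ → (Fin d → ℝ) → Fin d → Fin d → ℝ} (hα : 0 < α)
    (hα1 : α < 1) (ha : Coef lam Λ α a) (hl : 0 < lam) (hΛ : 0 ≤ Λ)
    {φ : ℝ × (Fin d → ℝ) → ℝ} (hφ : ContDiff ℝ 3 φ) (hs : HasCompactSupport φ) :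
    ∃ C, 0 ≤ C ∧ ∀ (β N M : ℝ) (v : Jet (Fin d → ℝ)), 0 < β → Reg β N v → 0 < M →
      (∀ t x, 0 < φ (t, x) → v.dt t x = tr (a t x) (v.d2 t x) - v.v t x ∧ |v.v t x| ≤ M) →
      ∀ t x, 3 / 2 < φ (t, x) → ‖v.d1 t x‖ ≤ C * M ∧ ‖v.d2 t x‖ ≤ C * M := by
  obtain ⟨K0, hK0, ζ, hζ, hz0, hz1, hζ1⟩ := exists_cutoffs (d := d) hα hα1.le hφ hs
  obtain ⟨C0, hC0, hsolv, -⟩ := ha.solvable hα hα1 hl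
  set K : ℝ := C0 * ((8 + 72 * d ^ 2 * Λ) * K0) + 1 with hK
  have hKpos : 0 < K := by positivity
  set R : ℝ := 8 ^ (1 / α) with hR
  have hR1 : 1 ≤ R := Real.one_le_rpow (by norm_num) (by positivity)
  have hRα : R ^ α = 8 := by
    rw [hR, ← Real.rpow_mul (by norm_num), one_div_mul_cancel hα.ne', Real.rpow_one]
  set b : ℝ := 8 * R ^ 2 with hb
  have hb8 : 8 ≤ b := by nlinarith
  set s0 : ℝ := 1 / 2 * (1 / (2 * K * b)) ^ (1 / α) with hs0
  have hs0' : 0 < s0 := by positivity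
  have hsα : ∀ k : ℕ, (2 * (s0 / R ^ k)) ^ α = 1 / (2 * K * b) / 8 ^ k := by
    intro k
    have e : 2 * (s0 / R ^ k) = (1 / (2 * K * b)) ^ (1 / α) / R ^ k := by rw [hs0]; ring
    rw [e, Real.div_rpow (by positivity) (by positivity), ← Real.rpow_mul (by positivity),
      one_div_mul_cancel hα.ne', Real.rpow_one, ← Real.rpow_natCast, ← Real.rpow_mul (by positivity),
      mul_comm (k : ℝ) α, Real.rpow_mul (by positivity), hRα, Real.rpow_natCast]
  set C : ℝ := K * (4 / s0 ^ 2 + 2) with hC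
  have hCpos : 0 < C := by positivity
  refine ⟨3 * C, by positivity, fun β N M v hβ hv hM hvs => ?_⟩
  have hN := hv.nonneg
  have hφpos : ∀ k t x, 1 ≤ 2 ^ k * φ (t, x) → 0 < φ (t, x) := fun k t x h => by
    by_contra hc
    have : (0 : ℝ) < 2 ^ k := by positivity
    nlinarith
  let w : ℕ → Jet (Fin d → ℝ) := fun k => (ζ k).mul v
  have hws : ∀ k, Sol a (cutSrc a (ζ k) v) (w k) := fun k => sol_cut ha.symm fun t x => by
    rcases lt_or_ge (2 ^ k * φ (t, x)) 1 with h | h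
    · exact Or.inl (hz0 k t x h).1
    · exact Or.inr (hvs t x (hφpos k t x h)).1
  have hwreg : ∀ k, ∃ N', Reg (min α β) N' (w k) := fun k =>
    ((hζ k).1.of_exponent_le (lt_min hα hβ).le (min_le_left _ _)).mul
      (hv.of_exponent_le (lt_min hα hβ).le (min_le_right _ _)) (lt_min hα hβ)
      ((min_le_left _ _).trans hα1.le)
  have up : ∀ k A, Src α ((8 + 72 * d ^ 2 * Λ) * (K0 * 8 ^ k * A)) (cutSrc a (ζ k) v) →
      0 ≤ A → Reg α (K * 8 ^ k * A) (w k) := by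
    intro k A h hA
    obtain ⟨N', hN'⟩ := hwreg k
    refine (Sol.upgrade ha hl.le hα (lt_min hα hβ) hsolv hN' h (hws k)).mono ?_
    calc _ = C0 * ((8 + 72 * d ^ 2 * Λ) * K0) * 8 ^ k * A := by ring
      _ ≤ _ := by gcongr; rw [hK]; linarith
  have hwM : ∀ k t x, |(w k).v t x| ≤ M := by
    intro k t x
    rcases lt_or_ge (2 ^ k * φ (t, x)) 1 with h | h
    · simpa [w, Jet.mul, (hz0 k t x h).1] using hM.le
    · have h1 := (hvs t x (hφpos k t x h)).2
      simp only [w, Jet.mul, abs_mul]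
      nlinarith [mul_le_mul (hζ1 k t x) h1 (abs_nonneg _) zero_le_one]
  have hcut : ∀ k, cutSrc a (ζ k) v = cutSrc a (ζ k) (w (k + 1)) := by
    intro k
    funext t x
    rcases lt_or_ge (2 ^ k * φ (t, x)) 1 with h | h
    · obtain ⟨-, e1, e2, e3⟩ := hz0 k t x h
      simp [cutSrc, e1, e2, e3, tr]
    · obtain ⟨e0, e1, -⟩ := hz1 (k + 1) t x (by rw [pow_succ]; linarith)
      simp [cutSrc, w, Jet.mul, e0, e1]
  have key := absorb_seq (P := fun k y => Reg α y (w k)) (b := fun k => b ^ k * M)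
    (fun k x y h hxy => h.mono hxy) (fun k => by positivity) hCpos
    ⟨K * N / M, by positivity, fun k => ?_⟩ (fun B hB hF k => ?_) 0
  · intro t x h
    obtain ⟨e0, e1, e2⟩ := hz1 0 t x (by simpa using h)
    have d1 := key.b1 t x
    have d2 := key.b2 t x
    have e : (w 0).d2 t x = v.d2 t x :=
      ContinuousLinearMap.ext fun h => ContinuousLinearMap.ext fun k => by
        rw [Jet.mul_d2_apply, e0, e1, e2]; simp
    rw [e] at d2
    simp only [w, Jet.mul, e0, e1, smul_zero, one_smul, add_zero, pow_zero, one_mul] at d1 d2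
    exact ⟨d1, d2⟩
  · refine (up k N (src_cutSrc ha hα hα1.le (hζ k).1 (hζ k).2 hβ hv hv.bv hv.b1 hv.b2)
      hN).mono ?_
    calc K * 8 ^ k * N ≤ K * b ^ k * N := by gcongr
      _ = _ := by field_simp
  · have hR0 : 0 < R := by linarith
    set A : ℝ := B * (b ^ (k + 1) * M) * (2 * (s0 / R ^ k)) ^ α + 4 * M / (s0 / R ^ k) ^ 2 + 2 * M
      with hA
    have hA1 : 0 ≤ B * (b ^ (k + 1) * M) * (2 * (s0 / R ^ k)) ^ α := by positivity
    have hA2 : 0 ≤ 4 * M / (s0 / R ^ k) ^ 2 := by positivity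
    have hsup := (hF (k + 1)).sup_bounds hα.le (by positivity) (hF (k + 1)).hol (hwM (k + 1))
      (s := s0 / R ^ k) (by positivity)
    have hsrc := src_cutSrc ha hα hα1.le (hζ k).1 (hζ k).2 hα (hF (k + 1)) (A := A)
      (fun t x => (hwM (k + 1) t x).trans (by linarith))
      (fun t x => (hsup t x).2) (fun t x => (hsup t x).1.trans (by linarith))
    rw [← hcut k] at hsrc
    refine (up k A hsrc (by linarith)).mono ?_
    have hbk : b ^ k = 8 ^ k * (R ^ k) ^ 2 := by rw [hb, mul_pow, ← pow_mul, ← pow_mul, mul_comm 2]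
    have e : K * 8 ^ k * A = B / 2 * (b ^ k * M) + K * (4 / s0 ^ 2) * (b ^ k * M) +
        2 * (K * 8 ^ k) * M := by
      rw [hA, hsα k]
      have e1 : K * 8 ^ k * (B * (b ^ (k + 1) * M) * (1 / (2 * K * b) / 8 ^ k)) =
          B / 2 * (b ^ k * M) := by
        rw [pow_succ]; field_simp
      have e2 : K * 8 ^ k * (4 * M / (s0 / R ^ k) ^ 2) = K * (4 / s0 ^ 2) * (b ^ k * M) := by
        rw [hbk]; field_simp
      rw [mul_add, mul_add, e1, e2]; ring
    rw [e]
    have h8 : K * 8 ^ k * M ≤ K * b ^ k * M := by gcongr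
    rw [hC]
    calc _ ≤ B / 2 * (b ^ k * M) + K * (4 / s0 ^ 2) * (b ^ k * M) + 2 * (K * b ^ k * M) := by
          linarith
      _ = _ := by ring

end Interior

section Clamp

variable {d : ℕ}

/-- Hölder bounds on a compact set from a local Hölder condition. -/
theorem holder_of_compact {X : Type*} [PseudoMetricSpace X] {b : X → ℝ} {K : Set X}
    (hK : IsCompact K) (hb : ContinuousOn b K)
    (h : ∀ p ∈ K, ∃ U ∈ 𝓝[K] p, ∃ α C : ℝ, 0 < α ∧ α ≤ 1 ∧ 0 ≤ C ∧
      ∀ q ∈ U, ∀ q' ∈ U, |b q - b q'| ≤ C * dist q q' ^ α) :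
    ∀ᶠ α in 𝓝[>] (0 : ℝ), ∀ᶠ C in (atTop : Filter ℝ), ∀ q ∈ K, ∀ q' ∈ K,
      |b q - b q'| ≤ C * dist q q' ^ α := by
  obtain ⟨M, hM⟩ := hK.exists_bound_of_continuousOn hb
  refine hK.induction_on (p := fun s => ∀ᶠ α in 𝓝[>] (0 : ℝ), ∀ᶠ C in (atTop : Filter ℝ),
    ∀ q ∈ s, ∀ q' ∈ K, |b q - b q'| ≤ C * dist q q' ^ α) (by simp) ?_ ?_ fun p hp => ?_
  · intro s t hst H
    filter_upwards [H] with α H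
    filter_upwards [H] with C H q hq using H q (hst hq)
  · intro s t H1 H2
    filter_upwards [H1, H2] with α H1 H2
    filter_upwards [H1, H2] with C H1 H2 q hq
    exact hq.elim (H1 q) (H2 q)
  · obtain ⟨U, hU, β, C0, hβ, hβ1, hC0, H⟩ := h p hp
    obtain ⟨r0, hr0, hr⟩ := Metric.mem_nhdsWithin_iff.1 hU
    set r := min (r0 / 2) 1 with hrd
    have hrp : 0 < r := by positivity
    have hr1 : r ≤ 1 := min_le_right _ _
    have hr2 : r ≤ r0 / 2 := min_le_left _ _
    have hM0 : 0 ≤ M := (norm_nonneg _).trans (hM p hp)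
    refine ⟨Metric.ball p r ∩ K, inter_mem (mem_nhdsWithin_of_mem_nhds (Metric.ball_mem_nhds p hrp))
      self_mem_nhdsWithin, ?_⟩
    filter_upwards [Ioo_mem_nhdsGT hβ] with α hα
    filter_upwards [eventually_ge_atTop (C0 + 2 * M / r)] with C hC q hq q' hq'
    have hMr : 0 ≤ 2 * M / r := by positivity
    have hq1 : dist q p < r := hq.1
    rcases lt_or_ge (dist q q') r with hd | hd
    · have h1 : q ∈ U := hr ⟨by rw [Metric.mem_ball]; linarith, hq.2⟩
      have h2 : q' ∈ U := hr ⟨by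
        rw [Metric.mem_ball]; linarith [dist_triangle_left q' p q], hq'⟩
      refine (H q h1 q' h2).trans ?_
      calc C0 * dist q q' ^ β ≤ C0 * dist q q' ^ α :=
            mul_le_mul_of_nonneg_left (Real.rpow_le_rpow_of_exponent_ge' dist_nonneg
              (by linarith) hα.1.le hα.2.le) hC0
        _ ≤ _ := by gcongr; linarith
    · have hrα : r ≤ dist q q' ^ α := by
        calc r = r ^ (1 : ℝ) := (Real.rpow_one r).symm
          _ ≤ r ^ α := Real.rpow_le_rpow_of_exponent_ge hrp hr1 (by linarith [hα.2])
          _ ≤ _ := Real.rpow_le_rpow hrp.le hd hα.1.le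
      have h1 := hM q hq.2
      have h2 := hM q' hq'
      rw [Real.norm_eq_abs] at h1 h2
      calc |b q - b q'| ≤ |b q| + |b q'| := abs_sub _ _
        _ ≤ 2 * M / r * r := by rw [div_mul_cancel₀ _ hrp.ne']; linarith
        _ ≤ 2 * M / r * dist q q' ^ α := by gcongr
        _ ≤ _ := by gcongr; linarith

/-- Positive definite continuous matrices are uniformly elliptic on compact sets. -/
theorem elliptic_of_compact {X : Type*} [TopologicalSpace X] {A : X → Fin d → Fin d → ℝ}
    {K : Set X} (hK : IsCompact K) (hA : ∀ i j, ContinuousOn (fun p => A p i j) K)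
    (h : ∀ p ∈ K, ∀ y : Fin d → ℝ, y ≠ 0 → 0 < ∑ i, ∑ j, A p i j * y i * y j) :
    ∃ lam : ℝ, 0 < lam ∧ ∀ p ∈ K, ∀ y : Fin d → ℝ,
      lam * ‖y‖ ^ 2 ≤ ∑ i, ∑ j, A p i j * y i * y j := by
  have hc : ContinuousOn (fun q : X × (Fin d → ℝ) => ∑ i, ∑ j, A q.1 i j * q.2 i * q.2 j)
      (K ×ˢ Metric.sphere 0 1) := by
    refine continuousOn_finsetSum _ fun i _ => continuousOn_finsetSum _ fun j _ => ?_
    refine (((hA i j).comp continuousOn_fst fun q hq => hq.1).mul ?_).mul ?_ <;> fun_prop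
  obtain ⟨lam, hl, H⟩ : ∃ lam : ℝ, 0 < lam ∧ ∀ q ∈ K ×ˢ Metric.sphere (0 : Fin d → ℝ) 1,
      lam ≤ ∑ i, ∑ j, A q.1 i j * q.2 i * q.2 j := by
    rcases (K ×ˢ Metric.sphere (0 : Fin d → ℝ) 1).eq_empty_or_nonempty with he | hne
    · exact ⟨1, one_pos, by simp [he]⟩
    · obtain ⟨q, hq, hmin⟩ := (hK.prod (isCompact_sphere _ _)).exists_isMinOn hne hc
      refine ⟨_, h q.1 hq.1 q.2 (fun h0 => ?_), fun q' hq' => hmin hq'⟩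
      have : ‖q.2‖ = 1 := by simpa using hq.2
      rw [h0, norm_zero] at this
      exact zero_ne_one this
  refine ⟨lam, hl, fun p hp y => ?_⟩
  rcases eq_or_ne y 0 with rfl | hy
  · simp
  · have hn : 0 < ‖y‖ := norm_pos_iff.2 hy
    have := H (p, ‖y‖⁻¹ • y) ⟨hp, by simp [norm_smul, hn.ne']⟩
    have e : ∑ i, ∑ j, A p i j * (‖y‖⁻¹ • y) i * (‖y‖⁻¹ • y) j =
        (∑ i, ∑ j, A p i j * y i * y j) / ‖y‖ ^ 2 := by
      rw [sum_div]
      refine sum_congr rfl fun i _ => ?_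
      rw [sum_div]
      refine sum_congr rfl fun j _ => ?_
      simp only [Pi.smul_apply, smul_eq_mul]
      field_simp
    simp only at this
    rw [e, le_div_iff₀ (by positivity)] at this
    exact this

/-- Projection of the reals onto `[l, u]`. -/
def clamp (l u s : ℝ) : ℝ := max l (min u s)

theorem abs_clamp_sub_le (l u s r : ℝ) : |clamp l u s - clamp l u r| ≤ |s - r| := by
  have h1 := abs_max_sub_max_le_abs (min u s) (min u r) l
  have h2 := abs_min_sub_min_le_max u s u r
  rw [sub_self, abs_zero, max_eq_right (abs_nonneg (s - r))] at h2
  rw [clamp, clamp, max_comm l, max_comm l]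
  exact h1.trans h2

theorem clamp_mem {l u : ℝ} (h : l ≤ u) (s : ℝ) : clamp l u s ∈ Set.Icc l u :=
  ⟨le_max_left _ _, max_le h (min_le_left _ _)⟩

theorem clamp_of_mem {l u s : ℝ} (h : s ∈ Set.Icc l u) : clamp l u s = s := by
  rw [clamp, min_eq_right h.2, max_eq_right h.1]

/-- The coefficients in reversed time, frozen outside `[0,σ] × [-r,r]^d`. -/
def clampCoef (T σ r : ℝ) (a : ℝ → (Fin d → ℝ) → Fin d → Fin d → ℝ) (τ : ℝ) (x : Fin d → ℝ) :
    Fin d → Fin d → ℝ :=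
  a (clamp 0 σ (T - τ)) fun i => clamp (-r) r (x i)

theorem norm_clamp_le {r : ℝ} (hr : 0 ≤ r) (x : Fin d → ℝ) :
    ‖fun i => clamp (-r) r (x i)‖ ≤ min ‖x‖ r := by
  refine (pi_norm_le_iff_of_nonneg (le_min (norm_nonneg _) hr)).2 fun i => le_min ?_ ?_
  · have h := abs_clamp_sub_le (-r) r (x i) 0
    rw [clamp_of_mem (s := 0) ⟨by linarith, hr⟩, sub_zero, sub_zero] at h
    exact h.trans (norm_le_pi_norm x i)
  · exact _root_.abs_le.2 (clamp_mem (by linarith) _)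

theorem clampCoef_of_mem {T σ r τ : ℝ} {a : ℝ → (Fin d → ℝ) → Fin d → Fin d → ℝ}
    {x : Fin d → ℝ} (hτ : T - σ ≤ τ) (hx : ‖x‖ ≤ r) :
    clampCoef T σ r a τ x = a (max 0 (T - τ)) x := by
  have e : clamp 0 σ (T - τ) = max 0 (T - τ) := by rw [clamp, min_eq_right (by linarith)]
  have e' : (fun i => clamp (-r) r (x i)) = x := funext fun i =>
    clamp_of_mem (_root_.abs_le.1 ((norm_le_pi_norm x i).trans hx))
  rw [clampCoef, e, e']

theorem dist_clamp_le (T σ r : ℝ) (t s : ℝ) (x y : Fin d → ℝ) :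
    dist ((clamp 0 σ (T - t), fun i => clamp (-r) r (x i)) : ℝ × (Fin d → ℝ))
      (clamp 0 σ (T - s), fun i => clamp (-r) r (y i)) ≤ max |t - s| ‖x - y‖ := by
  rw [Prod.dist_eq]
  refine max_le_max ?_ ?_
  · rw [Real.dist_eq]
    refine (abs_clamp_sub_le _ _ _ _).trans_eq ?_
    rw [abs_sub_comm t s]; congr 1; ring
  · refine (dist_pi_le_iff (norm_nonneg _)).2 fun i => ?_
    rw [Real.dist_eq]
    exact (abs_clamp_sub_le _ _ _ _).trans (norm_le_pi_norm (x - y) i)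

theorem coef_clampCoef {T σ r : ℝ} {a : ℝ → (Fin d → ℝ) → Fin d → Fin d → ℝ}
    (hcont : ∀ i j, ContinuousOn (fun p : ℝ × (Fin d → ℝ) => a p.1 p.2 i j)
      (Set.Icc 0 T ×ˢ (Set.univ : Set (Fin d → ℝ))))
    (hsymm : ∀ t ∈ Set.Icc (0 : ℝ) T, ∀ x : Fin d → ℝ, ∀ i j, a t x i j = a t x j i)
    (hpd : ∀ t ∈ Set.Icc (0 : ℝ) T, ∀ x : Fin d → ℝ, ∀ y : Fin d → ℝ, y ≠ 0 →
      0 < ∑ i, ∑ j, a t x i j * y i * y j)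
    (hhol : ∀ i j, LocallyHolderOn (fun p : ℝ × (Fin d → ℝ) => a p.1 p.2 i j)
      (Set.Ico 0 T ×ˢ (Set.univ : Set (Fin d → ℝ))))
    (hσ : 0 ≤ σ) (hσT : σ < T) (hr : 0 ≤ r) :
    ∃ lam Λ α, 0 < lam ∧ 0 ≤ Λ ∧ 0 < α ∧ α < 1 ∧ Coef lam Λ α (clampCoef T σ r a) := by
  set K : Set (ℝ × (Fin d → ℝ)) := Set.Icc 0 σ ×ˢ Metric.closedBall 0 r with hKd
  have hK : IsCompact K := isCompact_Icc.prod (isCompact_closedBall _ _)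
  have hK1 : K ⊆ Set.Icc 0 T ×ˢ (Set.univ : Set (Fin d → ℝ)) := fun p hp =>
    ⟨⟨hp.1.1, hp.1.2.trans hσT.le⟩, trivial⟩
  have hK2 : K ⊆ Set.Ico 0 T ×ˢ (Set.univ : Set (Fin d → ℝ)) := fun p hp =>
    ⟨⟨hp.1.1, hp.1.2.trans_lt hσT⟩, trivial⟩
  have hmem : ∀ (t : ℝ) (x : Fin d → ℝ),
      ((clamp 0 σ (T - t), fun i => clamp (-r) r (x i)) : ℝ × (Fin d → ℝ)) ∈ K := fun t x =>
    ⟨clamp_mem hσ _, by simpa using (norm_clamp_le hr x).trans (min_le_right _ _)⟩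
  have hH := fun i j => holder_of_compact hK ((hcont i j).mono hK1) fun p hp => by
    obtain ⟨U, hU, α, C, h⟩ := hhol i j p (hK2 hp)
    exact ⟨U, nhdsWithin_mono p hK2 hU, α, C, h⟩
  have hH' := eventually_all.2 fun i => eventually_all.2 fun j => hH i j
  obtain ⟨α, hα, hα01⟩ := (hH'.and (Ioo_mem_nhdsGT one_pos)).exists
  have hα' := eventually_all.2 fun i => eventually_all.2 fun j => hα i j
  obtain ⟨lam, hl, hlam⟩ := elliptic_of_compact (A := fun p : ℝ × (Fin d → ℝ) => a p.1 p.2) hK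
    (fun i j => (hcont i j).mono hK1) fun p hp => hpd p.1 (hK1 hp).1 p.2
  have hB : ∀ᶠ C in (atTop : Filter ℝ), ∀ i j, ∀ p ∈ K, |a p.1 p.2 i j| ≤ C :=
    eventually_all.2 fun i => eventually_all.2 fun j => by
      obtain ⟨M, hM⟩ := hK.exists_bound_of_continuousOn ((hcont i j).mono hK1)
      filter_upwards [eventually_ge_atTop M] with C hC p hp using (hM p hp).trans hC
  obtain ⟨Λ, ⟨hΛ, hΛB⟩, hΛ0⟩ := ((hα'.and hB).and (eventually_ge_atTop 0)).exists
  have key : ∀ t s x y i j, |clampCoef T σ r a t x i j - clampCoef T σ r a s y i j| ≤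
      Λ * max |t - s| ‖x - y‖ ^ α := fun t s x y i j =>
    (hΛ i j _ (hmem t x) _ (hmem s y)).trans (mul_le_mul_of_nonneg_left
      (Real.rpow_le_rpow dist_nonneg (dist_clamp_le T σ r t s x y) hα01.1.le) hΛ0)
  refine ⟨lam, Λ, α, hl, hΛ0, hα01.1, hα01.2, ⟨fun t x i j => hsymm _ (hK1 (hmem t x)).1 _ i j,
    fun t x y => hlam _ (hmem t x) y, fun t x i j => hΛB i j _ (hmem t x), fun t x y i j => ?_,
    fun i j => ?_⟩⟩
  · simpa using key t t x y i j
  · intro ε hε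
    have hlim : Tendsto (fun s : ℝ => Λ * s ^ α) (𝓝[>] 0) (𝓝 (Λ * 0 ^ α)) :=
      (((Real.continuous_rpow_const hα01.1.le).tendsto 0).mono_left nhdsWithin_le_nhds).const_mul Λ
    rw [Real.zero_rpow hα01.1.ne', mul_zero] at hlim
    obtain ⟨δ, hδ, hδ0⟩ := ((hlim.eventually (ge_mem_nhds hε)).and self_mem_nhdsWithin).exists
    refine ⟨δ, hδ0, fun t s x y h1 h2 => ?_⟩
    rw [Real.norm_eq_abs]
    refine ((key t s x y i j).trans ?_).trans hδ
    gcongr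
    · exact hα01.1.le
    · exact max_le h1.le h2.le

theorem abs_clampCoef_le {T σ r c : ℝ} {a : ℝ → (Fin d → ℝ) → Fin d → Fin d → ℝ} (hc : 0 ≤ c)
    (hg : ∀ t ∈ Set.Icc (0 : ℝ) T, ∀ x : Fin d → ℝ, ∀ i j, |a t x i j| ≤ c * (1 + ‖x‖ ^ 2))
    (hσ : 0 ≤ σ) (hσT : σ ≤ T) (hr : 0 ≤ r) (τ : ℝ) (x : Fin d → ℝ) (i j : Fin d) :
    |clampCoef T σ r a τ x i j| ≤ c * (1 + ‖x‖ ^ 2) := by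
  have h := clamp_mem hσ (T - τ)
  refine (hg _ ⟨h.1, h.2.trans hσT⟩ _ i j).trans ?_
  have := (norm_clamp_le hr x).trans (min_le_left _ _)
  gcongr

end Clamp

section Estimates

variable {d : ℕ} {α : ℝ}

/-- Symmetric positive semidefinite coefficients of at most quadratic growth. -/
structure QuadCoef (c : ℝ) (a : ℝ → (Fin d → ℝ) → Fin d → Fin d → ℝ) : Prop where
  nonneg : 0 ≤ c
  symm : ∀ t x i j, a t x i j = a t x j i
  psd : ∀ t x, ∀ y : Fin d → ℝ, 0 ≤ ∑ i, ∑ j, a t x i j * y i * y j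
  growth : ∀ t x i j, |a t x i j| ≤ c * (1 + ‖x‖ ^ 2)

theorem QuadCoef.comparison {c : ℝ} {a : ℝ → (Fin d → ℝ) → Fin d → Fin d → ℝ}
    (h : QuadCoef c a) {φ : ℝ → (Fin d → ℝ) → ℝ} {t₀ S C : ℝ} (m : ℕ)
    (hc : Continuous fun q : ℝ × (Fin d → ℝ) => φ q.1 q.2)
    (hC : ∀ t ∈ Set.Icc t₀ S, ∀ x, φ t x ≤ C * barr m x) (h0 : ∀ x, φ t₀ x ≤ 0)
    (hsub : ∀ t ∈ Set.Ioc t₀ S, ∀ x, 0 < φ t x → SubAt a φ t x 0) :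
    ∀ t ∈ Set.Icc t₀ S, ∀ x, φ t x ≤ 0 :=
  _root_.comparison m h.nonneg (fun t _ => h.symm t) (fun t _ => h.psd t) (fun t _ => h.growth t)
    hc.continuousOn hC h0 hsub

theorem QuadCoef.tr_barr2_le {c : ℝ} {a : ℝ → (Fin d → ℝ) → Fin d → Fin d → ℝ}
    (h : QuadCoef c a) (m : ℕ) (t : ℝ) (x : Fin d → ℝ) :
    tr (a t x) (barr2 m x) ≤ rate d c m * barr m x :=
  (le_abs_self _).trans (abs_tr_barr2_le h.nonneg (h.growth t x) m)

theorem rate_nonneg {c : ℝ} (hc : 0 ≤ c) (d m : ℕ) : 0 ≤ rate d c m := by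
  rw [rate]; positivity

theorem hasDerivAt_mul_exp (L t₀ t : ℝ) :
    HasDerivAt (fun s => Real.exp (L * (s - t₀))) (L * Real.exp (L * (t - t₀))) t := by
  refine ((((hasDerivAt_id t).sub_const t₀).const_mul L).exp).congr_deriv ?_
  simp [mul_comm]

/-- A bounded solution vanishes as long as the source does. -/
theorem Sol.vanish {c N : ℝ} {a : ℝ → (Fin d → ℝ) → Fin d → Fin d → ℝ} (h : QuadCoef c a)
    {w : Jet (Fin d → ℝ)} {g : ℝ → (Fin d → ℝ) → ℝ} (hw : Reg α N w) (hs : Sol a g w)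
    (hg : ∀ t ≤ 0, ∀ x, g t x = 0) {t : ℝ} (ht : t ≤ 0) (x : Fin d → ℝ) : w.v t x = 0 := by
  have hN := hw.nonneg
  have key : ∀ s : ℝ, |s| = 1 → ∀ t₀ ≤ t, s * w.v t x ≤ N * Real.exp (-1 * (t - t₀)) := by
    intro s hs1 t₀ h0
    have hsw : ∀ t x, s * w.v t x ≤ N := fun t x =>
      (le_abs_self _).trans (by rw [abs_mul, hs1, one_mul]; exact hw.bv t x)
    refine sub_nonpos.1 (h.comparison (t₀ := t₀) (S := 0)
      (φ := fun t x => s * w.v t x - N * Real.exp (-1 * (t - t₀))) (C := N) 0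
      ?_ ?_ ?_ ?_ t ⟨h0, ht⟩ x)
    · exact (hw.ucv.continuous.const_mul s).sub (by fun_prop)
    · intro t _ x
      have : 0 ≤ N * Real.exp (-1 * (t - t₀)) := by positivity
      simp only [barr, pow_zero, mul_one]
      linarith [hsw t x]
    · intro x
      simpa using hsw t₀ x
    · intro t ht x hpos
      refine ⟨s * w.dt t x - N * (-1 * Real.exp (-1 * (t - t₀))), fun y => s • w.d1 t y,
        s • w.d2 t x, ?_, fun y => ?_, (hw.h2 t x).const_smul s, ?_⟩
      · exact (((hw.ht t x).const_mul s).sub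
          ((hasDerivAt_mul_exp (-1) t₀ t).const_mul N)).hasDerivWithinAt
      · exact ((hw.h1 t y).const_mul s).sub_const _
      · rw [tr_smul, hs t x, hg t ht.2 x]
        linarith
  have hlim : Tendsto (fun t₀ => N * Real.exp (-1 * (t - t₀))) atBot (𝓝 (N * 0)) := by
    refine (Real.tendsto_exp_atBot.comp ?_).const_mul N
    have : (fun t₀ => -1 * (t - t₀)) = fun t₀ => t₀ + -t := by funext r; ring
    rw [this]
    exact tendsto_atBot_add_const_right _ _ tendsto_id
  rw [mul_zero] at hlim
  have hle : ∀ s : ℝ, |s| = 1 → s * w.v t x ≤ 0 := fun s hs1 =>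
    ge_of_tendsto hlim ((eventually_le_atBot t).mono fun t₀ h0 => key s hs1 t₀ h0)
  have h1 := hle 1 (by simp)
  have h2 := hle (-1) (by simp)
  linarith

/-- The solution driven by `κ' h` stays close to `κ F` when `F` is a smooth approximation of `h`. -/
theorem Sol.initial_estimate {c N A ε : ℝ} {m : ℕ} {a : ℝ → (Fin d → ℝ) → Fin d → Fin d → ℝ}
    (hq : QuadCoef c a) {u : Jet (Fin d → ℝ)} {κ κ1 : ℝ → ℝ} {h F : (Fin d → ℝ) → ℝ}
    {F1 : (Fin d → ℝ) → (Fin d → ℝ) →L[ℝ] ℝ} {F2 : (Fin d → ℝ) → (Fin d → ℝ) →L[ℝ] (Fin d → ℝ) →L[ℝ] ℝ}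
    (hu : Reg α N u) (hs : Sol a (fun t x => κ1 t * h x) u) (hκ : ∀ t, HasDerivAt κ (κ1 t) t)
    (hκ1 : ∀ t, 0 ≤ κ1 t) (hκ01 : ∀ t, 0 ≤ κ t ∧ κ t ≤ 1) (hκ0 : ∀ t ≤ 0, κ t = 0 ∧ κ1 t = 0)
    (hF1 : ∀ x, HasFDerivAt F (F1 x) x) (hF2 : ∀ x, HasFDerivAt F1 (F2 x) x)
    (hFA : ∀ x, |F x| ≤ A) (hFtr : ∀ t x, |tr (a t x) (F2 x)| ≤ A) (hε : 0 ≤ ε)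
    (hF : ∀ x, |h x - F x| ≤ ε * barr m x) {t : ℝ} (ht : 0 ≤ t) (x : Fin d → ℝ) :
    |u.v t x - κ t * F x| ≤ κ t * (ε * Real.exp (rate d c m * t) * barr m x) + 2 * A * t := by
  have hN := hu.nonneg
  have hA : 0 ≤ A := (abs_nonneg _).trans (hFA 0)
  set L := rate d c m with hL
  have hL0 : 0 ≤ L := rate_nonneg hq.nonneg d m
  have hFc : Continuous F := continuous_iff_continuousAt.2 fun x => (hF1 x).continuousAt
  have hκc : Continuous κ := continuous_iff_continuousAt.2 fun t => (hκ t).continuousAt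
  have key : ∀ s : ℝ, |s| = 1 → s * (u.v t x - κ t * F x) ≤
      κ t * (ε * Real.exp (L * t) * barr m x) + 2 * A * t := by
    intro s hs1
    have hsa : ∀ r : ℝ, s * r ≤ |r| := fun r =>
      (le_abs_self _).trans (by rw [abs_mul, hs1, one_mul])
    have hκF : ∀ t x, |κ t * F x| ≤ A := fun t x => by
      rw [abs_mul, abs_of_nonneg (hκ01 t).1]
      exact (mul_le_mul (hκ01 t).2 (hFA x) (abs_nonneg _) zero_le_one).trans_eq (one_mul A)
    refine sub_nonpos.1 (hq.comparison (t₀ := 0) (S := t) (φ := fun t x =>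
      s * (u.v t x - κ t * F x) - (κ t * (ε * Real.exp (L * (t - 0)) * barr m x) + 2 * A * t))
      (C := N + A) m ?_ ?_ ?_ ?_ t ⟨ht, le_rfl⟩ x |>.trans_eq' (by rw [sub_zero]))
    · have hb : Continuous fun q : ℝ × (Fin d → ℝ) => barr m q.2 :=
        (continuous_barr m).comp continuous_snd
      have hv := hu.ucv.continuous
      fun_prop
    · intro t ht x
      have hb := one_le_barr m x
      have h1 : s * (u.v t x - κ t * F x) ≤ (N + A) * 1 := by
        rw [mul_one]
        refine (hsa _).trans ((abs_sub _ _).trans (add_le_add (hu.bv t x) (hκF t x)))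
      have h2 : 0 ≤ κ t * (ε * Real.exp (L * (t - 0)) * barr m x) :=
        mul_nonneg (hκ01 t).1 (by positivity)
      have h3 : 0 ≤ 2 * A * t := mul_nonneg (by positivity) ht.1
      have h4 : (N + A) * 1 ≤ (N + A) * barr m x := by gcongr
      linarith
    · intro x
      rw [(hκ0 0 le_rfl).1, hs.vanish hq hu (fun t ht x => by rw [(hκ0 t ht).2, zero_mul]) le_rfl]
      simp
    · intro t ht x hpos
      set e := Real.exp (L * (t - 0)) with he
      have he1 : 1 ≤ e := Real.one_le_exp (mul_nonneg hL0 (by linarith [ht.1]))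
      have hb := barr_pos m x
      refine ⟨s * (u.dt t x - κ1 t * F x) - ((κ1 t * (ε * e * barr m x) +
          κ t * (ε * (L * e) * barr m x)) + 2 * A * 1),
        fun y => s • (u.d1 t y - κ t • F1 y) - (κ t * (ε * e)) • barr1 m y,
        s • (u.d2 t x - κ t • F2 x) - (κ t * (ε * e)) • barr2 m x, ?_, fun y => ?_, ?_, ?_⟩
      · exact (((hu.ht t x).sub ((hκ t).mul_const (F x))).const_mul s |>.sub
          (((hκ t).mul (((hasDerivAt_mul_exp L 0 t).const_mul ε).mul_const (barr m x))).add
            ((hasDerivAt_id t).const_mul (2 * A)))).hasDerivWithinAt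
      · refine (((hu.h1 t y).sub ((hF1 y).const_mul (κ t))).const_mul s).sub ?_
        refine (((hasFDerivAt_barr m y).const_mul (κ t * (ε * e))).add_const
          (2 * A * t)).congr_of_eventuallyEq (Eventually.of_forall fun z => ?_)
        simp only [he]; ring
      · exact (((hu.h2 t x).sub ((hF2 x).const_smul (κ t))).const_smul s).sub
          ((hasFDerivAt_barr1 m x).const_smul (κ t * (ε * e)))
      · rw [tr_sub, tr_smul, tr_smul, tr_sub, tr_smul, hs t x]
        have h1 : κ1 t * (s * (h x - F x)) ≤ κ1 t * (ε * e * barr m x) := by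
          refine mul_le_mul_of_nonneg_left ((hsa _).trans ((hF x).trans ?_)) (hκ1 t)
          have : ε ≤ ε * e := le_mul_of_one_le_right hε he1
          gcongr
        have h2 : κ t * (ε * e) * tr (a t x) (barr2 m x) ≤ κ t * (ε * e) * (L * barr m x) :=
          mul_le_mul_of_nonneg_left (hq.tr_barr2_le m t x)
            (mul_nonneg (hκ01 t).1 (by positivity))
        have h3 : s * (κ t * tr (a t x) (F2 x)) ≤ A := by
          refine (hsa _).trans ?_
          rw [abs_mul, abs_of_nonneg (hκ01 t).1]
          exact (mul_le_mul (hκ01 t).2 (hFtr t x) (abs_nonneg _) zero_le_one).trans_eq (one_mul A)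
        have h4 : 0 ≤ κ t * (ε * e * barr m x) := mul_nonneg (hκ01 t).1 (by positivity)
        have h5 : 0 ≤ 2 * A * t := mul_nonneg (by positivity) ht.1.le
        have h6 : -(s * (κ t * F x)) ≤ A := by
          have := (hsa (-(κ t * F x))).trans_eq (abs_neg _) |>.trans (hκF t x)
          linarith
        linarith
  rw [abs_le']
  exact ⟨by simpa using key 1 (by simp), by simpa using key (-1) (by simp)⟩

/-- Two solutions that agree at the initial time up to a small error stay close if they solve the
same equation on a large ball. -/
theorem Reg.difference_estimate {c N B δ η ρ t₀ S : ℝ} {m : ℕ}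
    {a : ℝ → (Fin d → ℝ) → Fin d → Fin d → ℝ} (hq : QuadCoef c a) {w : Jet (Fin d → ℝ)}
    (hw : Reg α N w) (hB : 0 ≤ B) (hδ : 0 ≤ δ) (hη : 0 ≤ η) (hρ : 0 < ρ)
    (hsol : ∀ t ∈ Set.Ioc t₀ S, ∀ x, ‖x‖ < ρ → w.dt t x = tr (a t x) (w.d2 t x) - w.v t x)
    (hgr : ∀ t ∈ Set.Icc t₀ S, ∀ x, |w.v t x| ≤ B * barr m x)
    (h0 : ∀ x, |w.v t₀ x| ≤ δ * barr (m + 1) x + η) {t : ℝ} (ht : t ∈ Set.Icc t₀ S)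
    (x : Fin d → ℝ) :
    |w.v t x| ≤ (δ + B / ρ ^ 2) * Real.exp (rate d c (m + 1) * (t - t₀)) * barr (m + 1) x + η := by
  set L := rate d c (m + 1) with hL
  have hL0 : 0 ≤ L := rate_nonneg hq.nonneg d (m + 1)
  set E := δ + B / ρ ^ 2 with hE
  have hBρ : 0 ≤ B / ρ ^ 2 := by positivity
  have hE0 : 0 ≤ E := by positivity
  have key : ∀ s : ℝ, |s| = 1 → s * w.v t x ≤
      E * Real.exp (L * (t - t₀)) * barr (m + 1) x + η := by
    intro s hs1
    have hsa : ∀ r : ℝ, s * r ≤ |r| := fun r =>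
      (le_abs_self _).trans (by rw [abs_mul, hs1, one_mul])
    refine sub_nonpos.1 (hq.comparison (t₀ := t₀) (S := S) (φ := fun t x =>
      s * w.v t x - (E * Real.exp (L * (t - t₀)) * barr (m + 1) x + η)) (C := B) m ?_ ?_ ?_ ?_ t ht x)
    · have hb : Continuous fun q : ℝ × (Fin d → ℝ) => barr (m + 1) q.2 :=
        (continuous_barr _).comp continuous_snd
      have hv := hw.ucv.continuous
      fun_prop
    · intro t ht x
      have h1 := (hsa _).trans (hgr t ht x)
      have h2 := barr_pos (m + 1) x
      have h3 : 0 ≤ E * Real.exp (L * (t - t₀)) * barr (m + 1) x := by positivity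
      linarith
    · intro x
      have h1 := (hsa _).trans (h0 x)
      have h2 := barr_pos (m + 1) x
      have h3 : 0 ≤ B / ρ ^ 2 * barr (m + 1) x := by positivity
      simp only [sub_self, mul_zero, Real.exp_zero, mul_one]
      rw [hE, add_mul]
      linarith
    · intro t ht x hpos
      set e := Real.exp (L * (t - t₀)) with he
      have he1 : 1 ≤ e := Real.one_le_exp (mul_nonneg hL0 (by linarith [ht.1]))
      have hb := barr_pos (m + 1) x
      have hsw : 0 < s * w.v t x := by
        have : 0 ≤ E * e * barr (m + 1) x := by positivity
        linarith
      have hxρ : ‖x‖ < ρ := by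
        by_contra! hx
        have hbm := barr_pos m x
        have h1 : ρ ^ 2 ≤ 1 + edot x x := by
          have : ρ ^ 2 ≤ ‖x‖ ^ 2 := by gcongr
          linarith [one_add_sq_le x]
        have h2 : B * barr m x ≤ B / ρ ^ 2 * barr (m + 1) x := by
          have : barr (m + 1) x = barr m x * (1 + edot x x) := by rw [barr, barr, pow_succ]
          rw [this]
          calc B * barr m x = B / ρ ^ 2 * (barr m x * ρ ^ 2) := by field_simp
            _ ≤ _ := by gcongr
        have h3 := (hsa _).trans (hgr t ⟨ht.1.le, ht.2⟩ x)
        have h4 : B / ρ ^ 2 * barr (m + 1) x ≤ E * e * barr (m + 1) x := by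
          have : B / ρ ^ 2 ≤ E * e := by nlinarith
          gcongr
        linarith
      refine ⟨s * w.dt t x - E * (L * e) * barr (m + 1) x,
        fun y => s • w.d1 t y - (E * e) • barr1 (m + 1) y,
        s • w.d2 t x - (E * e) • barr2 (m + 1) x, ?_, fun y => ?_, ?_, ?_⟩
      · exact (((hw.ht t x).const_mul s).sub ((((hasDerivAt_mul_exp L t₀ t).const_mul E).mul_const
          (barr (m + 1) x)).add_const η)).hasDerivWithinAt
      · exact ((hw.h1 t y).const_mul s).sub
          (((hasFDerivAt_barr (m + 1) y).const_mul (E * e)).add_const η)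
      · exact ((hw.h2 t x).const_smul s).sub
          ((hasFDerivAt_barr1 (m + 1) x).const_smul (E * e))
      · rw [tr_sub, tr_smul, tr_smul, hsol t ht x hxρ]
        have h2 : E * e * tr (a t x) (barr2 (m + 1) x) ≤ E * e * (L * barr (m + 1) x) :=
          mul_le_mul_of_nonneg_left (hq.tr_barr2_le (m + 1) t x) (by positivity)
        linarith
  rw [abs_le']
  exact ⟨by simpa using key 1 (by simp), by simpa using key (-1) (by simp)⟩

end Estimates

section Data

variable {d : ℕ}

theorem exists_weighted_bound {X V : Type*} [NormedAddCommGroup X] [NormedSpace ℝ X]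
    [NormedAddCommGroup V] [NormedSpace ℝ V] {ψ : X → V} (hψ : ContDiff ℝ 0 ψ) (hs : HasCompactSupport ψ) :
    ∃ K : ℝ, ∀ x, ‖ψ x‖ ≤ K ∧ (1 + ‖x‖ ^ 2) * ‖ψ x‖ ≤ K := by
  obtain ⟨K, hK⟩ := (hs.norm.mul_left (f := fun x : X => 1 + ‖x‖ ^ 2)).exists_bound_of_continuous
    ((by fun_prop : Continuous fun x : X => 1 + ‖x‖ ^ 2).mul hψ.continuous.norm)
  refine ⟨K, fun x => ?_⟩
  have h := (le_abs_self _).trans (hK x)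
  simp only [Pi.mul_apply] at h
  exact ⟨by nlinarith [norm_nonneg (ψ x), sq_nonneg ‖x‖, mul_nonneg (sq_nonneg ‖x‖) (norm_nonneg (ψ x))], h⟩

/-- A compactly supported `C²` function has bounded derivatives. -/
theorem exists_bounded_derivs {X : Type*} [NormedAddCommGroup X] [NormedSpace ℝ X] {F : X → ℝ} (hFs : ContDiff ℝ 2 F)
    (hFc : HasCompactSupport F) :
    ∃ (F1 : X → X →L[ℝ] ℝ)
      (F2 : X → X →L[ℝ] X →L[ℝ] ℝ) (A : ℝ),
      (∀ x, HasFDerivAt F (F1 x) x) ∧ (∀ x, HasFDerivAt F1 (F2 x) x) ∧ (∀ x, |F x| ≤ A) ∧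
      (∀ x, ‖F1 x‖ ≤ A) ∧ ∀ x, (1 + ‖x‖ ^ 2) * ‖F2 x‖ ≤ A := by
  have h1 : ContDiff ℝ 1 (fderiv ℝ F) := hFs.fderiv_right (by norm_num)
  have h2 : ContDiff ℝ 0 (fderiv ℝ (fderiv ℝ F)) := h1.fderiv_right (by norm_num)
  have hc1 : HasCompactSupport (fderiv ℝ F) := hFc.fderiv ℝ
  have hc2 : HasCompactSupport (fderiv ℝ (fderiv ℝ F)) := hc1.fderiv ℝ
  obtain ⟨A0, hA0⟩ := exists_weighted_bound (hFs.of_le (by norm_num)) hFc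
  obtain ⟨A1, hA1⟩ := exists_weighted_bound (h1.of_le (by norm_num)) hc1
  obtain ⟨A2, hA2⟩ := exists_weighted_bound h2 hc2
  exact ⟨fderiv ℝ F, fderiv ℝ (fderiv ℝ F), max A0 (max A1 A2),
    fun x => (hFs.differentiable (by norm_num) x).hasFDerivAt,
    fun x => (h1.differentiable (by norm_num) x).hasFDerivAt,
    fun x => (hA0 x).1.trans (by simp), fun x => (hA1 x).1.trans (by simp),
    fun x => (hA2 x).2.trans (by simp)⟩

/-- Approximation of continuous functions of polynomial growth by smooth compactly supported
functions in a weighted norm. -/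
theorem exists_smooth_approx {f : (Fin d → ℝ) → ℝ} {c ε : ℝ} {m : ℕ} (hf : Continuous f) (hc : 0 ≤ c)
    (hfg : ∀ x, |f x| ≤ c * barr m x) (hε : 0 < ε) :
    ∃ (F : (Fin d → ℝ) → ℝ) (F1 : (Fin d → ℝ) → (Fin d → ℝ) →L[ℝ] ℝ)
      (F2 : (Fin d → ℝ) → (Fin d → ℝ) →L[ℝ] (Fin d → ℝ) →L[ℝ] ℝ) (A : ℝ),
      (∀ x, HasFDerivAt F (F1 x) x) ∧ (∀ x, HasFDerivAt F1 (F2 x) x) ∧ (∀ x, |F x| ≤ A) ∧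
      (∀ x, ‖F1 x‖ ≤ A) ∧ (∀ x, (1 + ‖x‖ ^ 2) * ‖F2 x‖ ≤ A) ∧
      ∀ x, |f x - F x| ≤ ε * barr (m + 1) x := by
  obtain ⟨g, hg, hgf, -⟩ := hf.exists_contDiff_approx (ε := fun _ => ε / 2) 2 continuous_const
    fun _ => by positivity
  set R : ℝ := 1 + 2 * c / ε with hR
  have hR1 : 1 ≤ R := by rw [hR]; linarith [show 0 ≤ 2 * c / ε by positivity]
  let χ : ContDiffBump (0 : Fin d → ℝ) := ⟨R, R + 1, by linarith, by linarith⟩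
  set F : (Fin d → ℝ) → ℝ := fun x => χ x * g x with hF
  have hg2 : ContDiff ℝ 2 g := hg
  have hχ : ContDiff ℝ 2 χ := χ.contDiff
  have hFs : ContDiff ℝ 2 F := hχ.mul hg2
  have hFc : HasCompactSupport F := χ.hasCompactSupport.mul_right
  obtain ⟨F1, F2, A, hF1, hF2, b0, b1, b2⟩ := exists_bounded_derivs hFs hFc
  refine ⟨F, F1, F2, A, hF1, hF2, b0, b1, b2, fun x => ?_⟩
  · have hχ1 : χ x ≤ 1 := χ.le_one
    have hχ0 : 0 ≤ χ x := χ.nonneg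
    have e : f x - F x = χ x * (f x - g x) + (1 - χ x) * f x := by simp only [hF]; ring
    have hgx : |f x - g x| ≤ ε / 2 := by
      have := (hgf x).le
      rwa [dist_comm, Real.dist_eq] at this
    have hb := one_le_barr (m + 1) x
    have t1 : |χ x * (f x - g x)| ≤ ε / 2 * barr (m + 1) x := by
      rw [abs_mul, abs_of_nonneg hχ0]
      nlinarith [abs_nonneg (f x - g x)]
    have t2 : |(1 - χ x) * f x| ≤ ε / 2 * barr (m + 1) x := by
      rw [abs_mul, abs_of_nonneg (by linarith)]
      rcases le_or_gt ‖x‖ R with hx | hx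
      · have : χ x = 1 := χ.one_of_mem_closedBall (by simpa [χ] using hx)
        rw [this, sub_self, zero_mul]
        positivity
      · have hbm := barr_pos m x
        have hR2 : R ≤ 1 + edot x x := by
          nlinarith [one_add_sq_le x]
        have hcR : c ≤ ε / 2 * R := by
          have : ε / 2 * R = ε / 2 + c := by rw [hR]; field_simp
          linarith
        calc (1 - χ x) * |f x| ≤ 1 * (c * barr m x) := by
              gcongr
              · linarith
              · exact hfg x
          _ ≤ 1 * (ε / 2 * (1 + edot x x) * barr m x) := by
              gcongr
              exact hcR.trans (by gcongr)
          _ = ε / 2 * barr (m + 1) x := by rw [barr, barr, pow_succ]; ring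
    rw [e]
    exact (abs_add_le _ _).trans (by linarith)

/-- A smooth ramp from `0` to `1`. -/
theorem exists_ramp {c : ℝ} (hc : 0 < c) : ∃ (κ κ1 : ℝ → ℝ) (L : ℝ), (∀ t, HasDerivAt κ (κ1 t) t) ∧
    (∀ t, 0 ≤ κ1 t) ∧ (∀ t, 0 ≤ κ t ∧ κ t ≤ 1) ∧ (∀ t ≤ 0, κ t = 0 ∧ κ1 t = 0) ∧
    (∀ t, |κ1 t| ≤ L) ∧ (∀ t s, |κ1 t - κ1 s| ≤ L * |t - s|) ∧ ∀ t, c ≤ t → κ t = 1 ∧ κ1 t = 0 := by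
  set κ : ℝ → ℝ := fun s => Real.smoothTransition (s / c) with hκ
  have hsm : ContDiff ℝ 2 κ := Real.smoothTransition.contDiff.comp (by fun_prop)
  have c1 : ContDiff ℝ 1 (deriv κ) := by
    have : ContDiff ℝ (1 + 1) κ := by
      simpa [show (1 : WithTop ℕ∞) + 1 = 2 by norm_num] using hsm
    exact (contDiff_succ_iff_deriv.1 this).2.2
  have h0 : ∀ t ≤ 0, κ t = 0 := fun t ht =>
    Real.smoothTransition.zero_of_nonpos (div_nonpos_of_nonpos_of_nonneg ht hc.le)
  have h1 : ∀ t, c ≤ t → κ t = 1 := fun t ht =>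
    Real.smoothTransition.one_of_one_le ((one_le_div hc).2 ht)
  have hnn : ∀ t, 0 ≤ κ t := fun t => Real.smoothTransition.nonneg _
  have hle : ∀ t, κ t ≤ 1 := fun t => Real.smoothTransition.le_one _
  have d0 : ∀ t ≤ 0, deriv κ t = 0 := fun t ht =>
    IsLocalMin.deriv_eq_zero (Eventually.of_forall fun s => (h0 t ht).trans_le (hnn s))
  have d1 : ∀ t, c ≤ t → deriv κ t = 0 := fun t ht =>
    IsLocalMax.deriv_eq_zero (Eventually.of_forall fun s => (hle s).trans_eq (h1 t ht).symm)
  have hcs : HasCompactSupport (deriv κ) := by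
    refine HasCompactSupport.intro (isCompact_Icc (a := (0 : ℝ)) (b := c)) fun s hs => ?_
    rw [Set.mem_Icc, not_and_or, not_le, not_le] at hs
    rcases hs with hs | hs
    · exact d0 s hs.le
    · exact d1 s hs.le
  obtain ⟨L1, hL1⟩ := hcs.exists_bound_of_continuous c1.continuous
  obtain ⟨L2, hL2⟩ := hcs.deriv.exists_bound_of_continuous (c1.continuous_deriv le_rfl)
  have hmono : Monotone κ := fun s t hst =>
    Real.smoothTransition.monotone (by gcongr)
  refine ⟨κ, deriv κ, max L1 L2, fun t => (hsm.differentiable (by norm_num) t).hasDerivAt,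
    fun t => hmono.deriv_nonneg, fun t => ⟨hnn t, hle t⟩, fun t ht => ⟨h0 t ht, d0 t ht⟩,
    fun t => (hL1 t).trans (le_max_left _ _), fun t s => ?_, fun t ht => ⟨h1 t ht, d1 t ht⟩⟩
  exact convex_univ.norm_image_sub_le_of_norm_hasDerivWithin_le
    (fun y _ => (c1.differentiable (by norm_num) y).hasDerivAt.hasDerivWithinAt)
    (fun y _ => (hL2 y).trans (le_max_right _ _)) (Set.mem_univ s) (Set.mem_univ t)

theorem src_mul {F : (Fin d → ℝ) → ℝ} {F1 : (Fin d → ℝ) → (Fin d → ℝ) →L[ℝ] ℝ} {κ1 : ℝ → ℝ}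
    {A L α : ℝ} (hα : 0 < α) (hα1 : α < 1) (hF1 : ∀ x, HasFDerivAt F (F1 x) x) (hA : ∀ x, |F x| ≤ A)
    (hA1 : ∀ x, ‖F1 x‖ ≤ A) (hL : ∀ t, |κ1 t| ≤ L) (hlip : ∀ t s, |κ1 t - κ1 s| ≤ L * |t - s|) :
    ∃ G, Src α G fun t x => κ1 t * F x := by
  have hA0 : 0 ≤ A := (abs_nonneg _).trans (hA 0)
  have hL0 : 0 ≤ L := (abs_nonneg _).trans (hL 0)
  have hFl : ∀ x y, |F x - F y| ≤ 2 * A * ‖x - y‖ ^ α := fun x y => by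
    have h0 := norm_nonneg (x - y)
    rcases le_total ‖x - y‖ 1 with h | h
    · have h1 : |F x - F y| ≤ A * ‖x - y‖ := convex_univ.norm_image_sub_le_of_norm_hasFDerivWithin_le
        (fun z _ => (hF1 z).hasFDerivWithinAt) (fun z _ => hA1 z) (Set.mem_univ y) (Set.mem_univ x)
      have h2 : ‖x - y‖ ≤ ‖x - y‖ ^ α := by
        simpa using Real.rpow_le_rpow_of_exponent_ge' h0 h hα.le hα1.le
      nlinarith
    · have h2 : 1 ≤ ‖x - y‖ ^ α := Real.one_le_rpow h hα.le
      have := (abs_sub (F x) (F y)).trans (add_le_add (hA x) (hA y))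
      nlinarith
  have hAL : 0 ≤ L * A := by positivity
  refine ⟨2 * (L * A), fun t x => ?_, fun t x y => ?_, ?_⟩
  · rw [abs_mul]
    have := mul_le_mul (hL t) (hA x) (abs_nonneg _) hL0
    linarith
  · rw [← mul_sub, abs_mul]
    have := mul_le_mul (hL t) (hFl x y) (abs_nonneg _) hL0
    linarith
  · have u1 : UC fun (t : ℝ) (_ : Fin d → ℝ) => κ1 t := fun ε hε =>
      ⟨ε / (L + 1), by positivity, fun t s _ _ h _ => (hlip t s).trans (by
        rw [lt_div_iff₀ (by positivity)] at h
        nlinarith [abs_nonneg (t - s)])⟩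
    have u2 : UC fun (_ : ℝ) (x : Fin d → ℝ) => F x :=
      UC.of_time_holder hα (fun _ => hFl) fun ε hε => ⟨1, one_pos, fun t s x _ => by simpa using hε.le⟩
    exact u1.mul u2 (fun t _ => hL t) fun _ => hA

end Data

section Approximation

variable {d : ℕ}

/-- The coefficients in reversed time. -/
def revCoef (T : ℝ) (a : ℝ → (Fin d → ℝ) → Fin d → Fin d → ℝ) (τ : ℝ) (x : Fin d → ℝ) :
    Fin d → Fin d → ℝ :=
  a (clamp 0 T (T - τ)) x

theorem clampCoef_eq_revCoef {T σ r τ : ℝ} {a : ℝ → (Fin d → ℝ) → Fin d → Fin d → ℝ}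
    {x : Fin d → ℝ} (hτ0 : 0 ≤ τ) (hτ : T - σ ≤ τ) (hx : ‖x‖ ≤ r) :
    clampCoef T σ r a τ x = revCoef T a τ x := by
  rw [clampCoef_of_mem hτ hx, revCoef, clamp, min_eq_right (by linarith)]

/-- Solutions of regularized problems approximating the reversed equation with initial value `f`. -/
structure ApproxSeq (T : ℝ) (a : ℝ → (Fin d → ℝ) → Fin d → Fin d → ℝ) (f : (Fin d → ℝ) → ℝ)
    (m : ℕ) (L C : ℝ) (u : ℕ → Jet (Fin d → ℝ)) : Prop where
  reg : ∀ n, ∃ α N, 0 < α ∧ Reg α N (u n)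
  eqn : ∀ (n : ℕ) (t : ℝ) (x : Fin d → ℝ), (T + 1) / (n + 2) ≤ t → ‖x‖ ≤ n →
    (u n).dt t x = tr (revCoef T a t x) ((u n).d2 t x) - (u n).v t x
  growth : ∀ n, ∀ t ≥ (0 : ℝ), ∀ x, |(u n).v t x| ≤ C * Real.exp (L * t) * barr m x
  init : ∀ ε > 0, ∃ (F : (Fin d → ℝ) → ℝ) (A : ℝ) (K : ℕ), Continuous F ∧ 0 ≤ A ∧
    (∀ x, |f x - F x| ≤ ε * barr m x) ∧ ∀ n ≥ K, ∀ t ≥ (T + 1) / ((n : ℝ) + 2), ∀ x,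
      |(u n).v t x - F x| ≤ ε * Real.exp (L * t) * barr m x + A * t

theorem exists_approxSeq {T : ℝ} (hT : 0 < T) {a : ℝ → (Fin d → ℝ) → Fin d → Fin d → ℝ}
    (hcont : ∀ i j, ContinuousOn (fun p : ℝ × (Fin d → ℝ) => a p.1 p.2 i j)
      (Set.Icc 0 T ×ˢ (Set.univ : Set (Fin d → ℝ))))
    (hsymm : ∀ t ∈ Set.Icc (0 : ℝ) T, ∀ x : Fin d → ℝ, ∀ i j, a t x i j = a t x j i)
    (hpd : ∀ t ∈ Set.Icc (0 : ℝ) T, ∀ x : Fin d → ℝ, ∀ y : Fin d → ℝ, y ≠ 0 →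
      0 < ∑ i, ∑ j, a t x i j * y i * y j)
    (hhol : ∀ i j, LocallyHolderOn (fun p : ℝ × (Fin d → ℝ) => a p.1 p.2 i j)
      (Set.Ico 0 T ×ˢ (Set.univ : Set (Fin d → ℝ))))
    {c : ℝ} (hc : 0 ≤ c)
    (hgr : ∀ t ∈ Set.Icc (0 : ℝ) T, ∀ x : Fin d → ℝ, ∀ i j, |a t x i j| ≤ c * (1 + ‖x‖ ^ 2))
    {f : (Fin d → ℝ) → ℝ} (hf : Continuous f) {C : ℝ} {m : ℕ} (hC : 0 ≤ C)
    (hfg : ∀ x, |f x| ≤ C * barr m x) :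
    ∃ u, ApproxSeq T a f (m + 1) (rate d c (m + 1)) (C + 1) u := by
  have hε : ∀ k : ℕ, (0 : ℝ) < 1 / (k + 1) := fun k => by positivity
  choose F F1 F2 A hF1 hF2 hFA hFA1 hFA2 hFf using
    fun k : ℕ => exists_smooth_approx hf hC hfg (hε k)
  have hA0 : ∀ k, 0 ≤ A k := fun k => (abs_nonneg _).trans (hFA k 0)
  have hcp : ∀ n : ℕ, (0 : ℝ) < 1 / (n + 2) := fun n => by positivity
  choose κ κ1 Lκ hκ hκ1 hκ01 hκ0 hLκ hlip hκe using fun n : ℕ => exists_ramp (hcp n)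
  set σ : ℕ → ℝ := fun n => T - T / (n + 2) with hσ
  have hσ0 : ∀ n, 0 ≤ σ n := fun n => by
    have : T / (n + 2) ≤ T := div_le_self hT.le (by have := n.cast_nonneg (α := ℝ); linarith)
    simp only [hσ]; linarith
  have hσT : ∀ n, σ n < T := fun n => by
    have : 0 < T / (n + 2) := by positivity
    simp only [hσ]; linarith
  choose lam Λ α hl hΛ hα hα1 hco using fun n : ℕ =>
    coef_clampCoef hcont hsymm hpd hhol (hσ0 n) (hσT n) (Nat.cast_nonneg n)
  have hq : ∀ n : ℕ, QuadCoef c (clampCoef T (σ n) n a) := fun n =>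
    ⟨hc, (hco n).symm, (hco n).psd (hl n).le,
      abs_clampCoef_le hc hgr (hσ0 n) (hσT n).le (Nat.cast_nonneg n)⟩
  choose G hG using fun n => src_mul (hα n) (hα1 n) (hF1 n) (hFA n) (hFA1 n) (hLκ n) (hlip n)
  have hsol : ∀ n, ∃ w N, Reg (α n) N w ∧
      Sol (clampCoef T (σ n) n a) (fun t x => κ1 n t * F n x) w := fun n => by
    obtain ⟨M, -, hM, -⟩ := (hco n).solvable (hα n) (hα1 n) (hl n)
    obtain ⟨w, hw, hs⟩ := hM _ _ (hG n)
    exact ⟨w, _, hw, hs⟩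
  choose u N hu hs using hsol
  have hb0 : ∀ x : Fin d → ℝ, 0 < barr (m + 1) x := barr_pos (m + 1)
  refine ⟨u, fun n => ⟨α n, N n, hα n, hu n⟩, fun n t x ht hx => ?_, fun n t ht x => ?_,
    fun ε hε0 => ?_⟩
  · have hn : (0 : ℝ) < n + 2 := by positivity
    have e1 : T / (n + 2) ≤ (T + 1) / (n + 2) := by gcongr; linarith
    have e2 : 1 / ((n : ℝ) + 2) ≤ (T + 1) / (n + 2) := by gcongr; linarith
    have h0 : 0 ≤ T / (n + 2) := by positivity
    rw [hs n t x]
    beta_reduce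
    rw [(hκe n t (e2.trans ht)).2, zero_mul, add_zero,
      clampCoef_eq_revCoef (by linarith) (by simp only [hσ]; linarith) hx]
  · have hFg : ∀ x, |F n x - (fun _ => (0 : ℝ)) x| ≤ (C + 1) * barr (m + 1) x := fun x => by
      have h1 := hFf n x
      have h2 := (hfg x).trans (mul_le_mul_of_nonneg_left (barr_mono m.le_succ x) hC)
      have h3 : 1 / ((n : ℝ) + 1) ≤ 1 := by
        rw [div_le_one (by positivity)]; have := n.cast_nonneg (α := ℝ); linarith
      have h4 := mul_le_mul_of_nonneg_right h3 (hb0 x).le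
      have h5 : |F n x| ≤ |f x| + |f x - F n x| := by
        have := abs_sub (f x) (f x - F n x)
        rwa [sub_sub_cancel] at this
      simp only [sub_zero]
      linarith
    have := (hs n).initial_estimate (hq n) (hu n) (hκ n) (hκ1 n) (hκ01 n) (hκ0 n)
      (F := fun _ => 0) (F1 := fun _ => 0) (F2 := fun _ => 0) (A := 0)
      (fun x => hasFDerivAt_const _ _) (fun x => hasFDerivAt_const _ _) (fun x => by simp)
      (fun t x => by simp [tr]) (by positivity) hFg ht x
    rw [mul_zero, sub_zero, mul_zero, zero_mul, add_zero] at this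
    refine this.trans (mul_le_of_le_one_left ?_ (hκ01 n t).2)
    have := hb0 x
    positivity
  · obtain ⟨k, hk⟩ := exists_nat_one_div_lt (half_pos hε0)
    have hk1 : (1 : ℝ) / (k + 1) ≤ ε / 2 := hk.le
    refine ⟨F k, 2 * ((1 + d ^ 2 * c) * A k), k, ?_, ?_, fun x => ?_, fun n hn t ht x => ?_⟩
    · exact continuous_iff_continuousAt.2 fun x => (hF1 k x).continuousAt
    · have := hA0 k
      positivity
    · exact (hFf k x).trans (mul_le_mul_of_nonneg_right (by linarith) (hb0 x).le)
    · have e2 : 1 / ((n : ℝ) + 2) ≤ (T + 1) / (n + 2) := by gcongr; linarith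
      have ht0 : 0 ≤ t := ((hcp n).le.trans e2).trans ht
      have hkn : 1 / ((n : ℝ) + 1) ≤ 1 / (k + 1) := by gcongr
      have hFF : ∀ x, |F n x - F k x| ≤ ε * barr (m + 1) x := fun x => by
        have e : F n x - F k x = (f x - F k x) - (f x - F n x) := by ring
        have h1 := (hFf k x).trans (mul_le_mul_of_nonneg_right hk1 (hb0 x).le)
        have h2 := (hFf n x).trans (mul_le_mul_of_nonneg_right (hkn.trans hk1) (hb0 x).le)
        rw [e]
        exact (abs_sub _ _).trans (by linarith)
      have hAk := hA0 k
      have hd : (0 : ℝ) ≤ d ^ 2 * c := by positivity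
      have := (hs n).initial_estimate (hq n) (hu n) (hκ n) (hκ1 n) (hκ01 n) (hκ0 n)
        (A := (1 + d ^ 2 * c) * A k) (hF1 k) (hF2 k)
        (fun x => (hFA k x).trans (by nlinarith)) (fun t x => ?_) hε0.le hFF ht0 x
      · rw [(hκe n t (e2.trans ht)).1, one_mul, one_mul] at this
        exact this
      · refine (abs_tr_le ((hq n).growth t x) _).trans ?_
        have h1 := mul_le_mul_of_nonneg_left (hFA2 k x) hd
        calc d ^ 2 * (c * (1 + ‖x‖ ^ 2)) * ‖F2 k x‖ = d ^ 2 * c * ((1 + ‖x‖ ^ 2) * ‖F2 k x‖) := by ring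
          _ ≤ d ^ 2 * c * A k := h1
          _ ≤ (1 + d ^ 2 * c) * A k := by nlinarith

end Approximation

section Convergence

variable {d : ℕ} {T L C c : ℝ} {m : ℕ} {a : ℝ → (Fin d → ℝ) → Fin d → Fin d → ℝ}
  {f : (Fin d → ℝ) → ℝ} {u : ℕ → Jet (Fin d → ℝ)}

theorem quadCoef_revCoef (hT : 0 ≤ T)
    (hsymm : ∀ t ∈ Set.Icc (0 : ℝ) T, ∀ x : Fin d → ℝ, ∀ i j, a t x i j = a t x j i)
    (hpd : ∀ t ∈ Set.Icc (0 : ℝ) T, ∀ x : Fin d → ℝ, ∀ y : Fin d → ℝ, y ≠ 0 →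
      0 < ∑ i, ∑ j, a t x i j * y i * y j) (hc : 0 ≤ c)
    (hgr : ∀ t ∈ Set.Icc (0 : ℝ) T, ∀ x : Fin d → ℝ, ∀ i j, |a t x i j| ≤ c * (1 + ‖x‖ ^ 2)) :
    QuadCoef c (revCoef T a) where
  nonneg := hc
  symm t := hsymm _ (clamp_mem hT _)
  psd t x y := by
    rcases eq_or_ne y 0 with rfl | hy
    · simp
    · exact (hpd _ (clamp_mem hT _) x y hy).le
  growth t := hgr _ (clamp_mem hT _)

namespace ApproxSeq

theorem reg_sub (hu : ApproxSeq T a f m L C u) (n l : ℕ) :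
    ∃ β N, 0 < β ∧ Reg β N ((u n).sub (u l)) := by
  obtain ⟨α, N, hα, hN⟩ := hu.reg n
  obtain ⟨β, M, hβ, hM⟩ := hu.reg l
  have h0 : 0 < min α β := lt_min hα hβ
  exact ⟨min α β, _, h0, (hN.of_exponent_le h0.le (min_le_left _ _)).sub
    (hM.of_exponent_le h0.le (min_le_right _ _))⟩

theorem eqn_sub (hu : ApproxSeq T a f m L C u) {n l : ℕ} {t : ℝ} {x : Fin d → ℝ}
    (hn : (T + 1) / (n + 2) ≤ t) (hl : (T + 1) / (l + 2) ≤ t) (hxn : ‖x‖ ≤ n) (hxl : ‖x‖ ≤ l) :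
    ((u n).sub (u l)).dt t x =
      tr (revCoef T a t x) (((u n).sub (u l)).d2 t x) - ((u n).sub (u l)).v t x := by
  simp only [Jet.sub, tr_sub, hu.eqn n t x hn hxn, hu.eqn l t x hl hxl]
  ring

end ApproxSeq

theorem exists_start (T : ℝ) {τ : ℝ} (hτ : 0 < τ) (r : ℝ) :
    ∃ K : ℕ, ∀ n ≥ K, (T + 1) / ((n : ℝ) + 2) ≤ τ ∧ r ≤ n := by
  obtain ⟨K, hK⟩ := exists_nat_ge (max r ((T + 1) / τ))
  refine ⟨K, fun n hn => ?_⟩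
  have hn' : (K : ℝ) ≤ n := by exact_mod_cast hn
  have h1 := (le_max_right r ((T + 1) / τ)).trans (hK.trans hn')
  have hn0 : (0 : ℝ) ≤ n := n.cast_nonneg
  refine ⟨?_, (le_max_left _ _).trans (hK.trans hn')⟩
  rw [div_le_iff₀ hτ] at h1
  rw [div_le_iff₀ (by positivity)]
  nlinarith

theorem exists_barr_bound (m : ℕ) (R : ℝ) :
    ∃ Q, 1 ≤ Q ∧ ∀ x : Fin d → ℝ, ‖x‖ ≤ R → barr m x ≤ Q := by
  obtain ⟨Q, hQ⟩ := (isCompact_closedBall (0 : Fin d → ℝ) R).exists_bound_of_continuousOn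
    (continuous_barr (d := d) m).continuousOn
  refine ⟨max 1 Q, le_max_left _ _, fun x hx => ?_⟩
  exact ((le_abs_self _).trans (hQ x (by simpa using hx))).trans (le_max_right _ _)

/-- The approximating solutions form a uniform Cauchy sequence on compact sets. -/
theorem ApproxSeq.cauchy_v (hu : ApproxSeq T a f m L C u) (hq : QuadCoef c (revCoef T a))
    (hL : 0 ≤ L) (hC : 0 ≤ C) {τ : ℝ} (hτ : 0 < τ) (S R : ℝ) {ε : ℝ} (hε : 0 < ε) :
    ∃ K, ∀ n ≥ K, ∀ l ≥ K, ∀ t ∈ Set.Icc τ S, ∀ x, ‖x‖ ≤ R →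
      |(u n).v t x - (u l).v t x| ≤ ε := by
  obtain ⟨Q, hQ1, hQ⟩ := exists_barr_bound (d := d) (m + 1) R
  set P : ℝ := Real.exp (rate d c (m + 1) * S) * Q with hP
  have hP0 : 0 < P := by positivity
  set ε1 : ℝ := ε / (6 * Real.exp L * P) with hε1
  have hε10 : 0 < ε1 := by positivity
  obtain ⟨F, A, K, -, hA, -, hK⟩ := hu.init ε1 hε10
  set τ0 : ℝ := min τ (min 1 (ε / (6 * A + 1))) with hτ0
  have hτ00 : 0 < τ0 := by positivity
  have hτ0τ : τ0 ≤ τ := min_le_left _ _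
  have hτ01 : τ0 ≤ 1 := (min_le_right _ _).trans (min_le_left _ _)
  have hτ0ε : τ0 ≤ ε / (6 * A + 1) := (min_le_right _ _).trans (min_le_right _ _)
  set B : ℝ := 2 * C * Real.exp (L * S) with hB
  have hB0 : 0 ≤ B := by positivity
  set ρ : ℝ := 1 + 3 * B * P / ε with hρ
  have hρ1 : 1 ≤ ρ := by rw [hρ]; linarith [show 0 ≤ 3 * B * P / ε by positivity]
  obtain ⟨K', hK'⟩ := exists_start T hτ00 ρ
  refine ⟨max K K', fun n hn l hl t ht x hx => ?_⟩
  obtain ⟨hn1, hnρ⟩ := hK' n ((le_max_right _ _).trans hn)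
  obtain ⟨hl1, hlρ⟩ := hK' l ((le_max_right _ _).trans hl)
  obtain ⟨β, N, hβ, hw⟩ := hu.reg_sub n l
  have hmain := hw.difference_estimate (S := S) (t₀ := τ0) (m := m) hq hB0
    (show 0 ≤ 2 * ε1 * Real.exp L by positivity) (show 0 ≤ 2 * A * τ0 by positivity)
    (one_pos.trans_le hρ1)
    (fun s hs y hy => hu.eqn_sub (hn1.trans hs.1.le) (hl1.trans hs.1.le) (hy.le.trans hnρ)
      (hy.le.trans hlρ))
    (fun s hs y => by
      have e : Real.exp (L * s) ≤ Real.exp (L * S) := by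
        gcongr
        exact hs.2
      have hs0 := hτ00.le.trans hs.1
      have hb := (barr_pos m y).le
      calc _ ≤ |(u n).v s y| + |(u l).v s y| := abs_sub _ _
        _ ≤ C * Real.exp (L * s) * barr m y + C * Real.exp (L * s) * barr m y :=
          add_le_add (hu.growth n s hs0 y) (hu.growth l s hs0 y)
        _ = 2 * C * Real.exp (L * s) * barr m y := by ring
        _ ≤ B * barr m y := by rw [hB]; gcongr)
    (fun y => by
      have e : Real.exp (L * τ0) ≤ Real.exp L := by
        gcongr
        nlinarith
      have hb := (barr_pos m y).le
      have h1 := hK n ((le_max_left _ _).trans hn) τ0 hn1 y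
      have h2 := hK l ((le_max_left _ _).trans hl) τ0 hl1 y
      calc _ = |((u n).v τ0 y - F y) - ((u l).v τ0 y - F y)| := by simp [Jet.sub]
        _ ≤ _ := abs_sub _ _
        _ ≤ 2 * ε1 * Real.exp (L * τ0) * barr m y + 2 * A * τ0 := by linarith
        _ ≤ 2 * ε1 * Real.exp L * barr (m + 1) y + 2 * A * τ0 := by
          gcongr
          exact barr_mono (Nat.le_succ m) y)
    (Set.Icc_subset_Icc_left hτ0τ ht) x
  have hr := rate_nonneg hq.nonneg d (m + 1)
  have hexp : Real.exp (rate d c (m + 1) * (t - τ0)) * barr (m + 1) x ≤ P := by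
    rw [hP]
    gcongr
    · exact (barr_pos _ _).le
    · linarith [ht.2]
    · exact hQ x hx
  have e1 : 2 * ε1 * Real.exp L * P = ε / 3 := by
    rw [hε1]
    have := (Real.exp_pos L).ne'
    field_simp
    ring
  have e2 : B / ρ ^ 2 * P ≤ ε / 3 := by
    have : B * P ≤ ε / 3 * ρ := by
      rw [hρ, mul_add]
      have : ε / 3 * (3 * B * P / ε) = B * P := by field_simp
      rw [this]
      linarith
    rw [div_mul_eq_mul_div, div_le_iff₀ (by positivity)]
    calc _ ≤ ε / 3 * ρ := this
      _ ≤ ε / 3 * ρ ^ 2 := by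
        gcongr
        nlinarith
  have e3 : 2 * A * τ0 ≤ ε / 3 := by
    rw [le_div_iff₀ (by positivity)] at hτ0ε
    linarith
  calc |(u n).v t x - (u l).v t x| ≤ _ := hmain
    _ = (2 * ε1 * Real.exp L + B / ρ ^ 2) *
        (Real.exp (rate d c (m + 1) * (t - τ0)) * barr (m + 1) x) + 2 * A * τ0 := by ring
    _ ≤ (2 * ε1 * Real.exp L + B / ρ ^ 2) * P + 2 * A * τ0 := by gcongr
    _ ≤ ε := by linarith

end Convergence

section LimitJet

variable {d : ℕ} {T L C c : ℝ} {m : ℕ} {a : ℝ → (Fin d → ℝ) → Fin d → Fin d → ℝ}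
  {f : (Fin d → ℝ) → ℝ} {u : ℕ → Jet (Fin d → ℝ)}

/-- On compact subsets of positive times, `b` agrees with globally regular coefficients. -/
def LocCoef (b : ℝ → (Fin d → ℝ) → Fin d → Fin d → ℝ) : Prop :=
  ∀ δ > 0, ∀ R ≥ 0, ∃ lam Λ α b', 0 < lam ∧ 0 ≤ Λ ∧ 0 < α ∧ α < 1 ∧ Coef lam Λ α b' ∧
    ∀ t ≥ δ, ∀ x, ‖x‖ ≤ R → b' t x = b t x

theorem locCoef_revCoef (hT : 0 < T)
    (hcont : ∀ i j, ContinuousOn (fun p : ℝ × (Fin d → ℝ) => a p.1 p.2 i j)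
      (Set.Icc 0 T ×ˢ (Set.univ : Set (Fin d → ℝ))))
    (hsymm : ∀ t ∈ Set.Icc (0 : ℝ) T, ∀ x : Fin d → ℝ, ∀ i j, a t x i j = a t x j i)
    (hpd : ∀ t ∈ Set.Icc (0 : ℝ) T, ∀ x : Fin d → ℝ, ∀ y : Fin d → ℝ, y ≠ 0 →
      0 < ∑ i, ∑ j, a t x i j * y i * y j)
    (hhol : ∀ i j, LocallyHolderOn (fun p : ℝ × (Fin d → ℝ) => a p.1 p.2 i j)
      (Set.Ico 0 T ×ˢ (Set.univ : Set (Fin d → ℝ)))) : LocCoef (revCoef T a) := by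
  intro δ hδ R hR
  obtain ⟨lam, Λ, α, h1, h2, h3, h4, h5⟩ := coef_clampCoef hcont hsymm hpd hhol
    (le_max_left 0 (T - δ)) (max_lt hT (by linarith)) hR
  refine ⟨lam, Λ, α, _, h1, h2, h3, h4, h5, fun t ht x hx => ?_⟩
  rcases le_total T t with h | h
  · refine clampCoef_eq_revCoef (hδ.le.trans ht) ?_ hx
    linarith [le_max_left 0 (T - δ)]
  · refine clampCoef_eq_revCoef (hδ.le.trans ht) ?_ hx
    linarith [le_max_right 0 (T - δ), ht.le]

/-- All derivatives of the approximating solutions form locally uniform Cauchy sequences. -/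
theorem ApproxSeq.cauchy_jet (hu : ApproxSeq T a f m L C u) (hq : QuadCoef c (revCoef T a))
    (hloc : LocCoef (revCoef T a)) (hL : 0 ≤ L) (hC : 0 ≤ C) {τ : ℝ} (hτ : 0 < τ)
    (y : Fin d → ℝ) : JetCauchyOn (Metric.ball τ (τ / 4)) (Metric.ball y (τ / 4)) u := by
  set R : ℝ := ‖y‖ + τ with hR
  have hR0 : 0 ≤ R := by positivity
  obtain ⟨lam, Λ, α, b, hlam, hΛ, hα, hα1, hb, hbe⟩ := hloc (τ / 2) (by positivity) R hR0
  let ψ : ContDiffBump (τ, y) := ⟨τ / 4, τ / 2, by positivity, by linarith⟩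
  have hψ0 : ∀ (t : ℝ) (x : Fin d → ℝ), 0 < 2 * ψ (t, x) → |t - τ| < τ / 2 ∧ ‖x - y‖ < τ / 2 := by
    intro t x h
    have h1 : (t, x) ∈ Function.support ψ := fun h0 => by rw [h0] at h; simp at h
    rw [ψ.support_eq, Metric.mem_ball, Prod.dist_eq, max_lt_iff, Real.dist_eq, dist_eq_norm] at h1
    exact h1
  obtain ⟨C0, hC0, hest⟩ := interior_estimate hα hα1 hb hlam hΛ (φ := fun p => 2 * ψ p)
    (contDiff_const.mul ψ.contDiff) ψ.hasCompactSupport.mul_left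
  intro ε hε
  set D : ℝ := 1 + C0 + d ^ 2 * Λ * C0 with hD
  have hD0 : 0 < D := by positivity
  set M : ℝ := ε / D with hM
  have hM0 : 0 < M := by positivity
  have hMD : M + C0 * M + d ^ 2 * Λ * (C0 * M) = ε := by
    rw [hM, hD]
    field_simp
  have hCM : 0 ≤ C0 * M := by positivity
  have hΛM : 0 ≤ d ^ 2 * Λ * (C0 * M) := by positivity
  obtain ⟨K, hK⟩ := hu.cauchy_v hq hL hC (show 0 < τ / 2 by positivity) (2 * τ) R hM0
  obtain ⟨K', hK'⟩ := exists_start T (show 0 < τ / 2 by positivity) R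
  refine ⟨max K K', fun n hn l hl t ht x hx => ?_⟩
  obtain ⟨hn1, hnR⟩ := hK' n ((le_max_right _ _).trans hn)
  obtain ⟨hl1, hlR⟩ := hK' l ((le_max_right _ _).trans hl)
  obtain ⟨β, N, hβ, hw⟩ := hu.reg_sub n l
  have hmain : ∀ t x, 0 < 2 * ψ (t, x) → (((u n).sub (u l)).dt t x =
      tr (b t x) (((u n).sub (u l)).d2 t x) - ((u n).sub (u l)).v t x ∧
        |((u n).sub (u l)).v t x| ≤ M) := by
    intro t x h
    obtain ⟨h1, h2⟩ := hψ0 t x h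
    have h1' := _root_.abs_lt.1 h1
    have hxR : ‖x‖ ≤ R := by
      have := norm_le_norm_add_norm_sub' x y
      rw [hR]
      linarith
    have htτ : τ / 2 ≤ t := by linarith
    refine ⟨?_, hK n ((le_max_left _ _).trans hn) l ((le_max_left _ _).trans hl) t
      ⟨htτ, by linarith⟩ x hxR⟩
    rw [hbe t htτ x hxR]
    exact hu.eqn_sub (hn1.trans htτ) (hl1.trans htτ) (hxR.trans hnR) (hxR.trans hlR)
  have hone : ψ (t, x) = 1 := by
    refine ψ.one_of_mem_closedBall ?_
    rw [Metric.mem_closedBall, Prod.dist_eq]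
    exact max_le (Metric.mem_ball.1 ht).le (Metric.mem_ball.1 hx).le
  obtain ⟨e1, e2⟩ := hest β N M _ hβ hw hM0 hmain t x (by rw [hone]; norm_num)
  obtain ⟨e3, e4⟩ := hmain t x (by rw [hone]; norm_num)
  refine ⟨e4.trans (by linarith), e1.trans (by linarith), e2.trans (by linarith), ?_⟩
  change |((u n).sub (u l)).dt t x| ≤ ε
  rw [e3]
  have h5 := abs_tr_le (hb.bdd t x) (((u n).sub (u l)).d2 t x)
  have h6 : d ^ 2 * Λ * ‖((u n).sub (u l)).d2 t x‖ ≤ d ^ 2 * Λ * (C0 * M) := by gcongr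
  calc _ ≤ |tr (b t x) (((u n).sub (u l)).d2 t x)| + |((u n).sub (u l)).v t x| := abs_sub _ _
    _ ≤ _ := add_le_add (h5.trans h6) e4
    _ ≤ ε := by linarith

/-- A solution for positive times of the reversed equation, with initial value `f`. -/
structure RevSol (b : ℝ → (Fin d → ℝ) → Fin d → Fin d → ℝ) (f : (Fin d → ℝ) → ℝ) (m : ℕ)
    (L C : ℝ) (w : Jet (Fin d → ℝ)) : Prop where
  h1 : ∀ t > 0, ∀ x, HasFDerivAt (w.v t) (w.d1 t x) x
  h2 : ∀ t > 0, ∀ x, HasFDerivAt (w.d1 t) (w.d2 t x) x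
  ht : ∀ t > 0, ∀ x, HasDerivAt (fun s => w.v s x) (w.dt t x) t
  cv : ∀ t > 0, ∀ x, ContinuousAt (fun p : ℝ × (Fin d → ℝ) => w.v p.1 p.2) (t, x)
  c1 : ∀ t > 0, ∀ x, ContinuousAt (fun p : ℝ × (Fin d → ℝ) => w.d1 p.1 p.2) (t, x)
  c2 : ∀ t > 0, ∀ x, ContinuousAt (fun p : ℝ × (Fin d → ℝ) => w.d2 p.1 p.2) (t, x)
  ct : ∀ t > 0, ∀ x, ContinuousAt (fun p : ℝ × (Fin d → ℝ) => w.dt p.1 p.2) (t, x)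
  eqn : ∀ t > 0, ∀ x, w.dt t x = tr (b t x) (w.d2 t x) - w.v t x
  growth : ∀ t > 0, ∀ x, |w.v t x| ≤ C * Real.exp (L * t) * barr m x
  init : ∀ ε > 0, ∃ (F : (Fin d → ℝ) → ℝ) (A : ℝ), Continuous F ∧ 0 ≤ A ∧
    (∀ x, |f x - F x| ≤ ε * barr m x) ∧
    ∀ t > 0, ∀ x, |w.v t x - F x| ≤ ε * Real.exp (L * t) * barr m x + A * t

theorem ApproxSeq.exists_revSol (hu : ApproxSeq T a f m L C u) (hq : QuadCoef c (revCoef T a))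
    (hloc : LocCoef (revCoef T a)) (hL : 0 ≤ L) (hC : 0 ≤ C) :
    ∃ w, RevSol (revCoef T a) f m L C w := by
  have hcau := fun (t : ℝ) (ht : 0 < t) (y : Fin d → ℝ) => hu.cauchy_jet hq hloc hL hC ht y
  have hmem : ∀ {t : ℝ}, 0 < t → t ∈ Metric.ball t (t / 4) := fun h =>
    Metric.mem_ball_self (by positivity)
  have hmem' : ∀ {t : ℝ} (x : Fin d → ℝ), 0 < t → x ∈ Metric.ball x (t / 4) := fun _ h =>
    Metric.mem_ball_self (by positivity)
  obtain ⟨w, hw⟩ := exists_jet_limit (u := u) (P := fun t _ => 0 < t) fun t x ht =>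
    ⟨_, _, hmem ht, hmem' x ht, hcau t ht x⟩
  have hlim : ∀ {t : ℝ}, 0 < t → ∀ x : Fin d → ℝ, ∀ s ∈ Metric.ball t (t / 4),
      ∀ y ∈ Metric.ball x (t / 4), JetTendsto u w s y := by
    intro t ht x s hs y _
    rw [Metric.mem_ball, Real.dist_eq] at hs
    exact hw s y (by linarith [(_root_.abs_lt.1 hs).1])
  have hnhds : ∀ {t : ℝ}, 0 < t → ∀ x : Fin d → ℝ,
      Metric.ball t (t / 4) ×ˢ Metric.ball x (t / 4) ∈ 𝓝 (t, x) := fun ht x =>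
    prod_mem_nhds (Metric.ball_mem_nhds _ (by positivity)) (Metric.ball_mem_nhds _ (by positivity))
  have hreg := hu.reg
  choose α N hα hN using hreg
  refine ⟨w, fun t ht x => ?_, fun t ht x => ?_, fun t ht x => ?_, fun t ht x => ?_,
    fun t ht x => ?_, fun t ht x => ?_, fun t ht x => ?_, fun t ht x => ?_, fun t ht x => ?_,
    fun ε hε => ?_⟩
  · exact (hcau t ht x).h1 (hlim ht x) Metric.isOpen_ball (fun k s _ y _ => (hN k).h1 s y)
      (hmem ht) (hmem' x ht)
  · exact (hcau t ht x).h2 (hlim ht x) Metric.isOpen_ball (fun k s _ y _ => (hN k).h2 s y)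
      (hmem ht) (hmem' x ht)
  · exact (hcau t ht x).ht (hlim ht x) Metric.isOpen_ball (fun k s _ y _ => (hN k).ht s y)
      (hmem ht) (hmem' x ht)
  · exact (((hcau t ht x).uniform_v (hlim ht x)).continuousOn
      (Frequently.of_forall fun k => (hN k).ucv.continuous.continuousOn)).continuousAt (hnhds ht x)
  · exact (((hcau t ht x).uniform_d1 (hlim ht x)).continuousOn
      (Frequently.of_forall fun k => ((hN k).uc1 (hα k)).continuous.continuousOn)).continuousAt
        (hnhds ht x)
  · exact (((hcau t ht x).uniform_d2 (hlim ht x)).continuousOn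
      (Frequently.of_forall fun k => ((hN k).uc2 (hα k)).continuous.continuousOn)).continuousAt
        (hnhds ht x)
  · exact (((hcau t ht x).uniform_dt (hlim ht x)).continuousOn
      (Frequently.of_forall fun k => (hN k).uct.continuous.continuousOn)).continuousAt (hnhds ht x)
  · obtain ⟨K, hK⟩ := exists_start T ht ‖x‖
    have h := hw t x ht
    refine tendsto_nhds_unique h.dt (Tendsto.congr' ?_
      ((((continuous_tr (revCoef T a t x)).tendsto _).comp h.d2).sub h.v))
    filter_upwards [eventually_ge_atTop K] with n hn
    exact (hu.eqn n t x (hK n hn).1 (hK n hn).2).symm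
  · exact le_of_tendsto (hw t x ht).v.abs (Eventually.of_forall fun n => hu.growth n t ht.le x)
  · obtain ⟨F, A, K, hF, hA, hfF, hK⟩ := hu.init ε hε
    refine ⟨F, A, hF, hA, hfF, fun t ht x => ?_⟩
    obtain ⟨K', hK'⟩ := exists_start T ht 0
    refine le_of_tendsto ((hw t x ht).v.sub_const (F x)).abs ?_
    filter_upwards [eventually_ge_atTop (max K K')] with n hn
    exact hK n ((le_max_left _ _).trans hn) t (hK' n ((le_max_right _ _).trans hn)).1 x

end LimitJet

section Terminal

variable {d : ℕ} {T L C c : ℝ} {m : ℕ} {a : ℝ → (Fin d → ℝ) → Fin d → Fin d → ℝ}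
  {f : (Fin d → ℝ) → ℝ}

theorem revCoef_of_mem {t : ℝ} (ht : t ∈ Set.Icc 0 T) : revCoef T a (T - t) = a t := by
  funext x
  rw [revCoef, sub_sub_cancel, clamp_of_mem ht]

theorem pd1_eq {g : (Fin d → ℝ) → ℝ} {D : (Fin d → ℝ) →L[ℝ] ℝ} {x : Fin d → ℝ}
    (h : HasFDerivAt g D x) (i : Fin d) : pd1 g i x = D (eb i) := by
  rw [pd1, h.fderiv, eb]

theorem hasFDerivAt_pd1 {g : (Fin d → ℝ) → ℝ} {D : (Fin d → ℝ) → (Fin d → ℝ) →L[ℝ] ℝ}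
    {H : (Fin d → ℝ) →L[ℝ] (Fin d → ℝ) →L[ℝ] ℝ} {x : Fin d → ℝ}
    (h1 : ∀ y, HasFDerivAt g (D y) y) (h2 : HasFDerivAt D H x) (j : Fin d) :
    HasFDerivAt (pd1 g j) ((ContinuousLinearMap.apply ℝ ℝ (eb j)).comp H) x := by
  have : pd1 g j = fun y => ContinuousLinearMap.apply ℝ ℝ (eb j) (D y) :=
    funext fun y => pd1_eq (h1 y) j
  rw [this]
  exact (ContinuousLinearMap.hasFDerivAt _).comp x h2

theorem pd2_eq {g : (Fin d → ℝ) → ℝ} {D : (Fin d → ℝ) → (Fin d → ℝ) →L[ℝ] ℝ}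
    {H : (Fin d → ℝ) →L[ℝ] (Fin d → ℝ) →L[ℝ] ℝ} {x : Fin d → ℝ}
    (h1 : ∀ y, HasFDerivAt g (D y) y) (h2 : HasFDerivAt D H x) (i j : Fin d) :
    pd2 g i j x = H (eb i) (eb j) := by
  rw [pd2, (hasFDerivAt_pd1 h1 h2 j).fderiv]
  rfl

theorem tr_eq_sum_pd2 {g : (Fin d → ℝ) → ℝ} {H : (Fin d → ℝ) →L[ℝ] (Fin d → ℝ) →L[ℝ] ℝ}
    {x : Fin d → ℝ} (h : ∀ i j, pd2 g i j x = H (eb i) (eb j)) (A : Fin d → Fin d → ℝ) :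
    tr A H = (1 / 2) * ∑ i, ∑ j, A i j * pd2 g i j x := by
  simp only [tr, h]

theorem fderiv_eq_sum_pd1 (g : (Fin d → ℝ) → ℝ) (y : Fin d → ℝ) :
    fderiv ℝ g y = ∑ j, pd1 g j y • ContinuousLinearMap.proj (R := ℝ) (φ := fun _ => ℝ) j := by
  ext z
  conv_lhs => rw [pi_eq_sum_univ' z]
  simp [pd1, _root_.sum_apply, mul_comm]

theorem hasFDerivAt_sum_smul {X V ι : Type*} [NormedAddCommGroup X] [NormedSpace ℝ X]
    [NormedAddCommGroup V] [NormedSpace ℝ V] [Fintype ι] {g : ι → X → ℝ} {x : X}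
    (h : ∀ j, DifferentiableAt ℝ (g j) x) (e : ι → V) :
    HasFDerivAt (fun y => ∑ j, g j y • e j) (∑ j, (fderiv ℝ (g j) x).smulRight (e j)) x :=
  HasFDerivAt.fun_sum fun j _ => (h j).hasFDerivAt.smul_const _

theorem exists_second_deriv {g : (Fin d → ℝ) → ℝ} {x : Fin d → ℝ}
    (h : ∀ j, DifferentiableAt ℝ (pd1 g j) x) :
    ∃ H : (Fin d → ℝ) →L[ℝ] (Fin d → ℝ) →L[ℝ] ℝ, HasFDerivAt (fderiv ℝ g) H x ∧ ∀ i j, pd2 g i j x = H (eb i) (eb j) := by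
  refine ⟨∑ j, (fderiv ℝ (pd1 g j) x).smulRight
    (ContinuousLinearMap.proj (R := ℝ) (φ := fun _ => ℝ) j), ?_, fun i j => ?_⟩
  · rw [show fderiv ℝ g = fun y => ∑ j, pd1 g j y •
      ContinuousLinearMap.proj (R := ℝ) (φ := fun _ => ℝ) j from funext (fderiv_eq_sum_pd1 g)]
    exact hasFDerivAt_sum_smul h _
  · simp [pd2, eb, _root_.sum_apply, Pi.single_apply]

namespace IsC12

variable {w : ℝ → (Fin d → ℝ) → ℝ}

theorem hasDerivAt_time (h : IsC12 (Set.Ico 0 T) Set.univ w) {t : ℝ} (ht : t ∈ Set.Ioo 0 T)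
    (x : Fin d → ℝ) : HasDerivAt (fun s => w s x) (tderiv (Set.Icc 0 T) w t x) t := by
  have h1 := h.diff t (by rwa [interior_Ico]) x trivial
  have h2 : DifferentiableAt ℝ (fun s : ℝ => (s, x)) t :=
    differentiableAt_id.prodMk (differentiableAt_const x)
  have h3 : DifferentiableAt ℝ (fun s => w s x) t :=
    DifferentiableAt.comp (g := fun p : ℝ × (Fin d → ℝ) => w p.1 p.2) t h1 h2
  rw [tderiv, derivWithin_of_mem_nhds (Icc_mem_nhds ht.1 ht.2)]
  exact h3.hasDerivAt

theorem hasFDerivAt_space (h : IsC12 (Set.Ico 0 T) Set.univ w) {t : ℝ} (ht : t ∈ Set.Ioo 0 T)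
    (x : Fin d → ℝ) : HasFDerivAt (w t) (fderiv ℝ (w t) x) x := by
  have h1 := h.diff t (by rwa [interior_Ico]) x trivial
  have h2 : DifferentiableAt ℝ (fun y : Fin d → ℝ => (t, y)) x :=
    (differentiableAt_const t).prodMk differentiableAt_id
  have h3 : DifferentiableAt ℝ (w t) x :=
    DifferentiableAt.comp (g := fun p : ℝ × (Fin d → ℝ) => w p.1 p.2) x h1 h2
  exact h3.hasFDerivAt

end IsC12

/-- Solutions of the terminal-value problem of at most polynomial growth. -/
structure TVPSol (T : ℝ) (a : ℝ → (Fin d → ℝ) → Fin d → Fin d → ℝ) (f : (Fin d → ℝ) → ℝ)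
    (w : ℝ → (Fin d → ℝ) → ℝ) : Prop where
  cont : ContinuousOn (fun q : ℝ × (Fin d → ℝ) => w q.1 q.2) (Set.Icc 0 T ×ˢ Set.univ)
  c12 : IsC12 (Set.Ico 0 T) (Set.univ : Set (Fin d → ℝ)) w
  eqn : ∀ t ∈ Set.Ico (0 : ℝ) T, ∀ x : Fin d → ℝ,
    tderiv (Set.Icc 0 T) w t x + (1 / 2) * ∑ i, ∑ j, a t x i j * pd2 (w t) i j x = 0
  term : ∀ x, w T x = f x
  growth : ∃ C q : ℝ, 0 < C ∧ 0 < q ∧ ∀ t ∈ Set.Icc (0 : ℝ) T, ∀ x, |w t x| ≤ C * (1 + ‖x‖ ^ q)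

theorem norm_rpow_le_barr {q : ℝ} (hq : 0 ≤ q) (hqm : q ≤ m) (x : Fin d → ℝ) :
    ‖x‖ ^ q ≤ barr m x := by
  rcases le_total ‖x‖ 1 with h | h
  · exact (Real.rpow_le_one (norm_nonneg x) h hq).trans (one_le_barr m x)
  · calc ‖x‖ ^ q ≤ ‖x‖ ^ (m : ℝ) := Real.rpow_le_rpow_of_exponent_le h hqm
      _ = ‖x‖ ^ m := Real.rpow_natCast _ _
      _ ≤ barr m x := by
        refine pow_le_pow_left₀ (norm_nonneg x) (le_trans ?_ (one_add_sq_le x)) m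
        nlinarith

theorem le_barr_of_growth {q : ℝ} (hC : 0 ≤ C) (hq : 0 ≤ q) (hqm : q ≤ m) (x : Fin d → ℝ) :
    C * (1 + ‖x‖ ^ q) ≤ 2 * C * barr m x := by
  have h1 := norm_rpow_le_barr hq hqm x
  have h2 := one_le_barr m x
  calc C * (1 + ‖x‖ ^ q) ≤ C * (barr m x + barr m x) := by gcongr
    _ = 2 * C * barr m x := by ring

theorem TVPSol.le {w v : ℝ → (Fin d → ℝ) → ℝ} (hT : 0 < T) (hq : QuadCoef c (revCoef T a))
    (hw : TVPSol T a f w) (hv : TVPSol T a f v) :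
    ∀ t ∈ Set.Icc 0 T, ∀ x, w t x ≤ v t x := by
  obtain ⟨C, q, hC, hq0, hCq⟩ := hw.growth
  obtain ⟨C', q', hC', hq0', hCq'⟩ := hv.growth
  obtain ⟨m, hm⟩ := exists_nat_ge (max q q')
  have hpos : ∀ t ∈ Set.Ioc 0 T, ∀ x, w t x ≤ v t x := by
    intro t ht x
    have hmem : ∀ {s : ℝ}, s ∈ Set.Icc 0 (T - t) → T - s ∈ Set.Icc 0 T := fun hs =>
      ⟨by linarith [hs.2, ht.1], by linarith [hs.1]⟩
    have hmaps : ∀ g : ℝ → (Fin d → ℝ) → ℝ,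
        ContinuousOn (fun q : ℝ × (Fin d → ℝ) => g q.1 q.2) (Set.Icc 0 T ×ˢ Set.univ) →
        ContinuousOn (fun q : ℝ × (Fin d → ℝ) => g (T - q.1) q.2)
          (Set.Icc 0 (T - t) ×ˢ Set.univ) := fun g hg =>
      hg.comp (f := fun q : ℝ × (Fin d → ℝ) => (T - q.1, q.2)) (by fun_prop)
        fun q hq => ⟨hmem hq.1, trivial⟩
    have key := comparison (a := revCoef T a) (φ := fun s y => w (T - s) y - v (T - s) y)
      (t₀ := 0) (S := T - t) (C := 2 * C + 2 * C') m hq.nonneg (fun s _ => hq.symm s)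
      (fun s _ => hq.psd s) (fun s _ => hq.growth s) ((hmaps w hw.cont).sub (hmaps v hv.cont))
      (fun s hs y => by
        have h1 := le_barr_of_growth hC.le hq0.le ((le_max_left _ _).trans hm) y
        have h2 := le_barr_of_growth hC'.le hq0'.le ((le_max_right _ _).trans hm) y
        have h3 := (le_abs_self _).trans (hCq _ (hmem hs) y)
        have h4 := (neg_le_abs _).trans (hCq' _ (hmem hs) y)
        linarith)
      (fun y => by simp [hw.term, hv.term])
      (fun s hs y _ => by
        have hs1 : T - s ∈ Set.Ioo 0 T := ⟨by linarith [hs.2, ht.1], by linarith [hs.1]⟩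
        obtain ⟨H, hH, hHe⟩ := exists_second_deriv fun j =>
          hw.c12.diff2 (T - s) (by rwa [interior_Ico]) y trivial j
        obtain ⟨H', hH', hHe'⟩ := exists_second_deriv fun j =>
          hv.c12.diff2 (T - s) (by rwa [interior_Ico]) y trivial j
        have hsub : HasDerivAt (fun s => T - s) (-1) s := by
          simpa using (hasDerivAt_id s).const_sub T
        have d1 := (hw.c12.hasDerivAt_time hs1 y).comp s hsub
        have d2 := (hv.c12.hasDerivAt_time hs1 y).comp s hsub
        refine ⟨_, _, _, (d1.sub d2).hasDerivWithinAt,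
          fun z => (hw.c12.hasFDerivAt_space hs1 z).sub (hv.c12.hasFDerivAt_space hs1 z),
          hH.sub hH', ?_⟩
        have e1 := hw.eqn (T - s) ⟨hs1.1.le, hs1.2⟩ y
        have e2 := hv.eqn (T - s) ⟨hs1.1.le, hs1.2⟩ y
        have e3 : revCoef T a s = a (T - s) := by
          rw [← revCoef_of_mem (a := a) ⟨hs1.1.le, hs1.2.le⟩, sub_sub_cancel]
        rw [tr_sub, tr_eq_sum_pd2 hHe, tr_eq_sum_pd2 hHe', e3]
        linarith)
      (T - t) ⟨by linarith [ht.2], le_rfl⟩ x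
    simp only [sub_sub_cancel] at key
    linarith
  intro t ht x
  rcases ht.1.eq_or_lt with rfl | h
  · have hlim : ∀ g : ℝ → (Fin d → ℝ) → ℝ,
        ContinuousOn (fun q : ℝ × (Fin d → ℝ) => g q.1 q.2) (Set.Icc 0 T ×ˢ Set.univ) →
        Tendsto (fun s => g s x) (𝓝[Set.Ioc 0 T] 0) (𝓝 (g 0 x)) := by
      intro g hg
      have h1 : ContinuousOn (fun s => g s x) (Set.Icc 0 T) :=
        hg.comp (f := fun s : ℝ => (s, x)) (by fun_prop) fun s hs => ⟨hs, trivial⟩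
      exact (h1 0 ⟨le_rfl, hT.le⟩).mono_left (nhdsWithin_mono _ Set.Ioc_subset_Icc_self)
    have : (𝓝[Set.Ioc 0 T] (0 : ℝ)).NeBot := by
      rw [← mem_closure_iff_nhdsWithin_neBot, closure_Ioc hT.ne]
      exact ⟨le_rfl, hT.le⟩
    exact le_of_tendsto_of_tendsto (hlim w hw.cont) (hlim v hv.cont)
      (eventually_nhdsWithin_of_forall fun s hs => hpos s hs x)
  · exact hpos t ⟨h, ht.2⟩ x

end Terminal

section Existence

variable {d : ℕ} {T L C c : ℝ} {m : ℕ} {a b : ℝ → (Fin d → ℝ) → Fin d → Fin d → ℝ}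
  {f : (Fin d → ℝ) → ℝ} {w : Jet (Fin d → ℝ)}

/-- The terminal-value function obtained from a solution of the reversed equation. -/
def termFun (T : ℝ) (f : (Fin d → ℝ) → ℝ) (w : Jet (Fin d → ℝ)) (t : ℝ) (x : Fin d → ℝ) : ℝ :=
  if t < T then Real.exp (T - t) * w.v (T - t) x else f x

/-- The derivatives of the terminal-value function. -/
def termJet (T : ℝ) (w : Jet (Fin d → ℝ)) : Jet (Fin d → ℝ) where
  v t x := Real.exp (T - t) * w.v (T - t) x
  d1 t x := Real.exp (T - t) • w.d1 (T - t) x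
  d2 t x := Real.exp (T - t) • w.d2 (T - t) x
  dt t x := -(Real.exp (T - t) * (w.v (T - t) x + w.dt (T - t) x))

theorem termFun_eq {t : ℝ} (ht : t < T) : termFun T f w t = (termJet T w).v t := by
  funext x
  rw [termFun, if_pos ht, termJet]

theorem continuousAt_reverse {V : Type*} [NormedAddCommGroup V] [NormedSpace ℝ V]
    {g : ℝ → (Fin d → ℝ) → V} {t : ℝ} {x : Fin d → ℝ}
    (h : ContinuousAt (fun p : ℝ × (Fin d → ℝ) => g p.1 p.2) (T - t, x)) :
    ContinuousAt (fun p : ℝ × (Fin d → ℝ) => Real.exp (T - p.1) • g (T - p.1) p.2) (t, x) := by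
  have h1 : ContinuousAt (fun p : ℝ × (Fin d → ℝ) => (T - p.1, p.2)) (t, x) := by fun_prop
  have h2 : ContinuousAt (fun p : ℝ × (Fin d → ℝ) => g (T - p.1) p.2) (t, x) :=
    ContinuousAt.comp (g := fun p : ℝ × (Fin d → ℝ) => g p.1 p.2)
      (f := fun p : ℝ × (Fin d → ℝ) => (T - p.1, p.2)) (x := (t, x)) h h1
  exact ContinuousAt.smul (by fun_prop) h2

namespace RevSol

theorem hasDerivAt_term (h : RevSol b f m L C w) {t : ℝ} (ht : t < T) (x : Fin d → ℝ) :
    HasDerivAt (fun s => (termJet T w).v s x) ((termJet T w).dt t x) t := by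
  have h0 : HasDerivAt (fun s => T - s) (-1) t := by simpa using (hasDerivAt_id t).const_sub T
  have h1 := (h.ht (T - t) (sub_pos.2 ht) x).comp t h0
  have h2 := h0.exp.mul h1
  refine h2.congr_deriv ?_
  simp only [termJet, Function.comp]
  ring

theorem hasFDerivAt_term (h : RevSol b f m L C w) {t : ℝ} (ht : t < T) (x : Fin d → ℝ) :
    HasFDerivAt ((termJet T w).v t) ((termJet T w).d1 t x) x :=
  (h.h1 (T - t) (sub_pos.2 ht) x).const_mul _

theorem hasFDerivAt_term_d1 (h : RevSol b f m L C w) {t : ℝ} (ht : t < T) (x : Fin d → ℝ) :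
    HasFDerivAt ((termJet T w).d1 t) ((termJet T w).d2 t x) x :=
  (h.h2 (T - t) (sub_pos.2 ht) x).const_smul (Real.exp (T - t))

theorem continuousAt_term (h : RevSol b f m L C w) {t : ℝ} (ht : t < T) (x : Fin d → ℝ) :
    ContinuousAt (fun p : ℝ × (Fin d → ℝ) => (termJet T w).v p.1 p.2) (t, x) :=
  continuousAt_reverse (h.cv (T - t) (sub_pos.2 ht) x)

theorem continuousAt_term_d1 (h : RevSol b f m L C w) {t : ℝ} (ht : t < T) (x : Fin d → ℝ) :
    ContinuousAt (fun p : ℝ × (Fin d → ℝ) => (termJet T w).d1 p.1 p.2) (t, x) :=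
  continuousAt_reverse (V := (Fin d → ℝ) →L[ℝ] ℝ) (g := w.d1) (h.c1 (T - t) (sub_pos.2 ht) x)

theorem continuousAt_term_d2 (h : RevSol b f m L C w) {t : ℝ} (ht : t < T) (x : Fin d → ℝ) :
    ContinuousAt (fun p : ℝ × (Fin d → ℝ) => (termJet T w).d2 p.1 p.2) (t, x) :=
  continuousAt_reverse (V := (Fin d → ℝ) →L[ℝ] (Fin d → ℝ) →L[ℝ] ℝ) (g := w.d2) (h.c2 (T - t) (sub_pos.2 ht) x)

theorem continuousAt_term_dt (h : RevSol b f m L C w) {t : ℝ} (ht : t < T) (x : Fin d → ℝ) :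
    ContinuousAt (fun p : ℝ × (Fin d → ℝ) => (termJet T w).dt p.1 p.2) (t, x) :=
  (continuousAt_reverse (g := fun s y => w.v s y + w.dt s y)
    ((h.cv (T - t) (sub_pos.2 ht) x).add (h.ct (T - t) (sub_pos.2 ht) x))).neg

theorem eventually_termFun (T : ℝ) (f : (Fin d → ℝ) → ℝ) (w : Jet (Fin d → ℝ)) {t : ℝ}
    (ht : t < T) (x : Fin d → ℝ) : (fun p : ℝ × (Fin d → ℝ) => termFun T f w p.1 p.2) =ᶠ[𝓝 (t, x)]
      fun p => (termJet T w).v p.1 p.2 := by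
  filter_upwards [continuousAt_fst.eventually (gt_mem_nhds ht)] with p hp
  rw [termFun_eq hp]

theorem differentiableAt_termFun (h : RevSol b f m L C w) {t : ℝ} (ht : t < T) (x : Fin d → ℝ) :
    DifferentiableAt ℝ (fun p : ℝ × (Fin d → ℝ) => termFun T f w p.1 p.2) (t, x) := by
  have e : ∀ c : ℝ, ContinuousLinearMap.toSpanSingleton ℝ c = c • ContinuousLinearMap.id ℝ ℝ :=
    fun c => by ext; simp
  have hev : ∀ᶠ p : ℝ × (Fin d → ℝ) in 𝓝 (t, x), p.1 < T :=
    continuousAt_fst.eventually (gt_mem_nhds ht)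
  have := hasStrictFDerivAt_uncurry_coprod (𝕜 := ℝ) (u := (t, x)) (f := (termJet T w).v)
    (f₁ := fun t x => ContinuousLinearMap.toSpanSingleton ℝ ((termJet T w).dt t x))
    (f₂ := (termJet T w).d1)
    (hev.mono fun p hp => (h.hasDerivAt_term hp p.2).hasFDerivAt)
    (hev.mono fun p hp => h.hasFDerivAt_term hp p.2)
    (by
      simp only [e]
      exact (h.continuousAt_term_dt ht x).smul continuousAt_const)
    (h.continuousAt_term_d1 ht x)
  exact this.hasFDerivAt.differentiableAt.congr_of_eventuallyEq (eventually_termFun T f w ht x)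

theorem isC12_termFun (h : RevSol b f m L C w) :
    IsC12 (Set.Ico 0 T) Set.univ (termFun T f w) where
  cont p hp := ((h.continuousAt_term hp.1.2 p.2).congr
    (eventually_termFun T f w hp.1.2 p.2).symm).continuousWithinAt
  diff t ht x _ := h.differentiableAt_termFun (interior_subset ht).2 x
  diff2 t ht x _ j := by
    have ht' := (interior_subset ht).2
    rw [termFun_eq ht']
    exact (hasFDerivAt_pd1 (h.hasFDerivAt_term ht') (h.hasFDerivAt_term_d1 ht' x) j).differentiableAt
  derivs_extend := by
    refine ⟨fun p => (termJet T w).dt p.1 p.2, fun i p => (termJet T w).d1 p.1 p.2 (eb i),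
      fun i j p => (termJet T w).d2 p.1 p.2 (eb i) (eb j),
      fun p hp => (h.continuousAt_term_dt hp.1.2 p.2).continuousWithinAt,
      fun i p hp => ((h.continuousAt_term_d1 hp.1.2 p.2).clm_apply
        continuousAt_const).continuousWithinAt,
      fun i j p hp => (((h.continuousAt_term_d2 hp.1.2 p.2).clm_apply
        continuousAt_const).clm_apply continuousAt_const).continuousWithinAt,
      fun t ht x _ => ?_⟩
    have ht' := (interior_subset ht).2
    refine ⟨?_, fun i => ?_, fun i j => ?_⟩
    · refine (HasDerivAt.deriv ((h.hasDerivAt_term ht' x).congr_of_eventuallyEq ?_)).symm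
      filter_upwards [gt_mem_nhds ht'] with s hs
      rw [termFun_eq hs]
    · rw [termFun_eq ht']
      exact (pd1_eq (h.hasFDerivAt_term ht' x) i).symm
    · rw [termFun_eq ht']
      exact (pd2_eq (h.hasFDerivAt_term ht') (h.hasFDerivAt_term_d1 ht' x) i j).symm

theorem eqn_termFun (h : RevSol (revCoef T a) f m L C w) {t : ℝ} (ht : t ∈ Set.Ico 0 T)
    (x : Fin d → ℝ) : tderiv (Set.Icc 0 T) (termFun T f w) t x +
      (1 / 2) * ∑ i, ∑ j, a t x i j * pd2 (termFun T f w t) i j x = 0 := by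
  have hd : HasDerivAt (fun s => termFun T f w s x) ((termJet T w).dt t x) t := by
    refine (h.hasDerivAt_term ht.2 x).congr_of_eventuallyEq ?_
    filter_upwards [gt_mem_nhds ht.2] with s hs
    rw [termFun_eq hs]
  rw [tderiv, hd.hasDerivWithinAt.derivWithin
    (uniqueDiffOn_Icc (ht.1.trans_lt ht.2) t ⟨ht.1, ht.2.le⟩), termFun_eq ht.2,
    ← tr_eq_sum_pd2 fun i j => pd2_eq (h.hasFDerivAt_term ht.2) (h.hasFDerivAt_term_d1 ht.2 x) i j]
  simp only [termJet, tr_smul]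
  rw [h.eqn (T - t) (sub_pos.2 ht.2) x, revCoef_of_mem ⟨ht.1, ht.2.le⟩]
  ring

theorem continuousAt_terminal (h : RevSol b f m L C w) (hL : 0 ≤ L) (x : Fin d → ℝ) :
    ContinuousAt (fun p : ℝ × (Fin d → ℝ) => if 0 < p.1 then w.v p.1 p.2 else f p.2) (0, x) := by
  rw [Metric.continuousAt_iff]
  intro ε hε
  obtain ⟨Q, hQ1, hQ⟩ := exists_barr_bound (d := d) m (‖x‖ + 1)
  set ε1 : ℝ := ε / (5 * Real.exp L * Q) with hε1
  have hε10 : 0 < ε1 := by positivity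
  have hεQ : ε1 * Real.exp L * Q = ε / 5 := by
    have := (Real.exp_pos L).ne'
    rw [hε1]
    field_simp
  have hexp1 : 1 ≤ Real.exp L := Real.one_le_exp hL
  have hεQ' : ε1 * Q ≤ ε / 5 := by
    rw [← hεQ]
    gcongr
    nlinarith
  obtain ⟨F, A, hF, hA, hfF, hw⟩ := h.init ε1 hε10
  obtain ⟨δ, hδ, hFδ⟩ := Metric.continuous_iff.1 hF x (ε / 5) (by positivity)
  refine ⟨min δ (min 1 (ε / (5 * (A + 1)))), by positivity, fun p hp => ?_⟩
  rw [Prod.dist_eq, max_lt_iff, lt_min_iff, lt_min_iff, lt_min_iff, lt_min_iff] at hp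
  obtain ⟨⟨-, hp1, hpA⟩, hpδ, hp1', -⟩ := hp
  dsimp only at hp1 hpA hpδ hp1'
  rw [Real.dist_eq, sub_zero] at hp1 hpA
  have hpx : ‖p.2‖ ≤ ‖x‖ + 1 := by
    rw [dist_eq_norm] at hp1'
    linarith [norm_le_norm_add_norm_sub' p.2 x]
  have hAp : A * |p.1| ≤ ε / 5 := by
    rw [lt_div_iff₀ (by positivity)] at hpA
    nlinarith [abs_nonneg p.1]
  have hFp := hFδ p.2 hpδ
  have hfx : |f x - F x| ≤ ε / 5 := by
    refine (hfF x).trans (le_trans ?_ hεQ')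
    gcongr
    exact hQ x (by linarith)
  have key : |(if 0 < p.1 then w.v p.1 p.2 else f p.2) - F p.2| ≤ ε / 5 + ε / 5 := by
    split_ifs with hpos
    · refine (hw p.1 hpos p.2).trans (add_le_add (le_trans ?_ hεQ.le) ?_)
      · have hb := (barr_pos m p.2).le
        gcongr
        · have := (le_abs_self _).trans hp1.le
          nlinarith
        · exact hQ _ hpx
      · rwa [abs_of_pos hpos] at hAp
    · refine (hfF p.2).trans ?_
      have : ε1 * barr m p.2 ≤ ε1 * Q := by
        gcongr
        exact hQ _ hpx
      linarith
  rw [Real.dist_eq] at hFp ⊢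
  simp only [lt_irrefl, if_false]
  rw [_root_.abs_lt] at hFp ⊢
  rw [_root_.abs_le] at hfx key
  constructor <;> linarith [hFp.1, hFp.2, hfx.1, hfx.2, key.1, key.2]

theorem continuousOn_termFun (h : RevSol b f m L C w) (hL : 0 ≤ L) :
    ContinuousOn (fun q : ℝ × (Fin d → ℝ) => termFun T f w q.1 q.2)
      (Set.Icc 0 T ×ˢ Set.univ) := by
  rintro ⟨t, x⟩ ⟨⟨-, ht⟩, -⟩
  rcases ht.lt_or_eq with ht | ht
  · exact ((h.continuousAt_term ht x).congr (eventually_termFun T f w ht x).symm).continuousWithinAt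
  · obtain rfl : t = T := ht
    have h1 := continuousAt_reverse (T := t) (t := t) (x := x)
      (g := fun s y => if 0 < s then w.v s y else f y) (by
        rw [sub_self]
        exact h.continuousAt_terminal hL x)
    refine h1.continuousWithinAt.congr (fun p hp => ?_) ?_
    · rcases hp.1.2.lt_or_eq with hpt | hpt
      · simp [termFun, hpt]
      · simp [termFun, hpt]
    · simp [termFun]

theorem growth_termFun (h : RevSol b f m L C w) (hL : 0 ≤ L) (hC : 0 ≤ C)
    (hf : ∀ x, |f x| ≤ C * barr m x) {t : ℝ} (ht : t ∈ Set.Icc 0 T) (x : Fin d → ℝ) :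
    |termFun T f w t x| ≤ C * Real.exp ((1 + L) * T) * barr m x := by
  have hb := (barr_pos m x).le
  have hT := ht.1.trans ht.2
  rw [termFun]
  split_ifs with htT
  · rw [abs_mul, Real.abs_exp]
    calc _ ≤ Real.exp (T - t) * (C * Real.exp (L * (T - t)) * barr m x) := by
          gcongr
          exact h.growth _ (sub_pos.2 htT) x
      _ = C * (Real.exp (T - t) * Real.exp (L * (T - t))) * barr m x := by ring
      _ ≤ _ := by
        rw [← Real.exp_add]
        gcongr
        nlinarith [ht.1]
  · refine (hf x).trans ?_
    gcongr
    exact le_mul_of_one_le_right hC (Real.one_le_exp (by positivity))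

end RevSol

theorem barr_le (m : ℕ) (x : Fin d → ℝ) :
    barr m x ≤ (2 * (1 + d)) ^ m * (1 + ‖x‖ ^ (2 * (m : ℝ))) := by
  have h1 : edot x x ≤ d * (‖x‖ * ‖x‖) := (le_abs_self _).trans (abs_edot_le x x)
  have h0 : 0 ≤ edot x x := (sq_nonneg ‖x‖).trans (sq_norm_le_edot x)
  have h3 : ‖x‖ ^ (2 * (m : ℝ)) = (‖x‖ ^ 2) ^ m := by
    rw [← pow_mul, ← Real.rpow_natCast]
    push_cast
    rfl
  have hd : (0 : ℝ) ≤ d := d.cast_nonneg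
  have hx := sq_nonneg ‖x‖
  rw [h3]
  set s := ‖x‖ ^ 2 with hs
  have h4 : 1 + edot x x ≤ 2 * (1 + d) * max 1 s := by
    have h5 := le_max_left 1 s
    have h6 := le_max_right 1 s
    nlinarith
  calc barr m x ≤ (2 * (1 + d) * max 1 s) ^ m := pow_le_pow_left₀ (by linarith) h4 m
    _ = (2 * (1 + d)) ^ m * (max 1 s) ^ m := mul_pow _ _ _
    _ ≤ _ := by
      gcongr
      rcases max_choice 1 s with h | h <;> rw [h]
      · rw [one_pow]
        linarith [pow_nonneg hx m]
      · linarith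

theorem RevSol.tvpSol (hm : 0 < m) (h : RevSol (revCoef T a) f m L C w) (hL : 0 ≤ L) (hC : 0 < C)
    (hf : ∀ x, |f x| ≤ C * barr m x) : TVPSol T a f (termFun T f w) where
  cont := h.continuousOn_termFun hL
  c12 := h.isC12_termFun
  eqn t ht x := h.eqn_termFun ht x
  term x := by simp [termFun]
  growth := by
    refine ⟨C * Real.exp ((1 + L) * T) * (2 * (1 + d)) ^ m, 2 * m, by positivity, by positivity,
      fun t ht x => (h.growth_termFun hL hC.le hf ht x).trans ?_⟩
    rw [mul_assoc _ ((2 * (1 + (d : ℝ))) ^ m)]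
    gcongr
    exact barr_le m x

end Existence

/-- Theorem 2.5 (a) (Janson–Tysk): existence and uniqueness, in the class of functions of at
most polynomial growth uniformly in `t`, of solutions of the terminal-value problem (TVP). -/
theorem stmt4 (T : ℝ) (hT : 0 < T) (d : ℕ)
    (a : ℝ → (Fin d → ℝ) → Fin d → Fin d → ℝ)
    (ha_cont : ∀ i j, ContinuousOn (fun p : ℝ × (Fin d → ℝ) => a p.1 p.2 i j)
      (Set.Icc 0 T ×ˢ (Set.univ : Set (Fin d → ℝ))))
    (ha_symm : ∀ t ∈ Set.Icc (0 : ℝ) T, ∀ x : Fin d → ℝ, ∀ i j, a t x i j = a t x j i)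
    (ha_pd : ∀ t ∈ Set.Icc (0 : ℝ) T, ∀ x : Fin d → ℝ, ∀ y : Fin d → ℝ, y ≠ 0 →
      0 < ∑ i, ∑ j, a t x i j * y i * y j)
    (ha_holder : ∀ i j, LocallyHolderOn (fun p : ℝ × (Fin d → ℝ) => a p.1 p.2 i j)
      (Set.Ico 0 T ×ˢ (Set.univ : Set (Fin d → ℝ))))
    (c₁ : ℝ) (hc₁ : 0 ≤ c₁)
    (ha_growth : ∀ t ∈ Set.Icc (0 : ℝ) T, ∀ x : Fin d → ℝ, ∀ i j,
      |a t x i j| ≤ c₁ * (1 + ‖x‖ ^ 2))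
    (f : (Fin d → ℝ) → ℝ) (hf : Continuous f)
    (c₀ p : ℝ) (hc₀ : 0 < c₀) (hp : 0 < p)
    (hfg : ∀ x, |f x| ≤ c₀ * (1 + ‖x‖ ^ p)) :
    ∃ v : ℝ → (Fin d → ℝ) → ℝ,
      (ContinuousOn (fun q : ℝ × (Fin d → ℝ) => v q.1 q.2)
          (Set.Icc 0 T ×ˢ (Set.univ : Set (Fin d → ℝ))) ∧
        IsC12 (Set.Ico 0 T) (Set.univ : Set (Fin d → ℝ)) v ∧
        (∀ t ∈ Set.Ico (0 : ℝ) T, ∀ x : Fin d → ℝ,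
          tderiv (Set.Icc 0 T) v t x
            + (1 / 2) * ∑ i, ∑ j, a t x i j * pd2 (v t) i j x = 0) ∧
        (∀ x, v T x = f x) ∧
        (∃ C q : ℝ, 0 < C ∧ 0 < q ∧
          ∀ t ∈ Set.Icc (0 : ℝ) T, ∀ x, |v t x| ≤ C * (1 + ‖x‖ ^ q))) ∧
      ∀ w : ℝ → (Fin d → ℝ) → ℝ,
        (ContinuousOn (fun q : ℝ × (Fin d → ℝ) => w q.1 q.2)
            (Set.Icc 0 T ×ˢ (Set.univ : Set (Fin d → ℝ))) ∧
          IsC12 (Set.Ico 0 T) (Set.univ : Set (Fin d → ℝ)) w ∧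
          (∀ t ∈ Set.Ico (0 : ℝ) T, ∀ x : Fin d → ℝ,
            tderiv (Set.Icc 0 T) w t x
              + (1 / 2) * ∑ i, ∑ j, a t x i j * pd2 (w t) i j x = 0) ∧
          (∀ x, w T x = f x) ∧
          (∃ C q : ℝ, 0 < C ∧ 0 < q ∧
            ∀ t ∈ Set.Icc (0 : ℝ) T, ∀ x, |w t x| ≤ C * (1 + ‖x‖ ^ q))) →
        ∀ t ∈ Set.Icc (0 : ℝ) T, ∀ x, w t x = v t x := by
  obtain ⟨m, hm⟩ := exists_nat_ge p
  have hfb : ∀ x, |f x| ≤ 2 * c₀ * barr m x := fun x =>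
    (hfg x).trans (le_barr_of_growth hc₀.le hp.le hm x)
  have hq := quadCoef_revCoef hT.le ha_symm ha_pd hc₁ ha_growth
  have hloc := locCoef_revCoef hT ha_cont ha_symm ha_pd ha_holder
  obtain ⟨u, hu⟩ := exists_approxSeq hT ha_cont ha_symm ha_pd ha_holder hc₁ ha_growth hf
    (show 0 ≤ 2 * c₀ by positivity) hfb
  have hL := rate_nonneg hc₁ d (m + 1)
  have hC : 0 < 2 * c₀ + 1 := by positivity
  obtain ⟨w, hw⟩ := hu.exists_revSol hq hloc hL hC.le
  have hv := hw.tvpSol m.succ_pos hL hC fun x => (hfb x).trans (by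
    have h1 := barr_mono (Nat.le_succ m) x
    have h2 := (barr_pos m x).le
    gcongr
    linarith)
  refine ⟨termFun T f w, ⟨hv.cont, hv.c12, hv.eqn, hv.term, hv.growth⟩, ?_⟩
  rintro z ⟨h1, h2, h3, h4, h5⟩ t ht x
  have hz : TVPSol T a f z := ⟨h1, h2, h3, h4, h5⟩
  exact le_antisymm (hz.le hT hq hv t ht x) (hv.le hT hq hz t ht x)
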